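/- Let ℓ be a prime and let K|k and L|l be function fields over algebraically closed fields with char k ≠ ℓ, char l ≠ ℓ, and trdeg(K|k) ≥ 5. Every field isomorphism σ : K^i → L^i maps k onto l and, via the canonical isomorphisms k^M_1(K) ≅ k^M_1(K^i) and k^M_1(L) ≅ k^M_1(L^i) induced by the inclusions, induces a group isomorphism σ_* : k^M_1(K) → k^M_1(L) that is compatible with k^M_2 and compatible with 𝔊^1_rat. Moreover, the assignment σ ↦ σ_* induces a bijection from the set of field isomorphisms K^i → L^i modulo composition with powers of the Frobenius (two isomorphisms are identified if the characteristic is p > 0 and they differ by composition with a power of the p-power Frobenius; in characteristic 0 identification is equality) onto the set of (ℤ/ℓ)^×-orbits (where ε ∈ (ℤ/ℓ)^× acts by φ ↦ φ^ε) of group isomorphisms k^M_1(K) → k^M_1(L) compatible with k^M_2 and with 𝔊^1_rat. -/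

import Mathlib

/-! Common definitions: mod-ℓ Milnor K-theory, K^×/(K^×)^ℓ, Ω_K, relative algebraic
closure, transcendence degree predicates, discrete valuations, etc. -/

noncomputable section

open scoped TensorProduct

universe u v

/-- The `n`-fold tensor power (over `ℤ`) of the multiplicative group `Kˣ`,
written additively. -/
abbrev MilnorPre (n : ℕ) (K : Type*) [Field K] : Type _ :=
  PiTensorProduct ℤ (fun _ : Fin n => Additive Kˣ)

/-- The submodule of Steinberg relations: generated by all `a₁ ⊗ ⋯ ⊗ aₙ`
with `aᵢ + aⱼ = 1` for some `i < j`. -/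
def SteinbergRel (n : ℕ) (K : Type*) [Field K] : Submodule ℤ (MilnorPre n K) :=
  Submodule.span ℤ
    {x | ∃ a : Fin n → Kˣ,
      (∃ i j : Fin n, i < j ∧ ((a i : K) + (a j : K) = 1)) ∧
        x = PiTensorProduct.tprod ℤ (fun i => Additive.ofMul (a i))}

/-- The `n`-th Milnor K-group `K^M_n(K)`: the quotient of the `n`-fold tensor
power of `K^×` by the Steinberg relations. -/
abbrev MilnorK (n : ℕ) (K : Type*) [Field K] : Type _ :=
  MilnorPre n K ⧸ SteinbergRel n K

/-- The mod-`ℓ` Milnor K-group `k^M_n(K) = K^M_n(K)/ℓ`. -/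
abbrev MilnorKMod (ℓ n : ℕ) (K : Type*) [Field K] : Type _ :=
  MilnorK n K ⧸ LinearMap.range ((ℓ : ℤ) • (LinearMap.id : MilnorK n K →ₗ[ℤ] MilnorK n K))

/-- The symbol `{a₁, …, aₙ}` in `k^M_n(K)`. -/
def milnorSymbol (ℓ : ℕ) {n : ℕ} {K : Type*} [Field K] (a : Fin n → Kˣ) :
    MilnorKMod ℓ n K :=
  Submodule.Quotient.mk (Submodule.Quotient.mk
    (PiTensorProduct.tprod ℤ (fun i => Additive.ofMul (a i))))

/-- `k^M_1(K) = K^×/(K^×)^ℓ`, written multiplicatively. -/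
abbrev K1 (ℓ : ℕ) (K : Type*) [Field K] : Type _ :=
  Kˣ ⧸ (powMonoidHom ℓ : Kˣ →* Kˣ).range

/-- The projection `K^× → K^×/(K^×)^ℓ`. -/
def K1proj (ℓ : ℕ) (K : Type*) [Field K] : Kˣ →* K1 ℓ K :=
  QuotientGroup.mk' _

/-- The subgroup of `Kˣ` consisting of the units lying in an intermediate field `L`. -/
def fieldUnits {k K : Type*} [Field k] [Field K] [Algebra k K]
    (L : IntermediateField k K) : Subgroup Kˣ where
  carrier := {x : Kˣ | (x : K) ∈ L}
  one_mem' := by simpa using one_mem L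
  mul_mem' := by
    intro a b ha hb
    simpa using mul_mem ha hb
  inv_mem' := by
    intro a ha
    simpa using inv_mem (show (a : K) ∈ L from ha)

/-- `Ω_K(L)`: the image of `L^×` in `K^×/(K^×)^ℓ`. -/
def Omega (ℓ : ℕ) {k K : Type*} [Field k] [Field K] [Algebra k K]
    (L : IntermediateField k K) : Subgroup (K1 ℓ K) :=
  (fieldUnits L).map (K1proj ℓ K)

/-- A subextension `L` of `K|k` is relatively algebraically closed in `K` if every
element of `K` algebraic over `L` lies in `L`. -/
def RelAlgClosed {k K : Type*} [Field k] [Field K] [Algebra k K]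
    (L : IntermediateField k K) : Prop :=
  ∀ x : K, IsAlgebraic L x → x ∈ L

/-- `K` is a function field over `k`: a finitely generated field extension. -/
def IsFunctionField (k K : Type*) [Field k] [Field K] [Algebra k K] : Prop :=
  ∃ s : Finset K, IntermediateField.adjoin k (s : Set K) = ⊤

/-- `trdeg(K|k) = d`: there is a transcendence basis indexed by `Fin d`. -/
def HasTrdeg (k : Type*) (K : Type*) [Field k] [Field K] [Algebra k K] (d : ℕ) : Prop :=
  ∃ x : Fin d → K, IsTranscendenceBasis k x

/-- `trdeg(K|k) ≥ m`: there are `m` algebraically independent elements. -/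
def TrdegGe (k : Type*) (K : Type*) [Field k] [Field K] [Algebra k K] (m : ℕ) : Prop :=
  ∃ x : Fin m → K, AlgebraicIndependent k x

/-- `dim^M_K(S) ≥ d` for a subset `S ⊆ k^M_1(K)`: there are `s₁, …, s_d ∈ S` with
`{s₁, …, s_d} ≠ 0` in `k^M_d(K)`. -/
def dimMge (ℓ : ℕ) {K : Type*} [Field K] (S : Set (K1 ℓ K)) (d : ℕ) : Prop :=
  ∃ a : Fin d → Kˣ, (∀ i, K1proj ℓ K (a i) ∈ S) ∧ milnorSymbol ℓ a ≠ 0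

/-- `dim^M_K(S) = r`. -/
def dimMeq (ℓ : ℕ) {K : Type*} [Field K] (S : Set (K1 ℓ K)) (r : ℕ) : Prop :=
  dimMge ℓ S r ∧ ¬ dimMge ℓ S (r + 1)

/-- `t` is a general element of `K` over `k`: `t ∉ k` and `k(t)` is relatively
algebraically closed in `K`. -/
def IsGeneralElement (k : Type*) {K : Type*} [Field k] [Field K] [Algebra k K] (t : K) : Prop :=
  t ∉ (⊥ : IntermediateField k K) ∧ RelAlgClosed (IntermediateField.adjoin k {t})

/-- A rational subgroup of `k^M_1(K)`: `Ω_K(k(t))` for a general element `t`. -/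
def IsRationalSubgroup (ℓ : ℕ) (k : Type*) {K : Type*} [Field k] [Field K] [Algebra k K]
    (A : Subgroup (K1 ℓ K)) : Prop :=
  ∃ t : K, IsGeneralElement k t ∧ A = Omega ℓ (IntermediateField.adjoin k {t})

/-- `𝔊^r(K|k)`: the subgroups `Ω_K(L)` for `L` relatively algebraically closed
in `K` of transcendence degree `r` over `k`. -/
def GSet (ℓ : ℕ) (k : Type*) {K : Type*} [Field k] [Field K] [Algebra k K] (r : ℕ) :
    Set (Subgroup (K1 ℓ K)) :=
  {A | ∃ L : IntermediateField k K, RelAlgClosed L ∧ HasTrdeg k L r ∧ A = Omega ℓ L}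

/-- `𝔐^1(K)`: subgroups maximal among the subgroups `B` of `k^M_1(K)`
with `dim^M_K(B) = 1`. -/
def M1Set (ℓ : ℕ) (K : Type*) [Field K] : Set (Subgroup (K1 ℓ K)) :=
  {A | dimMeq ℓ (A : Set (K1 ℓ K)) 1 ∧
    ∀ B : Subgroup (K1 ℓ K), dimMeq ℓ (B : Set (K1 ℓ K)) 1 → A ≤ B → B = A}

/-- Condition (a) and (b) of the maximality characterization of `𝔊^r`:
`B` is generated by rational subgroups and `dim^M_K(B) = r`. -/
def SpannedByRatWithDim (ℓ : ℕ) (k : Type*) {K : Type*} [Field k] [Field K] [Algebra k K]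
    (r : ℕ) (B : Subgroup (K1 ℓ K)) : Prop :=
  (∃ S : Set (Subgroup (K1 ℓ K)), (∀ T ∈ S, IsRationalSubgroup ℓ k T) ∧ B = sSup S) ∧
    dimMeq ℓ (B : Set (K1 ℓ K)) r

/-- A discrete valuation of a field `F`: a surjective homomorphism `F^× → ℤ`
satisfying the ultrametric inequality. -/
structure DiscreteValuation (F : Type*) [Field F] where
  v : Fˣ → ℤ
  map_mul' : ∀ x y : Fˣ, v (x * y) = v x + v y
  surjective' : Function.Surjective v
  min_le' : ∀ x y z : Fˣ, (x : F) + (y : F) = (z : F) → min (v x) (v y) ≤ v z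

lemma DiscreteValuation.v_one {F : Type*} [Field F] (w : DiscreteValuation F) : w.v 1 = 0 := by
  have h := w.map_mul' 1 1
  simp only [mul_one] at h
  omega

/-- A discrete valuation of `F` is trivial on the base field `k`. -/
def DiscreteValuation.TrivialOn (k : Type*) {F : Type*} [Field k] [Field F] [Algebra k F]
    (w : DiscreteValuation F) : Prop :=
  ∀ (c : k) (hc : algebraMap k F c ≠ 0), w.v (Units.mk0 _ hc) = 0

/-- The unit group `U_w ⊆ F^×` of a discrete valuation. -/
def DiscreteValuation.units {F : Type*} [Field F] (w : DiscreteValuation F) : Subgroup Fˣ where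
  carrier := {x : Fˣ | w.v x = 0}
  one_mem' := w.v_one
  mul_mem' := by
    intro a b ha hb
    have h := w.map_mul' a b
    simp only [Set.mem_setOf_eq] at ha hb ⊢
    omega
  inv_mem' := by
    intro a ha
    have h := w.map_mul' a a⁻¹
    rw [mul_inv_cancel] at h
    have h1 := w.v_one
    simp only [Set.mem_setOf_eq] at ha ⊢
    omega

/-- `𝔘_v`: the image of the unit group `U_v` in `K^×/(K^×)^ℓ`. -/
def DiscreteValuation.unitsImage (ℓ : ℕ) {F : Type*} [Field F] (w : DiscreteValuation F) :
    Subgroup (K1 ℓ F) :=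
  w.units.map (K1proj ℓ F)

/-- For a discrete valuation `w` of an intermediate field `F` of `K|k`, the image of
the unit group `U_w` in `K^×/(K^×)^ℓ`. -/
def unitsImageIn (ℓ : ℕ) {k K : Type*} [Field k] [Field K] [Algebra k K]
    (F : IntermediateField k K) (w : DiscreteValuation F) : Subgroup (K1 ℓ K) :=
  (w.units.map (Units.map (algebraMap F K).toMonoidHom)).map (K1proj ℓ K)

/-- The residue field of `v` has transcendence degree `≥ m` over `k`: there are
`v`-units `x₁, …, x_m` whose residues are algebraically independent over `k`,
expressed by saying that every nonzero polynomial over `k` evaluated at the `xᵢ`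
is a unit of value `0`. -/
def DiscreteValuation.ResidueTrdegGe (k : Type*) {K : Type*} [Field k] [Field K] [Algebra k K]
    (v : DiscreteValuation K) (m : ℕ) : Prop :=
  ∃ x : Fin m → Kˣ, (∀ i, v.v (x i) = 0) ∧
    ∀ P : MvPolynomial (Fin m) k, P ≠ 0 →
      ∃ u : Kˣ, (u : K) = MvPolynomial.aeval (fun i => ((x i : K))) P ∧ v.v u = 0

/-- A divisorial-type valuation of `K|k` (where `d = trdeg(K|k)`): a discrete valuation
trivial on `k` whose residue field has transcendence degree exactly `d - 1` over `k`. -/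
def IsDivisorialType (k : Type*) {K : Type*} [Field k] [Field K] [Algebra k K] (d : ℕ)
    (v : DiscreteValuation K) : Prop :=
  v.TrivialOn k ∧ v.ResidueTrdegGe k (d - 1) ∧ ¬ v.ResidueTrdegGe k d

/-- `Δ_A`: the set of subgroups `A ⊓ 𝔘_v`, for `v` ranging over the divisorial-type
valuations of `K` with `A ⊄ 𝔘_v`. -/
def DeltaA (ℓ : ℕ) (k : Type*) {K : Type*} [Field k] [Field K] [Algebra k K] (d : ℕ)
    (A : Subgroup (K1 ℓ K)) : Set (Subgroup (K1 ℓ K)) :=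
  {T | ∃ v : DiscreteValuation K, IsDivisorialType k d v ∧
    ¬ A ≤ v.unitsImage ℓ ∧ T = A ⊓ v.unitsImage ℓ}

/-- A good rational subgroup: a rational subgroup `A = Ω_K(k(t))` such that for every
discrete valuation `w` of `k(t)` trivial on `k`, the image of `U_w` in `K^×/(K^×)^ℓ`
belongs to `Δ_A`. -/
def IsGoodRationalSubgroup (ℓ : ℕ) (k : Type*) {K : Type*} [Field k] [Field K] [Algebra k K]
    (d : ℕ) (A : Subgroup (K1 ℓ K)) : Prop :=
  ∃ t : K, IsGeneralElement k t ∧ A = Omega ℓ (IntermediateField.adjoin k {t}) ∧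
    ∀ w : DiscreteValuation (IntermediateField.adjoin k {t}), w.TrivialOn k →
      unitsImageIn ℓ (IntermediateField.adjoin k {t}) w ∈ DeltaA ℓ k d A

/-- A very general element: a general element `t` such that `Ω_K(k(t))` is a good
rational subgroup. -/
def IsVeryGeneral (ℓ : ℕ) (k : Type*) {K : Type*} [Field k] [Field K] [Algebra k K]
    (d : ℕ) (t : K) : Prop :=
  IsGeneralElement k t ∧ IsGoodRationalSubgroup ℓ k d (Omega ℓ (IntermediateField.adjoin k {t}))

/-- `x` is separable in `K`: in characteristic `p > 0`, `x` is not a `p`-th power;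
in characteristic `0` every element is separable. -/
def IsSeparableIn (K : Type*) [Field K] (x : K) : Prop :=
  ∀ p : ℕ, p.Prime → CharP K p → ¬ ∃ y : K, y ^ p = x

/-- A perfect closure of `K`: a perfect field which is a purely inseparable
extension of `K`. -/
structure PerfectClosureOf (K : Type u) [Field K] : Type (u + 1) where
  carrier : Type u
  [fieldInst : Field carrier]
  [algebraInst : Algebra K carrier]
  purelyInseparable : IsPurelyInseparable K carrier
  perfect : PerfectField carrier

attribute [instance] PerfectClosureOf.fieldInst PerfectClosureOf.algebraInst

/-- A group isomorphism `φ : k^M_1(K) → k^M_1(L)` is induced by a field isomorphism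
`σ : K^i → L^i` of the perfect closures, via the canonical identifications
`k^M_1(K) ≅ k^M_1(K^i)` and `k^M_1(L) ≅ k^M_1(L^i)`. -/
def InducesOnK1 (ℓ : ℕ) {K : Type u} {L : Type v} [Field K] [Field L]
    (PK : PerfectClosureOf K) (PL : PerfectClosureOf L)
    (σ : PK.carrier ≃+* PL.carrier) (φ : K1 ℓ K ≃* K1 ℓ L) : Prop :=
  ∀ (x : Kˣ) (y : Lˣ),
    (φ (K1proj ℓ K x) = K1proj ℓ L y ↔
      ∃ z : (PL.carrier)ˣ,
        Units.map σ.toRingHom.toMonoidHom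
            (Units.map (algebraMap K PK.carrier).toMonoidHom x) =
          Units.map (algebraMap L PL.carrier).toMonoidHom y * z ^ ℓ)

/-- `φ : k^M_1(K) → k^M_1(L)` is compatible with `k^M_2`: `φ ⊗ φ` descends, along the
multiplication maps, to an isomorphism `k^M_2(K) → k^M_2(L)`; equivalently, there is an
additive isomorphism `k^M_2(K) ≃ k^M_2(L)` carrying `{a, b}` to `{a', b'}` whenever
`φ` carries the class of `a` (resp. `b`) to the class of `a'` (resp. `b'`). -/
def CompatWithK2 (ℓ : ℕ) {K L : Type*} [Field K] [Field L] (φ : K1 ℓ K ≃* K1 ℓ L) : Prop :=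
  ∃ ψ : MilnorKMod ℓ 2 K ≃+ MilnorKMod ℓ 2 L,
    ∀ (a b : Kˣ) (a' b' : Lˣ),
      φ (K1proj ℓ K a) = K1proj ℓ L a' → φ (K1proj ℓ K b) = K1proj ℓ L b' →
        ψ (milnorSymbol ℓ ![a, b]) = milnorSymbol ℓ ![a', b']

/-- `φ : k^M_1(K) → k^M_1(L)` is compatible with `𝔊^1_rat`: it maps rational subgroups
bijectively onto rational subgroups. -/
def CompatWithRat (ℓ : ℕ) (k : Type*) (l : Type*) {K L : Type*}
    [Field k] [Field K] [Algebra k K] [Field l] [Field L] [Algebra l L]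
    (φ : K1 ℓ K ≃* K1 ℓ L) : Prop :=
  (∀ A : Subgroup (K1 ℓ K), IsRationalSubgroup ℓ k A →
     IsRationalSubgroup ℓ l (A.map φ.toMonoidHom)) ∧
  (∀ B : Subgroup (K1 ℓ L), IsRationalSubgroup ℓ l B →
     ∃ A : Subgroup (K1 ℓ K), IsRationalSubgroup ℓ k A ∧ A.map φ.toMonoidHom = B)

/-- Two isomorphisms of perfect closures differ by a power of the Frobenius
(in characteristic `0`, they are equal). -/
def FrobTwistEquiv {Ki Li : Type*} [Field Ki] [Field Li] (σ σ' : Ki ≃+* Li) : Prop :=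
  σ = σ' ∨ ∃ p : ℕ, p.Prime ∧ CharP Ki p ∧
    ((∃ n : ℕ, ∀ x, σ' x = σ (x ^ p ^ n)) ∨ (∃ n : ℕ, ∀ x, σ x = σ' (x ^ p ^ n)))

/-- A rigid datum: a multiplicative-to-linear map `c` on a field, a functional `f`, and a
`k`-line `t - a` on which `f` vanishes while `c` is injective mod scalars, satisfying the
Steinberg relation relative to `f`. -/
structure RigidDatum (ℓ : ℕ) [Fact ℓ.Prime] (k F A : Type*) [Field k] [Field F] [Algebra k F]
    [AddCommGroup A] [Module (ZMod ℓ) A] (c : F → A) (f : A →ₗ[ZMod ℓ] ZMod ℓ) (t : F) : Prop where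
  map_mul : ∀ x y, x ≠ 0 → y ≠ 0 → c (x * y) = c x + c y
  map_const : ∀ a : k, c (algebraMap k F a) = 0
  stein : ∀ x, x ≠ 0 → 1 - x ≠ 0 → f (c x) • c (1 - x) = f (c (1 - x)) • c x
  line_ne : ∀ a : k, t - algebraMap k F a ≠ 0
  line_mem : ∀ a : k, f (c (t - algebraMap k F a)) = 0
  line_indep : ∀ a b : k, a ≠ b → ∀ i j : ZMod ℓ,
    i • c (t - algebraMap k F a) + j • c (t - algebraMap k F b) = 0 → i = 0 ∧ j = 0

namespace RigidDatum

variable {ℓ : ℕ} [Fact ℓ.Prime] {k F A : Type*} [Field k] [Field F] [Algebra k F]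
    [AddCommGroup A] [Module (ZMod ℓ) A] {c : F → A} {f : A →ₗ[ZMod ℓ] ZMod ℓ} {t : F}
  (D : RigidDatum ℓ k F A c f t)

include D

lemma c_zero : c 0 = 0 := by simpa using D.map_const 0

lemma c_one : c 1 = 0 := by simpa using D.map_const 1

lemma c_neg (x : F) : c (-x) = c x := by
  by_cases hx : x = 0
  · simp [hx]
  have h1 : c (-1 : F) = 0 := by simpa using D.map_const (-1)
  have := D.map_mul (-1) x (by simp) hx
  simpa [h1] using this

lemma c_inv (x : F) : c x⁻¹ = - c x := by
  by_cases hx : x = 0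
  · simp [hx, D.c_zero]
  have := D.map_mul x x⁻¹ hx (inv_ne_zero hx)
  rw [mul_inv_cancel₀ hx, D.c_one] at this
  exact (neg_eq_of_add_eq_zero_right this.symm).symm

lemma c_div (x y : F) (hx : x ≠ 0) (hy : y ≠ 0) : c (x / y) = c x - c y := by
  rw [div_eq_mul_inv, D.map_mul _ _ hx (inv_ne_zero hy), D.c_inv, sub_eq_add_neg]

lemma c_smul (a : k) (ha : a ≠ 0) (x : F) : c (algebraMap k F a * x) = c x := by
  by_cases hx : x = 0
  · simp [hx]
  rw [D.map_mul _ _ (by simpa using ha) hx, D.map_const, zero_add]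

/-- For `f (c x) = 0`, `c x ≠ 0`, one has `f (c (1 + x)) = 0`. -/
lemma f_one_add_eq_zero {x : F} (hf : f (c x) = 0) (hc : c x ≠ 0) : f (c (1 + x)) = 0 := by
  by_cases h1 : 1 + x = 0
  · simp [h1, D.c_zero]
  have hx : x ≠ 0 := by rintro rfl; exact hc D.c_zero
  have := D.stein (-x) (neg_ne_zero.2 hx) (by simpa using h1)
  simp only [D.c_neg, sub_neg_eq_add, hf, zero_smul] at this
  exact (smul_eq_zero.1 this.symm).resolve_right hc

lemma ne_zero_of_f {x : F} (hf : f (c x) ≠ 0) : x ≠ 0 := by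
  rintro rfl; simp [D.c_zero] at hf

lemma one_add_ne_zero {x : F} (hf : f (c x) ≠ 0) : 1 + x ≠ 0 := by
  intro h
  have : x = -1 := by linear_combination h
  rw [this, D.c_neg, D.c_one] at hf
  simp at hf

lemma exists_c_one_add {x : F} (hf : f (c x) ≠ 0) : ∃ e : ZMod ℓ, c (1 + x) = e • c x := by
  have := D.stein (-x) (neg_ne_zero.2 (D.ne_zero_of_f hf)) (by simpa using D.one_add_ne_zero hf)
  simp only [D.c_neg, sub_neg_eq_add] at this
  refine ⟨(f (c x))⁻¹ * f (c (1 + x)), ?_⟩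
  rw [mul_smul, ← this, smul_smul, inv_mul_cancel₀ hf, one_smul]

/-- The elements of nonzero `f`-value that behave as elements of positive valuation. -/
def _root_.RigidDatum.Neg (c : F → A) (f : A →ₗ[ZMod ℓ] ZMod ℓ) (x : F) : Prop :=
  f (c x) ≠ 0 ∧ c (1 + x) = 0

lemma dichotomy {x : F} (hf : f (c x) ≠ 0) :
    (∀ a : k, c (1 + x / (t - algebraMap k F a)) = 0) ∨
    (∀ a : k, c (1 + x / (t - algebraMap k F a)) = c (x / (t - algebraMap k F a))) := by
  have hx := D.ne_zero_of_f hf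
  set s : k → F := fun a => t - algebraMap k F a with hs
  have hsne : ∀ a, s a ≠ 0 := D.line_ne
  have hdiv : ∀ a, c (x / s a) = c x - c (s a) := fun a => D.c_div _ _ hx (hsne a)
  have hfdiv : ∀ a, f (c (x / s a)) = f (c x) := fun a => by
    rw [hdiv, map_sub, D.line_mem a, sub_zero]
  have hfne : ∀ a, f (c (x / s a)) ≠ 0 := fun a => by rw [hfdiv]; exact hf
  choose e he using fun a => D.exists_c_one_add (hfne a)
  have hX : ∀ a, c (x + s a) = c (s a) + e a • (c x - c (s a)) := fun a => by
    have h1 : x + s a = s a * (1 + x / s a) := by field_simp [hsne a]; ring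
    rw [h1, D.map_mul _ _ (hsne a) (D.one_add_ne_zero (hfne a)), he, hdiv]
  have key : ∀ a b, a ≠ b → e a ≠ 0 → e a = 1 ∧ e b = 1 := by
    intro a b hab hea
    have hfX : f (c (x + s a)) = e a * f (c x) := by
      rw [hX, map_add, map_smul, map_sub, D.line_mem a]; simp
    have hfXne : f (c (x + s a)) ≠ 0 := by rw [hfX]; exact mul_ne_zero hea hf
    have hba : a - b ≠ 0 := sub_ne_zero.2 hab
    have h2 : algebraMap k F (a - b)⁻¹ ≠ 0 := (map_ne_zero _).2 (inv_ne_zero hba)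
    have hcc : c (algebraMap k F (a - b)⁻¹ * (x + s a)) = c (x + s a) :=
      D.c_smul _ (inv_ne_zero hba) _
    obtain ⟨d, hd⟩ := D.exists_c_one_add (x := algebraMap k F (a - b)⁻¹ * (x + s a)) (by rwa [hcc])
    have h3 : x + s b = algebraMap k F (a - b) *
        (1 + algebraMap k F (a - b)⁻¹ * (x + s a)) := by
      have : algebraMap k F (a - b) * algebraMap k F (a - b)⁻¹ = 1 := by
        rw [← _root_.map_mul, mul_inv_cancel₀ hba, map_one]
      rw [mul_add, ← mul_assoc, this]
      simp only [hs, map_sub]; ring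
    have h4 : c (x + s b) = d • c (x + s a) := by
      rw [h3, D.c_smul _ hba, hd, hcc]
    rw [hX, hX] at h4
    have h5 := congrArg f h4
    simp only [map_add, map_smul, map_sub, hs, D.line_mem] at h5
    simp only [sub_zero, zero_add, smul_eq_mul] at h5
    have h6 : e b = d * e a := by
      apply mul_right_cancel₀ hf; rw [h5]; ring
    have h7 : (d * (1 - e a)) • c (s a) + (-(1 - e b)) • c (s b) = 0 := by
      have h8 : c (s b) + e b • (c x - c (s b)) - d • (c (s a) + e a • (c x - c (s a))) = 0 := by
        rw [h4, sub_self]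
      rw [h6] at h8 ⊢
      rw [← neg_eq_zero, ← h8]
      module
    obtain ⟨h9, h10⟩ := D.line_indep a b hab _ _ h7
    have h11 : e b = 1 := by linear_combination h10
    rw [h11] at h6
    have hdne : d ≠ 0 := by rintro rfl; simp at h6
    refine ⟨?_, h11⟩
    have := (mul_eq_zero.1 h9).resolve_left hdne
    linear_combination -this
  by_cases hall : ∀ a, e a = 0
  · left; intro a; rw [he, hall, zero_smul]
  · right
    push Not at hall
    obtain ⟨a, ha⟩ := hall
    have h1 : ∀ b, e b = 1 := by
      intro b
      by_cases hab : a = b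
      · subst hab
        exact (key a (a + 1) (by simp) ha).1
      · exact (key a b hab ha).2
    intro b; rw [he, h1, one_smul]

lemma neg_or_inv {x : F} (hf : f (c x) ≠ 0) : Neg c f x ∨ Neg c f x⁻¹ := by
  have hx := D.ne_zero_of_f hf
  have hs := D.line_ne 0
  have h1 : c (x * (t - algebraMap k F 0)) = c x + c (t - algebraMap k F 0) :=
    D.map_mul _ _ hx hs
  have := D.dichotomy (x := x * (t - algebraMap k F 0)) (by rw [h1, map_add, D.line_mem]; simpa)
  rcases this with h | h
  · left; refine ⟨hf, ?_⟩
    have := h 0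
    rwa [mul_div_assoc, div_self hs, mul_one] at this
  · right
    refine ⟨by rw [D.c_inv, map_neg]; simpa, ?_⟩
    have := h 0
    rw [mul_div_assoc, div_self hs, mul_one] at this
    have h2 : 1 + x⁻¹ = (1 + x) / x := by field_simp; ring
    rw [h2, D.c_div _ _ (D.one_add_ne_zero hf) hx, this, sub_self]

lemma not_neg_inv {x : F} (h : Neg c f x) (h' : Neg c f x⁻¹) : False := by
  have hx := D.ne_zero_of_f h.1
  have h2 : 1 + x = x * (1 + x⁻¹) := by field_simp; ring
  have h3 := h.2
  rw [h2, D.map_mul _ _ hx (D.one_add_ne_zero h'.1), h'.2, add_zero] at h3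
  exact h.1 (by rw [h3, map_zero])

lemma c_one_add_of_not_neg {x : F} (hf : f (c x) ≠ 0) (h : ¬ Neg c f x) : c (1 + x) = c x := by
  have h' := (D.neg_or_inv hf).resolve_left h
  have hx := D.ne_zero_of_f hf
  have h2 : 1 + x = x * (1 + x⁻¹) := by field_simp; ring
  rw [h2, D.map_mul _ _ hx (D.one_add_ne_zero h'.1), h'.2, add_zero]

lemma neg_iff {x : F} (hf : f (c x) ≠ 0) : Neg c f x ↔ c (1 + x) ≠ c x := by
  constructor
  · rintro h h'
    rw [h.2] at h'
    exact hf (by rw [← h', map_zero])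
  · intro h; by_contra h'; exact h (D.c_one_add_of_not_neg hf h')

lemma neg_of_one_add_mem {x : F} (hf : f (c x) ≠ 0) (h : f (c (1 + x)) = 0) : Neg c f x := by
  rw [D.neg_iff hf]; intro h'; rw [h'] at h; exact hf h

lemma c_ratio {x : F} (hx : x ≠ 0) (a b : k) :
    c (x * ((t - algebraMap k F b) / (t - algebraMap k F a))) =
      c x + c (t - algebraMap k F b) - c (t - algebraMap k F a) := by
  rw [D.map_mul _ _ hx (div_ne_zero (D.line_ne b) (D.line_ne a)),
    D.c_div _ _ (D.line_ne b) (D.line_ne a), add_sub_assoc]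

lemma f_ratio {x : F} (hx : x ≠ 0) (a b : k) :
    f (c (x * ((t - algebraMap k F b) / (t - algebraMap k F a)))) = f (c x) := by
  rw [D.c_ratio hx, map_sub, map_add, D.line_mem, D.line_mem]; simp

lemma neg_ratio {x : F} (h : Neg c f x) (a b : k) :
    Neg c f (x * ((t - algebraMap k F b) / (t - algebraMap k F a))) := by
  have hx := D.ne_zero_of_f h.1
  have hsb := D.line_ne b
  have h1 : c (x * (t - algebraMap k F b)) = c x + c (t - algebraMap k F b) :=
    D.map_mul _ _ hx hsb
  have := D.dichotomy (x := x * (t - algebraMap k F b))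
    (by rw [h1, map_add, D.line_mem]; simpa using h.1)
  refine ⟨by rw [D.f_ratio hx]; exact h.1, ?_⟩
  rcases this with h2 | h2
  · have := h2 a; rwa [mul_div_assoc] at this
  · have := h2 b
    rw [mul_div_assoc, div_self hsb, mul_one, h.2] at this
    exact absurd (by rw [← this, map_zero]) h.1

lemma neg_smul {x : F} (h : Neg c f x) (d : k) (hd : d ≠ 0) :
    Neg c f (algebraMap k F d * x) := by
  by_cases hd1 : d = 1
  · simpa [hd1] using h
  have hx := D.ne_zero_of_f h.1
  have hcd : ∀ y, c (algebraMap k F d * y) = c y := D.c_smul d hd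
  have hf : f (c (algebraMap k F d * x)) ≠ 0 := by rw [hcd]; exact h.1
  by_contra hn
  have hinv := (D.neg_or_inv hf).resolve_left hn
  set s : k → F := fun a => t - algebraMap k F a with hs
  have hsne : ∀ a, s a ≠ 0 := D.line_ne
  -- u = x s_0 + s_0, u' = d x s_0 + s_1
  have hu : c (x * s 0 + s 0) = c (s 0) := by
    have : x * s 0 + s 0 = (1 + x) * s 0 := by ring
    rw [this, D.map_mul _ _ (D.one_add_ne_zero h.1) (hsne 0), h.2, zero_add]
  have hu'n : ¬ Neg c f (algebraMap k F d * x * (s 0 / s 1)) := by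
    intro h'
    have := D.neg_ratio h' 0 1
    have e : algebraMap k F d * x * (s 0 / s 1) * ((t - algebraMap k F 1) / (t - algebraMap k F 0))
        = algebraMap k F d * x := by
      change algebraMap k F d * x * (s 0 / s 1) * (s 1 / s 0) = _
      field_simp [hsne 0, hsne 1]
    rw [e] at this; exact hn this
  have hdx : algebraMap k F d * x ≠ 0 := D.ne_zero_of_f hf
  have hfu' : f (c (algebraMap k F d * x * (s 0 / s 1))) ≠ 0 := by
    rw [D.f_ratio hdx]; exact hf
  have hu' : c (algebraMap k F d * x * s 0 + s 1) = c x + c (s 0) := by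
    have e : algebraMap k F d * x * s 0 + s 1 =
        s 1 * (1 + algebraMap k F d * x * (s 0 / s 1)) := by field_simp [hsne 1]; ring
    rw [e, D.map_mul _ _ (hsne 1) (D.one_add_ne_zero hfu'), D.c_one_add_of_not_neg hfu' hu'n,
      D.c_ratio hdx, hcd]
    change c (s 1) + (c x + c (s 0) - c (s 1)) = _
    abel
  have hd1' : d - 1 ≠ 0 := sub_ne_zero.2 hd1
  set a₂ : k := -1 / (d - 1) with ha₂
  have hrel : algebraMap k F d * (x * s 0 + s 0) =
      (algebraMap k F (d - 1) * s a₂) + (algebraMap k F d * x * s 0 + s 1) := by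
    have : algebraMap k F (d - 1) * algebraMap k F a₂ = -1 := by
      rw [← _root_.map_mul, ha₂, mul_div_cancel₀ _ hd1']; simp
    simp only [hs]
    rw [mul_sub (algebraMap k F (d - 1)), this]
    simp only [map_sub, map_one, map_zero]; ring
  set w := (algebraMap k F d * x * s 0 + s 1) / (algebraMap k F (d - 1) * s a₂) with hw
  have hden : algebraMap k F (d - 1) * s a₂ ≠ 0 := mul_ne_zero ((map_ne_zero _).2 hd1') (hsne _)
  have hnum : algebraMap k F d * x * s 0 + s 1 ≠ 0 := by
    intro h0; rw [h0, D.c_zero] at hu'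
    have := congrArg f hu'
    rw [map_add, map_zero, D.line_mem, add_zero] at this
    exact h.1 this.symm
  have hcw : c w = c x + c (s 0) - c (s a₂) := by
    rw [hw, D.c_div _ _ hnum hden, hu', D.c_smul _ hd1']
  have hfw : f (c w) = f (c x) := by
    rw [hcw, map_sub, map_add, D.line_mem, D.line_mem]; simp
  have hfwne : f (c w) ≠ 0 := by rw [hfw]; exact h.1
  obtain ⟨e, he⟩ := D.exists_c_one_add hfwne
  have h5 : algebraMap k F d * (x * s 0 + s 0) = (algebraMap k F (d - 1) * s a₂) * (1 + w) := by
    rw [hrel, hw, mul_add, mul_one, mul_div_cancel₀ _ hden]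
  have h6 := congrArg c h5
  rw [hcd, hu, D.map_mul _ _ hden (D.one_add_ne_zero hfwne), D.c_smul _ hd1', he] at h6
  have h7 := congrArg f h6
  rw [map_add, D.line_mem, D.line_mem, map_smul, hfw, zero_add, smul_eq_mul] at h7
  have he0 : e = 0 := (mul_eq_zero.1 h7.symm).resolve_right h.1
  rw [he0, zero_smul, add_zero] at h6
  have hne : (0 : k) ≠ a₂ := by
    rw [ha₂, ne_eq, eq_comm, div_eq_zero_iff]; simp [hd1']
  have := D.line_indep 0 a₂ hne 1 (-1) (by
    change (1 : ZMod ℓ) • c (s 0) + (-1 : ZMod ℓ) • c (s a₂) = 0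
    rw [h6]; module)
  exact one_ne_zero this.1

lemma neg_neg {x : F} (h : Neg c f x) : Neg c f (-x) := by
  have := D.neg_smul h (-1) (by simp)
  simpa using this

lemma neg_div_one_add {x : F} (h : Neg c f x) : Neg c f (x / (1 + x)) := by
  have h1 := D.one_add_ne_zero h.1
  have h2 : Neg c f (-(x / (1 + x))) := by
    refine ⟨?_, ?_⟩
    · rw [D.c_neg, D.c_div _ _ (D.ne_zero_of_f h.1) h1, h.2, sub_zero]; exact h.1
    · have : 1 + -(x / (1 + x)) = (1 + x)⁻¹ := by field_simp; ring
      rw [this, D.c_inv, h.2, neg_zero]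
  simpa using D.neg_neg h2

lemma c_one_sub {x : F} (h : Neg c f x) : c (1 - x) = 0 := by
  have := (D.neg_neg h).2; rwa [← sub_eq_add_neg] at this

lemma one_sub_ne_zero {x : F} (h : Neg c f x) : 1 - x ≠ 0 := by
  have := D.one_add_ne_zero (D.neg_neg h).1; rwa [← sub_eq_add_neg] at this

lemma c_one_add_mul {z w : F} (hw : Neg c f w) (hz : 1 + z ≠ 0) :
    c (w * (1 + z) / (1 - w)) = c w + c (1 + z) ∧
    c (1 + z * w) = c (1 + w * (1 + z) / (1 - w)) := by
  have hw0 := D.ne_zero_of_f hw.1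
  have h1 := D.one_sub_ne_zero hw
  refine ⟨by rw [D.c_div _ _ (mul_ne_zero hw0 hz) h1, D.map_mul _ _ hw0 hz, D.c_one_sub hw,
    sub_zero], ?_⟩
  have e : 1 + z * w = (1 - w) * (1 + w * (1 + z) / (1 - w)) := by field_simp; ring
  by_cases h0 : 1 + w * (1 + z) / (1 - w) = 0
  · rw [e, h0, mul_zero]
  · rw [e, D.map_mul _ _ h1 h0, D.c_one_sub hw, zero_add]

lemma neg_mul {x y : F} (hx : Neg c f x) (hy : Neg c f y) (hxy : f (c (x * y)) ≠ 0) :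
    Neg c f (x * y) := by
  obtain ⟨h1, h2⟩ := D.c_one_add_mul hy (D.one_add_ne_zero hx.1)
  rw [hx.2, add_zero] at h1
  rw [D.neg_iff hxy, h2]
  intro h3
  have hf' : f (c (y * (1 + x) / (1 - y))) ≠ 0 := by rw [h1]; exact hy.1
  by_cases h4 : Neg c f (y * (1 + x) / (1 - y))
  · rw [h4.2] at h3; exact hxy (by rw [← h3, map_zero])
  · rw [D.c_one_add_of_not_neg hf' h4, h1,
      D.map_mul _ _ (D.ne_zero_of_f hx.1) (D.ne_zero_of_f hy.1)] at h3
    have : c x = 0 := by simpa using h3.symm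
    exact hx.1 (by rw [this, map_zero])

lemma c_one_add_mul_eq_zero {x y : F} (hx : Neg c f x) (hy : Neg c f y)
    (h : f (c (1 + x * y)) = 0) : c (1 + x * y) = 0 := by
  obtain ⟨h1, h2⟩ := D.c_one_add_mul hy (D.one_add_ne_zero hx.1)
  rw [hx.2, add_zero] at h1
  rw [h2] at h ⊢
  exact (D.neg_of_one_add_mem (by rw [h1]; exact hy.1) h).2

lemma line_ratio_ne : c (t - algebraMap k F 0) - c (t - algebraMap k F 1) ≠ 0 := by
  intro h
  have := D.line_indep 0 1 zero_ne_one 1 (-1) (by rw [← h]; module)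
  exact one_ne_zero this.1

lemma neg_ratio_iff {x : F} : Neg c f (x * ((t - algebraMap k F 0) / (t - algebraMap k F 1))) ↔
    Neg c f x := by
  refine ⟨fun h => ?_, fun h => D.neg_ratio h _ _⟩
  have h2 := D.neg_ratio h 0 1
  have h0 := D.line_ne 0
  have h1 := D.line_ne 1
  convert h2 using 1
  field_simp

lemma neg_mul_mul {x y w : F} (hx : Neg c f x) (hy : Neg c f y) (hw : Neg c f w)
    (h : f (c (x * y * w)) ≠ 0) : Neg c f (x * y * w) := by
  have hx0 := D.ne_zero_of_f hx.1
  have hy0 := D.ne_zero_of_f hy.1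
  have hw0 := D.ne_zero_of_f hw.1
  have main : ∀ x, Neg c f x → f (c (x * y * w)) ≠ 0 → c (x * y) ≠ 0 → Neg c f (x * y * w) := by
    intro x hx h hc
    by_cases hxy : f (c (x * y)) = 0
    swap
    · exact D.neg_mul (D.neg_mul hx hy hxy) hw h
    have hx0 := D.ne_zero_of_f hx.1
    have h0 : 1 + x * y ≠ 0 := by
      intro h0
      have : x * y = -1 := by linear_combination h0
      rw [this, D.c_neg, D.c_one] at hc; exact hc rfl
    have h3 : c (1 + x * y) = 0 :=
      D.c_one_add_mul_eq_zero hx hy (D.f_one_add_eq_zero hxy hc)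
    obtain ⟨h1, h2⟩ := D.c_one_add_mul hw h0
    rw [h3, add_zero] at h1
    rw [D.neg_iff h, h2]
    intro h4
    have hf' : f (c (w * (1 + x * y) / (1 - w))) ≠ 0 := by rw [h1]; exact hw.1
    by_cases h5 : Neg c f (w * (1 + x * y) / (1 - w))
    · rw [h5.2] at h4; exact h (by rw [← h4, map_zero])
    · rw [D.c_one_add_of_not_neg hf' h5, h1, D.map_mul _ _ (mul_ne_zero hx0 hy0) hw0] at h4
      exact hc (by simpa using h4.symm)
  by_cases hc : c (x * y) = 0
  · set r := (t - algebraMap k F 0) / (t - algebraMap k F 1) with hr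
    have hr0 : r ≠ 0 := div_ne_zero (D.line_ne 0) (D.line_ne 1)
    have hxr := D.neg_ratio hx 1 0
    have e1 : x * r * y * w = x * y * w * r := by ring
    have e2 : x * r * y = x * y * r := by ring
    have := main (x * r) hxr
      (by rw [e1, D.f_ratio (mul_ne_zero (mul_ne_zero hx0 hy0) hw0)]; exact h)
      (by rw [e2, D.c_ratio (mul_ne_zero hx0 hy0), hc, zero_add]; exact D.line_ratio_ne)
    rw [e1] at this
    exact D.neg_ratio_iff.1 this
  · exact main x hx h hc

lemma neg_mul_one_add {x y : F} (hx : Neg c f x) (hy : Neg c f y) : Neg c f (y * (1 + x)) := by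
  have hx0 := D.ne_zero_of_f hx.1
  have hx1 := D.one_add_ne_zero hx.1
  have main : ∀ y, Neg c f y → c (x * y) ≠ 0 → Neg c f (y * (1 + x)) := by
    intro y hy hc
    have hy0 := D.ne_zero_of_f hy.1
    have hcy : c (y * (1 + x)) = c y := by rw [D.map_mul _ _ hy0 hx1, hx.2, add_zero]
    have hf : f (c (y * (1 + x))) ≠ 0 := by rw [hcy]; exact hy.1
    have hy1 := D.one_add_ne_zero hy.1
    have hy2 := D.neg_div_one_add hy
    have e : 1 + y * (1 + x) = (1 + y) * (1 + x * (y / (1 + y))) := by field_simp; ring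
    have hc2 : c (y / (1 + y)) = c y := by rw [D.c_div _ _ hy0 hy1, hy.2, sub_zero]
    have hc3 : c (x * (y / (1 + y))) = c (x * y) := by
      rw [D.map_mul _ _ hx0 (D.ne_zero_of_f hy2.1), hc2, D.map_mul _ _ hx0 hy0]
    have hz : c (1 + x * (y / (1 + y))) = 0 := by
      by_cases hxy : f (c (x * (y / (1 + y)))) = 0
      · exact D.c_one_add_mul_eq_zero hx hy2 (D.f_one_add_eq_zero hxy (by rwa [hc3]))
      · exact (D.neg_mul hx hy2 hxy).2
    refine ⟨hf, ?_⟩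
    have h0 : 1 + x * (y / (1 + y)) ≠ 0 := by
      intro h0
      have := D.one_add_ne_zero hf
      rw [e, h0, mul_zero] at this
      exact this rfl
    rw [e, D.map_mul _ _ hy1 h0, hy.2, hz, add_zero]
  by_cases hc : c (x * y) = 0
  · have hy0 := D.ne_zero_of_f hy.1
    have := main _ (D.neg_ratio hy 1 0) (by
      rw [← mul_assoc, D.c_ratio (mul_ne_zero hx0 hy0), hc, zero_add]; exact D.line_ratio_ne)
    rw [mul_right_comm] at this
    exact D.neg_ratio_iff.1 this
  · exact main y hy hc

/-- The ring of elements of nonnegative valuation attached to a rigid datum. -/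
def _root_.RigidDatum.Mem (c : F → A) (f : A →ₗ[ZMod ℓ] ZMod ℓ) (x : F) : Prop :=
  x = 0 ∨ Neg c f x ∨ (f (c x) = 0 ∧ ∀ y, Neg c f y → Neg c f (x * y))

lemma mem_const (a : k) : Mem c f (algebraMap k F a) := by
  by_cases ha : a = 0
  · left; simp [ha]
  · right; right
    exact ⟨by rw [D.map_const, map_zero], fun y hy => D.neg_smul hy a ha⟩

lemma mem_or_inv (x : F) : Mem c f x ∨ Mem c f x⁻¹ := by
  by_cases hx : x = 0
  · left; left; exact hx
  by_cases hf : f (c x) = 0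
  · by_contra hcon
    push Not at hcon
    obtain ⟨h1, h2⟩ := hcon
    simp only [Mem, hx, inv_eq_zero, false_or, not_or, not_and, hf, true_implies, D.c_inv, map_neg,
      neg_zero] at h1 h2
    push Not at h1 h2
    obtain ⟨-, y, hy, hxy⟩ := h1
    obtain ⟨-, w, hw, hxw⟩ := h2
    have hy0 := D.ne_zero_of_f hy.1
    have hw0 := D.ne_zero_of_f hw.1
    have hf1 : f (c (x * y)) ≠ 0 := by rw [D.map_mul _ _ hx hy0, map_add, hf, zero_add]; exact hy.1
    have hf2 : f (c (x⁻¹ * w)) ≠ 0 := by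
      rw [D.map_mul _ _ (inv_ne_zero hx) hw0, map_add, D.c_inv, map_neg, hf, neg_zero, zero_add]
      exact hw.1
    have h3 := (D.neg_or_inv hf1).resolve_left hxy
    have e : y * w * (x * y)⁻¹ = x⁻¹ * w := by field_simp
    have := D.neg_mul_mul hy hw h3 (by rw [e]; exact hf2)
    rw [e] at this
    exact hxw this
  · rcases D.neg_or_inv hf with h | h
    · left; right; left; exact h
    · right; right; left; exact h

lemma mem_mul {x y : F} (hx : Mem c f x) (hy : Mem c f y) : Mem c f (x * y) := by
  rcases hx with rfl | hx | hx
  · left; simp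
  · rcases hy with rfl | hy | hy
    · left; simp
    · right
      by_cases hxy : f (c (x * y)) = 0
      · right
        refine ⟨hxy, fun w hw => D.neg_mul_mul hx hy hw ?_⟩
        rw [D.map_mul _ _ (mul_ne_zero (D.ne_zero_of_f hx.1) (D.ne_zero_of_f hy.1))
          (D.ne_zero_of_f hw.1), map_add, hxy, zero_add]
        exact hw.1
      · left; exact D.neg_mul hx hy hxy
    · right; left; rw [mul_comm]; exact hy.2 x hx
  · rcases hy with rfl | hy | hy
    · left; simp
    · right; left; exact hx.2 y hy
    · by_cases h0 : x * y = 0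
      · left; exact h0
      right; right
      refine ⟨?_, fun w hw => by rw [mul_assoc]; exact hx.2 _ (hy.2 w hw)⟩
      rw [D.map_mul _ _ (left_ne_zero_of_mul h0) (right_ne_zero_of_mul h0), map_add, hx.1, hy.1,
        add_zero]

lemma mem_one_add {x : F} (hx : Mem c f x) : Mem c f (1 + x) := by
  have hone : Mem c f 1 := by simpa using D.mem_const 1
  rcases hx with rfl | hx | hx
  · simpa using hone
  · right; right
    refine ⟨by rw [hx.2, map_zero], fun y hy => ?_⟩
    rw [mul_comm]; exact D.neg_mul_one_add hx hy
  · by_cases h1 : 1 + x = 0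
    · left; exact h1
    by_cases hx0 : x = 0
    · simpa [hx0] using hone
    by_cases hf : f (c (1 + x)) = 0
    · right; right
      refine ⟨hf, fun y hy => ?_⟩
      have hy0 := D.ne_zero_of_f hy.1
      have hxy := hx.2 y hy
      have hy1 := D.one_add_ne_zero hy.1
      have h2 : Neg c f ((x * y) * (1 + -(y / (1 + y)))) :=
        D.neg_mul_one_add (D.neg_neg (D.neg_div_one_add hy)) hxy
      have e : 1 + (1 + x) * y = (1 + y) * (1 + (x * y) * (1 + -(y / (1 + y)))) := by
        field_simp; ring
      refine ⟨by rw [D.map_mul _ _ h1 hy0, map_add, hf, zero_add]; exact hy.1, ?_⟩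
      rw [e, D.map_mul _ _ hy1 (D.one_add_ne_zero h2.1), hy.2, h2.2, add_zero]
    · right; left
      by_contra hn
      have hv := (D.neg_or_inv hf).resolve_left hn
      have h3 := hx.2 _ hv
      have h4 := D.c_one_sub hv
      have e : 1 - (1 + x)⁻¹ = x * (1 + x)⁻¹ := by field_simp; ring
      rw [e] at h4
      exact h3.1 (by rw [h4, map_zero])

lemma mem_add {x y : F} (hx : Mem c f x) (hy : Mem c f y) : Mem c f (x + y) := by
  by_cases hx0 : x = 0
  · simpa [hx0] using hy
  by_cases hy0 : y = 0
  · simpa [hy0] using hx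
  rcases D.mem_or_inv (x / y) with h | h
  · have := D.mem_mul hy (D.mem_one_add h)
    have e : y * (1 + x / y) = x + y := by field_simp; ring
    rwa [e] at this
  · have := D.mem_mul hx (D.mem_one_add h)
    have e : x * (1 + (x / y)⁻¹) = x + y := by field_simp
    rwa [e] at this

/-- A rigid datum comes from a valuation ring containing the constants whose units are killed
by `f`. -/
theorem exists_valuationSubring : ∃ O : ValuationSubring F,
    (∀ a : k, algebraMap k F a ∈ O) ∧ ∀ x : F, x ∈ O → x⁻¹ ∈ O → f (c x) = 0 := by
  have hneg1 : Mem c f (-1) := by simpa using D.mem_const (-1)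
  refine ⟨{ carrier := {x | Mem c f x}
            mul_mem' := fun hx hy => D.mem_mul hx hy
            one_mem' := by simpa using D.mem_const 1
            add_mem' := fun hx hy => D.mem_add hx hy
            zero_mem' := Or.inl rfl
            neg_mem' := fun {x} hx => by
              have := D.mem_mul hneg1 hx
              simpa using this
            mem_or_inv_mem' := D.mem_or_inv }, D.mem_const, ?_⟩
  intro x hx hx'
  by_contra hf
  have hx0 := D.ne_zero_of_f hf
  have hf' : f (c x⁻¹) ≠ 0 := by rw [D.c_inv, map_neg]; simpa using hf
  have h1 : Neg c f x := by
    rcases hx with h | h | h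
    · exact absurd h hx0
    · exact h
    · exact absurd h.1 hf
  have h2 : Neg c f x⁻¹ := by
    rcases hx' with h | h | h
    · simp [hx0] at h
    · exact h
    · exact absurd h.1 hf'
  exact D.not_neg_inv h1 h2

end RigidDatum

namespace MilnorRec

/-- `K^×/ℓ` written additively. -/
def KV (ℓ : ℕ) (K : Type*) [Field K] : Type _ := Additive (K1 ℓ K)

section KV
variable {ℓ : ℕ} {K : Type*} [Field K]

instance : AddCommGroup (KV ℓ K) := inferInstanceAs (AddCommGroup (Additive (K1 ℓ K)))

variable (ℓ) in
open Classical in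
/-- The class in `K^×/ℓ` of a field element, with junk value `0` at `0`. -/
def cl (x : K) : KV ℓ K :=
  if h : x = 0 then 0 else Additive.ofMul (K1proj ℓ K (Units.mk0 x h))

lemma cl_zero : cl ℓ (0 : K) = 0 := by simp [cl]

lemma cl_units (x : Kˣ) : cl ℓ (x : K) = Additive.ofMul (K1proj ℓ K x) := by
  simp [cl]; rfl

lemma cl_mul {x y : K} (hx : x ≠ 0) (hy : y ≠ 0) : cl ℓ (x * y) = cl ℓ x + cl ℓ y := by
  lift x to Kˣ using hx.isUnit
  lift y to Kˣ using hy.isUnit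
  rw [← Units.val_mul, cl_units, cl_units, cl_units, map_mul]; rfl

lemma cl_surj (v : KV ℓ K) : ∃ x : K, x ≠ 0 ∧ cl ℓ x = v := by
  obtain ⟨x, hx⟩ := QuotientGroup.mk'_surjective _ (Additive.toMul v)
  exact ⟨x, x.ne_zero, by rw [cl_units]; exact congrArg Additive.ofMul hx⟩

lemma cl_pow {x : K} (n : ℕ) : cl ℓ (x ^ n) = n • cl ℓ x := by
  by_cases hx : x = 0
  · subst hx; rcases n with _ | n
    · simpa using (by simpa using cl_mul (ℓ := ℓ) (one_ne_zero (α := K)) one_ne_zero : cl ℓ (1 : K) = 0)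
    · simp [cl_zero]
  lift x to Kˣ using Ne.isUnit hx
  rw [← Units.val_pow_eq_pow_val, cl_units, cl_units, map_pow]; rfl

lemma cl_one : cl ℓ (1 : K) = 0 := by simpa using cl_pow (ℓ := ℓ) (x := (1 : K)) 0

lemma cl_inv (x : K) : cl ℓ x⁻¹ = - cl ℓ x := by
  by_cases hx : x = 0
  · simp [hx, cl_zero]
  have := cl_mul (ℓ := ℓ) hx (inv_ne_zero hx)
  rw [mul_inv_cancel₀ hx, cl_one] at this
  exact (neg_eq_of_add_eq_zero_right this.symm).symm

lemma cl_div {x y : K} (hx : x ≠ 0) (hy : y ≠ 0) : cl ℓ (x / y) = cl ℓ x - cl ℓ y := by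
  rw [div_eq_mul_inv, cl_mul hx (inv_ne_zero hy), cl_inv, sub_eq_add_neg]

lemma cl_eq_zero_iff [NeZero ℓ] {x : K} : cl ℓ x = 0 ↔ ∃ y : K, x = y ^ ℓ := by
  by_cases hx : x = 0
  · subst hx; simp only [cl_zero, true_iff]; exact ⟨0, by simp [NeZero.ne]⟩
  lift x to Kˣ using Ne.isUnit hx
  rw [cl_units]
  constructor
  · intro h
    have h' : K1proj ℓ K x = 1 := h
    rw [K1proj, QuotientGroup.mk'_apply, QuotientGroup.eq_one_iff] at h'
    obtain ⟨y, hy⟩ := h'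
    exact ⟨y, by rw [← hy]; simp⟩
  · rintro ⟨y, hy⟩
    have hy0 : y ≠ 0 := by rintro rfl; simp [NeZero.ne] at hy
    change K1proj ℓ K x = 1
    rw [K1proj, QuotientGroup.mk'_apply, QuotientGroup.eq_one_iff]
    exact ⟨Units.mk0 y hy0, by ext; simp [hy]⟩

lemma nsmul_KV [NeZero ℓ] (v : KV ℓ K) : ℓ • v = 0 := by
  obtain ⟨x, -, rfl⟩ := cl_surj v
  rw [← cl_pow]; exact cl_eq_zero_iff.2 ⟨x, rfl⟩

instance [NeZero ℓ] : Module (ZMod ℓ) (KV ℓ K) := AddCommGroup.zmodModule nsmul_KV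

lemma cl_pow' [NeZero ℓ] {x : K} (n : ℕ) : cl ℓ (x ^ n) = (n : ZMod ℓ) • cl ℓ x := by
  rw [cl_pow, Nat.cast_smul_eq_nsmul]

lemma cl_prod {α : Type*} (s : Finset α) (g : α → K) (hg : ∀ i ∈ s, g i ≠ 0) :
    cl ℓ (∏ i ∈ s, g i) = ∑ i ∈ s, cl ℓ (g i) := by
  classical
  induction s using Finset.induction_on with
  | empty => simp [cl_one]
  | insert a s ha ih =>
    rw [Finset.prod_insert ha, Finset.sum_insert ha, cl_mul (hg _ (by simp)), ih]
    · exact fun i hi => hg i (by simp [hi])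
    · exact Finset.prod_ne_zero_iff.2 fun i hi => hg i (by simp [hi])

lemma cl_const [NeZero ℓ] {k : Type*} [Field k] [IsAlgClosed k] [Algebra k K] (a : k) :
    cl ℓ (algebraMap k K a) = 0 := by
  obtain ⟨b, hb⟩ := IsAlgClosed.exists_pow_nat_eq a (NeZero.pos ℓ)
  exact cl_eq_zero_iff.2 ⟨algebraMap k K b, by rw [← hb, map_pow]⟩

/-- The linear map on `KV` induced by a multiplicative function. -/
def KV.lift [NeZero ℓ] {A : Type*} [AddCommGroup A] [Module (ZMod ℓ) A] (m : K → A)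
    (hm : ∀ x y, x ≠ 0 → y ≠ 0 → m (x * y) = m x + m y) : KV ℓ K →ₗ[ZMod ℓ] A := by
  let m0 : Kˣ →* Multiplicative A :=
    { toFun := fun x => Multiplicative.ofAdd (m x)
      map_one' := by
        have := hm 1 1 one_ne_zero one_ne_zero
        simp only [mul_one, left_eq_add] at this
        simp [this]
      map_mul' := fun x y => by simp [hm x y x.ne_zero y.ne_zero] }
  let m1 : K1 ℓ K →* Multiplicative A := QuotientGroup.lift _ m0 (by
    rintro _ ⟨y, rfl⟩
    change m0 (y ^ ℓ) = 1
    rw [map_pow]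
    change ℓ • m y = 0
    rw [← Nat.cast_smul_eq_nsmul (ZMod ℓ)]; simp)
  exact AddMonoidHom.toZModLinearMap ℓ (MonoidHom.toAdditiveLeft m1)

lemma KV.lift_cl [NeZero ℓ] {A : Type*} [AddCommGroup A] [Module (ZMod ℓ) A] (m : K → A)
    (hm : ∀ x y, x ≠ 0 → y ≠ 0 → m (x * y) = m x + m y) {x : K} (hx : x ≠ 0) :
    KV.lift m hm (cl ℓ x) = m x := by
  lift x to Kˣ using hx.isUnit
  rw [cl_units]; rfl


/-- Functoriality of `KV` in field homomorphisms. -/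
def KV.map [NeZero ℓ] {M : Type*} [Field M] (σ : M →+* K) : KV ℓ M →ₗ[ZMod ℓ] KV ℓ K :=
  KV.lift (fun x => cl ℓ (σ x)) fun x y hx hy => by
    rw [map_mul, cl_mul ((map_ne_zero σ).2 hx) ((map_ne_zero σ).2 hy)]

lemma KV.map_cl [NeZero ℓ] {M : Type*} [Field M] (σ : M →+* K) (x : M) :
    KV.map σ (cl ℓ x) = cl ℓ (σ x) := by
  by_cases hx : x = 0
  · simp [hx, cl_zero]
  · exact KV.lift_cl _ _ hx

end KV

section PI
variable {ℓ : ℕ} [Fact ℓ.Prime] {p : ℕ} {M K : Type*} [Field M] [Field K] [Algebra M K]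

lemma natCast_pow_ne_zero (hp : (p : ZMod ℓ) ≠ 0) (n : ℕ) : ((p ^ n : ℕ) : ZMod ℓ) ≠ 0 := by
  rw [Nat.cast_pow]; exact pow_ne_zero _ hp

lemma KV.map_bijective [ExpChar M p] (hp : (p : ZMod ℓ) ≠ 0) [IsPurelyInseparable M K] :
    Function.Bijective (KV.map (ℓ := ℓ) (algebraMap M K)) := by
  constructor
  · rw [injective_iff_map_eq_zero]
    intro v hv
    obtain ⟨y, hy, rfl⟩ := cl_surj v
    rw [KV.map_cl, cl_eq_zero_iff] at hv
    obtain ⟨z, hz⟩ := hv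
    obtain ⟨n, w, hw⟩ := IsPurelyInseparable.pow_mem M p z
    have : y ^ p ^ n = w ^ ℓ := by
      apply (algebraMap M K).injective
      rw [map_pow, hz, map_pow, hw, ← pow_mul, ← pow_mul, mul_comm]
    have h2 : cl ℓ (y ^ p ^ n) = 0 := cl_eq_zero_iff.2 ⟨w, this⟩
    rw [cl_pow'] at h2
    exact (smul_eq_zero.1 h2).resolve_left (natCast_pow_ne_zero hp n)
  · intro v
    obtain ⟨x, hx, rfl⟩ := cl_surj v
    obtain ⟨n, w, hw⟩ := IsPurelyInseparable.pow_mem M p x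
    refine ⟨((p ^ n : ℕ) : ZMod ℓ)⁻¹ • cl ℓ w, ?_⟩
    rw [_root_.map_smul, KV.map_cl, hw, cl_pow', smul_smul,
      inv_mul_cancel₀ (natCast_pow_ne_zero hp n), one_smul]

/-- A purely inseparable extension of degree prime to `ℓ` does not change `KV`. -/
def KV.piEquiv [ExpChar M p] (hp : (p : ZMod ℓ) ≠ 0) [IsPurelyInseparable M K] :
    KV ℓ M ≃ₗ[ZMod ℓ] KV ℓ K :=
  LinearEquiv.ofBijective (KV.map (algebraMap M K)) (KV.map_bijective hp)

lemma KV.piEquiv_symm_cl [ExpChar M p] (hp : (p : ZMod ℓ) ≠ 0) [IsPurelyInseparable M K] (x : M) :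
    (KV.piEquiv (K := K) hp).symm (cl ℓ (algebraMap M K x)) = cl ℓ x := by
  rw [LinearEquiv.symm_apply_eq]
  exact (KV.map_cl _ _).symm

end PI

section QGen
open IntermediateField
variable (ℓ : ℕ) (p : ℕ) (k : Type*) {K : Type*} [Field k] [Field K] [Algebra k K]

/-- `t` is transcendental and `k(t)` is relatively algebraically closed up to
purely inseparable elements. -/
def QGen (t : K) : Prop :=
  Transcendental k t ∧ ∀ α : K, IsAlgebraic k⟮t⟯ α → ∃ n : ℕ, α ^ p ^ n ∈ k⟮t⟯

/-- The span of the classes of `t - a`, `a ∈ k`. -/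
def Om [NeZero ℓ] (t : K) : Submodule (ZMod ℓ) (KV ℓ K) :=
  Submodule.span (ZMod ℓ) (Set.range fun a : k => cl ℓ (t - algebraMap k K a))

variable {ℓ p k}

lemma sub_const_ne_zero {t : K} (ht : Transcendental k t) (a : k) : t - algebraMap k K a ≠ 0 := by
  intro h
  rw [sub_eq_zero.1 h] at ht
  exact ht (isAlgebraic_algebraMap a)

lemma cl_aeval_mem_Om [NeZero ℓ] [IsAlgClosed k] {t : K} (ht : Transcendental k t)
    (P : Polynomial k) : cl ℓ (Polynomial.aeval t P) ∈ Om ℓ k t := by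
  by_cases hP : P = 0
  · simp [hP, cl_zero]
  induction h : P.natDegree generalizing P with
  | zero =>
    rw [Polynomial.eq_C_of_natDegree_eq_zero h, Polynomial.aeval_C, cl_const]
    exact zero_mem _
  | succ n ih =>
    obtain ⟨a, ha⟩ := IsAlgClosed.exists_root P (by
      rw [Polynomial.degree_eq_natDegree hP, h]; exact_mod_cast Nat.succ_ne_zero n)
    obtain ⟨Q, rfl⟩ := Polynomial.dvd_iff_isRoot.2 ha
    have hQ : Q ≠ 0 := by rintro rfl; simp at hP
    rw [Polynomial.natDegree_mul (Polynomial.X_sub_C_ne_zero a) hQ,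
      Polynomial.natDegree_X_sub_C] at h
    have hne : Polynomial.aeval t Q ≠ 0 := fun h0 => ht ⟨Q, hQ, h0⟩
    rw [map_mul, cl_mul (by simpa using sub_const_ne_zero ht a) hne]
    refine add_mem (Submodule.subset_span ⟨a, by simp⟩) (ih Q hQ (by omega))

lemma cl_mem_Om [NeZero ℓ] [IsAlgClosed k] {t : K} (ht : Transcendental k t) {w : K}
    (hw : w ∈ k⟮t⟯) : cl ℓ w ∈ Om ℓ k t := by
  obtain ⟨P, Q, rfl⟩ := (IntermediateField.mem_adjoin_simple_iff k w).1 hw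
  by_cases hP : Polynomial.aeval t P = 0
  · simp [hP, cl_zero]
  by_cases hQ : Polynomial.aeval t Q = 0
  · simp [hQ, cl_zero]
  rw [cl_div hP hQ]
  exact sub_mem (cl_aeval_mem_Om ht P) (cl_aeval_mem_Om ht Q)

lemma QGen.linearIndependent [Fact ℓ.Prime] [IsAlgClosed k] (hp : (p : ZMod ℓ) ≠ 0) {t : K}
    (ht : QGen p k t) :
    LinearIndependent (ZMod ℓ) (fun a : k => cl ℓ (t - algebraMap k K a)) := by
  classical
  rw [linearIndependent_iff']
  intro s g hg a ha
  have h1 : cl ℓ (∏ a ∈ s, (t - algebraMap k K a) ^ (g a).val) = 0 := by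
    rw [cl_prod _ _ fun i _ => pow_ne_zero _ (sub_const_ne_zero ht.1 i), ← hg]
    refine Finset.sum_congr rfl fun i _ => ?_
    rw [cl_pow', ZMod.natCast_zmod_val]
  obtain ⟨α, hα⟩ := cl_eq_zero_iff.1 h1
  have hmem : ∏ a ∈ s, (t - algebraMap k K a) ^ (g a).val ∈ k⟮t⟯ :=
    prod_mem fun i _ => pow_mem (sub_mem (mem_adjoin_simple_self k t) (IntermediateField.algebraMap_mem _ i)) _
  have halg : IsAlgebraic k⟮t⟯ α := by
    have : IsAlgebraic k⟮t⟯ (α ^ ℓ) := by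
      rw [← hα]; exact isAlgebraic_algebraMap (⟨_, hmem⟩ : k⟮t⟯)
    exact this.of_pow (NeZero.pos ℓ)
  obtain ⟨n, hn⟩ := ht.2 α halg
  obtain ⟨P, Q, hPQ⟩ := (IntermediateField.mem_adjoin_simple_iff k _).1 hn
  have hprod : ∏ a ∈ s, (t - algebraMap k K a) ^ (g a).val ≠ 0 :=
    Finset.prod_ne_zero_iff.2 fun i _ => pow_ne_zero _ (sub_const_ne_zero ht.1 i)
  have hα0 : α ≠ 0 := by rintro rfl; simp [NeZero.ne] at hα; exact hprod hα
  have hQ0 : Polynomial.aeval t Q ≠ 0 := by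
    intro h; rw [h, div_zero] at hPQ; exact pow_ne_zero _ hα0 hPQ
  have hP0 : Polynomial.aeval t P ≠ 0 := by
    intro h; rw [h, zero_div] at hPQ; exact pow_ne_zero _ hα0 hPQ
  have key : Q ^ ℓ * (∏ a ∈ s, (Polynomial.X - Polynomial.C a) ^ (g a).val) ^ p ^ n = P ^ ℓ := by
    apply transcendental_iff_injective.1 ht.1
    simp only [map_mul, map_pow, map_prod, map_sub, Polynomial.aeval_X, Polynomial.aeval_C]
    rw [hα, ← pow_mul, mul_comm ℓ, pow_mul, hPQ, ← mul_pow, mul_div_cancel₀ _ hQ0]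
  have hQ : Q ≠ 0 := by rintro rfl; simp at hQ0
  have hP : P ≠ 0 := by rintro rfl; simp at hP0
  have hprod' : ∏ a ∈ s, (Polynomial.X - Polynomial.C a) ^ (g a).val ≠ 0 :=
    Finset.prod_ne_zero_iff.2 fun i _ => pow_ne_zero _ (Polynomial.X_sub_C_ne_zero i)
  have hr := congrArg (Polynomial.rootMultiplicity a) key
  rw [← Polynomial.count_roots, ← Polynomial.count_roots,
    Polynomial.roots_mul (mul_ne_zero (pow_ne_zero _ hQ) (pow_ne_zero _ hprod')),
    Polynomial.roots_pow, Polynomial.roots_pow, Polynomial.roots_pow,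
    Polynomial.roots_prod _ _ hprod'] at hr
  simp only [Polynomial.roots_pow, Polynomial.roots_X_sub_C, Multiset.count_add,
    Multiset.count_nsmul, Multiset.count_bind, Multiset.count_singleton] at hr
  have hsum : (s.val.map fun b => (g b).val * if a = b then 1 else 0).sum = (g a).val := by
    change ∑ b ∈ s, _ = _
    simp [ha]
  rw [hsum] at hr
  have hz := congrArg (Nat.cast : ℕ → ZMod ℓ) hr
  simp only [Nat.cast_add, Nat.cast_mul, CharP.cast_eq_zero, zero_mul, zero_add,
    ZMod.natCast_zmod_val] at hz
  exact (mul_eq_zero.1 hz).resolve_left (natCast_pow_ne_zero hp n)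

end QGen
end MilnorRec

namespace MilnorRec
section Adm
variable {ℓ : ℕ} [Fact ℓ.Prime] (p : ℕ) (k : Type*) {K : Type*} [Field k] [Field K] [Algebra k K]

/-- A functional on `K^×/ℓ` which satisfies the Steinberg relation modulo a subspace
transverse to a rational line on which the functional vanishes. -/
structure AdmWith (f : KV ℓ K →ₗ[ZMod ℓ] ZMod ℓ) (T : Submodule (ZMod ℓ) (KV ℓ K)) : Prop where
  le_ker : ∀ v ∈ T, f v = 0
  ne_zero : f ≠ 0
  stein : ∀ x : K, x ≠ 0 → 1 - x ≠ 0 →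
    f (cl ℓ x) • cl ℓ (1 - x) - f (cl ℓ (1 - x)) • cl ℓ x ∈ T
  gen : ∃ t : K, QGen p k t ∧ (∀ v ∈ Om ℓ k t, f v = 0) ∧ Disjoint (Om ℓ k t) T

/-- Admissible functionals. -/
def Adm (f : KV ℓ K →ₗ[ZMod ℓ] ZMod ℓ) : Prop := ∃ T, AdmWith p k f T

/-- `f` sees `u` at the point `a`. -/
def Sees (f : KV ℓ K →ₗ[ZMod ℓ] ZMod ℓ) (u : K) (a : k) : Prop :=
  f (cl ℓ (u - algebraMap k K a)) ≠ 0 ∧ ∃ b : k, f (cl ℓ (u - algebraMap k K b)) = 0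

/-- `O` contains the constants and `f` vanishes on its units. -/
def Compat (f : KV ℓ K →ₗ[ZMod ℓ] ZMod ℓ) (O : ValuationSubring K) : Prop :=
  (∀ a : k, algebraMap k K a ∈ O) ∧ ∀ x : K, O.valuation x = 1 → f (cl ℓ x) = 0

variable {p k}

lemma AdmWith.exists_compat [IsAlgClosed k] (hp : (p : ZMod ℓ) ≠ 0)
    {f : KV ℓ K →ₗ[ZMod ℓ] ZMod ℓ} {T : Submodule (ZMod ℓ) (KV ℓ K)} (h : AdmWith p k f T) :
    ∃ O, Compat k f O := by
  obtain ⟨t, ht, hft, hd⟩ := h.gen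
  have D : RigidDatum ℓ k K (KV ℓ K ⧸ T) (fun x => T.mkQ (cl ℓ x)) (T.liftQ f h.le_ker) t :=
    { map_mul := fun x y hx hy => by rw [cl_mul hx hy, map_add]
      map_const := fun a => by rw [cl_const, map_zero]
      stein := fun x hx hx' => by
        have := (Submodule.Quotient.mk_eq_zero T).2 (h.stein x hx hx')
        rw [Submodule.Quotient.mk_sub, Submodule.Quotient.mk_smul, Submodule.Quotient.mk_smul,
          sub_eq_zero] at this
        exact this
      line_ne := fun a => sub_const_ne_zero ht.1 a
      line_mem := fun a => hft _ (Submodule.subset_span ⟨a, rfl⟩)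
      line_indep := fun a b hab i j hij => by
        have hmem : i • cl ℓ (t - algebraMap k K a) + j • cl ℓ (t - algebraMap k K b) ∈ T := by
          rw [← Submodule.Quotient.mk_eq_zero, Submodule.Quotient.mk_add,
            Submodule.Quotient.mk_smul, Submodule.Quotient.mk_smul]
          exact hij
        have hO : i • cl ℓ (t - algebraMap k K a) + j • cl ℓ (t - algebraMap k K b) ∈ Om ℓ k t :=
          add_mem (Submodule.smul_mem _ _ (Submodule.subset_span ⟨a, rfl⟩))
            (Submodule.smul_mem _ _ (Submodule.subset_span ⟨b, rfl⟩))
        have h0 := Submodule.disjoint_def.1 hd _ hO hmem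
        have H := ht.linearIndependent (ℓ := ℓ) hp
        have H2 := LinearIndependent.pair_iff.1 (H.comp ![a, b] (by
            intro x y; fin_cases x <;> fin_cases y <;> simp [hab, hab.symm]) |> fun H' => by
          have e : (fun a => cl ℓ (t - algebraMap k K a)) ∘ ![a, b] =
              ![cl ℓ (t - algebraMap k K a), cl ℓ (t - algebraMap k K b)] := by
            ext x; fin_cases x <;> rfl
          rw [e] at H'; exact H')
        exact H2 i j h0 }
  obtain ⟨O, h1, h2⟩ := D.exists_valuationSubring
  refine ⟨O, h1, fun x hx => ?_⟩
  have hx0 : x ≠ 0 := by rintro rfl; simp at hx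
  refine h2 x ((O.valuation_le_one_iff x).1 hx.le) ((O.valuation_le_one_iff _).1 ?_)
  rw [map_inv₀, hx, inv_one]

lemma Adm.exists_compat [IsAlgClosed k] (hp : (p : ZMod ℓ) ≠ 0)
    {f : KV ℓ K →ₗ[ZMod ℓ] ZMod ℓ} (h : Adm p k f) : ∃ O, Compat k f O :=
  let ⟨_, h⟩ := h; h.exists_compat hp

namespace Compat
variable {f : KV ℓ K →ₗ[ZMod ℓ] ZMod ℓ} {O : ValuationSubring K} (h : Compat k f O)
include h

lemma val_const {a : k} (ha : a ≠ 0) : O.valuation (algebraMap k K a) = 1 := by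
  refine le_antisymm ((O.valuation_le_one_iff _).2 (h.1 a)) ?_
  have := (O.valuation_le_one_iff _).2 (h.1 a⁻¹)
  rw [map_inv₀, map_inv₀] at this
  exact (inv_le_one₀ (by simpa [zero_lt_iff] using ha)).1 this

lemma val_const_le (a : k) : O.valuation (algebraMap k K a) ≤ 1 :=
  (O.valuation_le_one_iff _).2 (h.1 a)

lemma val_ne_one {x : K} (hx : f (cl ℓ x) ≠ 0) : O.valuation x ≠ 1 := fun h1 => hx (h.2 x h1)

lemma eq_of_val_eq {x y : K} (hy : y ≠ 0) (hxy : O.valuation x = O.valuation y) :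
    f (cl ℓ x) = f (cl ℓ y) := by
  have hy' : O.valuation y ≠ 0 := by simpa using hy
  have hx : x ≠ 0 := by rintro rfl; rw [map_zero] at hxy; exact hy' hxy.symm
  have := h.2 (x / y) (by rw [map_div₀, hxy, div_self hy'])
  rw [cl_div hx hy, map_sub, sub_eq_zero] at this
  exact this

lemma val_sub_const {x : K} {a : k} (ha : a ≠ 0) (hx : O.valuation x < 1) :
    O.valuation (x - algebraMap k K a) = 1 := by
  rw [Valuation.map_sub_eq_of_lt_right _ (by rwa [h.val_const ha]), h.val_const ha]

lemma val_sub_sub {u : K} {a b : k} (hab : b ≠ a) (hx : O.valuation (u - algebraMap k K a) < 1) :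
    O.valuation (u - algebraMap k K b) = 1 := by
  have := h.val_sub_const (sub_ne_zero.2 hab) hx
  rwa [RingHom.map_sub, sub_sub_sub_cancel_right] at this

lemma eq_zero_of_lt {u : K} {a b : k} (hab : b ≠ a)
    (hx : O.valuation (u - algebraMap k K a) < 1) : f (cl ℓ (u - algebraMap k K b)) = 0 :=
  h.2 _ (h.val_sub_sub hab hx)

lemma unique {u : K} {a b : k} (ha : O.valuation (u - algebraMap k K a) < 1)
    (hb : O.valuation (u - algebraMap k K b) < 1) : b = a := by
  by_contra hab
  exact hb.ne (h.val_sub_sub hab ha)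

lemma lt_of_sees {u : K} {a : k} (hs : Sees k f u a) : O.valuation (u - algebraMap k K a) < 1 := by
  obtain ⟨h1, b, hb⟩ := hs
  refine lt_of_le_of_ne (not_lt.1 fun hgt => h1 ?_) (h.val_ne_one h1)
  have h0 : u - algebraMap k K a ≠ 0 := by intro h0; simp [h0] at hgt
  rw [← hb]
  refine (h.eq_of_val_eq h0 ?_).symm
  have : u - algebraMap k K b = (u - algebraMap k K a) + algebraMap k K (a - b) := by
    rw [map_sub]; ring
  rw [this, Valuation.map_add_eq_of_lt_left]
  exact (h.val_const_le _).trans_lt hgt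

/-- On the nonzero multiples `P + c Q`, the functional is constant. -/
lemma add_const {P Q : K} (hP : P ≠ 0) (hQ : Q ≠ 0) (hPQ : f (cl ℓ P) ≠ f (cl ℓ Q)) :
    (∀ c : k, c ≠ 0 → f (cl ℓ (P + algebraMap k K c * Q)) = f (cl ℓ Q)) ∨
    (∀ c : k, c ≠ 0 → f (cl ℓ (P + algebraMap k K c * Q)) = f (cl ℓ P)) := by
  rcases lt_trichotomy (O.valuation P) (O.valuation Q) with hlt | heq | hlt
  · refine Or.inl fun c hc => h.eq_of_val_eq hQ ?_
    rw [Valuation.map_add_eq_of_lt_right] <;> simp [h.val_const hc, hlt]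
  · exact absurd (h.eq_of_val_eq hQ heq) hPQ
  · refine Or.inr fun c hc => h.eq_of_val_eq hP ?_
    rw [Valuation.map_add_eq_of_lt_left]; simp [h.val_const hc, hlt]

end Compat
end Adm

section Transport
variable {ℓ : ℕ} [Fact ℓ.Prime] (p : ℕ) (k l : Type*) {K L : Type*} [Field k] [Field K] [Algebra k K]
  [Field l] [Field L] [Algebra l L]

/-- One half of the compatibility of `φ` with rational lines and the Steinberg relation. -/
structure HalfTransport (p' : ℕ) (φ : KV ℓ K ≃ₗ[ZMod ℓ] KV ℓ L) : Prop where
  stein : ∀ (f : KV ℓ K →ₗ[ZMod ℓ] ZMod ℓ) (T : Submodule (ZMod ℓ) (KV ℓ K)),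
    (∀ v ∈ T, f v = 0) →
    (∀ x : K, x ≠ 0 → 1 - x ≠ 0 →
      f (cl ℓ x) • cl ℓ (1 - x) - f (cl ℓ (1 - x)) • cl ℓ x ∈ T) →
    ∀ x : L, x ≠ 0 → 1 - x ≠ 0 →
      f (φ.symm (cl ℓ x)) • cl ℓ (1 - x) - f (φ.symm (cl ℓ (1 - x))) • cl ℓ x ∈ T.map φ.toLinearMap
  rat : ∀ t : K, QGen p k t → ∃ U : L, QGen p' l U ∧ (Om ℓ k t).map φ.toLinearMap = Om ℓ l U

variable {p k l}

lemma HalfTransport.adm {p' : ℕ} {φ : KV ℓ K ≃ₗ[ZMod ℓ] KV ℓ L} (H : HalfTransport p k l p' φ)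
    {f : KV ℓ K →ₗ[ZMod ℓ] ZMod ℓ} (hf : Adm p k f) :
    Adm p' l (f ∘ₗ φ.symm.toLinearMap) := by
  obtain ⟨T, hT⟩ := hf
  obtain ⟨t, ht, hft, hd⟩ := hT.gen
  obtain ⟨U, hU, hmap⟩ := H.rat t ht
  refine ⟨T.map φ.toLinearMap, ?_, ?_, H.stein f T hT.le_ker hT.stein, U, hU, ?_, ?_⟩
  · rintro _ ⟨v, hv, rfl⟩
    simpa using hT.le_ker v hv
  · intro h0
    apply hT.ne_zero
    ext v
    simpa using LinearMap.congr_fun h0 (φ v)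
  · rw [← hmap]
    rintro _ ⟨v, hv, rfl⟩
    simpa using hft v hv
  · rw [← hmap]
    exact Submodule.disjoint_map φ.injective hd

end Transport
end MilnorRec

namespace MilnorRec
open IntermediateField

section TB
variable {k K ι : Type*} [Field k] [Field K] [Algebra k K]

lemma _root_.IsTranscendenceBasis.of_isAlgebraic [Finite ι] {x : ι → K}
    (hx : IsTranscendenceBasis k x) {x' : ι → K}
    (h : ∀ i, IsAlgebraic (Algebra.adjoin k (Set.range x')) (x i)) :
    IsTranscendenceBasis k x' := by
  have hA := hx.isAlgebraic
  have : Algebra.IsAlgebraic (Algebra.adjoin k (Set.range x')) K := by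
    refine ⟨fun a => ?_⟩
    refine IsAlgebraic.adjoin_of_forall_isAlgebraic (s := Set.range x) ?_ (hA.isAlgebraic a)
    rintro _ ⟨⟨i, rfl⟩, -⟩
    exact h i
  refine Algebra.IsAlgebraic.isTranscendenceBasis_of_lift_le_trdeg_of_finite k x' ?_
  exact hx.lift_cardinalMk_eq_trdeg.le

lemma _root_.IsTranscendenceBasis.of_mem_adjoin [Finite ι] {x : ι → K}
    (hx : IsTranscendenceBasis k x) {x' : ι → K}
    (h : ∀ i, x i ∈ adjoin k (Set.range x')) :
    IsTranscendenceBasis k x' :=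
  hx.of_isAlgebraic fun i => isAlgebraic_adjoin_iff.1 <|
    isAlgebraic_algebraMap (⟨x i, h i⟩ : adjoin k (Set.range x'))

end TB

section PFG
variable (p : ℕ) (k K : Type*) [Field k] [Field K] [Algebra k K]

/-- `K` is finitely generated over `k` up to purely inseparable elements. -/
def PFG : Prop := ∃ s : Finset K, ∀ x : K, ∃ n : ℕ, x ^ p ^ n ∈ adjoin k (s : Set K)

variable {p k K}

lemma PFG.finiteDimensional_separableClosure (h : PFG p k K) [ExpChar k p]
    (E : IntermediateField k K) [Algebra.IsAlgebraic E K] :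
    FiniteDimensional E (separableClosure E K) := by
  obtain ⟨s, hs⟩ := h
  have : FiniteDimensional E (adjoin E (s : Set K)) :=
    finiteDimensional_adjoin fun x _ => (Algebra.IsAlgebraic.isAlgebraic x).isIntegral
  have : ExpChar E p := expChar_of_injective_algebraMap (algebraMap k E).injective p
  have hle : separableClosure E K ≤ adjoin E (s : Set K) := by
    intro m hm
    obtain ⟨n, hn⟩ := hs m
    have h1 := adjoin_simple_eq_adjoin_pow_expChar_pow_of_isSeparable E K
      (mem_separableClosure_iff.1 hm) p n
    have h2 : m ^ p ^ n ∈ adjoin E (s : Set K) := by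
      have : adjoin k (s : Set K) ≤ (adjoin E (s : Set K)).restrictScalars k :=
        adjoin_le_iff.2 (subset_adjoin E (s : Set K))
      exact this hn
    have h3 : E⟮m ^ p ^ n⟯ ≤ adjoin E (s : Set K) := adjoin_simple_le_iff.2 h2
    exact h3 (h1 ▸ mem_adjoin_simple_self E m)
  exact FiniteDimensional.of_injective (IntermediateField.inclusion hle).toLinearMap
    (IntermediateField.inclusion hle).injective

lemma PFG.finite_intermediateField (h : PFG p k K) [ExpChar k p]
    (E : IntermediateField k K) [Algebra.IsAlgebraic E K] :
    Finite (IntermediateField E (separableClosure E K)) := by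
  have := h.finiteDimensional_separableClosure E
  exact Field.finite_intermediateField_of_exists_primitive_element _ _
    (Field.exists_primitive_element _ _)

end PFG

section Simple
open Polynomial
variable {k K : Type*} [Field k] [Field K] [Algebra k K]

lemma mem_range_algebraMap_of_isAlgebraic [IsAlgClosed k] {c : K} (hc : IsAlgebraic k c) :
    ∃ a : k, algebraMap k K a = c :=
  minpoly.mem_range_of_degree_eq_one k c
    (IsAlgClosed.degree_eq_one_of_irreducible k (minpoly.irreducible hc.isIntegral))

lemma exists_bivariate_of_isAlgebraic {u α : K} (halg : IsAlgebraic k⟮u⟯ α) :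
    ∃ F : k[X][X], F ≠ 0 ∧ ∑ i ∈ Finset.range (F.natDegree + 1), aeval u (F.coeff i) * α ^ i = 0 := by
  obtain ⟨G, hG, hGα⟩ := isAlgebraic_adjoin_iff.1 halg
  let f : k[X] →ₐ[k] Algebra.adjoin k {u} := aeval ⟨u, Algebra.self_mem_adjoin_singleton k u⟩
  have hf : ∀ P, (f P : K) = aeval u P := fun P => by
    change (Algebra.adjoin k {u}).val (f P) = _
    rw [← aeval_algHom_apply]; rfl
  have hsurj : Function.Surjective f := by
    rintro ⟨y, hy⟩
    obtain ⟨P, rfl⟩ := (Algebra.adjoin_singleton_eq_range_aeval k u ▸ hy : y ∈ (aeval u).range)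
    exact ⟨P, Subtype.ext (hf P)⟩
  obtain ⟨F, rfl⟩ := Polynomial.map_surjective f.toRingHom hsurj G
  refine ⟨F, by rintro rfl; simp at hG, ?_⟩
  rw [Polynomial.aeval_def, Polynomial.eval₂_map, Polynomial.eval₂_eq_sum_range] at hGα
  rw [← hGα]
  refine Finset.sum_congr rfl fun i _ => ?_
  rw [← hf]; rfl

lemma mem_adjoin_simple_of_isAlgebraic [IsAlgClosed k] (C : IntermediateField k K) {u α : K}
    (hu : Transcendental C u) (hα : α ∈ C⟮u⟯) (halg : IsAlgebraic k⟮u⟯ α) : α ∈ k⟮u⟯ := by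
  obtain ⟨P, Q, rfl⟩ := (IntermediateField.mem_adjoin_simple_iff C α).1 hα
  by_cases hQu : aeval u Q = 0
  · rw [hQu, div_zero]; exact zero_mem _
  have hQ : Q ≠ 0 := by rintro rfl; simp at hQu
  obtain ⟨F, hF, hFα⟩ := exists_bivariate_of_isAlgebraic halg
  set N := F.natDegree
  have hH : ∑ i ∈ Finset.range (N + 1),
      (F.coeff i).map (algebraMap k C) * P ^ i * Q ^ (N - i) = 0 := by
    apply transcendental_iff_injective.1 hu
    rw [map_zero, map_sum, ← mul_zero (aeval u Q ^ N), ← hFα, Finset.mul_sum]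
    refine Finset.sum_congr rfl fun i hi => ?_
    have hi' : i ≤ N := by simpa [Nat.lt_succ_iff] using hi
    obtain ⟨j, hj⟩ := Nat.exists_eq_add_of_le hi'
    rw [map_mul, map_mul, map_pow, map_pow, aeval_map_algebraMap, hj, Nat.add_sub_cancel_left, pow_add, div_pow]
    have := pow_ne_zero i (show aeval u Q ≠ 0 from hQu)
    field_simp
  obtain ⟨m, hm⟩ : ∃ m, Q.coeff m ≠ 0 := by
    by_contra! h; exact hQ (Polynomial.ext h)
  obtain ⟨φ, hφ⟩ : ∃ φ : C →ₗ[k] k, φ (Q.coeff m) ≠ 0 := by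
    by_contra! h
    exact hm ((Module.forall_dual_apply_eq_zero_iff k _).1 h)
  let co : C[X] → k[X] := fun R => ∑ i ∈ R.support, monomial i (φ (R.coeff i))
  have hco : ∀ R i, (co R).coeff i = φ (R.coeff i) := by
    intro R i
    simp only [co, finsetSum_coeff, coeff_monomial, Finset.sum_ite_eq', mem_support_iff]
    split_ifs with h
    · rfl
    · rw [notMem_support_iff.1 h, map_zero]
  have hev : ∀ R (a : k), φ (R.eval (algebraMap k C a)) = (co R).eval a := by
    intro R a
    simp only [co, eval_finsetSum, eval_monomial]
    rw [eval_eq_sum, Polynomial.sum, map_sum]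
    refine Finset.sum_congr rfl fun i _ => ?_
    rw [← map_pow, mul_comm, ← Algebra.smul_def, map_smul, smul_eq_mul, mul_comm]
  have key : P * (co Q).map (algebraMap k C) = (co P).map (algebraMap k C) * Q := by
    rw [← sub_eq_zero]
    set D := P * (co Q).map (algebraMap k C) - (co P).map (algebraMap k C) * Q with hD
    by_contra hD0
    have hlead : F.leadingCoeff ≠ 0 := leadingCoeff_ne_zero.2 hF
    set Z := D * Q * (F.leadingCoeff).map (algebraMap k C) with hZ
    have hZ0 : Z ≠ 0 := mul_ne_zero (mul_ne_zero hD0 hQ)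
      ((Polynomial.map_ne_zero_iff (algebraMap k C).injective).2 hlead)
    have : ∃ a : k, Z.eval (algebraMap k C a) ≠ 0 := by
      by_contra! h
      refine hZ0 (eq_zero_of_infinite_isRoot Z (Set.Infinite.mono ?_
        (Set.infinite_range_of_injective (algebraMap k C).injective)))
      rintro _ ⟨a, rfl⟩
      exact h a
    obtain ⟨a, ha⟩ := this
    simp only [hZ, eval_mul, eval_map_algebraMap, aeval_algebraMap_apply] at ha
    have ha1 := left_ne_zero_of_mul (left_ne_zero_of_mul ha)
    have ha2 := right_ne_zero_of_mul (left_ne_zero_of_mul ha)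
    have ha3 : F.leadingCoeff.eval a ≠ 0 := by
      intro h; apply right_ne_zero_of_mul ha; rw [coe_aeval_eq_eval, h, map_zero]
    have h1 := congrArg (eval (algebraMap k C a)) hH
    rw [eval_finsetSum, eval_zero] at h1
    have halgc : IsAlgebraic k (P.eval (algebraMap k C a) / Q.eval (algebraMap k C a)) := by
      refine ⟨F.map (evalRingHom a), ?_, ?_⟩
      · intro h0
        apply ha3
        have : (F.map (evalRingHom a)).coeff N = 0 := by rw [h0, coeff_zero]
        rwa [coeff_map] at this
      · rw [aeval_def, eval₂_map, eval₂_eq_sum_range]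
        have hQN : Q.eval (algebraMap k C a) ^ N ≠ 0 := pow_ne_zero _ ha2
        refine (mul_eq_zero.1 ?_).resolve_left hQN
        rw [← h1, Finset.mul_sum]
        refine Finset.sum_congr rfl fun i hi => ?_
        have hi' : i ≤ N := by simpa [Nat.lt_succ_iff] using hi
        obtain ⟨j, hj⟩ := Nat.exists_eq_add_of_le hi'
        simp only [eval_mul, eval_pow, eval_map_algebraMap, aeval_algebraMap_apply,
          coe_aeval_eq_eval, RingHom.comp_apply, coe_evalRingHom]
        rw [hj, Nat.add_sub_cancel_left, pow_add, div_pow]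
        have := pow_ne_zero i ha2
        field_simp
    obtain ⟨c, hc⟩ := mem_range_algebraMap_of_isAlgebraic halgc
    rw [eq_div_iff ha2] at hc
    have h2 : c * (co Q).eval a = (co P).eval a := by
      rw [← hev, ← hev, ← hc, ← Algebra.smul_def, map_smul, smul_eq_mul]
    apply ha1
    simp only [hD, eval_sub, eval_mul, eval_map_algebraMap, aeval_algebraMap_apply,
      coe_aeval_eq_eval]
    rw [← h2, ← hc, map_mul]; ring
  have hQφ : co Q ≠ 0 := by
    intro h; apply hφ; rw [← hco, h, coeff_zero]
  have huk : Transcendental k u := fun h => hu (h.extendScalars (algebraMap k C).injective)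
  have hQφu : aeval u (co Q) ≠ 0 := fun h => huk ⟨_, hQφ, h⟩
  have := congrArg (aeval u) key
  rw [map_mul, map_mul, aeval_map_algebraMap, aeval_map_algebraMap] at this
  rw [(div_eq_div_iff hQu hQφu).2 this]
  exact (IntermediateField.mem_adjoin_simple_iff k _).2 ⟨_, _, rfl⟩

end Simple

section Bertini
variable {p : ℕ} {k K ι : Type*} [Field k] [Field K] [Algebra k K] [Fintype ι]

/-- The linear combination of the coordinates `x` with coefficients `c`. -/
def lin (x : ι → K) (c : ι → k) : K := ∑ i, algebraMap k K (c i) * x i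

/-- The change of basis replacing the coordinate `x i₀` by `lin x c` and the others by
elements which vanish in the direction `w`. -/
lemma isTranscendenceBasis_update_lin [DecidableEq ι] {x : ι → K} (hx : IsTranscendenceBasis k x)
    {w c : ι → k} {i₀ : ι} (hw : w i₀ ≠ 0) (hc : ∑ i, c i * w i ≠ 0) :
    IsTranscendenceBasis k (fun j => if j = i₀ then lin x c else
      x j - algebraMap k K (w j / w i₀) * x i₀) := by
  set x' : ι → K := fun j => if j = i₀ then lin x c else
      x j - algebraMap k K (w j / w i₀) * x i₀ with hx'
  have hmem : ∀ j, x' j ∈ adjoin k (Set.range x') := fun j => subset_adjoin _ _ ⟨j, rfl⟩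
  have h0 : algebraMap k K (∑ i, c i * w i) * x i₀ ∈ adjoin k (Set.range x') := by
    have : algebraMap k K (∑ i, c i * w i) * x i₀ = algebraMap k K (w i₀) * (lin x c -
        ∑ j, algebraMap k K (c j) * (x j - algebraMap k K (w j / w i₀) * x i₀)) := by
      simp only [lin, mul_sub, Finset.sum_sub_distrib, sub_sub_cancel, map_sum, map_mul,
        Finset.mul_sum, Finset.sum_mul, map_div₀]
      refine Finset.sum_congr rfl fun j _ => ?_
      have : algebraMap k K (w i₀) ≠ 0 := by simpa using hw
      field_simp
    rw [this]
    refine mul_mem (IntermediateField.algebraMap_mem _ _) (sub_mem ?_ (sum_mem fun j _ =>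
      mul_mem (IntermediateField.algebraMap_mem _ _) ?_))
    · have := hmem i₀; simpa [hx'] using this
    · by_cases hj : j = i₀
      · subst hj; rw [div_self hw, map_one, one_mul, sub_self]; exact zero_mem _
      · have := hmem j; simpa [hx', hj] using this
  have h1 : x i₀ ∈ adjoin k (Set.range x') := by
    have := mul_mem (IntermediateField.algebraMap_mem (adjoin k (Set.range x')) (∑ i, c i * w i)⁻¹) h0
    rwa [← mul_assoc, ← map_mul, inv_mul_cancel₀ hc, map_one, one_mul] at this
  refine hx.of_mem_adjoin fun j => ?_
  by_cases hj : j = i₀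
  · rw [hj]; exact h1
  · have := add_mem (hmem j) (mul_mem (IntermediateField.algebraMap_mem _ (w j / w i₀)) h1)
    simpa [hx', hj] using this

lemma transcendental_lin {x : ι → K} (hx : IsTranscendenceBasis k x) {c : ι → k} (hc : c ≠ 0) :
    Transcendental k (lin x c) := by
  classical
  obtain ⟨i, hi⟩ := Function.ne_iff.1 hc
  have := (isTranscendenceBasis_update_lin hx (w := Pi.single i 1) (c := c) (i₀ := i)
    (by simp) (by simpa [Pi.single_apply] using hi)).1.transcendental i
  simpa using this

/-- Two directions which are not proportional are separated by a vector. -/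
lemma exists_orthogonal_not_orthogonal {c d : ι → k} (h : ∀ a : k, d = a • c → False) :
    ∃ w : ι → k, ∑ i, c i * w i = 0 ∧ ∑ i, d i * w i ≠ 0 := by
  classical
  by_contra! H
  by_cases hc : c = 0
  · have hd : d = 0 := by
      ext i
      have := H (Pi.single i 1) (by simp [hc])
      simpa [Pi.single_apply] using this
    exact h 0 (by simp [hd])
  obtain ⟨i, hi⟩ := Function.ne_iff.1 hc
  refine h (d i / c i) (funext fun j => ?_)
  by_cases hij : j = i
  · subst hij; simp at hi ⊢; field_simp
  have := H (Pi.single i (c j) - Pi.single j (c i)) (by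
    simp [mul_sub, Pi.single_apply, Finset.sum_sub_distrib, mul_comm])
  simp [mul_sub, Pi.single_apply, Finset.sum_sub_distrib] at this
  simp at hi
  simp only [Pi.smul_apply, smul_eq_mul]
  field_simp
  linear_combination -this


lemma lin_eq_of_orthogonal {x : ι → K} {c w : ι → k} {i₀ : ι} (h : ∑ i, c i * w i = 0) :
    lin x c = ∑ j, algebraMap k K (c j) * (x j - algebraMap k K (w j / w i₀) * x i₀) := by
  have : ∑ j, algebraMap k K (c j) * (algebraMap k K (w j / w i₀) * x i₀) = 0 := by
    have h2 : ∑ j, c j * (w j / w i₀) = 0 := by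
      simp_rw [← mul_div_assoc, ← Finset.sum_div, h, zero_div]
    simp_rw [← mul_assoc, ← map_mul, ← Finset.sum_mul, ← map_sum, h2, map_zero, zero_mul]
  simp_rw [mul_sub, Finset.sum_sub_distrib, this, sub_zero, lin]

lemma exists_finset_forall_qgen [ExpChar k p] [IsAlgClosed k] (hF : PFG p k K) {x : ι → K}
    (hx : IsTranscendenceBasis k x) :
    ∃ B : Finset (ι → k), ∀ c : ι → k, c ≠ 0 → (∀ b ∈ B, ∀ a : k, c ≠ a • b) →
      QGen p k (lin x c) := by
  classical
  set E := adjoin k (Set.range x) with hE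
  have hEK : Algebra.IsAlgebraic E K := hx.isAlgebraic_field
  let M := separableClosure E K
  have : ExpChar E p := expChar_of_injective_algebraMap (algebraMap k E).injective p
  have : ExpChar M p := expChar_of_injective_algebraMap (algebraMap k M).injective p
  have : Finite (IntermediateField E M) := hF.finite_intermediateField E
  have := Fintype.ofFinite (IntermediateField E M)
  let Nf : (ι → k) → IntermediateField E M := fun c =>
    adjoin E {m : M | IsAlgebraic k⟮lin x c⟯ (m : K)}
  let bad : (ι → k) → Prop := fun c => c ≠ 0 ∧ ¬ QGen p k (lin x c)
  let rep : IntermediateField E M → (ι → k) := fun N =>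
    if h : ∃ c, bad c ∧ Nf c = N then h.choose else 0
  refine ⟨Finset.univ.image rep, fun c hc hB => ?_⟩
  by_contra hQ
  have hex : ∃ c', bad c' ∧ Nf c' = Nf c := ⟨c, ⟨hc, hQ⟩, rfl⟩
  obtain ⟨-, hb⟩ : bad (rep (Nf c)) ∧ Nf (rep (Nf c)) = Nf c := by
    simp only [rep, dif_pos hex]; exact hex.choose_spec
  set b := rep (Nf c)
  obtain ⟨w, hbw, hcw⟩ := exists_orthogonal_not_orthogonal
    (fun a => hB b (Finset.mem_image_of_mem _ (Finset.mem_univ _)) a)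
  obtain ⟨i₀, -, hi₀⟩ := Finset.exists_ne_zero_of_sum_ne_zero hcw
  have hw := right_ne_zero_of_mul hi₀
  have hx' := isTranscendenceBasis_update_lin hx hw hcw
  set x' : ι → K := fun j => if j = i₀ then lin x c else
      x j - algebraMap k K (w j / w i₀) * x i₀ with hx'def
  have hx'i : x' i₀ = lin x c := by simp [hx'def]
  set C₀ := adjoin k (Set.image x' {i₀}ᶜ) with hC₀
  let C : IntermediateField k K := (algebraicClosure C₀ K).restrictScalars k
  have hC₀mem : ∀ y ∈ C₀, y ∈ C := fun y hy =>
    (algebraicClosure C₀ K).algebraMap_mem ⟨y, hy⟩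
  have hu : Transcendental C (lin x c) := by
    intro h
    have h1 : IsAlgebraic C₀ (lin x c) := by
      have : Algebra.IsAlgebraic C₀ (algebraicClosure C₀ K) := inferInstance
      have h' : IsAlgebraic (algebraicClosure C₀ K) (lin x c) := h
      exact h'.restrictScalars C₀
    rw [isAlgebraic_adjoin_iff, ← hx'i] at h1
    exact hx'.1.transcendental_adjoin (by simp) h1
  apply hQ
  refine ⟨transcendental_lin hx hc, fun α hα => ?_⟩
  obtain ⟨n, m, hm⟩ := IsPurelyInseparable.pow_mem M p α
  refine ⟨n, mem_adjoin_simple_of_isAlgebraic C hu ?_ (hα.pow _)⟩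
  have hmN : m ∈ Nf b := by
    rw [hb]
    refine subset_adjoin _ _ ?_
    change IsAlgebraic _ (m : K)
    have : (m : K) = α ^ p ^ n := hm
    rw [this]; exact hα.pow _
  have hj : ∀ j, x j - algebraMap k K (w j / w i₀) * x i₀ ∈ C₀ := by
    intro j
    by_cases hj : j = i₀
    · subst hj; rw [div_self hw, map_one, one_mul, sub_self]; exact zero_mem _
    · refine subset_adjoin _ _ ⟨j, hj, by simp [hx'def, hj]⟩
  have hyb : lin x b ∈ C₀ := by
    rw [lin_eq_of_orthogonal (i₀ := i₀) hbw]
    exact sum_mem fun j _ => mul_mem (IntermediateField.algebraMap_mem _ _) (hj j)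
  have hcC : ∀ y ∈ C, y ∈ C⟮lin x c⟯ := fun y hy =>
    IntermediateField.algebraMap_mem C⟮lin x c⟯ (⟨y, hy⟩ : C)
  have hEC : ∀ y ∈ E, y ∈ C⟮lin x c⟯ := by
    have hle : E ≤ (C⟮lin x c⟯).restrictScalars k := by
      have h1 : ∀ i, x' i ∈ C⟮lin x c⟯ := by
        intro i
        by_cases hi : i = i₀
        · rw [hi, hx'i]; exact mem_adjoin_simple_self _ _
        · exact hcC _ (hC₀mem _ (subset_adjoin _ _ ⟨i, hi, rfl⟩))
      have h0 : x i₀ ∈ C⟮lin x c⟯ := by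
        have e : x i₀ = (algebraMap k K (∑ i, c i * w i))⁻¹ * (algebraMap k K (w i₀) * (lin x c -
            ∑ j, algebraMap k K (c j) * (x j - algebraMap k K (w j / w i₀) * x i₀))) := by
          rw [eq_inv_mul_iff_mul_eq₀ ((map_ne_zero (algebraMap k K)).2 hcw)]
          simp only [lin, mul_sub, Finset.sum_sub_distrib, sub_sub_cancel, map_sum, map_mul,
            Finset.mul_sum, Finset.sum_mul, map_div₀]
          refine Finset.sum_congr rfl fun j _ => ?_
          have : algebraMap k K (w i₀) ≠ 0 := by simpa using hw
          field_simp
        have hk : ∀ a : k, algebraMap k K a ∈ C⟮lin x c⟯ := fun a =>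
          hcC _ (IntermediateField.algebraMap_mem C a)
        rw [e]
        exact mul_mem (inv_mem (hk _)) (mul_mem (hk _) (sub_mem (mem_adjoin_simple_self _ _)
          (sum_mem fun j _ => mul_mem (hk _) (hcC _ (hC₀mem _ (hj j))))))
      refine adjoin_le_iff.2 ?_
      rintro _ ⟨i, rfl⟩
      have := add_mem (hcC _ (hC₀mem _ (hj i))) (mul_mem
        (hcC _ (IntermediateField.algebraMap_mem C (w i / w i₀))) h0)
      simpa using this
    exact fun y hy => hle hy
  have hall : ∀ m' ∈ Nf b, ((m' : M) : K) ∈ C⟮lin x c⟯ := by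
    intro m' hm'
    induction hm' using adjoin_induction with
    | mem y hy =>
      refine hcC _ ?_
      change (y : K) ∈ algebraicClosure C₀ K
      rw [mem_algebraicClosure_iff]
      have hle : k⟮lin x b⟯ ≤ C₀ := adjoin_simple_le_iff.2 hyb
      let := (IntermediateField.inclusion hle).toRingHom.toAlgebra
      have : IsScalarTower k⟮lin x b⟯ C₀ K := IsScalarTower.of_algebraMap_eq fun _ => rfl
      exact IsAlgebraic.extendScalars (R := k⟮lin x b⟯) (IntermediateField.inclusion hle).injective hy
    | algebraMap y => exact hEC _ y.2
    | add x y _ _ hx hy => exact add_mem hx hy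
    | inv x _ hx => simpa using inv_mem hx
    | mul x y _ _ hx hy => exact mul_mem hx hy
  have := hall m hmN
  rwa [show (m : K) = α ^ p ^ n from hm] at this

end Bertini
end MilnorRec

namespace MilnorRec
section Hensel
open Polynomial

/-- A finite separable extension of the fraction field of `A` embeds into Laurent series over a
finite extension, extending a given arc `ψ` of `A` which is generic enough at its origin. -/
lemma exists_hahnSeries_lift {A E N : Type*} [CommRing A] [IsDomain A] [IsIntegrallyClosed A]
    [Field E] [Algebra A E] [IsFractionRing A E] [Field N] [Algebra A N] [Algebra E N]
    [IsScalarTower A E N] [FiniteDimensional E N] [Algebra.IsSeparable E N] (S : Finset N) :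
    ∃ h : A, h ≠ 0 ∧ ∀ (F : Type u) [Field F] (ψ : A →+* PowerSeries F), Function.Injective ψ →
      PowerSeries.constantCoeff (ψ h) ≠ 0 →
      ∃ F' : IntermediateField F (AlgebraicClosure F), FiniteDimensional F F' ∧
        ∃ Φ : N →+* HahnSeries ℤ F',
          (∀ a : A, Φ (algebraMap A N a) =
            HahnSeries.ofPowerSeries ℤ F' ((ψ a).map (algebraMap F F'))) ∧
          ∀ s ∈ S, ∃ w : PowerSeries F', Φ s = HahnSeries.ofPowerSeries ℤ F' w := by
  obtain ⟨θ₀, hθ₀⟩ := Field.exists_primitive_element E N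
  have halg : Algebra.IsAlgebraic A E := IsLocalization.isAlgebraic E (nonZeroDivisors A)
  have : IsAlgebraic A θ₀ := by
    have : Algebra.IsAlgebraic A N := Algebra.IsAlgebraic.trans A E N
    exact this.isAlgebraic _
  obtain ⟨a₀, ha₀, hint⟩ := this.exists_integral_multiple
  set θ := a₀ • θ₀ with hθ
  have hAE : Function.Injective (algebraMap A E) := IsFractionRing.injective A E
  have ha₀E : algebraMap A E a₀ ≠ 0 := (map_ne_zero_iff _ hAE).2 ha₀
  have hprim : IntermediateField.adjoin E {θ} = ⊤ := by
    rw [eq_top_iff, ← hθ₀, IntermediateField.adjoin_simple_le_iff]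
    have e : θ₀ = algebraMap E N (algebraMap A E a₀)⁻¹ * θ := by
      rw [hθ, Algebra.smul_def, IsScalarTower.algebraMap_apply A E N, ← mul_assoc, ← map_mul,
        inv_mul_cancel₀ ha₀E, map_one, one_mul]
    rw [e]
    exact mul_mem (IntermediateField.algebraMap_mem _ _)
      (IntermediateField.mem_adjoin_simple_self E θ)
  set f := minpoly A θ with hf
  have hfm : f.Monic := minpoly.monic hint
  have hfE : minpoly E θ = f.map (algebraMap A E) :=
    minpoly.isIntegrallyClosed_eq_field_fractions E N hint
  have hsep : (minpoly E θ).Separable := Algebra.IsSeparable.isSeparable E θ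
  obtain ⟨a, b, hab⟩ := hsep
  obtain ⟨da, hda, ha⟩ := IsLocalization.integerNormalization_spec (nonZeroDivisors A) a
  obtain ⟨db, hdb, hb⟩ := IsLocalization.integerNormalization_spec (nonZeroDivisors A) b
  set a' := IsLocalization.integerNormalization (nonZeroDivisors A) a
  set b' := IsLocalization.integerNormalization (nonZeroDivisors A) b
  have hbez : C db * a' * f + C da * b' * derivative f = C (da * db) := by
    apply Polynomial.map_injective _ hAE
    simp only [Polynomial.map_add, Polynomial.map_mul, map_C, ha, hb, ← derivative_map, ← hfE]
    rw [← IsScalarTower.algebraMap_smul E da a, ← IsScalarTower.algebraMap_smul E db b,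
      smul_eq_C_mul, smul_eq_C_mul]
    have : C ((algebraMap A E) db) * (C ((algebraMap A E) da) * a) * minpoly E θ +
      C ((algebraMap A E) da) * (C ((algebraMap A E) db) * b) * derivative (minpoly E θ) =
      C ((algebraMap A E) da) * C ((algebraMap A E) db) *
        (a * minpoly E θ + b * derivative (minpoly E θ)) := by ring
    rw [this, hab, mul_one, map_mul, map_mul]
  have hS : ∀ s : N, ∃ c : A, c ≠ 0 ∧ ∃ g : A[X], algebraMap A N c * s = aeval θ g := by
    intro s
    have hs : s ∈ IntermediateField.adjoin E {θ} := hprim ▸ IntermediateField.mem_top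
    rw [← IntermediateField.mem_toSubalgebra,
      IntermediateField.adjoin_simple_toSubalgebra_of_isAlgebraic (Algebra.IsAlgebraic.isAlgebraic θ),
      Algebra.adjoin_singleton_eq_range_aeval] at hs
    obtain ⟨g, rfl⟩ := hs
    obtain ⟨c, hc, hg⟩ := IsLocalization.integerNormalization_spec (nonZeroDivisors A) g
    refine ⟨c, nonZeroDivisors.ne_zero hc, IsLocalization.integerNormalization (nonZeroDivisors A) g, ?_⟩
    rw [← aeval_map_algebraMap E, hg, ← IsScalarTower.algebraMap_smul E c g, map_smul,
      Algebra.smul_def, ← IsScalarTower.algebraMap_apply]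
    rfl
  choose c hc g hg using hS
  refine ⟨da * db * ∏ s ∈ S, c s, mul_ne_zero (mul_ne_zero (nonZeroDivisors.ne_zero hda)
    (nonZeroDivisors.ne_zero hdb)) (Finset.prod_ne_zero_iff.2 fun s _ => hc s), ?_⟩
  intro F _ ψ hψ hh
  simp only [map_mul, map_prod] at hh
  have hδ := left_ne_zero_of_mul hh
  have hcs : ∀ s ∈ S, PowerSeries.constantCoeff (ψ (c s)) ≠ 0 := fun s hs =>
    (Finset.prod_ne_zero_iff.1 (right_ne_zero_of_mul hh)) s hs
  let ψ₀ : A →+* F := (PowerSeries.constantCoeff).comp ψ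
  obtain ⟨r, hr⟩ : ∃ r : AlgebraicClosure F, aeval r (f.map ψ₀) = 0 := by
    have hd : (f.map ψ₀).degree ≠ 0 := by
      rw [hfm.degree_map]
      have := minpoly.degree_pos hint
      exact this.ne'
    exact IsAlgClosed.exists_aeval_eq_zero _ _ hd
  let F' := IntermediateField.adjoin F {r}
  have hfin : FiniteDimensional F F' :=
    IntermediateField.adjoin.finiteDimensional (Algebra.IsIntegral.isIntegral r)
  let r' : F' := ⟨r, IntermediateField.mem_adjoin_simple_self F r⟩
  have hr' : aeval r' (f.map ψ₀) = 0 := by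
    apply (algebraMap F' (AlgebraicClosure F)).injective
    rw [← aeval_algebraMap_apply, map_zero]; exact hr
  let Ψ : A →+* PowerSeries F' := (PowerSeries.map (algebraMap F F')).comp ψ
  have hΨ0 : ∀ P : A[X], ∀ R : PowerSeries F', PowerSeries.constantCoeff (P.eval₂ Ψ R) =
      aeval (PowerSeries.constantCoeff R) (P.map ψ₀) := by
    intro P R
    rw [hom_eval₂, aeval_def, eval₂_map]
    congr 1
  obtain ⟨R, hR, hR0⟩ : ∃ R : PowerSeries F', (f.map Ψ).IsRoot R ∧
      R - PowerSeries.C r' ∈ Ideal.span {(PowerSeries.X : PowerSeries F')} := by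
    refine HenselianRing.is_henselian (f.map Ψ) (hfm.map _) (PowerSeries.C r') ?_ ?_
    · rw [Ideal.mem_span_singleton, PowerSeries.X_dvd_iff, eval_map, hΨ0]
      simpa using hr'
    · refine IsUnit.map _ (PowerSeries.isUnit_iff_constantCoeff.2 (Ne.isUnit ?_))
      rw [derivative_map, eval_map, hΨ0, PowerSeries.constantCoeff_C]
      intro h0
      have := congrArg (fun P => aeval r' (P.map ψ₀)) hbez
      simp only [Polynomial.map_add, Polynomial.map_mul, map_add, map_mul, hr', h0, mul_zero,
        add_zero, map_C, aeval_C] at this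
      have h2 := mul_ne_zero (left_ne_zero_of_mul hδ) (right_ne_zero_of_mul hδ)
      exact h2 ((map_eq_zero_iff _ (algebraMap F F').injective).1 (by
        rw [map_mul]; exact this.symm))
  have hΨinj : Function.Injective ((HahnSeries.ofPowerSeries ℤ F').comp Ψ) := by
    exact HahnSeries.ofPowerSeries_injective.comp
      ((PowerSeries.map_injective _ (algebraMap F F').injective).comp hψ)
  let i : E →+* HahnSeries ℤ F' := IsFractionRing.lift hΨinj
  have hi : ∀ z : A, i (algebraMap A E z) = HahnSeries.ofPowerSeries ℤ F' (Ψ z) := fun z =>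
    IsFractionRing.lift_algebraMap hΨinj z
  have hroot : (minpoly E θ).eval₂ i (HahnSeries.ofPowerSeries ℤ F' R) = 0 := by
    rw [hfE, eval₂_map]
    have e : i.comp (algebraMap A E) = (HahnSeries.ofPowerSeries ℤ F').comp Ψ := RingHom.ext hi
    rw [e, ← hom_eval₂, ← eval_map]
    rw [show eval R (f.map Ψ) = 0 from hR, map_zero]
  let j : AdjoinRoot (minpoly E θ) →+* HahnSeries ℤ F' := AdjoinRoot.lift i _ hroot
  let eqv : N ≃ₐ[E] AdjoinRoot (minpoly E θ) :=
    (IntermediateField.topEquiv.symm.trans (IntermediateField.equivOfEq hprim.symm)).trans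
      (IntermediateField.adjoinRootEquivAdjoin E (Algebra.IsIntegral.isIntegral θ)).symm
  let Φ : N →+* HahnSeries ℤ F' := j.comp eqv.toRingEquiv.toRingHom
  have hΦ : ∀ a : A, Φ (algebraMap A N a) = HahnSeries.ofPowerSeries ℤ F' (Ψ a) := by
    intro z
    rw [← hi, IsScalarTower.algebraMap_apply A E N]
    change j (eqv (algebraMap E N (algebraMap A E z))) = _
    rw [AlgEquiv.commutes]
    exact AdjoinRoot.lift_of hroot
  have hΦθ : Φ θ = HahnSeries.ofPowerSeries ℤ F' R := by
    change j (eqv θ) = _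
    have : eqv θ = AdjoinRoot.root _ := by
      rw [← AlgEquiv.eq_symm_apply]
      change θ = IntermediateField.topEquiv ((IntermediateField.equivOfEq hprim.symm).symm
        ((IntermediateField.adjoinRootEquivAdjoin E (Algebra.IsIntegral.isIntegral θ))
          (AdjoinRoot.root _)))
      rw [IntermediateField.adjoinRootEquivAdjoin_apply_root]
      rfl
    rw [this]; exact AdjoinRoot.lift_root hroot
  refine ⟨F', hfin, Φ, hΦ, fun s hs => ?_⟩
  have hu : IsUnit (Ψ (c s)) := by
    rw [PowerSeries.isUnit_iff_constantCoeff]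
    refine Ne.isUnit ?_
    change PowerSeries.constantCoeff (PowerSeries.map (algebraMap F F') (ψ (c s))) ≠ 0
    rw [← PowerSeries.coeff_zero_eq_constantCoeff_apply, PowerSeries.coeff_map, _root_.map_ne_zero,
      PowerSeries.coeff_zero_eq_constantCoeff_apply]
    exact hcs s hs
  obtain ⟨v, hv⟩ := hu.exists_left_inv
  refine ⟨v * (g s).eval₂ Ψ R, ?_⟩
  have h1 := congrArg Φ (hg s)
  rw [map_mul, hΦ, aeval_def, hom_eval₂, hΦθ] at h1
  have e : Φ.comp (algebraMap A N) = (HahnSeries.ofPowerSeries ℤ F').comp Ψ := RingHom.ext hΦ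
  rw [e, ← hom_eval₂] at h1
  rw [map_mul, ← h1, ← mul_assoc, ← map_mul, hv, map_one, one_mul]

end Hensel
end MilnorRec

namespace MilnorRec
section Hahn

lemma HahnSeries.order_of_add_eq_one {F : Type*} [Field F] {A B : HahnSeries ℤ F} (hA : A ≠ 0)
    (hB : B ≠ 0) (h : A + B = 1) :
    (A.order = 0 ∧ B.order = 0) ∨ (A.order = 0 ∧ A.leadingCoeff = 1) ∨
      (B.order = 0 ∧ B.leadingCoeff = 1) ∨
      (A.order = B.order ∧ B.leadingCoeff = -A.leadingCoeff) := by
  rcases lt_trichotomy A.order B.order with hlt | heq | hlt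
  · right; left
    have h0 := HahnSeries.coeff_eq_zero_of_lt_order hlt
    have h1 : (1 : HahnSeries ℤ F).coeff A.order = A.leadingCoeff := by
      rw [← h, HahnSeries.coeff_add, h0, add_zero, HahnSeries.leadingCoeff_eq]
    have h2 := HahnSeries.leadingCoeff_ne_zero.2 hA
    rw [HahnSeries.coeff_one] at h1
    split_ifs at h1 with h3
    · exact ⟨h3, h1.symm⟩
    · exact absurd h1.symm h2
  · by_cases h3 : A.order = 0
    · left; exact ⟨h3, heq ▸ h3⟩
    · right; right; right
      refine ⟨heq, ?_⟩
      have h1 : (1 : HahnSeries ℤ F).coeff A.order = A.leadingCoeff + B.leadingCoeff := by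
        rw [← h, HahnSeries.coeff_add, HahnSeries.leadingCoeff_eq, HahnSeries.leadingCoeff_eq, heq]
      rw [HahnSeries.coeff_one, if_neg h3] at h1
      exact (neg_eq_of_add_eq_zero_right h1.symm).symm
  · right; right; left
    have h0 := HahnSeries.coeff_eq_zero_of_lt_order hlt
    have h1 : (1 : HahnSeries ℤ F).coeff B.order = B.leadingCoeff := by
      rw [← h, HahnSeries.coeff_add, h0, zero_add, HahnSeries.leadingCoeff_eq]
    have h2 := HahnSeries.leadingCoeff_ne_zero.2 hB
    rw [HahnSeries.coeff_one] at h1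
    split_ifs at h1 with h3
    · exact ⟨h3, h1.symm⟩
    · exact absurd h1.symm h2

variable {ℓ : ℕ} [Fact ℓ.Prime] {p : ℕ} {k : Type*} [Field k] [IsAlgClosed k]

/-- The order functional attached to an embedding into Laurent series is admissible. -/
lemma adm_of_hahnSeries {M K F : Type*} [Field M] [Field K] [Field F] [Algebra k M] [Algebra k K]
    [Algebra k F] [Algebra M K] [IsScalarTower k M K] [ExpChar k p] [IsPurelyInseparable M K]
    (hp : (p : ZMod ℓ) ≠ 0) (Ψ : M →+* HahnSeries ℤ F)
    (hk : ∀ a : k, Ψ (algebraMap k M a) = HahnSeries.C (algebraMap k F a)) {t : M} {t₀ : F}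
    (ht₀ : Ψ t = HahnSeries.C t₀) (htK : QGen p k (algebraMap M K t)) (htF : QGen p k t₀)
    (hu : ∃ u : M, u ≠ 0 ∧ ((Ψ u).order : ZMod ℓ) ≠ 0) :
    ∃ f : KV ℓ K →ₗ[ZMod ℓ] ZMod ℓ, Adm p k f ∧
      ∀ u : M, u ≠ 0 → f (cl ℓ (algebraMap M K u)) = ((Ψ u).order : ZMod ℓ) := by
  have : ExpChar M p := expChar_of_injective_algebraMap (algebraMap k M).injective p
  have hne : ∀ {x : M}, x ≠ 0 → Ψ x ≠ 0 := fun hx => (map_ne_zero Ψ).2 hx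
  let G : KV ℓ M →ₗ[ZMod ℓ] ZMod ℓ × KV ℓ F :=
    KV.lift (fun x => (((Ψ x).order : ZMod ℓ), cl ℓ (Ψ x).leadingCoeff)) fun x y hx hy => by
      rw [map_mul, HahnSeries.order_mul (hne hx) (hne hy), HahnSeries.leadingCoeff_mul,
        cl_mul (HahnSeries.leadingCoeff_ne_zero.2 (hne hx))
          (HahnSeries.leadingCoeff_ne_zero.2 (hne hy)), Int.cast_add]
      rfl
  have hG : ∀ x : M, x ≠ 0 → G (cl ℓ x) =
      (((Ψ x).order : ZMod ℓ), cl ℓ (Ψ x).leadingCoeff) := fun x hx => KV.lift_cl _ _ hx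
  let GK : KV ℓ K →ₗ[ZMod ℓ] ZMod ℓ × KV ℓ F := G ∘ₗ (KV.piEquiv (K := K) hp).symm.toLinearMap
  have hGK : ∀ x : M, x ≠ 0 → GK (cl ℓ (algebraMap M K x)) =
      (((Ψ x).order : ZMod ℓ), cl ℓ (Ψ x).leadingCoeff) := fun x hx => by
    rw [← hG x hx, ← KV.piEquiv_symm_cl (K := K) hp x]; rfl
  have hneg : cl ℓ (-1 : F) = 0 := by
    have := cl_const (K := F) (ℓ := ℓ) (-1 : k)
    rwa [map_neg, map_one] at this
  have stM : ∀ x : M, x ≠ 0 → 1 - x ≠ 0 →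
      (GK (cl ℓ (algebraMap M K x))).1 • GK (cl ℓ (1 - algebraMap M K x)) =
        (GK (cl ℓ (1 - algebraMap M K x))).1 • GK (cl ℓ (algebraMap M K x)) := by
    intro x hx hx'
    rw [← map_one (algebraMap M K), ← map_sub, hGK x hx, hGK _ hx']
    have hAB : Ψ x + Ψ (1 - x) = 1 := by rw [← map_add, add_sub_cancel, map_one]
    refine Prod.ext ?_ ?_
    · simp only [Prod.smul_mk, smul_eq_mul]; ring
    · simp only [Prod.smul_mk]
      rcases HahnSeries.order_of_add_eq_one (hne hx) (hne hx') hAB with h | h | h | h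
      · rw [h.1, h.2]; simp
      · rw [h.1, h.2, cl_one]; simp
      · rw [h.1, h.2, cl_one]; simp
      · rw [h.1, h.2, neg_eq_neg_one_mul, cl_mul (neg_ne_zero.2 one_ne_zero)
          (HahnSeries.leadingCoeff_ne_zero.2 (hne hx)), hneg, zero_add]
  have hval : ∀ a : k, GK (cl ℓ (algebraMap M K t - algebraMap k K a)) =
      (0, cl ℓ (t₀ - algebraMap k F a)) := fun a => by
    have e : algebraMap M K t - algebraMap k K a = algebraMap M K (t - algebraMap k M a) := by
      rw [map_sub, ← IsScalarTower.algebraMap_apply]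
    have h0 : t - algebraMap k M a ≠ 0 := by
      intro h0
      rw [h0, map_zero] at e
      exact sub_const_ne_zero htK.1 a e
    rw [e, hGK _ h0, map_sub, hk, ht₀, ← map_sub, HahnSeries.order_C,
      HahnSeries.leadingCoeff_eq, HahnSeries.order_C, HahnSeries.C_apply, HahnSeries.coeff_single_same, Int.cast_zero]
  refine ⟨LinearMap.fst _ _ _ ∘ₗ GK, ⟨LinearMap.ker GK, ?_, ?_, ?_, _, htK, ?_, ?_⟩, ?_⟩
  · intro v hv
    rw [LinearMap.comp_apply, LinearMap.mem_ker.1 hv]; rfl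
  · obtain ⟨u, hu0, hu⟩ := hu
    intro h0
    apply hu
    have := LinearMap.congr_fun h0 (cl ℓ (algebraMap M K u))
    rwa [LinearMap.comp_apply, hGK u hu0] at this
  · intro x hx hx'
    obtain ⟨n, y, hy⟩ := IsPurelyInseparable.pow_mem M p x
    have : ExpChar K p := expChar_of_injective_algebraMap (algebraMap k K).injective p
    have hq := natCast_pow_ne_zero hp n
    have e1 : cl ℓ x = ((p ^ n : ℕ) : ZMod ℓ)⁻¹ • cl ℓ (algebraMap M K y) := by
      rw [hy, cl_pow', smul_smul, inv_mul_cancel₀ hq, one_smul]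
    have e2 : cl ℓ (1 - x) = ((p ^ n : ℕ) : ZMod ℓ)⁻¹ • cl ℓ (1 - algebraMap M K y) := by
      rw [hy, ← one_pow (p ^ n), ← sub_pow_expChar_pow, one_pow, cl_pow', smul_smul,
        inv_mul_cancel₀ hq, one_smul]
    have hy0 : y ≠ 0 := by
      rintro rfl
      rw [map_zero] at hy
      exact hx (pow_eq_zero_iff (pow_ne_zero _ (expChar_pos K p).ne') |>.1 hy.symm)
    have hy1 : 1 - y ≠ 0 := by
      intro h0
      have : (1 - x) ^ p ^ n = 0 := by
        rw [sub_pow_expChar_pow, one_pow, ← hy, ← map_one (algebraMap M K), ← map_sub, h0, map_zero]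
      exact hx' (pow_eq_zero_iff (pow_ne_zero _ (expChar_pos K p).ne') |>.1 this)
    have key : ∀ (c : ZMod ℓ) (g₁ g₂ : ZMod ℓ × KV ℓ F), g₁.1 • g₂ = g₂.1 • g₁ →
        (c • g₁).1 • c • g₂ = (c • g₂).1 • c • g₁ := fun c g₁ g₂ h => by
      rw [Prod.smul_fst, Prod.smul_fst, smul_assoc, smul_assoc, smul_comm _ c g₂, h,
        smul_comm _ c g₁]
    rw [LinearMap.mem_ker, map_sub, map_smul, map_smul, sub_eq_zero, e1, e2]
    simp only [map_smul, LinearMap.comp_apply, LinearMap.fst_apply]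
    exact key _ _ _ (stM y hy0 hy1)
  · intro v hv
    induction hv using Submodule.span_induction with
    | mem x hx => obtain ⟨a, rfl⟩ := hx; rw [LinearMap.comp_apply, hval]; rfl
    | zero => simp
    | add x y _ _ hx hy => rw [map_add, hx, hy, add_zero]
    | smul a x _ hx => rw [map_smul, hx, smul_zero]
  · rw [Submodule.disjoint_def]
    intro v hv hv0
    obtain ⟨c, rfl⟩ := (Finsupp.mem_span_range_iff_exists_finsupp).1 hv
    have H := htF.linearIndependent (ℓ := ℓ) hp
    rw [LinearMap.mem_ker, map_finsuppSum] at hv0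
    have h2 := congrArg Prod.snd hv0
    simp only [map_smul, hval] at h2
    have h3 : (c.sum fun a i => i • cl ℓ (t₀ - algebraMap k F a)) = 0 := by
      refine Eq.trans ?_ h2
      rw [Finsupp.sum, Finsupp.sum, Prod.snd_sum]; rfl
    have := linearIndependent_iff.1 H c (by rw [Finsupp.linearCombination_apply]; exact h3)
    rw [this]; simp
  · intro u hu0
    rw [LinearMap.comp_apply, hGK u hu0]; rfl

end Hahn
end MilnorRec

namespace MilnorRec
section Arc
open IntermediateField
variable {ι k K : Type*} [Field k] [Field K] [Algebra k K]

lemma exists_arc {x : ι → K} (hx : AlgebraicIndependent k x) {E : IntermediateField k K}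
    (hE : adjoin k (Set.range x) = E) {N : Type*} [Field N] [Algebra E N] [FiniteDimensional E N]
    [Algebra.IsSeparable E N] (S : Finset N) :
    ∃ h : MvPolynomial ι k, h ≠ 0 ∧ ∀ ξ : ι → Polynomial E,
      (∀ i, (((ξ i).eval 1 : E) : K) = x i) → MvPolynomial.aeval (fun i => (ξ i).eval 0) h ≠ 0 →
      ∃ F : IntermediateField E (AlgebraicClosure E), FiniteDimensional E F ∧
        ∃ Φ : N →+* HahnSeries ℤ F,
          (∀ a : k, Φ (algebraMap E N (algebraMap k E a)) = HahnSeries.C (algebraMap k F a)) ∧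
          (∀ i (e : E), (e : K) = x i → Φ (algebraMap E N e) =
            HahnSeries.ofPowerSeries ℤ F (((ξ i).map (algebraMap E F) : Polynomial F) : PowerSeries F)) ∧
          ∀ s ∈ S, ∃ w : PowerSeries F, Φ s = HahnSeries.ofPowerSeries ℤ F w := by
  let A := MvPolynomial ι k
  have hxE : ∀ i, x i ∈ E := fun i => hE ▸ subset_adjoin _ _ ⟨i, rfl⟩
  let xE : ι → E := fun i => ⟨x i, hxE i⟩
  let f : A →ₐ[k] E := MvPolynomial.aeval xE
  have hf : ∀ P : A, (f P : K) = MvPolynomial.aeval x P := fun P => by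
    change E.val (MvPolynomial.aeval xE P) = _
    exact MvPolynomial.comp_aeval_apply _ _ _
  let : Algebra A E := f.toRingHom.toAlgebra
  have hinj : Function.Injective (algebraMap A E) := by
    intro P Q hPQ
    apply hx
    rw [← hf, ← hf]; exact congrArg Subtype.val hPQ
  have : IsFractionRing A E := by
    have : FaithfulSMul A E := (faithfulSMul_iff_algebraMap_injective A E).2 hinj
    refine IsFractionRing.of_field A E fun z => ?_
    obtain ⟨r, s, hrs⟩ := (mem_adjoin_range_iff k x (z : K)).1 (hE ▸ z.2)
    refine ⟨r, s, Subtype.ext ?_⟩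
    rw [hrs, ← hf, ← hf]; rfl
  let : Algebra A N := ((algebraMap E N).comp (algebraMap A E)).toAlgebra
  have : IsScalarTower A E N := IsScalarTower.of_algebraMap_eq fun _ => rfl
  obtain ⟨h, h0, H⟩ := exists_hahnSeries_lift (A := A) (E := E) S
  refine ⟨h, h0, fun ξ h1 h2 => ?_⟩
  let g : A →ₐ[k] Polynomial E := MvPolynomial.aeval ξ
  let ψ : A →+* PowerSeries E := (Polynomial.coeToPowerSeries.ringHom).comp g.toRingHom
  have hev : ∀ (a : E) (P : A), (g P).eval a = MvPolynomial.aeval (fun i => (ξ i).eval a) P := by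
    intro a P
    change ((Polynomial.aeval a).restrictScalars k : Polynomial E →ₐ[k] E) (MvPolynomial.aeval ξ P) = _
    exact MvPolynomial.comp_aeval_apply _ _ _
  have hψ : Function.Injective ψ := by
    refine (Polynomial.coe_injective E).comp ?_
    intro P Q hPQ
    apply hx
    have := congrArg (fun R : Polynomial E => ((R.eval 1 : E) : K)) hPQ
    have h3 : ∀ P : A, (((g P).eval 1 : E) : K) = MvPolynomial.aeval x P := fun P => by
      have e : (fun i => (ξ i).eval 1) = xE := funext fun i => Subtype.ext (h1 i)
      rw [hev, e, ← hf]
    rw [← h3, ← h3]; exact this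
  obtain ⟨F, hF, Φ, hΦ, hS⟩ := H E ψ hψ (by
    change PowerSeries.constantCoeff ((g h : Polynomial E) : PowerSeries E) ≠ 0
    rwa [Polynomial.constantCoeff_coe, Polynomial.coeff_zero_eq_eval_zero, hev])
  have hmap : ∀ P : Polynomial E, (P : PowerSeries E).map (algebraMap E F) =
      ((P.map (algebraMap E F) : Polynomial F) : PowerSeries F) := fun P => by
    ext n; simp
  refine ⟨F, hF, Φ, fun a => ?_, fun i e he => ?_, hS⟩
  · have e1 : algebraMap E N (algebraMap k E a) = algebraMap A N (MvPolynomial.C a) := by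
      rw [IsScalarTower.algebraMap_apply A E N]
      congr 1
      exact (MvPolynomial.aeval_C xE a).symm
    rw [e1, hΦ]
    change HahnSeries.ofPowerSeries ℤ F (PowerSeries.map _ ((g (MvPolynomial.C a) : Polynomial E) :
      PowerSeries E)) = _
    rw [hmap, show g (MvPolynomial.C a) = algebraMap k (Polynomial E) a from MvPolynomial.aeval_C _ _,
      IsScalarTower.algebraMap_apply k E (Polynomial E), Polynomial.algebraMap_eq, Polynomial.map_C,
      Polynomial.coe_C, HahnSeries.ofPowerSeries_C, IsScalarTower.algebraMap_apply k E F]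
  · have e1 : algebraMap E N e = algebraMap A N (MvPolynomial.X i) := by
      rw [IsScalarTower.algebraMap_apply A E N]
      congr 1
      exact Subtype.ext (he.trans (congrArg Subtype.val (MvPolynomial.aeval_X xE i)).symm)
    rw [e1, hΦ]
    change HahnSeries.ofPowerSeries ℤ F (PowerSeries.map _ ((g (MvPolynomial.X i) : Polynomial E) :
      PowerSeries E)) = _
    rw [hmap, show g (MvPolynomial.X i) = ξ i from MvPolynomial.aeval_X _ _]

end Arc
end MilnorRec

namespace MilnorRec
section SepRel
open MvPolynomial
variable {σ k : Type*} [Fintype σ] [Field k]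

/-- The sum of the degrees of the monomials of a polynomial. -/
def weight (P : MvPolynomial σ k) : ℕ := ∑ m ∈ P.support, ∑ o, m o

lemma weight_sum_monomial_le (T : Finset (σ →₀ ℕ)) (g : (σ →₀ ℕ) → σ →₀ ℕ) (c : (σ →₀ ℕ) → k) :
    weight (∑ m ∈ T, monomial (g m) (c m)) ≤ ∑ m ∈ T, ∑ o, g m o := by
  classical
  have hsub : (∑ m ∈ T, monomial (g m) (c m)).support ⊆ T.image g := by
    refine support_sum.trans ?_
    intro m hm
    obtain ⟨n, hn, hm⟩ := Finset.mem_biUnion.1 hm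
    have := support_monomial_subset hm
    rw [Finset.mem_singleton] at this
    exact Finset.mem_image.2 ⟨n, hn, this.symm⟩
  refine (Finset.sum_le_sum_of_subset hsub).trans ?_
  exact Finset.sum_image_le_of_nonneg (fun _ _ => Nat.zero_le _)

omit [Fintype σ] in
lemma sum_monomial_ne_zero {T : Finset (σ →₀ ℕ)} (hT : T.Nonempty) {g : (σ →₀ ℕ) → σ →₀ ℕ}
    (hg : Set.InjOn g T) {c : (σ →₀ ℕ) → k} (hc : ∀ m ∈ T, c m ≠ 0) :
    ∑ m ∈ T, monomial (g m) (c m) ≠ 0 := by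
  classical
  obtain ⟨n, hn⟩ := hT
  intro h0
  have := congrArg (coeff (g n)) h0
  rw [coeff_sum, Finset.sum_eq_single n] at this
  · rw [coeff_monomial, if_pos rfl, coeff_zero] at this
    exact hc n hn this
  · intro m hm hne
    rw [coeff_monomial, if_neg fun h => hne (hg hm hn h)]
  · exact fun h => absurd hn h

omit [Fintype σ] in
lemma pderiv_eq_sum (i : σ) (P : MvPolynomial σ k) :
    pderiv i P = ∑ m ∈ P.support, monomial (m - Finsupp.single i 1) (P.coeff m * m i) := by
  conv_lhs => rw [P.as_sum]
  rw [map_sum]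
  exact Finset.sum_congr rfl fun m _ => pderiv_monomial

lemma weight_pderiv_lt {i : σ} {P : MvPolynomial σ k} (h : pderiv i P ≠ 0) :
    weight (pderiv i P) < weight P := by
  classical
  rw [pderiv_eq_sum] at h ⊢
  obtain ⟨m, hm, hne⟩ := Finset.exists_ne_zero_of_sum_ne_zero h
  refine (weight_sum_monomial_le _ _ _).trans_lt ?_
  have hmi : m i ≠ 0 := by
    rintro h0; rw [h0] at hne; simp at hne
  refine Finset.sum_lt_sum (fun m _ => Finset.sum_le_sum fun o _ => ?_) ⟨m, hm, ?_⟩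
  · simp
  · refine Finset.sum_lt_sum (fun o _ => ?_) ⟨i, Finset.mem_univ _, ?_⟩
    · simp
    · simp; omega

omit [Fintype σ] in
lemma natCast_eq_zero_of_pderiv_eq_zero {i : σ} {P : MvPolynomial σ k} (h : pderiv i P = 0)
    {m : σ →₀ ℕ} (hm : m ∈ P.support) : (m i : k) = 0 := by
  classical
  by_cases h0 : m i = 0
  · rw [h0, Nat.cast_zero]
  have := congrArg (coeff (m - Finsupp.single i 1)) h
  rw [pderiv_eq_sum, coeff_sum, Finset.sum_eq_single m] at this
  · rw [coeff_monomial, if_pos rfl, coeff_zero] at this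
    exact (mul_eq_zero.1 this).resolve_left (mem_support_iff.1 hm)
  · intro n hn hne
    rw [coeff_monomial]
    split_ifs with h
    · have hni : n i = 0 := by
        by_contra hni
        apply hne
        have h1 : Finsupp.single i 1 ≤ n := by simpa [Finsupp.single_le_iff] using Nat.one_le_iff_ne_zero.2 hni
        have h2 : Finsupp.single i 1 ≤ m := by simpa [Finsupp.single_le_iff] using Nat.one_le_iff_ne_zero.2 h0
        rw [← tsub_add_cancel_of_le h1, h, tsub_add_cancel_of_le h2]
      rw [hni]; simp
    · rfl
  · exact fun h => absurd hm h

open Classical in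
/-- Divide the exponents of the variables in `s` by `p`. -/
def divExp (p : ℕ) (s : Set σ) (m : σ →₀ ℕ) : σ →₀ ℕ :=
  Finsupp.equivFunOnFinite.symm fun o => if o ∈ s then m o / p else m o

lemma exists_root_step {p : ℕ} (hp : p.Prime) (s : Set σ) (c : k → k) (hc : ∀ a, a ≠ 0 → c a ≠ 0)
    {P : MvPolynomial σ k} (hP : P ≠ 0) (hdvd : ∀ m ∈ P.support, ∀ o ∈ s, p ∣ m o)
    (hs : ∃ m ∈ P.support, ∃ o ∈ s, m o ≠ 0) :
    weight (∑ m ∈ P.support, monomial (divExp p s m) (c (P.coeff m))) < weight P ∧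
    ∑ m ∈ P.support, monomial (divExp p s m) (c (P.coeff m)) ≠ 0 := by
  constructor
  · refine (weight_sum_monomial_le _ _ _).trans_lt ?_
    have hle : ∀ m o, divExp p s m o ≤ m o := fun m o => by
      simp only [divExp, Finsupp.coe_equivFunOnFinite_symm]
      split_ifs
      · exact Nat.div_le_self _ _
      · exact le_rfl
    obtain ⟨m, hm, o, ho, hmo⟩ := hs
    refine Finset.sum_lt_sum (fun m _ => Finset.sum_le_sum fun o _ => hle m o) ⟨m, hm, ?_⟩
    refine Finset.sum_lt_sum (fun o _ => hle m o) ⟨o, Finset.mem_univ _, ?_⟩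
    simp only [divExp, Finsupp.coe_equivFunOnFinite_symm, if_pos ho]
    exact Nat.div_lt_self (Nat.pos_of_ne_zero hmo) hp.one_lt
  · refine sum_monomial_ne_zero (Finset.nonempty_iff_ne_empty.2 (by simpa using hP)) ?_
      fun m hm => hc _ (mem_support_iff.1 hm)
    intro m hm n hn h
    ext o
    have := DFunLike.congr_fun h o
    simp only [divExp, Finsupp.coe_equivFunOnFinite_symm] at this
    split_ifs at this with ho
    · obtain ⟨a, ha⟩ := hdvd m hm o ho
      obtain ⟨b, hb⟩ := hdvd n hn o ho
      rw [ha, hb, Nat.mul_div_cancel_left _ hp.pos, Nat.mul_div_cancel_left _ hp.pos] at this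
      rw [ha, hb, this]
    · exact this

omit [Fintype σ] in
lemma exists_ne_zero_of_aeval_eq_zero {ι A : Type*} [CommRing A] [Algebra k A]
    {f : σ → A} (e : ι → σ) (he : AlgebraicIndependent k (f ∘ e)) {P : MvPolynomial σ k} (hP : P ≠ 0)
    (h : aeval f P = 0) : ∃ m ∈ P.support, ∃ o ∉ Set.range e, m o ≠ 0 := by
  by_contra! hc
  obtain ⟨Q, rfl⟩ := exists_rename_eq_of_vars_subset_range P e he.injective.of_comp (by
    intro o ho
    obtain ⟨m, hm, hmo⟩ := (mem_vars_iff_mem_support o).1 ho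
    by_contra h'
    exact (Finsupp.mem_support_iff.1 hmo) (hc m hm o h'))
  rw [aeval_rename] at h
  rw [he.eq_zero_of_aeval_eq_zero _ h, map_zero] at hP
  exact hP rfl

end SepRel
end MilnorRec

namespace MilnorRec
section SepRel
open MvPolynomial

lemma aeval_sum_monomial {σ k A : Type*} [Fintype σ] [Field k] [CommRing A] [Algebra k A] (f : σ → A)
    (T : Finset (σ →₀ ℕ)) (g : (σ →₀ ℕ) → σ →₀ ℕ) (c : (σ →₀ ℕ) → k) :
    aeval f (∑ m ∈ T, monomial (g m) (c m)) = ∑ m ∈ T, algebraMap k A (c m) * ∏ o, f o ^ g m o := by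
  rw [map_sum]
  refine Finset.sum_congr rfl fun m _ => ?_
  rw [aeval_monomial, Finsupp.prod_fintype]
  simp

variable {ι k K : Type*} [Fintype ι] [Field k] [Field K] [Algebra k K] {p : ℕ}

private lemma separable_relation_aux [ExpChar k p] [IsAlgClosed k] [ExpChar K p]
    (hperf : ∀ y : K, ∃ z, z ^ p = y) {x : ι → K} (hx : AlgebraicIndependent k x) {u : K} (N : ℕ) :
    ∀ U : K, Transcendental k U → (∃ m n, U ^ p ^ n = u ^ p ^ m) →
    ∀ P : MvPolynomial (Option ι) k, P ≠ 0 → aeval (fun o : Option ι => o.elim U x) P = 0 →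
    weight P = N →
    ∃ U : K, (∃ m n, U ^ p ^ n = u ^ p ^ m) ∧ ∃ P : MvPolynomial (Option ι) k,
      aeval (fun o : Option ι => o.elim U x) P = 0 ∧
      aeval (fun o : Option ι => o.elim U x) (pderiv none P) ≠ 0 ∧
      ∃ i, aeval (fun o : Option ι => o.elim U x) (pderiv (some i) P) ≠ 0 := by
  induction N using Nat.strong_induction_on with
  | _ N IH =>
  intro U hU hUu P hP hPU hN
  have hnone : ∃ m ∈ P.support, ∃ o ∈ ({none} : Set (Option ι)), m o ≠ 0 := by
    obtain ⟨m, hm, o, ho, h⟩ := exists_ne_zero_of_aeval_eq_zero (some : ι → Option ι)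
      (show AlgebraicIndependent k ((fun o : Option ι => o.elim U x) ∘ some) from hx) hP hPU
    cases o with
    | none => exact ⟨m, hm, none, rfl, h⟩
    | some i => exact absurd ⟨i, rfl⟩ ho
  have hsome : ∃ m ∈ P.support, ∃ o ∈ Set.range (some : ι → Option ι), m o ≠ 0 := by
    obtain ⟨m, hm, o, ho, h⟩ := exists_ne_zero_of_aeval_eq_zero (fun _ : Unit => (none : Option ι))
      (show AlgebraicIndependent k ((fun o : Option ι => o.elim U x) ∘ fun _ : Unit => none) from
        algebraicIndependent_unique_type_iff.2 hU) hP hPU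
    cases o with
    | none => exact absurd ⟨(), rfl⟩ ho
    | some i => exact ⟨m, hm, some i, ⟨i, rfl⟩, h⟩
  have hchar : ∀ {s : Set (Option ι)}, (∃ m ∈ P.support, ∃ o ∈ s, m o ≠ 0) →
      (∀ o ∈ s, pderiv o P = 0) → p.Prime ∧ ∀ m ∈ P.support, ∀ o ∈ s, p ∣ m o := by
    intro s hs h0
    have h1 : ∀ m ∈ P.support, ∀ o ∈ s, (m o : k) = 0 := fun m hm o ho =>
      natCast_eq_zero_of_pderiv_eq_zero (h0 o ho) hm
    rcases ‹ExpChar k p› with h | hp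
    · obtain ⟨m, hm, o, ho, hne⟩ := hs
      exact absurd (Nat.cast_eq_zero.1 (h1 m hm o ho)) hne
    · exact ⟨hp, fun m hm o ho => (CharP.cast_eq_zero_iff k p _).1 (h1 m hm o ho)⟩
  by_cases h1 : pderiv none P = 0
  · obtain ⟨hp, hdvd⟩ := hchar hnone (by rintro o rfl; exact h1)
    obtain ⟨hw, hne⟩ := exists_root_step hp {none} id (fun _ h => h) hP hdvd hnone
    obtain ⟨m, n, hmn⟩ := hUu
    refine IH _ (hN ▸ hw) (U ^ p) (hU.pow hp.pos) ⟨m + 1, n, ?_⟩ _ hne ?_ rfl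
    · rw [pow_right_comm, hmn, ← pow_mul, pow_succ]
    · rw [aeval_sum_monomial, ← hPU]
      conv_rhs => rw [P.as_sum, aeval_sum_monomial _ _ (fun m => m)]
      refine Finset.sum_congr rfl fun m hm => ?_
      congr 1
      refine Finset.prod_congr rfl fun o _ => ?_
      cases o with
      | none =>
        simp only [divExp, Finsupp.coe_equivFunOnFinite_symm, Set.mem_singleton, if_true, Option.elim]
        rw [← pow_mul, Nat.mul_div_cancel' (hdvd m hm none rfl)]
      | some i => simp [divExp]
  by_cases h1' : aeval (fun o : Option ι => o.elim U x) (pderiv none P) = 0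
  · exact IH _ (hN ▸ weight_pderiv_lt h1) U hU hUu _ h1 h1' rfl
  by_cases h2 : ∃ i, pderiv (some i) P ≠ 0
  · obtain ⟨i, hi⟩ := h2
    by_cases h2' : aeval (fun o : Option ι => o.elim U x) (pderiv (some i) P) = 0
    · exact IH _ (hN ▸ weight_pderiv_lt hi) U hU hUu _ hi h2' rfl
    · exact ⟨U, hUu, P, hPU, h1', i, h2'⟩
  push Not at h2
  obtain ⟨hp, hdvd⟩ := hchar hsome (by rintro _ ⟨i, rfl⟩; exact h2 i)
  have hroot : ∀ a : k, ∃ b, b ^ p = a := fun a => IsAlgClosed.exists_pow_nat_eq a hp.pos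
  choose c hc using hroot
  obtain ⟨hw, hne⟩ := exists_root_step hp (Set.range some) c
    (fun a ha h => ha (by rw [← hc a, h, zero_pow hp.ne_zero])) hP hdvd hsome
  obtain ⟨V, hV⟩ := hperf U
  obtain ⟨m, n, hmn⟩ := hUu
  refine IH _ (hN ▸ hw) V (fun h => hU (hV ▸ h.pow p)) ⟨m, n + 1, ?_⟩ _ hne ?_ rfl
  · rw [pow_succ', pow_mul, hV, hmn]
  · refine eq_zero_of_pow_eq_zero (n := p) ?_
    rw [aeval_sum_monomial, ← frobenius_def, map_sum, ← hPU]
    conv_rhs => rw [P.as_sum, aeval_sum_monomial _ _ (fun m => m)]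
    refine Finset.sum_congr rfl fun m hm => ?_
    rw [map_mul, frobenius_def, ← map_pow, hc, map_prod]
    congr 1
    refine Finset.prod_congr rfl fun o _ => ?_
    rw [frobenius_def]
    cases o with
    | none => simp [divExp, ← hV, ← pow_mul, mul_comm]
    | some i =>
      simp only [divExp, Finsupp.coe_equivFunOnFinite_symm, Set.mem_range_self, if_true, Option.elim]
      rw [← pow_mul, Nat.div_mul_cancel (hdvd m hm _ ⟨i, rfl⟩)]

omit [Fintype ι] in
/-- Up to a Frobenius twist, an element satisfies a relation over a transcendence basis which is
separable in both directions. -/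
lemma exists_separable_relation [ExpChar k p] [IsAlgClosed k]
    (hperf : ∀ y : K, ∃ z, z ^ p = y) [Finite ι] {x : ι → K} (hx : IsTranscendenceBasis k x) {u : K}
    (hu : Transcendental k u) :
    ∃ U : K, (∃ m n, U ^ p ^ n = u ^ p ^ m) ∧ ∃ P : MvPolynomial (Option ι) k,
      aeval (fun o : Option ι => o.elim U x) P = 0 ∧
      aeval (fun o : Option ι => o.elim U x) (pderiv none P) ≠ 0 ∧
      ∃ i, aeval (fun o : Option ι => o.elim U x) (pderiv (some i) P) ≠ 0 := by
  have : ExpChar K p := expChar_of_injective_algebraMap (algebraMap k K).injective p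
  have := Fintype.ofFinite ι
  have hdep : ¬ AlgebraicIndependent k (fun o : Option ι => o.elim u x) := by
    intro h
    have := ((hx.1.option_iff_transcendental u).1 h)
    exact this (hx.isAlgebraic.isAlgebraic u)
  obtain ⟨P, h0, hne⟩ : ∃ P : MvPolynomial (Option ι) k,
      aeval (fun o : Option ι => o.elim u x) P = 0 ∧ P ≠ 0 := by
    rw [algebraicIndependent_iff] at hdep
    push Not at hdep
    exact hdep
  exact separable_relation_aux hperf hx.1 _ u hu ⟨0, 0, rfl⟩ P hne h0 rfl

end SepRel
end MilnorRec

namespace MilnorRec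
section PointArc
open MvPolynomial

lemma order_ofPowerSeries_eq_zero {F : Type*} [Field F] {w : PowerSeries F}
    (h : PowerSeries.constantCoeff w ≠ 0) : (HahnSeries.ofPowerSeries ℤ F w).order = 0 := by
  refine le_antisymm (HahnSeries.order_le_of_coeff_ne_zero ?_) ?_
  · rw [show (0 : ℤ) = ((0 : ℕ) : ℤ) by rfl, HahnSeries.ofPowerSeries_apply_coeff]
    simpa using h
  · have hw : HahnSeries.ofPowerSeries ℤ F w ≠ 0 := by
      intro h0
      rw [← map_zero (HahnSeries.ofPowerSeries ℤ F)] at h0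
      rw [HahnSeries.ofPowerSeries_injective h0, map_zero] at h
      exact h rfl
    by_contra hlt
    refine HahnSeries.coeff_order_eq_zero.not.2 hw ?_
    rw [HahnSeries.ofPowerSeries_apply]
    refine HahnSeries.embDomain_of_notMem_range ?_
    rintro ⟨n, hn⟩
    refine hlt ?_
    rw [← HahnSeries.ofPowerSeries_apply] at hn
    rw [← hn]
    exact Nat.cast_nonneg n

lemma order_ofPowerSeries_eq_one {F : Type*} [Field F] {w : PowerSeries F}
    (h : PowerSeries.constantCoeff w = 0) (h1 : PowerSeries.coeff 1 w ≠ 0) :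
    (HahnSeries.ofPowerSeries ℤ F w).order = 1 := by
  obtain ⟨v, rfl⟩ := PowerSeries.X_dvd_iff.2 h
  have hv : PowerSeries.constantCoeff v ≠ 0 := by
    rw [show (1:ℕ) = 0 + 1 by rfl, PowerSeries.coeff_succ_X_mul] at h1
    simpa using h1
  rw [map_mul, HahnSeries.order_mul, order_ofPowerSeries_eq_zero hv]
  · simp [HahnSeries.ofPowerSeries_X]
  · simp [HahnSeries.ofPowerSeries_X]
  · intro h0
    rw [← map_zero (HahnSeries.ofPowerSeries ℤ F)] at h0
    rw [HahnSeries.ofPowerSeries_injective h0, map_zero] at hv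
    exact hv rfl

lemma derivation_aeval {σ k A : Type*} [Fintype σ] [CommRing k] [CommRing A] [Algebra k A]
    (D : Derivation k A A) (f : σ → A) (P : MvPolynomial σ k) :
    D (aeval f P) = ∑ o, aeval f (pderiv o P) * D (f o) := by
  classical
  induction P using MvPolynomial.induction_on with
  | C a => simp [algHom_C]
  | add P Q hP hQ => simp [hP, hQ, add_mul, Finset.sum_add_distrib]
  | mul_X P i hP =>
    rw [map_mul, aeval_X, D.leibniz, hP, smul_eq_mul, smul_eq_mul, Finset.mul_sum]
    simp only [Derivation.leibniz, pderiv_X, smul_eq_mul, map_add, map_mul, aeval_X, add_mul,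
      Finset.sum_add_distrib]
    congr 1
    · rw [Finset.sum_eq_single i]
      · simp
      · intro o _ h
        simp [Pi.single_eq_of_ne' h]
      · simp
    · exact Finset.sum_congr rfl fun o _ => by ring

lemma exists_const_of_relation {ι k F : Type*} [Fintype ι] [Field k] [IsAlgClosed k] [Field F]
    [Algebra k F] {y : ι → F} {a : ι → k}
    (hy : ∀ c : ι → k, c ≠ 0 → ∑ i, algebraMap k F (c i) * (y i - algebraMap k F (a i)) ≠ 0)
    {w : PowerSeries F} {ξ : ι → PowerSeries F}
    (hξ : ∀ i, ξ i = PowerSeries.C (algebraMap k F (a i)) +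
      PowerSeries.X * PowerSeries.C (y i - algebraMap k F (a i)))
    {P : MvPolynomial (Option ι) k} (hP : aeval (fun o : Option ι => o.elim w ξ) P = 0)
    (h0 : PowerSeries.constantCoeff (aeval (fun o : Option ι => o.elim w ξ) (pderiv none P)) ≠ 0)
    {i : ι} (hi : PowerSeries.constantCoeff
      (aeval (fun o : Option ι => o.elim w ξ) (pderiv (some i) P)) ≠ 0) :
    ∃ A : k, PowerSeries.constantCoeff w = algebraMap k F A ∧ PowerSeries.coeff 1 w ≠ 0 := by
  have hcc : ∀ Q : MvPolynomial (Option ι) k,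
      PowerSeries.constantCoeff (aeval (fun o : Option ι => o.elim w ξ) Q) =
      aeval (fun o : Option ι => o.elim (PowerSeries.constantCoeff w) fun i => algebraMap k F (a i)) Q := by
    intro Q
    induction Q using MvPolynomial.induction_on with
    | C c => simp [algHom_C, PowerSeries.algebraMap_apply]
    | add P Q hP hQ => simp [hP, hQ]
    | mul_X P i hP =>
      rw [map_mul, map_mul, hP, map_mul]
      congr 1
      cases i <;> simp [hξ]
  obtain ⟨A, hA⟩ : ∃ A : k, algebraMap k F A = PowerSeries.constantCoeff w := by
    refine mem_range_algebraMap_of_isAlgebraic ?_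
    set W := PowerSeries.constantCoeff w
    let Q : Polynomial k := aeval (fun o : Option ι => o.elim Polynomial.X fun i => Polynomial.C (a i)) P
    have hev : ∀ R : MvPolynomial (Option ι) k, Polynomial.aeval W
        (aeval (fun o : Option ι => o.elim Polynomial.X fun i => Polynomial.C (a i)) R) =
        aeval (fun o : Option ι => o.elim W fun i => algebraMap k F (a i)) R := by
      intro R
      rw [← AlgHom.comp_apply, comp_aeval]
      congr 2
      funext o
      cases o <;> simp
    refine ⟨Q, ?_, ?_⟩
    · intro hQ
      have := derivation_aeval (Polynomial.derivative' (R := k))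
        (fun o : Option ι => o.elim Polynomial.X fun i => Polynomial.C (a i)) P
      rw [show aeval (fun o : Option ι => o.elim Polynomial.X fun i => Polynomial.C (a i)) P = 0 from hQ,
        map_zero, Fintype.sum_option] at this
      simp at this
      rw [hcc, ← hev, ← this, map_zero] at h0
      exact h0 rfl
    · rw [show Polynomial.aeval W Q = _ from hev P, ← hcc, hP, map_zero]
  refine ⟨A, hA.symm, fun hw1 => ?_⟩
  have hD := derivation_aeval ((PowerSeries.derivative F).restrictScalars k)
    (fun o : Option ι => o.elim w ξ) P
  rw [hP, map_zero, Fintype.sum_option] at hD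
  have hD := congrArg PowerSeries.constantCoeff hD
  have hevA : ∀ R : MvPolynomial (Option ι) k,
      aeval (fun o : Option ι => o.elim (PowerSeries.constantCoeff w) fun i => algebraMap k F (a i)) R
      = algebraMap k F (eval (fun o : Option ι => o.elim A a) R) := by
    intro R
    rw [← hA]
    refine Eq.trans ?_ (aeval_algebraMap_apply F (fun o : Option ι => o.elim A a) R)
    congr 2
    funext o
    cases o <;> simp
  refine hy (fun i => eval (fun o : Option ι => o.elim A a) (pderiv (some i) P)) (fun h => hi ?_) ?_
  · rw [hcc, hevA, show eval _ _ = _ from congrFun h i]; simp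
  · have hw' : PowerSeries.constantCoeff (PowerSeries.derivative F w) = 0 := by
      rw [← PowerSeries.coeff_zero_eq_constantCoeff_apply, PowerSeries.coeff_derivative]
      simpa using hw1
    have hξ' : ∀ i, PowerSeries.constantCoeff (PowerSeries.derivative F (ξ i)) =
        y i - algebraMap k F (a i) := by
      intro i
      rw [← PowerSeries.coeff_zero_eq_constantCoeff_apply, PowerSeries.coeff_derivative, hξ]
      simp
    simp only [map_zero, map_add, map_mul, map_sum, Option.elim_none, Option.elim_some, Derivation.restrictScalars_apply, hw',
      hξ', mul_zero, zero_add] at hD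
    rw [hD]
    refine Finset.sum_congr rfl fun i _ => ?_
    rw [hcc, hevA]

end PointArc

section Sees
variable {ℓ : ℕ} [Fact ℓ.Prime] {p : ℕ} {k K : Type*} [Field k] [Field K] [Algebra k K]

lemma Sees.of_pow_eq [ExpChar k p] [IsAlgClosed k] (hp : (p : ZMod ℓ) ≠ 0)
    {f : KV ℓ K →ₗ[ZMod ℓ] ZMod ℓ} {u w : K} {m n : ℕ} (h : w ^ p ^ n = u ^ p ^ m) {a b : k}
    (hab : b ^ p ^ n = a ^ p ^ m) (hs : Sees k f w b) : Sees k f u a := by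
  have : ExpChar K p := expChar_of_injective_algebraMap (algebraMap k K).injective p
  have key : ∀ a b : k, b ^ p ^ n = a ^ p ^ m →
      ((p ^ n : ℕ) : ZMod ℓ) * f (cl ℓ (w - algebraMap k K b)) =
      ((p ^ m : ℕ) : ZMod ℓ) * f (cl ℓ (u - algebraMap k K a)) := by
    intro a b hab
    have : (w - algebraMap k K b) ^ p ^ n = (u - algebraMap k K a) ^ p ^ m := by
      rw [sub_pow_expChar_pow, sub_pow_expChar_pow, h, ← map_pow, hab, map_pow]
    have := congrArg (fun z => f (cl ℓ z)) this
    simpa only [cl_pow', map_smul, smul_eq_mul] using this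
  have hn := natCast_pow_ne_zero hp n
  have hm := natCast_pow_ne_zero hp m
  obtain ⟨h1, c, hc⟩ := hs
  refine ⟨fun h0 => h1 ?_, ?_⟩
  · have := key a b hab
    rw [h0, mul_zero] at this
    exact (mul_eq_zero.1 this).resolve_left hn
  · obtain ⟨d, hd⟩ := IsAlgClosed.exists_pow_nat_eq (c ^ p ^ n) (pow_pos (expChar_pos k p) m)
    refine ⟨d, ?_⟩
    have := key d c hd.symm
    rw [hc, mul_zero] at this
    exact (mul_eq_zero.1 this.symm).resolve_left hm

end Sees
end MilnorRec

namespace MilnorRec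
open IntermediateField

section Aux
variable {ι k K : Type*} [Field k] [Field K] [Algebra k K] {p : ℕ}

lemma PFG.of_finiteDimensional [Finite ι] {x : ι → K} {E : IntermediateField k K}
    (hE : adjoin k (Set.range x) = E) {F : Type*} [Field F] [Algebra E F] [Algebra k F]
    [IsScalarTower k E F] [FiniteDimensional E F] : PFG p k F := by
  classical
  have := Fintype.ofFinite ι
  have hxE : ∀ i, x i ∈ E := fun i => hE ▸ subset_adjoin _ _ ⟨i, rfl⟩
  let b := Module.finBasis E F
  let s : Finset F := Finset.univ.image (fun i => algebraMap E F ⟨x i, hxE i⟩) ∪ Finset.univ.image b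
  refine ⟨s, fun y => ⟨0, ?_⟩⟩
  have key : ∀ (z : K) (hz : z ∈ E), algebraMap E F ⟨z, hz⟩ ∈ adjoin k (s : Set F) := by
    subst hE
    intro z hz
    induction hz using adjoin_induction with
    | mem z hz =>
      obtain ⟨i, rfl⟩ := hz
      exact subset_adjoin _ _ (by simp [s])
    | algebraMap a =>
      have : algebraMap (adjoin k (Set.range x)) F ⟨algebraMap k K a, IntermediateField.algebraMap_mem _ a⟩
          = algebraMap k F a := (IsScalarTower.algebraMap_apply k (adjoin k (Set.range x)) F a).symm
      rw [this]; exact IntermediateField.algebraMap_mem _ _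
    | add z w hz hw h1 h2 =>
      have := add_mem h1 h2
      rw [← map_add] at this; exact this
    | inv z hz h1 =>
      have := inv_mem h1
      rw [← map_inv₀] at this; exact this
    | mul z w hz hw h1 h2 =>
      have := mul_mem h1 h2
      rw [← map_mul] at this; exact this
  rw [pow_zero, pow_one, ← b.sum_repr y]
  refine sum_mem fun i _ => ?_
  rw [Algebra.smul_def]
  exact mul_mem (key _ (b.repr y i).2) (subset_adjoin _ _ (by simp [s]))

lemma exists_add_smul_not_mem [Infinite k] {μ ν : ι → k}
    (h : LinearIndependent k ![μ, ν]) (B : Finset (ι → k)) :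
    ∃ c : k, μ + c • ν ≠ 0 ∧ ∀ b ∈ B, ∀ a : k, μ + c • ν ≠ a • b := by
  have hne : ∀ c : k, μ + c • ν ≠ 0 := fun c hc =>
    one_ne_zero (LinearIndependent.pair_iff.1 h 1 c (by rw [one_smul, hc])).1
  by_contra! hcon
  have hcon : ∀ c : k, ∃ b ∈ B, ∃ a : k, μ + c • ν = a • b := fun c => hcon c (hne c)
  choose b hb a ha using hcon
  have hinj : Function.Injective (fun c => (⟨b c, hb c⟩ : B)) := by
    intro c d hcd
    have hbd : b c = b d := congrArg Subtype.val hcd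
    have h0 : (a d - a c) • μ + (a d * c - a c * d) • ν = 0 := by
      have : a d • (μ + c • ν) = a c • (μ + d • ν) := by
        rw [ha c, ha d, hbd, smul_comm]
      have h2 := sub_eq_zero.2 this
      rw [← h2]; module
    obtain ⟨h1, h2⟩ := LinearIndependent.pair_iff.1 h _ _ h0
    rw [sub_eq_zero.1 h1, ← mul_sub] at h2
    rcases mul_eq_zero.1 h2 with h3 | h3
    · exact absurd (by rw [ha c, h3, zero_smul]) (hne c)
    · exact sub_eq_zero.1 h3
  have := Finite.of_injective _ hinj
  exact not_finite k

lemma exists_finset_forall_qgen_pair [Fintype ι] [ExpChar k p] [IsAlgClosed k] (hF : PFG p k K)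
    {E : IntermediateField k K} {x : ι → K} (hE : adjoin k (Set.range x) = E)
    {F : Type*} [Field F] [Algebra E F] [Algebra k F]
    [IsScalarTower k E F] [FiniteDimensional E F] {y : ι → E}
    (hy : IsTranscendenceBasis k (fun i => (y i : K))) :
    ∃ B : Finset (ι → k), ∀ c : ι → k, c ≠ 0 → (∀ b ∈ B, ∀ a : k, c ≠ a • b) →
      QGen p k (lin y c : E).1 ∧ QGen p k (algebraMap E F (lin y c)) := by
  classical
  have hyE : IsTranscendenceBasis k y := IsTranscendenceBasis.of_comp_algebraMap (A' := K) hy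
  have hyF : IsTranscendenceBasis k (algebraMap E F ∘ y) := hyE.algebraMap_comp
  obtain ⟨B₁, h1⟩ := exists_finset_forall_qgen hF hy
  obtain ⟨B₂, h2⟩ := exists_finset_forall_qgen (PFG.of_finiteDimensional (p := p) hE) hyF
  refine ⟨B₁ ∪ B₂, fun c hc hB => ⟨?_, ?_⟩⟩
  · have := h1 c hc fun b hb => hB b (Finset.mem_union_left _ hb)
    convert this
    simp [lin]
  · have := h2 c hc fun b hb => hB b (Finset.mem_union_right _ hb)
    convert this
    simp [lin, ← IsScalarTower.algebraMap_apply k E F]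

variable {ℓ : ℕ} [Fact ℓ.Prime]

lemma exists_adm_of_arc [Fintype ι] [ExpChar k p] [IsAlgClosed k] (hF : PFG p k K)
    (hp : (p : ZMod ℓ) ≠ 0) {E : IntermediateField k K} {x : ι → K}
    (hE : adjoin k (Set.range x) = E) [Algebra.IsAlgebraic E K] {N : Type*} [Field N] [Algebra E N]
    {F : IntermediateField E (AlgebraicClosure E)} [FiniteDimensional E F] (Φ : N →+* HahnSeries ℤ F)
    (hk : ∀ a : k, Φ (algebraMap E N (algebraMap k E a)) = HahnSeries.C (algebraMap k F a))
    {y : ι → E} (hy : IsTranscendenceBasis k (fun i => (y i : K))) {μ ν : ι → k}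
    (hμν : LinearIndependent k ![μ, ν])
    (hμ : Φ (algebraMap E N (lin y μ)) = HahnSeries.C (algebraMap E F (lin y μ)))
    (hν : Φ (algebraMap E N (lin y ν)) = HahnSeries.C (algebraMap E F (lin y ν)))
    {e : E} (he : e ≠ 0) (heo : ((Φ (algebraMap E N e)).order : ZMod ℓ) ≠ 0)
    (j : separableClosure E K →ₐ[E] N) :
    ∃ f : KV ℓ K →ₗ[ZMod ℓ] ZMod ℓ, Adm p k f ∧ ∀ u : separableClosure E K, u ≠ 0 →
      f (cl ℓ (u : K)) = ((Φ (j u)).order : ZMod ℓ) := by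
  have : Infinite k := IsAlgClosed.instInfinite
  obtain ⟨B, hB⟩ := exists_finset_forall_qgen_pair hF hE (F := F) hy
  obtain ⟨c, hc0, hcB⟩ := exists_add_smul_not_mem hμν B
  obtain ⟨hK, hFq⟩ := hB _ hc0 hcB
  have : ExpChar E p := expChar_of_injective_algebraMap (algebraMap k E).injective p
  have hlin : lin y (μ + c • ν) = lin y μ + algebraMap k E c * lin y ν := by
    simp [lin, add_mul, Finset.sum_add_distrib, Finset.mul_sum, mul_assoc]
  have hj : ∀ e : E, j (algebraMap E _ e) = algebraMap E N e := fun e => j.commutes e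
  have : IsScalarTower k (separableClosure E K) K := IsScalarTower.of_algebraMap_eq fun _ => rfl
  refine adm_of_hahnSeries (M := separableClosure E K) hp (Φ.comp j.toRingHom)
    (fun a => ?_) (t := algebraMap E _ (lin y (μ + c • ν)))
    (t₀ := algebraMap E F (lin y (μ + c • ν))) ?_ ?_ hFq ⟨algebraMap E _ e, by simpa using he, ?_⟩
  · rw [← hk, ← hj]; rfl
  · change Φ (j _) = _
    rw [hj, hlin]
    simp only [map_add, map_mul, hμ, hν, hk, IsScalarTower.algebraMap_apply k E F]
  · exact hK
  · change ((Φ (j _)).order : ZMod ℓ) ≠ 0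
    rwa [hj]

end Aux
end MilnorRec

namespace MilnorRec
open IntermediateField MvPolynomial

section Point
variable {ι k : Type*} [Field k]

section Series
variable {M F : Type*} [Field M] [Field F] [Algebra k M] [Algebra k F] {Ψ : M →+* HahnSeries ℤ F}
  (hk : ∀ a : k, Ψ (algebraMap k M a) = HahnSeries.C (algebraMap k F a))
include hk

lemma order_sub_const {U : M} {w : PowerSeries F} (hw : Ψ U = HahnSeries.ofPowerSeries ℤ F w) {A : k}
    (hA : PowerSeries.constantCoeff w = algebraMap k F A) :
    (PowerSeries.coeff 1 w ≠ 0 → (Ψ (U - algebraMap k M A)).order = 1) ∧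
      ∀ b : k, b ≠ A → (Ψ (U - algebraMap k M b)).order = 0 := by
  have h : ∀ b : k, Ψ (U - algebraMap k M b) =
      HahnSeries.ofPowerSeries ℤ F (w - PowerSeries.C (algebraMap k F b)) := fun b => by
    rw [map_sub, map_sub, hw, hk, HahnSeries.ofPowerSeries_C]
  refine ⟨fun h1 => ?_, fun b hb => ?_⟩
  · rw [h]
    exact order_ofPowerSeries_eq_one (by simp [hA]) (by simpa [PowerSeries.coeff_C] using h1)
  · rw [h]
    refine order_ofPowerSeries_eq_zero ?_
    rw [map_sub, hA, PowerSeries.constantCoeff_C, ← map_sub]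
    simpa [sub_eq_zero] using hb.symm

lemma exists_order_sub_const [Fintype ι] [IsAlgClosed k] {x : ι → M} {y : ι → F} {a : ι → k}
    (hy : ∀ c : ι → k, c ≠ 0 → ∑ i, algebraMap k F (c i) * (y i - algebraMap k F (a i)) ≠ 0)
    (hx : ∀ i, Ψ (x i) = HahnSeries.ofPowerSeries ℤ F (PowerSeries.C (algebraMap k F (a i)) +
      PowerSeries.X * PowerSeries.C (y i - algebraMap k F (a i))))
    {U : M} {P : MvPolynomial (Option ι) k} (hP : aeval (fun o : Option ι => o.elim U x) P = 0)
    (h0 : aeval (fun o : Option ι => o.elim U x) (pderiv none P) ≠ 0)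
    {i : ι} (hi : aeval (fun o : Option ι => o.elim U x) (pderiv (some i) P) ≠ 0)
    (hU : ∃ w, Ψ U = HahnSeries.ofPowerSeries ℤ F w)
    (h0' : ∃ w, Ψ (aeval (fun o : Option ι => o.elim U x) (pderiv none P))⁻¹ =
      HahnSeries.ofPowerSeries ℤ F w)
    (hi' : ∃ w, Ψ (aeval (fun o : Option ι => o.elim U x) (pderiv (some i) P))⁻¹ =
      HahnSeries.ofPowerSeries ℤ F w) :
    ∃ A : k, (Ψ (U - algebraMap k M A)).order = 1 ∧
      ∀ b : k, b ≠ A → (Ψ (U - algebraMap k M b)).order = 0 := by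
  obtain ⟨w, hw⟩ := hU
  let ξ : ι → PowerSeries F := fun i => PowerSeries.C (algebraMap k F (a i)) +
      PowerSeries.X * PowerSeries.C (y i - algebraMap k F (a i))
  have hev : ∀ Q : MvPolynomial (Option ι) k, Ψ (aeval (fun o : Option ι => o.elim U x) Q) =
      HahnSeries.ofPowerSeries ℤ F (aeval (fun o : Option ι => o.elim w ξ) Q) := by
    intro Q
    induction Q using MvPolynomial.induction_on with
    | C c => simp [algHom_C, hk, PowerSeries.algebraMap_apply, HahnSeries.ofPowerSeries_C]
    | add P Q hP hQ => simp [hP, hQ]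
    | mul_X P i hP =>
      rw [map_mul, map_mul, hP, map_mul, map_mul]
      congr 1
      cases i <;> simp [hx, hw, ξ]
  have hunit : ∀ Q : MvPolynomial (Option ι) k, aeval (fun o : Option ι => o.elim U x) Q ≠ 0 →
      (∃ w, Ψ (aeval (fun o : Option ι => o.elim U x) Q)⁻¹ = HahnSeries.ofPowerSeries ℤ F w) →
      PowerSeries.constantCoeff (aeval (fun o : Option ι => o.elim w ξ) Q) ≠ 0 := by
    rintro Q hQ ⟨v, hv⟩ h
    have h1 : HahnSeries.ofPowerSeries ℤ F (aeval (fun o : Option ι => o.elim w ξ) Q * v) =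
        HahnSeries.ofPowerSeries ℤ F 1 := by
      rw [map_mul, ← hv, ← hev, ← map_mul, mul_inv_cancel₀ hQ, map_one, map_one]
    have h2 := congrArg PowerSeries.constantCoeff (HahnSeries.ofPowerSeries_injective h1)
    rw [map_mul, h, zero_mul, map_one] at h2
    exact zero_ne_one h2
  have hP' : aeval (fun o : Option ι => o.elim w ξ) P = 0 := by
    refine HahnSeries.ofPowerSeries_injective (Γ := ℤ) ?_
    rw [← hev, hP, map_zero, map_zero]
  obtain ⟨A, hA, h1⟩ := exists_const_of_relation hy (fun _ => rfl) hP' (hunit _ h0 h0') (hunit _ hi hi')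
  obtain ⟨h2, h3⟩ := order_sub_const hk hw hA
  exact ⟨A, h2 h1, h3⟩

end Series

variable {K : Type*} [Field K] [Algebra k K] {p : ℕ}

lemma mem_separableClosure_of_relation {x : ι → K} {E : IntermediateField k K} (hxE : ∀ i, x i ∈ E)
    {U : K} {P : MvPolynomial (Option ι) k} (hP : aeval (fun o : Option ι => o.elim U x) P = 0)
    (h0 : aeval (fun o : Option ι => o.elim U x) (pderiv none P) ≠ 0) :
    U ∈ separableClosure E K := by
  let g : Option ι → Polynomial E := fun o => o.elim Polynomial.X fun i => Polynomial.C ⟨x i, hxE i⟩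
  have hev : ∀ Q : MvPolynomial (Option ι) k, Polynomial.aeval U (aeval g Q) =
      aeval (fun o : Option ι => o.elim U x) Q := by
    intro Q
    induction Q using MvPolynomial.induction_on with
    | C c => simp [algHom_C, ← IsScalarTower.algebraMap_apply]
    | add P Q hP hQ => simp [hP, hQ]
    | mul_X P i hP =>
      rw [map_mul, map_mul, hP, map_mul]
      congr 1
      cases i
      · simp [g]
      · simp [g]
  have hder : ∀ Q : MvPolynomial (Option ι) k, Polynomial.derivative (aeval g Q) =
      aeval g (pderiv none Q) := by
    classical
    intro Q
    induction Q using MvPolynomial.induction_on with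
    | C c => simp [algHom_C, Polynomial.algebraMap_apply]
    | add P Q hP hQ => simp [hP, hQ]
    | mul_X P i hP =>
      rw [map_mul, Polynomial.derivative_mul, hP]
      cases i
      · simp [g, add_comm, mul_comm]
      · simp [g, mul_comm]
  rw [mem_separableClosure_iff]
  have hint : IsIntegral E U := by
    refine (IsAlgebraic.isIntegral ⟨aeval g P, fun h => h0 ?_, by rw [hev, hP]⟩)
    rw [← hev, ← hder, h]; simp
  refine (Polynomial.separable_iff_derivative_ne_zero (minpoly.irreducible hint)).2 fun hd => h0 ?_
  obtain ⟨q, hq⟩ := minpoly.dvd E U ((hev P).trans hP)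
  rw [← hev, ← hder, hq, Polynomial.derivative_mul, hd]
  simp

end Point
end MilnorRec

namespace MilnorRec
open IntermediateField MvPolynomial

section Master
variable {ι k K : Type*} [Field k] [Field K] [Algebra k K] {p ℓ : ℕ} [Fact ℓ.Prime]

lemma sum_mul_sub_ne_zero [Fintype ι] {x : ι → K} (hx : IsTranscendenceBasis k x)
    (a c : ι → k) (hc : c ≠ 0) : ∑ i, algebraMap k K (c i) * (x i - algebraMap k K (a i)) ≠ 0 := by
  have := sub_const_ne_zero (transcendental_lin hx hc) (∑ i, c i * a i)
  simpa [lin, mul_sub, Finset.sum_sub_distrib] using this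

lemma constantCoeff_C_add_X_mul {R : Type*} [CommRing R] (a b : R) :
    PowerSeries.constantCoeff (PowerSeries.C a + PowerSeries.X * PowerSeries.C b) = a := by
  simp

lemma coeff_one_C_add_X_mul {R : Type*} [CommRing R] (a b : R) :
    PowerSeries.coeff 1 (PowerSeries.C a + PowerSeries.X * PowerSeries.C b) = b := by
  rw [show (1 : ℕ) = 0 + 1 from rfl, map_add, PowerSeries.coeff_succ_X_mul]
  simp [PowerSeries.coeff_C]

/-- Coordinates of the blow-up of a point. -/
lemma isTranscendenceBasis_blowup {E : Type*} [Field E] [Algebra k E] {x : ι → E} [DecidableEq ι]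
    {K : Type*} [Field K] [Algebra k K] [Algebra E K] [IsScalarTower k E K]
    [Finite ι] (hx : IsTranscendenceBasis k fun i => algebraMap E K (x i)) (a : ι → k) (i₁ : ι) :
    IsTranscendenceBasis k fun i => algebraMap E K (if i = i₁ then x i₁ - algebraMap k E (a i₁) else
      (x i - algebraMap k E (a i)) / (x i₁ - algebraMap k E (a i₁))) := by
  set y : ι → K := fun i => algebraMap E K (if i = i₁ then x i₁ - algebraMap k E (a i₁) else
      (x i - algebraMap k E (a i)) / (x i₁ - algebraMap k E (a i₁))) with hy
  have hy1 : y i₁ = algebraMap E K (x i₁) - algebraMap k K (a i₁) := by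
    simp [hy, ← IsScalarTower.algebraMap_apply]
  have hne : y i₁ ≠ 0 := by
    rw [hy1]; exact sub_const_ne_zero (hx.1.transcendental i₁) _
  refine IsTranscendenceBasis.of_mem_adjoin hx fun i => ?_
  have hmem : ∀ i, y i ∈ adjoin k (Set.range y) := fun i => subset_adjoin _ _ ⟨i, rfl⟩
  have hc : ∀ c : k, algebraMap k K c ∈ adjoin k (Set.range y) := fun c => IntermediateField.algebraMap_mem _ c
  have h1 : algebraMap E K (x i₁) = y i₁ + algebraMap k K (a i₁) := by rw [hy1]; ring
  by_cases h : i = i₁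
  · subst h
    rw [h1]
    exact add_mem (hmem _) (hc _)
  · have : algebraMap E K (x i) = y i * y i₁ + algebraMap k K (a i) := by
      have e : y i = (algebraMap E K (x i) - algebraMap k K (a i)) / y i₁ := by
        rw [hy1]
        simp [hy, h, ← IsScalarTower.algebraMap_apply]
      rw [e, div_mul_cancel₀ _ hne]; ring
    rw [this]
    exact add_mem (mul_mem (hmem _) (hmem _)) (hc _)

lemma map_div_eq_C {N F : Type*} [Field N] [Field F] (Φ : N →+* HahnSeries ℤ F) {a b : N} {c d : F}
    (ha : Φ a = HahnSeries.single 1 c) (hb : Φ b = HahnSeries.single 1 d) (hd : d ≠ 0) :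
    Φ (a / b) = HahnSeries.C (c / d) := by
  rw [map_div₀, ha, hb, div_eq_iff (by simpa using hd), HahnSeries.C_apply,
    HahnSeries.single_mul_single, zero_add, div_mul_cancel₀ _ hd]

lemma sees_of_order {E : IntermediateField k K} {N F : Type*} [Field N] [Algebra E N] [Field F]
    {Φ : N →+* HahnSeries ℤ F} {j : separableClosure E K →ₐ[E] N} {f : KV ℓ K →ₗ[ZMod ℓ] ZMod ℓ}
    (hf : ∀ u : separableClosure E K, u ≠ 0 → f (cl ℓ (u : K)) = ((Φ (j u)).order : ZMod ℓ))
    (V : separableClosure E K) (A : k) (h1 : (Φ (j (V - algebraMap k _ A))).order = 1)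
    (h2 : ∀ b : k, b ≠ A → (Φ (j (V - algebraMap k _ b))).order = 0) : Sees k f (V : K) A := by
  have hne : ∀ b : k, b ≠ A → f (cl ℓ ((V : K) - algebraMap k K b)) = 0 := fun b hb => by
    by_cases hz : V - algebraMap k _ b = 0
    · have : (V : K) - algebraMap k K b = 0 := congrArg Subtype.val hz
      rw [this, cl_zero, map_zero]
    · have := hf _ hz
      rw [h2 b hb, Int.cast_zero] at this
      exact this
  refine ⟨?_, A + 1, hne _ (by simp)⟩
  have hz : V - algebraMap k _ A ≠ 0 := by
    intro hz; rw [hz] at h1; simp at h1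
  have := hf _ hz
  rw [h1] at this
  change f (cl ℓ ((V : K) - algebraMap k K A)) = _ at this
  rw [this]; simp

lemma exists_adm_of_point_arc [Fintype ι] [ExpChar k p] [IsAlgClosed k] (hF : PFG p k K)
    (hp : (p : ZMod ℓ) ≠ 0) {x : ι → K}
    (hx : IsTranscendenceBasis k x) {i₁ i₂ i₃ : ι} (h12 : i₁ ≠ i₂) (h13 : i₁ ≠ i₃) (h23 : i₂ ≠ i₃)
    {E : IntermediateField k K} (hE : adjoin k (Set.range x) = E) (xE : ι → E)
    (hxE : ∀ i, (xE i : K) = x i) {N : Type*} [Field N] [Algebra E N]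
    {F : IntermediateField E (AlgebraicClosure E)} [FiniteDimensional E F] (Φ : N →+* HahnSeries ℤ F)
    (hΦk : ∀ a : k, Φ (algebraMap E N (algebraMap k E a)) = HahnSeries.C (algebraMap k F a))
    (a : ι → k)
    (hΦx : ∀ i, Φ (algebraMap E N (xE i)) = HahnSeries.ofPowerSeries ℤ F
      (PowerSeries.C (algebraMap k F (a i)) + PowerSeries.X *
        PowerSeries.C (algebraMap E F (xE i) - algebraMap k F (a i))))
    (j : separableClosure E K →ₐ[E] N) : ∃ f : KV ℓ K →ₗ[ZMod ℓ] ZMod ℓ, Adm p k f ∧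
      ∀ u : separableClosure E K, u ≠ 0 → f (cl ℓ (u : K)) = ((Φ (j u)).order : ZMod ℓ) := by
  classical
  have hEK : Algebra.IsAlgebraic E K := hE ▸ hx.isAlgebraic_field
  have hx' : IsTranscendenceBasis k fun i => algebraMap E K (xE i) := by
    rwa [show (fun i => algebraMap E K (xE i)) = x from funext hxE]
  have hd : ∀ i, xE i - algebraMap k E (a i) ≠ 0 := fun i h => by
    have := sub_const_ne_zero (hx.1.transcendental i) (a i)
    rw [← hxE] at this
    exact this (congrArg Subtype.val h)
  have hΦd : ∀ i, Φ (algebraMap E N (xE i - algebraMap k E (a i))) =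
      HahnSeries.single 1 (algebraMap E F (xE i - algebraMap k E (a i))) := by
    intro i
    rw [map_sub, map_sub, hΦx, hΦk]
    simp [HahnSeries.ofPowerSeries_C, HahnSeries.ofPowerSeries_X, HahnSeries.C_apply, mul_sub,
      HahnSeries.single_mul_single, ← IsScalarTower.algebraMap_apply k E F]
  let y : ι → E := fun i => if i = i₁ then xE i₁ - algebraMap k E (a i₁) else
    (xE i - algebraMap k E (a i)) / (xE i₁ - algebraMap k E (a i₁))
  have hy : IsTranscendenceBasis k (fun i => (y i : K)) := isTranscendenceBasis_blowup (E := E) hx' a i₁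
  have hΦy : ∀ i, i ≠ i₁ → Φ (algebraMap E N (y i)) = HahnSeries.C (algebraMap E F (y i)) := by
    intro i hi
    simp only [y, if_neg hi]
    rw [map_div₀ (algebraMap E N), map_div₀ (algebraMap E F)]
    exact map_div_eq_C Φ (hΦd i) (hΦd i₁) ((map_ne_zero _).2 (hd i₁))
  have hlin : ∀ i, lin y (Pi.single i (1 : k)) = y i := fun i => by
    rw [lin, Finset.sum_eq_single i]
    · simp
    · intro m _ hm; simp [Pi.single_eq_of_ne hm]
    · simp
  exact exists_adm_of_arc (ℓ := ℓ) hF hp hE Φ hΦk hy (μ := Pi.single i₂ 1)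
    (ν := Pi.single i₃ 1) (LinearIndependent.pair_iff.2 fun s t hst => by
      have h2 := congrFun hst i₂
      have h3 := congrFun hst i₃
      simp [h23, h23.symm] at h2 h3
      exact ⟨h2, h3⟩) (by rw [hlin]; exact hΦy _ h12.symm) (by rw [hlin]; exact hΦy _ h13.symm)
    (hd i₁) (by
      rw [hΦd, HahnSeries.order_single]
      · simp
      · exact (map_ne_zero _).2 (hd i₁)) j

set_option maxHeartbeats 1000000 in
/-- Admissible functionals attached to a general point of affine space. -/
theorem exists_adm_point [Fintype ι] [ExpChar k p] [IsAlgClosed k] (hF : PFG p k K)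
    (hp : (p : ZMod ℓ) ≠ 0) (hperf : ∀ y : K, ∃ z, z ^ p = y) {x : ι → K}
    (hx : IsTranscendenceBasis k x) {i₁ i₂ i₃ : ι} (h12 : i₁ ≠ i₂) (h13 : i₁ ≠ i₃) (h23 : i₂ ≠ i₃)
    {E : IntermediateField k K} (hE : adjoin k (Set.range x) = E) {N : Type*} [Field N] [Algebra E N]
    [FiniteDimensional E N] [Algebra.IsSeparable E N] (SN : Finset N) (SK : Finset K)
    (hSK : ∀ u ∈ SK, Transcendental k u) :
    ∃ h : MvPolynomial ι k, h ≠ 0 ∧ ∀ a : ι → k, eval a h ≠ 0 →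
      ∃ F : IntermediateField E (AlgebraicClosure E), ∃ Φ : N →+* HahnSeries ℤ F,
        (∀ a : k, Φ (algebraMap E N (algebraMap k E a)) = HahnSeries.C (algebraMap k F a)) ∧
        (∀ s ∈ SN, ∃ w : PowerSeries F, Φ s = HahnSeries.ofPowerSeries ℤ F w) ∧
        ∀ j : separableClosure E K →ₐ[E] N, ∃ f : KV ℓ K →ₗ[ZMod ℓ] ZMod ℓ, Adm p k f ∧
          (∀ u : separableClosure E K, u ≠ 0 → f (cl ℓ (u : K)) = ((Φ (j u)).order : ZMod ℓ)) ∧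
          (∀ i, Sees k f (x i) (a i)) ∧ ∀ u ∈ SK, ∃ b : k, Sees k f u b := by
  classical
  have hEK : Algebra.IsAlgebraic E K := hE ▸ hx.isAlgebraic_field
  have := hF.finiteDimensional_separableClosure E
  have hxE : ∀ i, x i ∈ E := fun i => hE ▸ subset_adjoin _ _ ⟨i, rfl⟩
  let M := separableClosure E K
  have hkMK : IsScalarTower k M K := IsScalarTower.of_algebraMap_eq fun _ => rfl
  have hkEM : IsScalarTower k E M := IsScalarTower.of_algebraMap_eq fun _ => rfl
  let xE : ι → E := fun i => ⟨x i, hxE i⟩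
  let xM : ι → M := fun i => algebraMap E M (xE i)
  choose U hU P hP h0 i hi using fun u : SK => exists_separable_relation hperf hx (hSK u u.2)
  have hUM : ∀ u, U u ∈ M := fun u => mem_separableClosure_of_relation hxE (hP u) (h0 u)
  let UM : SK → M := fun u => ⟨U u, hUM u⟩
  have hcoe : ∀ (u : SK) (Q : MvPolynomial (Option ι) k),
      ((aeval (fun o : Option ι => o.elim (UM u) xM) Q : M) : K) =
        aeval (fun o : Option ι => o.elim (U u) x) Q := by
    intro u Q
    change IsScalarTower.toAlgHom k M K _ = _
    rw [← AlgHom.comp_apply, comp_aeval]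
    congr 2
    funext o
    cases o <;> rfl
  have hPM : ∀ u, aeval (fun o : Option ι => o.elim (UM u) xM) (P u) = 0 := fun u => by
    apply Subtype.ext; rw [hcoe, hP]; rfl
  have h0M : ∀ u, aeval (fun o : Option ι => o.elim (UM u) xM) (pderiv none (P u)) ≠ 0 := fun u h => by
    apply h0 u; rw [← hcoe, h]; rfl
  have hiM : ∀ u, aeval (fun o : Option ι => o.elim (UM u) xM) (pderiv (some (i u)) (P u)) ≠ 0 :=
    fun u h => by apply hi u; rw [← hcoe, h]; rfl
  have hfin : Finite (M →ₐ[E] N) := inferInstance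
  have := Fintype.ofFinite (M →ₐ[E] N)
  let S : Finset N := SN ∪ (Finset.univ : Finset (SK × (M →ₐ[E] N))).biUnion fun q =>
    {q.2 (UM q.1), q.2 (aeval (fun o : Option ι => o.elim (UM q.1) xM) (pderiv none (P q.1)))⁻¹,
      q.2 (aeval (fun o : Option ι => o.elim (UM q.1) xM) (pderiv (some (i q.1)) (P q.1)))⁻¹}
  obtain ⟨h, hne, H⟩ := exists_arc hx.1 hE S
  refine ⟨h, hne, fun a ha => ?_⟩
  let ξ : ι → Polynomial E := fun i => Polynomial.C (algebraMap k E (a i)) +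
    Polynomial.X * Polynomial.C (xE i - algebraMap k E (a i))
  obtain ⟨F, hFfin, Φ, hΦk, hΦx, hΦS⟩ := H ξ (fun i => by simp [ξ, xE]) (by
    have : (fun i => (ξ i).eval 0) = fun i => algebraMap k E (a i) := by ext i; simp [ξ]
    rw [this]
    have e : aeval (fun i => algebraMap k E (a i)) h = algebraMap k E (eval a h) :=
      aeval_algebraMap_apply E a h
    rw [e]
    exact (map_ne_zero _).2 ha)
  have hΦx : ∀ i, Φ (algebraMap E N (xE i)) = HahnSeries.ofPowerSeries ℤ F
      (PowerSeries.C (algebraMap k F (a i)) + PowerSeries.X *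
        PowerSeries.C (algebraMap E F (xE i) - algebraMap k F (a i))) := by
    intro i
    rw [hΦx i (xE i) rfl]
    simp [ξ, ← IsScalarTower.algebraMap_apply k E F]
  have hxEb : IsTranscendenceBasis k xE := IsTranscendenceBasis.of_comp_algebraMap (A' := K) hx
  have : FaithfulSMul E F := (faithfulSMul_iff_algebraMap_injective E F).2 (algebraMap E F).injective
  have hxFb : IsTranscendenceBasis k (algebraMap E F ∘ xE) := hxEb.algebraMap_comp
  have hyF := sum_mul_sub_ne_zero hxFb a
  refine ⟨F, Φ, hΦk, fun s hs => hΦS s (Finset.mem_union_left _ hs), fun j => ?_⟩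
  have hj : ∀ e : E, j (algebraMap E _ e) = algebraMap E N e := fun e => j.commutes e
  obtain ⟨f, hfA, hf⟩ := exists_adm_of_point_arc hF hp hx h12 h13 h23 hE xE (fun _ => rfl) Φ hΦk a
    hΦx j
  have hΨk : ∀ b : k, (Φ.comp j.toRingHom) (algebraMap k M b) = HahnSeries.C (algebraMap k F b) :=
    fun b => by rw [← hΦk, ← hj]; rfl
  have hsees := sees_of_order hf
  refine ⟨f, hfA, hf, fun i => ?_, fun u hu => ?_⟩
  · obtain ⟨h1, h2⟩ := order_sub_const hΨk (U := xM i) (by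
      change Φ (j _) = _; rw [hj]; exact hΦx i) (A := a i) (constantCoeff_C_add_X_mul _ _)
    refine hsees (xM i) (a i) (h1 ?_) h2
    rw [coeff_one_C_add_X_mul]
    exact sub_const_ne_zero (hxFb.1.transcendental i) (a i)
  · have hS : ∀ s ∈ ({j (UM ⟨u, hu⟩), j (aeval (fun o : Option ι => o.elim (UM ⟨u, hu⟩) xM)
          (pderiv none (P ⟨u, hu⟩)))⁻¹, j (aeval (fun o : Option ι => o.elim (UM ⟨u, hu⟩) xM)
          (pderiv (some (i ⟨u, hu⟩)) (P ⟨u, hu⟩)))⁻¹} : Finset N), ∃ w, Φ s =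
          HahnSeries.ofPowerSeries ℤ F w := fun s hs =>
      hΦS s (Finset.mem_union_right _ (Finset.mem_biUnion.2 ⟨(⟨u, hu⟩, j), Finset.mem_univ _, hs⟩))
    obtain ⟨A, h1, h2⟩ := exists_order_sub_const hΨk hyF (x := xM) (fun i => by
      change Φ (j _) = _; rw [hj]; exact hΦx i) (hPM ⟨u, hu⟩) (h0M ⟨u, hu⟩) (hiM ⟨u, hu⟩)
      (hS _ (Finset.mem_insert_self _ _))
      (hS _ (Finset.mem_insert_of_mem (Finset.mem_insert_self _ _)))
      (hS _ (Finset.mem_insert_of_mem (Finset.mem_insert_of_mem (Finset.mem_singleton_self _))))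
    obtain ⟨m, n, hmn⟩ := hU ⟨u, hu⟩
    obtain ⟨b, hb⟩ := IsAlgClosed.exists_pow_nat_eq (A ^ p ^ n) (pow_pos (expChar_pos k p) m)
    exact ⟨b, Sees.of_pow_eq hp hmn hb.symm (hsees (UM ⟨u, hu⟩) A h1 h2)⟩

end Master
end MilnorRec

namespace MilnorRec
open IntermediateField MvPolynomial

section Res
variable {k K : Type*} [Field k] [Field K] [Algebra k K]

/-- The residue of `u` at the place `O` is the constant `a`. -/
def Res (O : ValuationSubring K) (u : K) (a : k) : Prop :=
  O.valuation (u - algebraMap k K a) < 1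

variable {ℓ : ℕ} [Fact ℓ.Prime] {f : KV ℓ K →ₗ[ZMod ℓ] ZMod ℓ} {O : ValuationSubring K}

lemma Res.val_le (h : Compat k f O) {u : K} {a : k} (hu : Res O u a) : O.valuation u ≤ 1 := by
  have : u = (u - algebraMap k K a) + algebraMap k K a := by ring
  rw [this]
  exact (O.valuation.map_add _ _).trans (max_le hu.le (h.val_const_le a))

lemma Res.add {u v : K} {a b : k} (hu : Res O u a) (hv : Res O v b) : Res O (u + v) (a + b) := by
  have : u + v - algebraMap k K (a + b) = (u - algebraMap k K a) + (v - algebraMap k K b) := by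
    rw [map_add]; ring
  rw [Res, this]
  exact Valuation.map_add_lt _ hu hv

lemma Res.const (a : k) : Res O (algebraMap k K a) a := by simp [Res]

lemma Res.mul (h : Compat k f O) {u v : K} {a b : k} (hu : Res O u a) (hv : Res O v b) :
    Res O (u * v) (a * b) := by
  have : u * v - algebraMap k K (a * b) =
      (u - algebraMap k K a) * v + algebraMap k K a * (v - algebraMap k K b) := by
    rw [map_mul]; ring
  rw [Res, this]
  refine Valuation.map_add_lt _ ?_ ?_ <;> rw [map_mul]
  · exact (mul_le_of_le_one_right zero_le (hv.val_le h)).trans_lt hu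
  · exact (mul_le_of_le_one_left zero_le (h.val_const_le a)).trans_lt hv

lemma Res.neg (h : Compat k f O) {u : K} {a : k} (hu : Res O u a) : Res O (-u) (-a) := by
  simpa using (Res.const (O := O) (-1 : k)).mul h hu

lemma Res.sub (h : Compat k f O) {u v : K} {a b : k} (hu : Res O u a) (hv : Res O v b) :
    Res O (u - v) (a - b) := by
  simpa [sub_eq_add_neg] using hu.add (hv.neg h)

lemma Res.pow (h : Compat k f O) {u : K} {a : k} (hu : Res O u a) (n : ℕ) :
    Res O (u ^ n) (a ^ n) := by
  induction n with
  | zero => simpa using Res.const (O := O) (1 : k)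
  | succ n ih => simpa [pow_succ] using ih.mul h hu

lemma Res.unique (h : Compat k f O) {u : K} {a b : k} (hu : Res O u a) (hv : Res O u b) : a = b :=
  (h.unique hu hv).symm

lemma Res.val_eq_one (h : Compat k f O) {u : K} {a : k} (hu : Res O u a) (ha : a ≠ 0) :
    O.valuation u = 1 := by
  simpa using h.val_sub_sub ha.symm hu

lemma Res.inv (h : Compat k f O) {u : K} {a : k} (hu : Res O u a) (ha : a ≠ 0) :
    Res O u⁻¹ a⁻¹ := by
  have h1 := hu.val_eq_one h ha
  have hu0 : u ≠ 0 := by rintro rfl; simp at h1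
  have ha' : algebraMap k K a ≠ 0 := (map_ne_zero _).2 ha
  have : u⁻¹ - algebraMap k K a⁻¹ = -(u - algebraMap k K a) * (u⁻¹ * algebraMap k K a⁻¹) := by
    rw [map_inv₀]; field_simp; ring
  rw [Res, this, map_mul, map_mul, map_inv₀, h1, h.val_const (inv_ne_zero ha), Valuation.map_neg]
  simpa [Res] using hu

lemma Res.aeval (h : Compat k f O) {ι : Type*} {x : ι → K} {a : ι → k}
    (hx : ∀ i, Res O (x i) (a i)) (P : MvPolynomial ι k) :
    Res O (MvPolynomial.aeval x P) (eval a P) := by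
  induction P using MvPolynomial.induction_on with
  | C c => simpa [algHom_C] using Res.const (O := O) c
  | add P Q hP hQ => simpa using hP.add hQ
  | mul_X P i hP => simpa using hP.mul h (hx i)

lemma Sees.res (h : Compat k f O) {u : K} {a : k} (hs : Sees k f u a) : Res O u a :=
  h.lt_of_sees hs

end Res

section Setup
variable (p ℓ : ℕ) (k K : Type*) [Field k] [Field K] [Algebra k K]

/-- Perfect closures of function fields of transcendence degree at least `d`. -/
structure Setup (d : ℕ) : Prop where
  pfg : PFG p k K
  ne_zero : (p : ZMod ℓ) ≠ 0
  perf : ∀ y : K, ∃ z, z ^ p = y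
  basis : ∃ n, d ≤ n ∧ ∃ x : Fin n → K, IsTranscendenceBasis k x

variable {p ℓ k K} {d : ℕ}

lemma Setup.mono {e : ℕ} (h : Setup p ℓ k K d) (he : e ≤ d) : Setup p ℓ k K e :=
  ⟨h.pfg, h.ne_zero, h.perf, let ⟨n, hn, hx⟩ := h.basis; ⟨n, he.trans hn, hx⟩⟩

lemma exists_three [Finite ι] (h : 3 ≤ Nat.card ι) : ∃ i j m : ι, i ≠ j ∧ i ≠ m ∧ j ≠ m := by
  have := Fintype.ofFinite ι
  rw [Nat.card_eq_fintype_card] at h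
  obtain ⟨a, b, c, h1, h2, h3⟩ := Fintype.two_lt_card_iff.1 h
  exact ⟨a, b, c, h1, h2, h3⟩

variable {ι : Type*}

lemma exists_eval_ne_zero [Infinite k] {h : MvPolynomial ι k} (hh : h ≠ 0) :
    ∃ a, eval a h ≠ 0 := by
  by_contra! H
  exact hh (MvPolynomial.funext fun a => by rw [H a, map_zero])

variable [Fact ℓ.Prime] [ExpChar k p] [IsAlgClosed k]

lemma Setup.exists_adm_sees_basis (H : Setup p ℓ k K d) [Fintype ι] (hι : 3 ≤ Nat.card ι)
    {x : ι → K} (hx : IsTranscendenceBasis k x) (S : Finset K) (hS : ∀ u ∈ S, Transcendental k u) :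
    ∃ h : MvPolynomial ι k, h ≠ 0 ∧ ∀ a : ι → k, eval a h ≠ 0 →
      ∃ f : KV ℓ K →ₗ[ZMod ℓ] ZMod ℓ, Adm p k f ∧ (∀ i, Sees k f (x i) (a i)) ∧
        ∀ u ∈ S, ∃ b : k, Sees k f u b := by
  obtain ⟨i₁, i₂, i₃, h12, h13, h23⟩ := exists_three hι
  have hEK : Algebra.IsAlgebraic (adjoin k (Set.range x)) K := hx.isAlgebraic_field
  have := H.pfg.finiteDimensional_separableClosure (adjoin k (Set.range x))
  obtain ⟨h, h0, hh⟩ := exists_adm_point (ℓ := ℓ) H.pfg H.ne_zero H.perf hx h12 h13 h23 rfl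
    (N := separableClosure (adjoin k (Set.range x)) K) ∅ S hS
  refine ⟨h, h0, fun a ha => ?_⟩
  obtain ⟨F, Φ, -, -, hj⟩ := hh a ha
  obtain ⟨f, h1, -, h2, h3⟩ := hj (AlgHom.id _ _)
  exact ⟨f, h1, h2, h3⟩

lemma Setup.exists_adm_sees (H : Setup p ℓ k K 3) (S : Finset K)
    (hS : ∀ u ∈ S, Transcendental k u) :
    ∃ f : KV ℓ K →ₗ[ZMod ℓ] ZMod ℓ, Adm p k f ∧ ∀ u ∈ S, ∃ b : k, Sees k f u b := by
  obtain ⟨n, hn, x, hx⟩ := H.basis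
  obtain ⟨h, h0, hh⟩ := H.exists_adm_sees_basis (by simpa) hx S hS
  obtain ⟨a, ha⟩ := exists_eval_ne_zero h0
  obtain ⟨f, h1, -, h3⟩ := hh a ha
  exact ⟨f, h1, h3⟩

end Setup

section Conjugates
variable {E K : Type*} [Field E] [Field K] [Algebra E K]

lemma exists_two_embeddings (M : Type*) [Field M] [Algebra E M] [FiniteDimensional E M]
    [Algebra.IsSeparable E M] (w : M) (hw : ∀ e : E, algebraMap E M e ≠ w) :
    ∃ N : IntermediateField E (AlgebraicClosure E), FiniteDimensional E N ∧
      Algebra.IsSeparable E N ∧ ∃ j₁ j₂ : M →ₐ[E] N, j₁ w ≠ j₂ w := by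
  let N := normalClosure E M (AlgebraicClosure E)
  have hle : N ≤ separableClosure E (AlgebraicClosure E) :=
    normalClosure_le_iff.2 fun i => by
      have : Algebra.IsSeparable E i.fieldRange :=
        AlgEquiv.Algebra.isSeparable (AlgEquiv.ofInjectiveField i)
      exact le_separableClosure E _ _
  have hsep : Algebra.IsSeparable E N := (le_separableClosure_iff _ _ _).1 hle
  have hfin : FiniteDimensional E N := inferInstance
  have hnor : Normal E N := inferInstance
  have hgal : IsGalois E N := ⟨⟩
  let i0 : M →ₐ[E] AlgebraicClosure E := IsAlgClosed.lift
  let i : M →ₐ[E] N := i0.codRestrict N.toSubalgebra fun x =>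
    AlgHom.fieldRange_le_normalClosure i0 ⟨x, rfl⟩
  by_contra! Hn
  have hall : ∀ j₁ j₂ : M →ₐ[E] N, j₁ w = j₂ w := Hn N hfin hsep
  have : i w ∈ (⊥ : IntermediateField E N) := (IsGalois.mem_bot_iff_fixed _).2 fun g =>
    hall (g.toAlgHom.comp i) i
  obtain ⟨e, he⟩ := IntermediateField.mem_bot.1 this
  refine hw e (i.injective ?_)
  exact (i.commutes e).trans he

end Conjugates
end MilnorRec

namespace MilnorRec
open IntermediateField MvPolynomial

section Determined
variable {p ℓ : ℕ} {k K : Type*} [Field k] [Field K] [Algebra k K] {d : ℕ} {ι : Type*}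

lemma constantCoeff_eq_of_order_ne_zero {F : Type*} [Field F] {w : PowerSeries F}
    (h : (HahnSeries.ofPowerSeries ℤ F w).order ≠ 0) : PowerSeries.constantCoeff w = 0 := by
  by_contra hc
  exact h (order_ofPowerSeries_eq_zero hc)

variable [Fact ℓ.Prime] [ExpChar k p] [IsAlgClosed k]

lemma Sees.pow (hp : (p : ZMod ℓ) ≠ 0) {f : KV ℓ K →ₗ[ZMod ℓ] ZMod ℓ} {u : K} {a : k}
    (hs : Sees k f u a) (n : ℕ) : Sees k f (u ^ p ^ n) (a ^ p ^ n) :=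
  hs.of_pow_eq (u := u ^ p ^ n) hp (m := 0) (n := n) (by simp) (by simp)

/-- A function whose values are determined by those of a transcendence basis is rational in
the basis, up to Frobenius. -/
theorem Setup.rational_of_determined (H : Setup p ℓ k K d) [Fintype ι] (hι : 3 ≤ Nat.card ι)
    {x : ι → K} (hx : IsTranscendenceBasis k x) {W : K} (hW : Transcendental k W)
    (g : (ι → k) → k)
    (hg : ∀ f : KV ℓ K →ₗ[ZMod ℓ] ZMod ℓ, Adm p k f → ∀ a b, (∀ i, Sees k f (x i) (a i)) →
      Sees k f W b → b = g a) :
    ∃ (n : ℕ) (A B : MvPolynomial ι k), aeval x B ≠ 0 ∧ W ^ p ^ n * aeval x B = aeval x A ∧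
      ∀ a, g a ^ p ^ n * eval a B = eval a A := by
  classical
  obtain ⟨h, h0, hh⟩ := H.exists_adm_sees_basis hι hx {W} (by simpa using hW)
  have hinj : Function.Injective (aeval x : MvPolynomial ι k →ₐ[k] K) :=
    algebraicIndependent_iff_injective_aeval.1 hx.1
  have key : ∃ n, W ^ p ^ n ∈ adjoin k (Set.range x) := by
    set E := adjoin k (Set.range x) with hE
    have hEK : Algebra.IsAlgebraic E K := hx.isAlgebraic_field
    have := H.pfg.finiteDimensional_separableClosure E
    have hEp : ExpChar E p := expChar_of_injective_algebraMap (algebraMap k E).injective p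
    obtain ⟨n, w, hw⟩ := IsPurelyInseparable.pow_mem (separableClosure E K) p W
    by_cases hwE : ∀ e : E, algebraMap E (separableClosure E K) e ≠ w
    · exfalso
      obtain ⟨N, hN1, hN2, j₁, j₂, hj⟩ := exists_two_embeddings _ w hwE
      obtain ⟨i₁, i₂, i₃, h12, h13, h23⟩ := exists_three hι
      obtain ⟨h', h0', H'⟩ := exists_adm_point (ℓ := ℓ) H.pfg H.ne_zero H.perf hx h12 h13 h23
        hE.symm (N := N) {j₁ w, j₂ w, (j₁ w - j₂ w)⁻¹} {W} (by simpa using hW)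
      obtain ⟨a, ha⟩ := exists_eval_ne_zero h0'
      obtain ⟨F, Φ, hΦk, hΦS, hΦj⟩ := H' a ha
      obtain ⟨w₁, hw₁⟩ := hΦS (j₁ w) (Finset.mem_insert_self _ _)
      obtain ⟨w₂, hw₂⟩ := hΦS (j₂ w) (Finset.mem_insert_of_mem (Finset.mem_insert_self _ _))
      obtain ⟨w₃, hw₃⟩ := hΦS (j₁ w - j₂ w)⁻¹
        (Finset.mem_insert_of_mem (Finset.mem_insert_of_mem (Finset.mem_singleton_self _)))
      have hcc : ∀ (j : separableClosure E K →ₐ[E] N) (v : PowerSeries F),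
          Φ (j w) = HahnSeries.ofPowerSeries ℤ F v →
          PowerSeries.constantCoeff v = algebraMap k F (g a ^ p ^ n) := by
        intro j v hv
        obtain ⟨f, hf, hord, hsx, hsW⟩ := hΦj j
        obtain ⟨b, hb⟩ := hsW W (Finset.mem_singleton_self _)
        have hb' := (hb.pow H.ne_zero n).1
        rw [hg f hf a b hsx hb] at hb'
        set A : k := g a ^ p ^ n
        have hcoe : ((w - algebraMap k (separableClosure E K) A : separableClosure E K) : K) =
            W ^ p ^ n - algebraMap k K A := congrArg (· - algebraMap k K A) hw
        have hne : w - algebraMap k (separableClosure E K) A ≠ 0 := by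
          intro hz
          rw [← hcoe, hz] at hb'
          exact hb' (by rw [ZeroMemClass.coe_zero, cl_zero, map_zero])
        have h1 := hord _ hne
        rw [hcoe] at h1
        have h2 : (Φ (j (w - algebraMap k (separableClosure E K) A))).order ≠ 0 := by
          intro h2; rw [h2, Int.cast_zero] at h1; exact hb' h1
        have hjA : j (algebraMap k (separableClosure E K) A) = algebraMap E N (algebraMap k E A) :=
          j.commutes (algebraMap k E A)
        rw [map_sub, map_sub, hv, hjA, hΦk, ← HahnSeries.ofPowerSeries_C, ← map_sub] at h2
        have := constantCoeff_eq_of_order_ne_zero h2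
        rw [map_sub, PowerSeries.constantCoeff_C, sub_eq_zero] at this
        exact this
      have h1 := hcc j₁ w₁ hw₁
      have h2 := hcc j₂ w₂ hw₂
      have h3 : (w₁ - w₂) * w₃ = 1 := by
        apply HahnSeries.ofPowerSeries_injective (Γ := ℤ)
        rw [map_mul, map_sub, ← hw₁, ← hw₂, ← hw₃, ← map_sub, ← map_mul,
          mul_inv_cancel₀ (sub_ne_zero.2 hj), map_one, map_one]
      have h4 := congrArg PowerSeries.constantCoeff h3
      rw [map_mul, map_sub, h1, h2, sub_self, zero_mul, map_one] at h4
      exact zero_ne_one h4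
    · push Not at hwE
      obtain ⟨e, he⟩ := hwE
      refine ⟨n, ?_⟩
      have : W ^ p ^ n = (e : K) := by
        rw [← hw, ← he]; rfl
      rw [this]; exact e.2
  obtain ⟨n, hn⟩ := key
  have hAB : ∃ A B : MvPolynomial ι k, aeval x B ≠ 0 ∧ W ^ p ^ n * aeval x B = aeval x A := by
    obtain ⟨r, s, hrs⟩ := (mem_adjoin_range_iff k x _).1 hn
    by_cases hs : aeval x s = 0
    · refine ⟨0, 1, by simp, ?_⟩
      rw [hrs, hs]; simp
    · exact ⟨r, s, hs, by rw [hrs, div_mul_cancel₀ _ hs]⟩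
  obtain ⟨A, B, hB, hAB⟩ := hAB
  refine ⟨n, A * h, B * h, ?_, ?_, fun a => ?_⟩
  · rw [map_mul]
    exact mul_ne_zero hB fun hz => h0 (hinj (by rw [hz, map_zero]))
  · rw [map_mul, map_mul, ← mul_assoc, hAB]
  · by_cases ha : eval a h = 0
    · simp [ha]
    obtain ⟨f, hf, hsx, hsW⟩ := hh a ha
    obtain ⟨b, hb⟩ := hsW W (Finset.mem_singleton_self _)
    obtain ⟨O, hO⟩ := hf.exists_compat H.ne_zero
    have hr : ∀ P, Res O (aeval x P) (eval a P) := Res.aeval hO fun i => (hsx i).res hO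
    have h1 := ((hb.res hO).pow hO (p ^ n)).mul hO (hr B)
    rw [hAB] at h1
    have := Res.unique hO h1 (hr A)
    rw [hg f hf a b hsx hb] at this
    rw [map_mul, map_mul, ← mul_assoc, this]

end Determined
end MilnorRec

namespace MilnorRec
open IntermediateField MvPolynomial

section PolyLemma
variable {p ℓ : ℕ} {k K : Type*} [Field k] [Field K] [Algebra k K] {d : ℕ} {ι : Type*}

lemma Setup.card_basis (H : Setup p ℓ k K d) {x : ι → K} (hx : IsTranscendenceBasis k x) :
    Finite ι ∧ d ≤ Nat.card ι := by
  obtain ⟨n, hn, y, hy⟩ := H.basis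
  have h := hx.lift_cardinalMk_eq hy
  have h' : Cardinal.mk ι = n := by simpa using h
  have hfin : Finite ι := by
    rw [← Cardinal.mk_lt_aleph0_iff, h']; exact Cardinal.natCast_lt_aleph0
  refine ⟨hfin, ?_⟩
  rw [Nat.card, h', Cardinal.toNat_natCast]; exact hn

variable [IsAlgClosed k]

lemma exists_const_of_isAlgebraic {u : K} (hu : ¬ Transcendental k u) :
    ∃ a, u = algebraMap k K a := by
  obtain ⟨a, ha⟩ := mem_range_algebraMap_of_isAlgebraic (not_not.1 hu)
  exact ⟨a, ha.symm⟩

variable [Fact ℓ.Prime] [ExpChar k p]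

lemma Setup.eq_zero_of_res (H : Setup p ℓ k K 3) (S : Finset K) (hS : ∀ u ∈ S, Transcendental k u)
    {D : K} (h : ∀ f : KV ℓ K →ₗ[ZMod ℓ] ZMod ℓ, Adm p k f → (∀ u ∈ S, ∃ b, Sees k f u b) →
      ∀ O, Compat k f O → Res O D (0 : k)) : D = 0 := by
  classical
  by_contra hD
  by_cases hDt : Transcendental k D
  · have hDi : Transcendental k D⁻¹ := fun h => hDt (by simpa using h.inv)
    obtain ⟨f, hf, hs⟩ := H.exists_adm_sees (insert D⁻¹ S) (by
      simpa [hDi] using hS)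
    obtain ⟨O, hO⟩ := hf.exists_compat H.ne_zero
    obtain ⟨b, hb⟩ := hs D⁻¹ (Finset.mem_insert_self _ _)
    have h1 := (h f hf (fun u hu => hs u (Finset.mem_insert_of_mem hu)) O hO).mul hO (hb.res hO)
    rw [mul_inv_cancel₀ hD, zero_mul] at h1
    have := Res.unique hO h1 (by simpa using Res.const (O := O) (1 : k))
    exact zero_ne_one this
  · obtain ⟨c, rfl⟩ := exists_const_of_isAlgebraic hDt
    obtain ⟨f, hf, hs⟩ := H.exists_adm_sees S hS
    obtain ⟨O, hO⟩ := hf.exists_compat H.ne_zero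
    have := Res.unique hO (h f hf hs O hO) (Res.const c)
    rw [← this, map_zero] at hD
    exact hD rfl

lemma exists_eq_C_of_isRelPrime [Finite ι] {A B : MvPolynomial ι k}
    (hAB : IsRelPrime A B) (h : ∀ a, eval a B = 0 → eval a A = 0) : ∃ c : k, c ≠ 0 ∧ B = C c := by
  have hmem : A ∈ (Ideal.span {B}).radical := by
    rw [← vanishingIdeal_zeroLocus_eq_radical (K := k) (Ideal.span {B})]
    intro a ha
    have := (mem_zeroLocus_iff.1 ha) B (Ideal.mem_span_singleton_self B)
    exact h a this
  obtain ⟨n, hn⟩ := hmem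
  have hdvd : B ∣ A ^ n := Ideal.mem_span_singleton.1 hn
  have hu : IsUnit B := (hAB.pow_left (m := n)) hdvd dvd_rfl
  obtain ⟨c, hc, hcB⟩ := MvPolynomial.isUnit_iff_eq_C_of_isReduced.1 hu
  exact ⟨c, hc.ne_zero, hcB⟩

/-- A function determined by algebraically independent elements, all of whose values are attained,
is a polynomial up to Frobenius. -/
theorem Setup.polynomial_of_determined (H : Setup p ℓ k K 3) [Finite ι] {y : ι → K}
    (hy : AlgebraicIndependent k y) {W : K} (hW : Transcendental k W) (g : (ι → k) → k)
    (hg : ∀ f : KV ℓ K →ₗ[ZMod ℓ] ZMod ℓ, Adm p k f → ∀ a b, (∀ i, Sees k f (y i) (a i)) →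
      Sees k f W b → b = g a)
    (hg' : ∀ a, ∃ f : KV ℓ K →ₗ[ZMod ℓ] ZMod ℓ, Adm p k f ∧ (∀ i, Sees k f (y i) (a i)) ∧
      Sees k f W (g a)) :
    ∃ (n : ℕ) (R : MvPolynomial ι k), W ^ p ^ n = aeval y R ∧ ∀ a, g a ^ p ^ n = eval a R := by
  classical
  obtain ⟨t, hyt, ht⟩ := exists_isTranscendenceBasis_superset hy.to_subtype_range
  obtain ⟨hfin, hcard⟩ := H.card_basis ht
  have := Fintype.ofFinite t
  let e : ι → t := fun i => ⟨y i, hyt ⟨i, rfl⟩⟩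
  have he : Function.Injective e := fun i j hij => hy.injective (congrArg Subtype.val hij)
  obtain ⟨n, A, B, hB, -, hAB⟩ := H.rational_of_determined hcard ht hW (fun a => g (a ∘ e))
    (fun f hf a b hs hb => hg f hf (a ∘ e) b (fun i => hs (e i)) hb)
  have hB0 : B ≠ 0 := by rintro rfl; simp at hB
  obtain ⟨a₀, ha₀⟩ := exists_eval_ne_zero hB0
  let s : MvPolynomial t k →ₐ[k] MvPolynomial ι k :=
    aeval fun z => if h : ∃ i, e i = z then X h.choose else C (a₀ z)
  have hs : ∀ a P, eval a (s P) = eval (fun z => if h : ∃ i, e i = z then a h.choose else a₀ z) P := by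
    intro a P
    simp only [s]
    induction P using MvPolynomial.induction_on with
    | C c => simp
    | add P Q hP hQ => rw [map_add, map_add, hP, hQ, map_add]
    | mul_X P z hP =>
      rw [map_mul, map_mul, hP, map_mul, aeval_X, eval_X]
      split <;> simp
  have hse : ∀ a : ι → k, (fun z => if h : ∃ i, e i = z then a h.choose else a₀ z) ∘ e = a := by
    intro a
    funext i
    have h : ∃ j, e j = e i := ⟨i, rfl⟩
    simp only [Function.comp_apply, dif_pos h, he h.choose_spec]
  have hsB : s B ≠ 0 := by
    intro h0
    have := hs (a₀ ∘ e) B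
    rw [h0, map_zero] at this
    apply ha₀
    rw [this]
    congr 2
    funext z
    split
    · next h => exact (congrArg a₀ h.choose_spec).symm
    · rfl
  have hAB' : ∀ a, g a ^ p ^ n * eval a (s B) = eval a (s A) := fun a => by
    rw [hs, hs, ← hAB, hse]
  have hinj : Function.Injective (aeval y : MvPolynomial ι k →ₐ[k] K) :=
    algebraicIndependent_iff_injective_aeval.1 hy
  have := Fintype.ofFinite ι
  have hrel : ∀ (A B : MvPolynomial ι k), (∀ a, g a ^ p ^ n * eval a B = eval a A) →
      W ^ p ^ n * aeval y B = aeval y A := by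
    intro A B hAB
    refine sub_eq_zero.1 (H.eq_zero_of_res (insert W (Finset.univ.image y)) ?_ ?_)
    · intro u hu
      rcases Finset.mem_insert.1 hu with rfl | hu
      · exact hW
      · obtain ⟨i, -, rfl⟩ := Finset.mem_image.1 hu
        exact hy.transcendental i
    · intro f hf hs O hO
      choose a ha using fun i => hs (y i) (Finset.mem_insert_of_mem
        (Finset.mem_image_of_mem _ (Finset.mem_univ i)))
      obtain ⟨b, hb⟩ := hs W (Finset.mem_insert_self _ _)
      have hr : ∀ P, Res O (aeval y P) (eval a P) := Res.aeval hO fun i => (ha i).res hO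
      have := (((hb.res hO).pow hO (p ^ n)).mul hO (hr B)).sub hO (hr A)
      rwa [hg f hf a b ha hb, hAB, sub_self] at this
  obtain ⟨B₁, A₁, G, hrp, hGB, hGA⟩ :=
    UniqueFactorizationMonoid.exists_reduced_factors (s B) hsB (s A)
  have hG : G ≠ 0 := by rintro rfl; exact hsB (by rw [← hGB, zero_mul])
  have h1 : W ^ p ^ n * aeval y B₁ = aeval y A₁ := by
    have := hrel _ _ hAB'
    rw [← hGB, ← hGA, map_mul, map_mul, mul_left_comm] at this
    exact mul_left_cancel₀ (fun h0 => hG (hinj (by rw [h0, map_zero]))) this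
  have h2 : ∀ a, g a ^ p ^ n * eval a B₁ = eval a A₁ := by
    intro a
    obtain ⟨f, hf, hsy, hsW⟩ := hg' a
    obtain ⟨O, hO⟩ := hf.exists_compat H.ne_zero
    have hr : ∀ P, Res O (aeval y P) (eval a P) := Res.aeval hO fun i => (hsy i).res hO
    have := ((hsW.res hO).pow hO (p ^ n)).mul hO (hr B₁)
    rw [h1] at this
    exact Res.unique hO this (hr A₁)
  have hB₁ : B₁ ≠ 0 := by rintro rfl; exact hsB (by rw [← hGB, mul_zero])
  obtain ⟨c, hc, rfl⟩ := exists_eq_C_of_isRelPrime hrp.symm fun a ha => by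
    rw [← h2, ha, mul_zero]
  refine ⟨n, C c⁻¹ * A₁, ?_, fun a => ?_⟩
  · rw [map_mul, ← h1, mul_left_comm, ← map_mul, ← C_mul, inv_mul_cancel₀ hc]; simp
  · rw [map_mul, ← h2, eval_C, eval_C, mul_left_comm, inv_mul_cancel₀ hc, mul_one]

end PolyLemma
end MilnorRec

namespace MilnorRec
open IntermediateField MvPolynomial

section Lines
variable {ι k : Type*} [Field k]

lemma natDegree_prod_le_and_coeff (v w : ι → k) (m : ι →₀ ℕ) (s : Finset ι) :
    (∏ i ∈ s, (Polynomial.C (v i) * Polynomial.X + Polynomial.C (w i)) ^ m i).natDegree ≤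
        ∑ i ∈ s, m i ∧
      (∏ i ∈ s, (Polynomial.C (v i) * Polynomial.X + Polynomial.C (w i)) ^ m i).coeff
        (∑ i ∈ s, m i) = ∏ i ∈ s, v i ^ m i := by
  classical
  induction s using Finset.induction_on with
  | empty => simp
  | insert i s hi ih =>
    have h1 : (Polynomial.C (v i) * Polynomial.X + Polynomial.C (w i)).natDegree ≤ 1 :=
      Polynomial.natDegree_linear_le
    have h2 := Polynomial.natDegree_pow_le_of_le (m i) h1
    have h3 := Polynomial.coeff_pow_of_natDegree_le (m := m i) h1
    rw [mul_one] at h2 h3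
    rw [Finset.prod_insert hi, Finset.sum_insert hi, Finset.prod_insert hi]
    refine ⟨Polynomial.natDegree_mul_le_of_le h2 ih.1, ?_⟩
    rw [Polynomial.coeff_mul_add_eq_of_natDegree_le h2 ih.1, ih.2, h3]
    simp

/-- A nonzero polynomial stays nonzero on a line of general direction. -/
lemma exists_forall_aeval_line_ne_zero {h : MvPolynomial ι k} (hh : h ≠ 0) :
    ∃ H : MvPolynomial ι k, H ≠ 0 ∧ ∀ v w : ι → k, eval v H ≠ 0 →
      aeval (fun i => Polynomial.C (v i) * Polynomial.X + Polynomial.C (w i)) h ≠ 0 := by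
  classical
  refine ⟨homogeneousComponent h.totalDegree h, ?_, fun v w hv h0 => hv ?_⟩
  · obtain ⟨m, hm, hmd⟩ := Finset.exists_mem_eq_sup h.support (support_nonempty.2 hh)
      (fun m => m.sum fun _ e => e)
    have hd : m.degree = h.totalDegree := by
      rw [totalDegree, hmd]; rfl
    intro h0
    have := congrArg (coeff m) h0
    rw [coeff_homogeneousComponent, if_pos hd, coeff_zero] at this
    exact (mem_support_iff.1 hm) this
  · have e := congrArg (fun P => Polynomial.coeff P h.totalDegree) h0
    rw [Polynomial.coeff_zero] at e
    rw [← e, aeval_def, eval₂_eq, homogeneousComponent_apply,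
      map_sum, Polynomial.finsetSum_coeff, Finset.sum_filter]
    refine Finset.sum_congr rfl fun m hm => ?_
    have hle : m.degree ≤ h.totalDegree := le_totalDegree hm
    obtain ⟨h1, h2⟩ := natDegree_prod_le_and_coeff v w m m.support
    rw [Polynomial.algebraMap_eq, Polynomial.coeff_C_mul]
    change _ = coeff m h * Polynomial.coeff (∏ i ∈ m.support, _) _
    change (∏ i ∈ m.support, (Polynomial.C (v i) * Polynomial.X + Polynomial.C (w i)) ^ m i).natDegree ≤
      m.degree at h1
    change (∏ i ∈ m.support, (Polynomial.C (v i) * Polynomial.X + Polynomial.C (w i)) ^ m i).coeff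
      m.degree = _ at h2
    split_ifs with hd
    · rw [← hd, h2, eval_monomial]; rfl
    · rw [Polynomial.coeff_eq_zero_of_natDegree_lt (h1.trans_lt (lt_of_le_of_ne hle hd)), mul_zero]

lemma exists_dual_family [Fintype ι] {r : ℕ} {c : Fin r → ι → k} (hc : LinearIndependent k c) :
    ∃ e : Fin r → ι → k, ∀ i j, ∑ m, c i m * e j m = if i = j then 1 else 0 := by
  classical
  let A : Matrix (Fin r) ι k := Matrix.of c
  have hsurj : Function.Surjective A.mulVecLin := by
    have hr : A.rank = Fintype.card (Fin r) := LinearIndependent.rank_matrix hc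
    rw [← LinearMap.range_eq_top]
    exact Submodule.eq_top_of_finrank_eq (by rw [Module.finrank_fintype_fun_eq_card]; exact hr)
  choose e he using fun j => hsurj (Pi.single j 1)
  refine ⟨e, fun i j => ?_⟩
  have := congrFun (he j) i
  rw [Pi.single_apply] at this
  exact this

lemma exists_pair_orthogonal [Fintype ι] {r : ℕ} (h : r + 2 ≤ Fintype.card ι) (e : Fin r → ι → k) :
    ∃ μ ν : ι → k, LinearIndependent k ![μ, ν] ∧ (∀ j, ∑ m, μ m * e j m = 0) ∧
      ∀ j, ∑ m, ν m * e j m = 0 := by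
  let T : (ι → k) →ₗ[k] (Fin r → k) := (Matrix.of e).mulVecLin
  have hT : ∀ μ ∈ LinearMap.ker T, ∀ j, ∑ m, μ m * e j m = 0 := fun μ hμ j => by
    have := congrFun (LinearMap.mem_ker.1 hμ) j
    simpa [T, Matrix.mulVec, dotProduct, mul_comm] using this
  have h1 := T.finrank_range_add_finrank_ker
  have h2 : Module.finrank k (LinearMap.range T) ≤ r := by
    simpa using Submodule.finrank_le (LinearMap.range T)
  rw [Module.finrank_fintype_fun_eq_card] at h1
  have h3 : 1 < Module.finrank k (LinearMap.ker T) := by omega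
  have : Nontrivial (LinearMap.ker T) := Module.nontrivial_of_finrank_pos (R := k) (by omega)
  obtain ⟨μ, hμ⟩ := exists_ne (0 : LinearMap.ker T)
  obtain ⟨ν, hν⟩ := exists_linearIndependent_pair_of_one_lt_finrank h3 hμ
  refine ⟨μ, ν, ?_, hT _ μ.2, hT _ ν.2⟩
  rw [LinearIndependent.pair_iff] at hν ⊢
  exact fun s t hst => hν s t (Subtype.ext hst)

end Lines

lemma order_eq_of_coeff {F : Type*} [Field F] {x : HahnSeries ℤ F} {N : ℤ} (h : x.coeff N ≠ 0)
    (h' : ∀ i < N, x.coeff i = 0) : x.order = N := by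
  refine le_antisymm (HahnSeries.order_le_of_coeff_ne_zero h) (not_lt.1 fun hlt => ?_)
  have hx : x ≠ 0 := by rintro rfl; simp at h
  exact HahnSeries.coeff_order_eq_zero.not.2 hx (h' _ hlt)

section Good
variable (p ℓ : ℕ) (k : Type*) {K : Type*} [Field k] [Field K] [Algebra k K] [Fact ℓ.Prime]

/-- A space of affine coordinates all of which are general, with enough admissible functionals. -/
structure Good (V : Submodule k K) : Prop where
  qgen : ∀ y ∈ V, y ≠ 0 → QGen p k y
  arc : ∀ r ≤ 3, ∀ y : Fin r → K, (∀ i, y i ∈ V) → LinearIndependent k y → ∀ n : Fin r → ℕ,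
    (∀ i, 0 < n i) → (∃ j, (n j : ZMod ℓ) ≠ 0) → ∀ a : Fin r → k,
    ∃ f : KV ℓ K →ₗ[ZMod ℓ] ZMod ℓ, Adm p k f ∧ ∀ (c : Fin r → k) (j : Fin r), c j ≠ 0 →
      (∀ i, c i ≠ 0 → n j ≤ n i) →
      f (cl ℓ (∑ i, algebraMap k K (c i) * (y i - algebraMap k K (a i)))) = n j ∧
      ∀ b : k, b ≠ 0 → f (cl ℓ (∑ i, algebraMap k K (c i) * (y i - algebraMap k K (a i)) -
        algebraMap k K b)) = 0

variable {k} {ι : Type*} [Fintype ι]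

/-- The combinations of the coordinates `x` whose coefficients are orthogonal to `v`. -/
def hyp (x : ι → K) (v : ι → k) : Submodule k K :=
  (LinearMap.ker (Fintype.linearCombination k v)).map (Fintype.linearCombination k x)

variable {p ℓ}

lemma mem_hyp {x : ι → K} {v : ι → k} {y : K} :
    y ∈ hyp x v ↔ ∃ c : ι → k, ∑ i, c i * v i = 0 ∧ lin x c = y := by
  simp [hyp, Submodule.mem_map, Fintype.linearCombination_apply, lin, Algebra.smul_def]

lemma lin_eq_linearCombination (x : ι → K) (c : ι → k) :
    lin x c = Fintype.linearCombination k x c := by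
  simp [Fintype.linearCombination_apply, lin, Algebra.smul_def]

/-- The initial point of the arc contracting the linear forms `c j` to the constants `a j` is
general when all the `c j` are orthogonal to a general direction. -/
lemma aeval_contraction_ne_zero {E : Type*} [Field E] [Algebra k E] {x : ι → E}
    (hx : AlgebraicIndependent k x) {h : MvPolynomial ι k} {v : ι → k}
    (hv : ∀ w : ι → k,
      aeval (fun i => Polynomial.C (v i) * Polynomial.X + Polynomial.C (w i)) h ≠ 0)
    {r : ℕ} (c e : Fin r → ι → k) (hc : ∀ j, ∑ i, c j i * v i = 0) (a : Fin r → k) :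
    aeval (fun i => x i - ∑ j, (lin x (c j) - algebraMap k E (a j)) * algebraMap k E (e j i)) h ≠
      0 := by
  intro h0
  let q : ι → MvPolynomial ι k := fun i => X i - ∑ j, ((∑ m, C (c j m) * X m) - C (a j)) * C (e j i)
  have hq : aeval x (bind₁ q h) = 0 := by
    rw [← h0, aeval_bind₁]
    congr 2
    funext i
    simp [q, lin, ← algebraMap_eq]
  have hq0 : bind₁ q h = 0 := hx (by rw [hq, map_zero])
  apply hv fun i => ∑ j, a j * e j i
  have := congrArg (aeval fun i => (Polynomial.C (v i) * Polynomial.X : Polynomial k)) hq0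
  rw [aeval_bind₁, map_zero] at this
  rw [← this]
  congr 2
  funext i
  have hl : ∀ j, aeval (fun i => (Polynomial.C (v i) * Polynomial.X : Polynomial k))
      (∑ m, C (c j m) * X m : MvPolynomial ι k) = 0 := fun j => by
    rw [map_sum]
    simp only [map_mul, ← algebraMap_eq, AlgHom.commutes, aeval_X, Polynomial.algebraMap_eq]
    rw [← zero_mul (Polynomial.X : Polynomial k), ← Polynomial.C_0, ← hc j, map_sum, Finset.sum_mul]
    exact Finset.sum_congr rfl fun i _ => by rw [Polynomial.C_mul, mul_assoc]
  have hq1 : ∀ i, aeval (fun i => (Polynomial.C (v i) * Polynomial.X : Polynomial k)) (q i) =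
      Polynomial.C (v i) * Polynomial.X - ∑ j, (aeval (fun i =>
        (Polynomial.C (v i) * Polynomial.X : Polynomial k)) (∑ m, C (c j m) * X m) -
          Polynomial.C (a j)) * Polynomial.C (e j i) := fun i => by
    simp [q, ← algebraMap_eq, Polynomial.algebraMap_eq]
  rw [hq1]
  simp [hl]

lemma coeff_sum_single_sub {F : Type*} [Field F] {r : ℕ} (n : Fin r → ℕ) (z : Fin r → F) (b : F)
    (i : ℤ) : (∑ m, HahnSeries.single (n m : ℤ) (z m) - HahnSeries.C b).coeff i =
      (∑ m, if i = n m then z m else 0) - if i = 0 then b else 0 := by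
  rw [HahnSeries.coeff_sub, HahnSeries.coeff_sum, HahnSeries.C_apply]
  simp only [HahnSeries.coeff_single]
  congr!

set_option maxHeartbeats 1000000 in
theorem exists_adm_of_contraction [ExpChar k p] [IsAlgClosed k] (hF : PFG p k K)
    (hp : (p : ZMod ℓ) ≠ 0) {x : ι → K} (hx : IsTranscendenceBasis k x) {h : MvPolynomial ι k}
    {E : IntermediateField k K} (hE : adjoin k (Set.range x) = E)
    (H : ∀ ξ : ι → Polynomial E, (∀ i, (((ξ i).eval 1 : E) : K) = x i) →
      aeval (fun i => (ξ i).eval 0) h ≠ 0 → ∃ F : IntermediateField E (AlgebraicClosure E),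
        FiniteDimensional E F ∧ ∃ Φ : separableClosure E K →+* HahnSeries ℤ F,
          (∀ a : k, Φ (algebraMap E _ (algebraMap k E a)) = HahnSeries.C (algebraMap k F a)) ∧
          ∀ i (e : E), (e : K) = x i → Φ (algebraMap E _ e) =
            HahnSeries.ofPowerSeries ℤ F (((ξ i).map (algebraMap E F) : Polynomial F) : PowerSeries F))
    {v : ι → k} (hv : ∀ w : ι → k,
      aeval (fun i => Polynomial.C (v i) * Polynomial.X + Polynomial.C (w i)) h ≠ 0)
    {r : ℕ} (hr : r + 2 ≤ Fintype.card ι) {c : Fin r → ι → k} (hc : LinearIndependent k c)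
    (hcv : ∀ j, ∑ i, c j i * v i = 0) (n : Fin r → ℕ) (hn : ∀ i, 0 < n i)
    (hnℓ : ∃ j, (n j : ZMod ℓ) ≠ 0) (a : Fin r → k) :
    ∃ f : KV ℓ K →ₗ[ZMod ℓ] ZMod ℓ, Adm p k f ∧ ∀ (d : Fin r → k) (j : Fin r), d j ≠ 0 →
      (∀ i, d i ≠ 0 → n j ≤ n i) →
      f (cl ℓ (∑ i, algebraMap k K (d i) * (lin x (c i) - algebraMap k K (a i)))) = n j ∧
      ∀ b : k, b ≠ 0 → f (cl ℓ (∑ i, algebraMap k K (d i) * (lin x (c i) - algebraMap k K (a i)) -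
        algebraMap k K b)) = 0 := by
  classical
  have hEK : Algebra.IsAlgebraic E K := hE ▸ hx.isAlgebraic_field
  have hxE : ∀ i, x i ∈ E := fun i => hE ▸ subset_adjoin _ _ ⟨i, rfl⟩
  let M := separableClosure E K
  let xE : ι → E := fun i => ⟨x i, hxE i⟩
  have hxEb : IsTranscendenceBasis k xE := IsTranscendenceBasis.of_comp_algebraMap (A' := K) hx
  obtain ⟨e, he⟩ := exists_dual_family hc
  obtain ⟨μ, ν, hμν, hμ, hν⟩ := exists_pair_orthogonal hr e
  let z : Fin r → E := fun j => lin xE (c j) - algebraMap k E (a j)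
  let ξ : ι → Polynomial E := fun i => Polynomial.C (xE i) - ∑ j, (1 - Polynomial.X ^ n j) *
    Polynomial.C (z j * algebraMap k E (e j i))
  obtain ⟨F, hFfin, Φ, hΦk, hΦx⟩ := H ξ (fun i => by simp [ξ, xE, Polynomial.eval_finsetSum]) (by
    have : (fun i => (ξ i).eval 0) = fun i => xE i - ∑ j, (lin xE (c j) - algebraMap k E (a j)) *
        algebraMap k E (e j i) := by
      ext i; simp [ξ, z, Polynomial.eval_finsetSum, fun j => (hn j).ne']
    rw [this]
    exact aeval_contraction_ne_zero hxEb.1 hv c e hcv a)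
  have : FaithfulSMul E F := (faithfulSMul_iff_algebraMap_injective E F).2 (algebraMap E F).injective
  let ρ : Polynomial E →+* HahnSeries ℤ F := ((HahnSeries.ofPowerSeries ℤ F).comp
    (Polynomial.coeToPowerSeries.ringHom)).comp (Polynomial.mapRingHom (algebraMap E F))
  have hρC : ∀ e, ρ (Polynomial.C e) = HahnSeries.C (algebraMap E F e) := fun e => by
    simp [ρ, HahnSeries.ofPowerSeries_C]
  have hρX : ρ Polynomial.X = HahnSeries.single (1 : ℤ) 1 := by
    simp [ρ, HahnSeries.ofPowerSeries_X]
  have hΦlin : ∀ w : ι → k, Φ (algebraMap E M (lin xE w)) = HahnSeries.C (algebraMap E F (lin xE w)) -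
      ∑ j, (1 - HahnSeries.single (n j : ℤ) 1) * HahnSeries.C (algebraMap E F (z j) *
        algebraMap k F (∑ i, w i * e j i)) := by
    intro w
    have h1 : ∀ i, Φ (algebraMap E M (xE i)) = HahnSeries.C (algebraMap E F (xE i)) -
        ∑ j, (1 - HahnSeries.single (n j : ℤ) 1) * HahnSeries.C (algebraMap E F (z j) *
          algebraMap k F (e j i)) := fun i => by
      rw [hΦx i (xE i) rfl]
      change ρ (ξ i) = _
      simp only [ξ, map_sub, map_sum, map_mul, map_pow, map_one, hρC, hρX, HahnSeries.single_pow,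
        one_pow, nsmul_eq_mul, mul_one, ← IsScalarTower.algebraMap_apply k E F]
    have h2 : ∀ a : k, Φ (algebraMap E M (algebraMap k E a)) = HahnSeries.C (algebraMap k F a) := hΦk
    rw [lin, map_sum, map_sum]
    simp only [map_mul, h1, h2]
    rw [Finset.sum_congr rfl fun i _ => mul_sub _ _ _, Finset.sum_sub_distrib, map_sum, map_sum]
    congr 1
    · exact Finset.sum_congr rfl fun i _ => by
        rw [map_mul, map_mul, ← IsScalarTower.algebraMap_apply k E F]
    · simp only [Finset.mul_sum, map_sum, map_mul]
      rw [Finset.sum_comm]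
      exact Finset.sum_congr rfl fun j _ => Finset.sum_congr rfl fun i _ => by ring
  have hΦz : ∀ j, Φ (algebraMap E M (z j)) = HahnSeries.single (n j : ℤ) (algebraMap E F (z j)) := by
    intro j
    have h1 : ∑ m, (1 - HahnSeries.single (n m : ℤ) (1 : F)) * HahnSeries.C (algebraMap E F (z m) *
        algebraMap k F (∑ i, c j i * e m i)) =
        (1 - HahnSeries.single (n j : ℤ) 1) * HahnSeries.C (algebraMap E F (z j)) := by
      rw [Finset.sum_eq_single j]
      · rw [he, if_pos rfl, map_one (algebraMap k F), mul_one]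
      · intro m _ hm
        rw [he, if_neg hm.symm, map_zero, mul_zero, map_zero, mul_zero]
      · simp
    have h2 : algebraMap E F (z j) = algebraMap E F (lin xE (c j)) - algebraMap k F (a j) := by
      rw [map_sub, ← IsScalarTower.algebraMap_apply k E F]
    have h3 : HahnSeries.single (n j : ℤ) (algebraMap E F (z j)) =
        HahnSeries.single (n j : ℤ) 1 * HahnSeries.C (algebraMap E F (z j)) := by
      rw [HahnSeries.C_apply, HahnSeries.single_mul_single, one_mul, add_zero]
    rw [h3, map_sub, map_sub, hΦk, hΦlin, h1, h2, map_sub HahnSeries.C]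
    ring
  have hzE : ∀ d : Fin r → k, d ≠ 0 → ∑ j, algebraMap k E (d j) * z j ≠ 0 := by
    intro d hd h0
    have h1 : ∑ j, d j • c j ≠ 0 := fun h => hd (funext (Fintype.linearIndependent_iff.1 hc d h))
    have h2 := sub_const_ne_zero (transcendental_lin hxEb h1) (∑ j, d j * a j)
    refine h2 (Eq.trans ?_ h0)
    simp only [z, mul_sub, Finset.sum_sub_distrib, map_sum, map_mul, lin, Finset.sum_apply,
      Pi.smul_apply, smul_eq_mul, Finset.mul_sum, Finset.sum_mul]
    rw [Finset.sum_comm]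
    simp only [mul_assoc]
  obtain ⟨j₀, hj₀⟩ := hnℓ
  have hz : ∀ j, z j ≠ 0 := fun j => by
    have := hzE (Pi.single j 1) (by simp)
    rw [Finset.sum_eq_single j (fun m _ hm => by simp [hm]) (by simp)] at this
    simpa using this
  obtain ⟨f, hf, hfo⟩ := exists_adm_of_arc (ℓ := ℓ) hF hp hE Φ hΦk (y := xE) hx hμν
    (by rw [hΦlin]; simp [hμ]) (by rw [hΦlin]; simp [hν]) (hz j₀) (by
      rw [hΦz, HahnSeries.order_single ((map_ne_zero _).2 (hz j₀))]; simpa using hj₀)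
    (AlgHom.id E M)
  refine ⟨f, hf, fun d j hdj hmin => ?_⟩
  let u : k → M := fun b => algebraMap E M (∑ i, algebraMap k E (d i) * z i - algebraMap k E b)
  have hu : ∀ b, ((u b : M) : K) = ∑ i, algebraMap k K (d i) * (lin x (c i) - algebraMap k K (a i)) -
      algebraMap k K b := fun b => by
    have : IsScalarTower k E K := inferInstance
    change ((∑ i, algebraMap k E (d i) * z i - algebraMap k E b : E) : K) = _
    simp [z, lin, xE]
  have hΦk' : ∀ a : k, Φ (algebraMap E M (algebraMap k E a)) = HahnSeries.C (algebraMap k F a) := hΦk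
  have hΦu : ∀ b, Φ (u b) = ∑ i, HahnSeries.single (n i : ℤ) (algebraMap k F (d i) *
      algebraMap E F (z i)) - HahnSeries.C (algebraMap k F b) := fun b => by
    simp only [u, map_sub, map_sum, map_mul, hΦz, hΦk']
    congr 1
    exact Finset.sum_congr rfl fun i _ => by
      rw [HahnSeries.C_apply, HahnSeries.single_mul_single, zero_add]
  have key : ∀ (b : k) (N : ℕ), (Φ (u b)).coeff N ≠ 0 → (∀ i < (N : ℤ), (Φ (u b)).coeff i = 0) →
      f (cl ℓ ((u b : M) : K)) = (N : ZMod ℓ) := by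
    intro b N h1 h2
    have h3 : u b ≠ 0 := fun h => by rw [h] at h1; simp at h1
    have h4 := hfo (u b) h3
    rw [AlgHom.id_apply, order_eq_of_coeff h1 h2] at h4
    simpa using h4
  have hle : ∀ i : ℤ, i < n j → (∑ m, if i = n m then algebraMap k F (d m) * algebraMap E F (z m)
      else 0) = 0 := fun i hi => Finset.sum_eq_zero fun m _ => by
    split_ifs with h1
    · have : d m = 0 := by
        by_contra h2
        have := hmin m h2
        omega
      rw [this, map_zero, zero_mul]
    · rfl
  constructor
  · have h1 := key 0 (n j) ?_ ?_
    · rwa [hu, map_zero, sub_zero] at h1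
    · rw [hΦu, coeff_sum_single_sub, map_zero, ite_self, sub_zero]
      have h2 := hzE (fun m => if n j = n m then d m else 0) (fun h => hdj (by
        simpa using congrFun h j))
      refine fun h3 => h2 ((algebraMap E F).injective ?_)
      rw [map_zero, ← h3, map_sum]
      exact Finset.sum_congr rfl fun m _ => by
        rw [map_mul, ← IsScalarTower.algebraMap_apply k E F]
        simp only [Nat.cast_inj]
        split_ifs <;> simp
    · intro i hi
      rw [hΦu, coeff_sum_single_sub, map_zero, ite_self, sub_zero, hle i hi]
  · intro b hb
    have h1 := key b 0 ?_ ?_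
    · rwa [hu, Nat.cast_zero] at h1
    · rw [hΦu, coeff_sum_single_sub, hle _ (by have := hn j; omega)]
      simpa using hb
    · intro i hi
      rw [hΦu, coeff_sum_single_sub, hle _ (by have := hn j; omega), if_neg (by
        rintro rfl; simp at hi), sub_zero]

/-- Hyperplanes of general direction are good. -/
theorem exists_good [ExpChar k p] [IsAlgClosed k] (hF : PFG p k K)
    (hp : (p : ZMod ℓ) ≠ 0) {x : ι → K} (hx : IsTranscendenceBasis k x) (hι : 5 ≤ Fintype.card ι) :
    ∃ H : MvPolynomial ι k, H ≠ 0 ∧ ∀ v : ι → k, eval v H ≠ 0 → Good p ℓ k (hyp x v) := by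
  classical
  obtain ⟨B, hB⟩ := exists_finset_forall_qgen hF hx
  set E := adjoin k (Set.range x) with hE
  have hEK : Algebra.IsAlgebraic E K := hx.isAlgebraic_field
  have := hF.finiteDimensional_separableClosure E
  obtain ⟨h, hh, harc⟩ := exists_arc hx.1 hE.symm (∅ : Finset (separableClosure E K))
  obtain ⟨H, hH, hline⟩ := exists_forall_aeval_line_ne_zero hh
  have hform : ∀ b : ι → k, b ≠ 0 → (∑ i, C (b i) * X i : MvPolynomial ι k) ≠ 0 := by
    intro b hb h0
    obtain ⟨i, hi⟩ := Function.ne_iff.1 hb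
    have := congrArg (eval (Pi.single i 1)) h0
    simp [Pi.single_apply] at this
    exact hi this
  refine ⟨H * ∏ b ∈ B.filter (· ≠ 0), ∑ i, C (b i) * X i, mul_ne_zero hH
    (Finset.prod_ne_zero_iff.2 fun b hb => hform b (Finset.mem_filter.1 hb).2), fun v hv => ?_⟩
  rw [map_mul, map_prod] at hv
  have hvH := left_ne_zero_of_mul hv
  have hvB := Finset.prod_ne_zero_iff.1 (right_ne_zero_of_mul hv)
  constructor
  · intro y hy hy0
    obtain ⟨c, hcv, rfl⟩ := mem_hyp.1 hy
    have hc : c ≠ 0 := by rintro rfl; simp [lin] at hy0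
    refine hB c hc fun b hb a hcb => ?_
    have hb0 : b ≠ 0 := by rintro rfl; simp at hcb; exact hc hcb
    have ha : a ≠ 0 := by rintro rfl; simp at hcb; exact hc hcb
    apply hvB b (Finset.mem_filter.2 ⟨hb, hb0⟩)
    simp only [hcb, Pi.smul_apply, smul_eq_mul, mul_assoc, ← Finset.mul_sum] at hcv
    simpa using (mul_eq_zero.1 hcv).resolve_left ha
  · intro r hr y hy hyi n hn hnℓ a
    choose c hcv hc using fun i => mem_hyp.1 (hy i)
    obtain rfl : (fun i => lin x (c i)) = y := funext hc
    have hci : LinearIndependent k c := by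
      refine LinearIndependent.of_comp (Fintype.linearCombination k x) ?_
      convert hyi using 1
      funext i
      exact (lin_eq_linearCombination x (c i)).symm
    exact exists_adm_of_contraction hF hp hx hE.symm (fun ξ h1 h2 => by
      obtain ⟨F, h3, Φ, h4, h5, -⟩ := harc ξ h1 h2
      exact ⟨F, h3, Φ, h4, h5⟩) (fun w => hline v w hvH) (by omega) hci hcv n hn hnℓ a

end Good
end MilnorRec

namespace MilnorRec
open IntermediateField MvPolynomial

section Chart
variable {p p' ℓ : ℕ} {k l K L : Type*} [Field k] [Field K] [Algebra k K]
  [Field l] [Field L] [Algebra l L] [Fact ℓ.Prime]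

/-- `φ` carries the points of the line with coordinate `y` to those of the line with
coordinate `Y`, along the bijection `π`. -/
structure Chart (φ : KV ℓ K ≃ₗ[ZMod ℓ] KV ℓ L) (y : K) (Y : L) (π : k ≃ l) (ε : k → ZMod ℓ) :
    Prop where
  ne_zero : ∀ a, ε a ≠ 0
  map : ∀ a, φ (cl ℓ (y - algebraMap k K a)) = ε a • cl ℓ (Y - algebraMap l L (π a))
  trans : Transcendental l Y

variable {φ : KV ℓ K ≃ₗ[ZMod ℓ] KV ℓ L} {y : K} {Y : L} {π : k ≃ l} {ε : k → ZMod ℓ}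

lemma Chart.apply (h : Chart φ y Y π ε) (f : KV ℓ K →ₗ[ZMod ℓ] ZMod ℓ) (a : k) :
    f (cl ℓ (y - algebraMap k K a)) =
      ε a * (f ∘ₗ φ.symm.toLinearMap) (cl ℓ (Y - algebraMap l L (π a))) := by
  have := congrArg φ.symm (h.map a)
  rw [LinearEquiv.symm_apply_apply, map_smul] at this
  rw [this, map_smul, smul_eq_mul]
  rfl

lemma Chart.sees_iff (h : Chart φ y Y π ε) {f : KV ℓ K →ₗ[ZMod ℓ] ZMod ℓ} {a : k} :
    Sees k f y a ↔ Sees l (f ∘ₗ φ.symm.toLinearMap) Y (π a) := by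
  have h0 : ∀ b : k, f (cl ℓ (y - algebraMap k K b)) = 0 ↔
      (f ∘ₗ φ.symm.toLinearMap) (cl ℓ (Y - algebraMap l L (π b))) = 0 := fun b => by
    rw [h.apply f b, mul_eq_zero, or_iff_right (h.ne_zero b)]
  unfold Sees
  rw [Ne, h0, π.exists_congr_left]
  refine and_congr_right fun _ => exists_congr fun b => ?_
  rw [h0, Equiv.apply_symm_apply]

lemma comp_symm_comp (f' : KV ℓ L →ₗ[ZMod ℓ] ZMod ℓ) :
    (f' ∘ₗ φ.toLinearMap) ∘ₗ φ.symm.toLinearMap = f' := by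
  ext v; simp

lemma Chart.sees_iff' (h : Chart φ y Y π ε) {f' : KV ℓ L →ₗ[ZMod ℓ] ZMod ℓ} {b : l} :
    Sees l f' Y b ↔ Sees k (f' ∘ₗ φ.toLinearMap) y (π.symm b) := by
  rw [h.sees_iff, comp_symm_comp, Equiv.apply_symm_apply]

lemma HalfTransport.adm' (H : HalfTransport p' l k p φ.symm)
    {f' : KV ℓ L →ₗ[ZMod ℓ] ZMod ℓ} (hf : Adm p' l f') : Adm p k (f' ∘ₗ φ.toLinearMap) :=
  H.adm hf

lemma Chart.affine (h : Chart φ y Y π ε) [IsAlgClosed l] {α β : l} (hα : α ≠ 0) :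
    ∃ (Y' : L) (π' : k ≃ l), (∀ a, π' a = α * π a + β) ∧ Chart φ y Y' π' ε := by
  refine ⟨algebraMap l L α * Y + algebraMap l L β,
    π.trans ((Equiv.mulLeft₀ α hα).trans (Equiv.addRight β)), fun a => by simp, h.ne_zero,
    fun a => ?_, fun hY => ?_⟩
  · rw [h.map]
    have h1 : algebraMap l L α * Y + algebraMap l L β - algebraMap l L (α * π a + β) =
      algebraMap l L α * (Y - algebraMap l L (π a)) := by simp only [map_add, map_mul]; ring
    change _ = ε a • cl ℓ (_ - algebraMap l L (α * π a + β))
    rw [h1, cl_mul (by simpa using hα) (sub_const_ne_zero h.trans _), cl_const, zero_add]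
  · refine h.trans ?_
    have h2 := ((hY.sub (isAlgebraic_algebraMap β)).mul (isAlgebraic_algebraMap α⁻¹))
    rwa [add_sub_cancel_right, map_inv₀, mul_comm, inv_mul_cancel_left₀ (by simpa using hα)] at h2

lemma Chart.frob (h : Chart φ y Y π ε) [ExpChar l p'] [PerfectRing l p'] (hp : (p' : ZMod ℓ) ≠ 0)
    (n : ℕ) : ∃ (π' : k ≃ l) , (∀ a, π' a = π a ^ p' ^ n) ∧
      Chart φ y (Y ^ p' ^ n) π' fun a => ε a * ((p' ^ n : ℕ) : ZMod ℓ)⁻¹ := by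
  have : ExpChar L p' := expChar_of_injective_algebraMap (algebraMap l L).injective p'
  refine ⟨π.trans (iterateFrobeniusEquiv l p' n).toEquiv, fun a => ?_, fun a => ?_, fun a => ?_,
    h.trans.pow (expChar_pow_pos l p' n)⟩
  · simp [iterateFrobenius_def]
  · exact mul_ne_zero (h.ne_zero a) (inv_ne_zero (natCast_pow_ne_zero hp n))
  · have h1 : Y ^ p' ^ n - algebraMap l L (π a ^ p' ^ n) =
      (Y - algebraMap l L (π a)) ^ p' ^ n := by rw [map_pow, sub_pow_expChar_pow]
    simp only [Equiv.trans_apply, RingEquiv.toEquiv_eq_coe, EquivLike.coe_coe,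
      iterateFrobeniusEquiv_def]
    rw [h.map, h1, cl_pow', smul_smul, inv_mul_cancel_right₀ (natCast_pow_ne_zero hp n)]

lemma Chart.unfrob (h : Chart φ y Y π ε) [ExpChar l p'] (hp : (p' : ZMod ℓ) ≠ 0)
    (hperf : ∀ y : L, ∃ z, z ^ p' = y) {n : ℕ} {π₀ : k ≃ l} (hπ : ∀ a, π₀ a ^ p' ^ n = π a) :
    ∃ Y₀, Chart φ y Y₀ π₀ fun a => ε a * ((p' ^ n : ℕ) : ZMod ℓ) := by
  have : ExpChar L p' := expChar_of_injective_algebraMap (algebraMap l L).injective p'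
  obtain ⟨Y₀, hY⟩ : ∃ Y₀, Y₀ ^ p' ^ n = Y := by
    clear hπ
    induction n with
    | zero => exact ⟨Y, by simp⟩
    | succ n ih =>
      obtain ⟨Y₁, h1⟩ := ih
      obtain ⟨Y₀, h0⟩ := hperf Y₁
      exact ⟨Y₀, by rw [pow_succ', pow_mul, h0, h1]⟩
  refine ⟨Y₀, fun a => mul_ne_zero (h.ne_zero a) (natCast_pow_ne_zero hp n), fun a => ?_,
    fun h0 => h.trans (hY ▸ h0.pow _)⟩
  have h1 : Y - algebraMap l L (π a) = (Y₀ - algebraMap l L (π₀ a)) ^ p' ^ n := by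
    rw [sub_pow_expChar_pow, hY, ← map_pow, hπ]
  rw [h.map, h1, cl_pow', smul_smul]

/-- A chart whose bijection agrees up to Frobenius with a given one can be twisted to it. -/
lemma Chart.twist (h : Chart φ y Y π ε) [ExpChar l p'] [PerfectRing l p'] (hp : (p' : ZMod ℓ) ≠ 0)
    (hperf : ∀ y : L, ∃ z, z ^ p' = y) {n m : ℕ} {π₀ : k ≃ l}
    (hπ : ∀ a, π₀ a ^ p' ^ n = π a ^ p' ^ m) :
    ∃ Y₀, Chart φ y Y₀ π₀ fun a => ε a * ((p' ^ m : ℕ) : ZMod ℓ)⁻¹ * ((p' ^ n : ℕ) : ZMod ℓ) := by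
  obtain ⟨π', h1, h2⟩ := h.frob hp m
  exact h2.unfrob hp hperf fun a => (hπ a).trans (h1 a).symm

end Chart

section Exists
variable {p p' ℓ : ℕ} {k l K L : Type*} [Field k] [Field K] [Algebra k K]
  [Field l] [Field L] [Algebra l L] [Fact ℓ.Prime] {φ : KV ℓ K ≃ₗ[ZMod ℓ] KV ℓ L}
  {V : Submodule k K}

lemma Good.exists_adm (hV : Good p ℓ k V) {r : ℕ} (hr : r ≤ 3) {y : Fin r → K} (hy : ∀ i, y i ∈ V)
    (hli : LinearIndependent k y) (a : Fin r → k) (hr0 : 0 < r) :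
    ∃ f : KV ℓ K →ₗ[ZMod ℓ] ZMod ℓ, Adm p k f ∧ ∀ c : Fin r → k, c ≠ 0 →
      Sees k f (∑ i, algebraMap k K (c i) * y i) (∑ i, c i * a i) := by
  obtain ⟨f, hf, h⟩ := hV.arc r hr y hy hli (fun _ => 1) (by simp) ⟨⟨0, hr0⟩, by simp⟩ a
  refine ⟨f, hf, fun c hc => ?_⟩
  obtain ⟨j, hj⟩ := Function.ne_iff.1 hc
  obtain ⟨h1, h2⟩ := h c j hj (by simp)
  have e : ∑ i, algebraMap k K (c i) * (y i - algebraMap k K (a i)) =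
      ∑ i, algebraMap k K (c i) * y i - algebraMap k K (∑ i, c i * a i) := by
    simp [mul_sub, Finset.sum_sub_distrib]
  rw [e] at h1
  refine ⟨by rw [h1]; simp, ∑ i, c i * a i + 1, ?_⟩
  have h3 := h2 1 one_ne_zero
  rwa [e, sub_sub, ← map_add] at h3

/-- The coordinate functionals of a good line. -/
lemma Good.exists_dual (hV : Good p ℓ k V) {y : K} (hy : y ∈ V) (hy0 : y ≠ 0) (a : k) :
    ∃ f : KV ℓ K →ₗ[ZMod ℓ] ZMod ℓ, Adm p k f ∧ f (cl ℓ (y - algebraMap k K a)) = 1 ∧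
      ∀ b ≠ a, f (cl ℓ (y - algebraMap k K b)) = 0 := by
  obtain ⟨f, hf, h⟩ := hV.arc 1 (by norm_num) (fun _ => y) (fun _ => hy)
    (LinearIndependent.of_subsingleton 0 hy0) (fun _ => 1) (by simp) ⟨0, by simp⟩ (fun _ => a)
  obtain ⟨h1, h2⟩ := h 1 0 (by simp) (by simp)
  refine ⟨f, hf, by simpa using h1, fun b hb => ?_⟩
  simpa using h2 (b - a) (sub_ne_zero.2 hb)

variable [IsAlgClosed l]

omit [IsAlgClosed l] in
lemma exists_chart_of_finite {y : K} {Y : L} (hY : Transcendental l Y)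
    (hmap : (Om ℓ k y).map φ.toLinearMap = Om ℓ l Y) (hli : LinearIndependent (ZMod ℓ)
      (fun b : l => cl ℓ (Y - algebraMap l L b))) (f : k → KV ℓ K →ₗ[ZMod ℓ] ZMod ℓ)
    (hf : ∀ a, f a (cl ℓ (y - algebraMap k K a)) = 1)
    (hf' : ∀ a, ∀ b ≠ a, f a (cl ℓ (y - algebraMap k K b)) = 0)
    (hO : ∀ a, ∃ O, Compat l (f a ∘ₗ φ.symm.toLinearMap) O ∧ O.valuation Y ≤ 1) :
    ∃ π ε, Chart φ y Y (π : k ≃ l) ε := by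
  classical
  have hmem : ∀ b, φ.symm (cl ℓ (Y - algebraMap l L b)) ∈ Om ℓ k y := fun b => by
    have : cl ℓ (Y - algebraMap l L b) ∈ (Om ℓ k y).map φ.toLinearMap := by
      rw [hmap]; exact Submodule.subset_span ⟨b, rfl⟩
    obtain ⟨v, hv, h⟩ := this
    rw [← h]
    simpa using hv
  have hcoord : ∀ v ∈ Om ℓ k y, ∃ c : k →₀ ZMod ℓ, (∀ a, f a v = c a) ∧
      v = c.sum fun a m => m • cl ℓ (y - algebraMap k K a) := by
    intro v hv
    obtain ⟨c, rfl⟩ := (Finsupp.mem_span_range_iff_exists_finsupp).1 hv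
    refine ⟨c, fun a => ?_, rfl⟩
    rw [Finsupp.sum, map_sum]
    rw [Finset.sum_eq_single a]
    · rw [map_smul, hf, smul_eq_mul, mul_one]
    · intro b _ hb
      rw [map_smul, hf' a b hb, smul_zero]
    · intro ha
      rw [Finsupp.notMem_support_iff.1 ha, zero_smul, map_zero]
  have hzero : ∀ v ∈ Om ℓ k y, (∀ a, f a v = 0) → v = 0 := fun v hv h => by
    obtain ⟨c, hc, hvc⟩ := hcoord v hv
    have : c = 0 := Finsupp.ext fun a => (hc a).symm.trans (h a)
    rw [hvc, this, Finsupp.sum_zero_index]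
  have hpt : ∀ a, ∃ b, f a (φ.symm (cl ℓ (Y - algebraMap l L b))) ≠ 0 ∧
      ∀ b' ≠ b, f a (φ.symm (cl ℓ (Y - algebraMap l L b'))) = 0 := by
    intro a
    obtain ⟨O, hO, hYO⟩ := hO a
    have hex : ∃ b, f a (φ.symm (cl ℓ (Y - algebraMap l L b))) ≠ 0 := by
      by_contra! h
      have h1 : Om ℓ l Y ≤ LinearMap.ker (f a ∘ₗ φ.symm.toLinearMap) :=
        Submodule.span_le.2 (by rintro _ ⟨b, rfl⟩; exact h b)
      have h2 : φ (cl ℓ (y - algebraMap k K a)) ∈ Om ℓ l Y := by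
        rw [← hmap]; exact ⟨_, Submodule.subset_span ⟨a, rfl⟩, rfl⟩
      have h3 := h1 h2
      simp [hf] at h3
    obtain ⟨b, hb⟩ := hex
    refine ⟨b, hb, fun b' hb' => hO.eq_zero_of_lt hb' (lt_of_le_of_ne ?_ (hO.val_ne_one hb))⟩
    exact (O.valuation.map_sub _ _).trans (max_le hYO (hO.val_const_le b))
  choose π hπ hπ' using hpt
  have hval : Function.Surjective π := by
    intro b
    by_contra! h
    have h1 := hzero _ (hmem b) fun a => hπ' a b (h a).symm
    exact hli.ne_zero b (by simpa using h1)
  have hinj : Function.Injective π := by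
    intro a₁ a₂ h12
    by_contra hne
    have h2 : φ (cl ℓ (y - algebraMap k K a₁)) ∈ Om ℓ l Y := by
      rw [← hmap]; exact ⟨_, Submodule.subset_span ⟨a₁, rfl⟩, rfl⟩
    obtain ⟨c, hc⟩ := (Finsupp.mem_span_range_iff_exists_finsupp).1 h2
    have h3 : ∀ a, f a (cl ℓ (y - algebraMap k K a₁)) =
        c (π a) * f a (φ.symm (cl ℓ (Y - algebraMap l L (π a)))) := by
      intro a
      have h4 : cl ℓ (y - algebraMap k K a₁) =
          c.sum fun i m => m • φ.symm (cl ℓ (Y - algebraMap l L i)) := by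
        have := congrArg φ.symm hc
        rw [LinearEquiv.symm_apply_apply, Finsupp.sum, map_sum] at this
        simpa [Finsupp.sum] using this.symm
      conv_lhs => rw [h4]
      rw [Finsupp.sum, map_sum, Finset.sum_eq_single (π a)]
      · rw [map_smul, smul_eq_mul]
      · intro b _ hb
        rw [map_smul, hπ' a b hb, smul_zero]
      · intro ha
        rw [Finsupp.notMem_support_iff.1 ha, zero_smul, map_zero]
    have h5 := h3 a₁
    have h6 := h3 a₂
    rw [hf] at h5
    rw [hf' a₂ a₁ hne, ← h12] at h6
    rcases mul_eq_zero.1 h6.symm with h7 | h7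
    · rw [h7, zero_mul] at h5; exact one_ne_zero h5
    · rw [h12] at h7; exact hπ a₂ h7
  refine ⟨Equiv.ofBijective π ⟨hinj, hval⟩,
    fun a => (f a (φ.symm (cl ℓ (Y - algebraMap l L (π a)))))⁻¹,
    fun a => inv_ne_zero (hπ a), fun a => ?_, hY⟩
  obtain ⟨c, hc, hv⟩ := hcoord _ (hmem (π a))
  have hcs : c = Finsupp.single a (c a) := Finsupp.ext fun a' => by
    by_cases h : a' = a
    · rw [h, Finsupp.single_eq_same]
    · rw [Finsupp.single_eq_of_ne h, ← hc]
      exact hπ' a' _ fun h' => h (hinj h').symm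
  rw [hcs, Finsupp.sum_single_index (by rw [zero_smul]), ← hc] at hv
  change φ _ = _ • cl ℓ (Y - algebraMap l L (π a))
  rw [eq_inv_smul_iff₀ (hπ a), ← map_smul]
  exact (congrArg φ hv).symm.trans (φ.apply_symm_apply _)

omit [IsAlgClosed l] in
lemma Om_inv_sub {U : L} (hU : Transcendental l U) (b : l) :
    Transcendental l (U - algebraMap l L b)⁻¹ ∧ l⟮(U - algebraMap l L b)⁻¹⟯ = l⟮U⟯ := by
  have h2 : l⟮(U - algebraMap l L b)⁻¹⟯ = l⟮U⟯ := by
    apply le_antisymm <;> rw [adjoin_simple_le_iff]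
    · exact inv_mem (sub_mem (mem_adjoin_simple_self l U) (IntermediateField.algebraMap_mem _ _))
    · have h1 := inv_mem (mem_adjoin_simple_self l (U - algebraMap l L b)⁻¹)
      rw [inv_inv] at h1
      simpa using add_mem h1 (IntermediateField.algebraMap_mem _ b)
  refine ⟨fun h => hU ?_, h2⟩
  have h1 := h.inv.add (isAlgebraic_algebraMap b)
  rwa [inv_inv, sub_add_cancel] at h1

lemma QGen.of_adjoin_eq {t u : K} (ht : QGen p k t) (hu : Transcendental k u)
    (h : k⟮u⟯ = k⟮t⟯) : QGen p k u := by
  refine ⟨hu, fun α hα => ?_⟩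
  have key : ∀ F G : IntermediateField k K, F = G → IsAlgebraic F α → IsAlgebraic G α := by
    rintro F _ rfl h; exact h
  obtain ⟨n, hn⟩ := ht.2 α (key _ _ h hα)
  exact ⟨n, h ▸ hn⟩

lemma Om_eq_of_adjoin_eq [IsAlgClosed k] {t u : K} (ht : Transcendental k t)
    (hu : Transcendental k u) (h : k⟮u⟯ = k⟮t⟯) : Om ℓ k u = Om ℓ k t := by
  apply le_antisymm <;> refine Submodule.span_le.2 ?_ <;> rintro _ ⟨a, rfl⟩
  · exact cl_mem_Om ht (h ▸ sub_mem (mem_adjoin_simple_self k u)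
      (IntermediateField.algebraMap_mem _ a))
  · exact cl_mem_Om hu (h.symm ▸ sub_mem (mem_adjoin_simple_self k t)
      (IntermediateField.algebraMap_mem _ a))

/-- A general line in a good space has a chart. -/
theorem exists_chart [IsAlgClosed k] (hp' : (p' : ZMod ℓ) ≠ 0) (H : HalfTransport p k l p' φ)
    (hV : Good p ℓ k V) {y : K} (hy : y ∈ V) (hy0 : y ≠ 0) : ∃ Y π ε, Chart φ y Y (π : k ≃ l) ε := by
  classical
  choose f hf hf1 hf0 using hV.exists_dual hy hy0
  choose O hO using fun a => (H.adm (hf a)).exists_compat hp'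
  obtain ⟨U, hU, hmap⟩ := H.rat y (hV.qgen y hy hy0)
  have hli := hU.linearIndependent (ℓ := ℓ) hp'
  by_cases hfin : ∀ a, (O a).valuation U ≤ 1
  · obtain ⟨π, ε, h⟩ := exists_chart_of_finite hU.1 hmap hli f hf1 hf0
      fun a => ⟨O a, hO a, hfin a⟩
    exact ⟨U, π, ε, h⟩
  push Not at hfin
  obtain ⟨a₀, ha₀⟩ := hfin
  have hmemU : ∀ a, φ (cl ℓ (y - algebraMap k K a)) ∈ Om ℓ l U := fun a => by
    rw [← hmap]; exact ⟨_, Submodule.subset_span ⟨a, rfl⟩, rfl⟩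
  obtain ⟨c, hc⟩ := (Finsupp.mem_span_range_iff_exists_finsupp).1 (hmemU a₀)
  have hc' : cl ℓ (y - algebraMap k K a₀) =
      c.sum fun i m => m • φ.symm (cl ℓ (U - algebraMap l L i)) := by
    have := congrArg φ.symm hc
    rw [LinearEquiv.symm_apply_apply, Finsupp.sum, map_sum] at this
    simpa [Finsupp.sum] using this.symm
  have hsees : ∀ a ≠ a₀, (O a).valuation U ≤ 1 := by
    intro a ha
    by_contra! hgt
    have hconst : ∀ a, 1 < (O a).valuation U → ∀ b,
        f a (φ.symm (cl ℓ (U - algebraMap l L b))) = f a (φ.symm (cl ℓ U)) := fun a ha b => by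
      refine (hO a).eq_of_val_eq (by rintro rfl; simp at ha) ?_
      exact Valuation.map_sub_eq_of_lt_left _ (((hO a).val_const_le b).trans_lt ha)
    have h1 : f a₀ (cl ℓ (y - algebraMap k K a₀)) =
        (c.sum fun _ m => m) * f a₀ (φ.symm (cl ℓ U)) := by
      rw [hc', Finsupp.sum, Finsupp.sum, map_sum, Finset.sum_mul]
      exact Finset.sum_congr rfl fun i _ => by rw [map_smul, smul_eq_mul, hconst a₀ ha₀]
    have h2 : f a (cl ℓ (y - algebraMap k K a₀)) =
        (c.sum fun _ m => m) * f a (φ.symm (cl ℓ U)) := by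
      rw [hc', Finsupp.sum, Finsupp.sum, map_sum, Finset.sum_mul]
      exact Finset.sum_congr rfl fun i _ => by rw [map_smul, smul_eq_mul, hconst a hgt]
    rw [hf1] at h1
    rw [hf0 a a₀ ha.symm] at h2
    rcases mul_eq_zero.1 h2.symm with h3 | h3
    · rw [h3, zero_mul] at h1; exact one_ne_zero h1
    · obtain ⟨d, hd⟩ := (Finsupp.mem_span_range_iff_exists_finsupp).1 (hmemU a)
      have hd' : cl ℓ (y - algebraMap k K a) =
          d.sum fun i m => m • φ.symm (cl ℓ (U - algebraMap l L i)) := by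
        have := congrArg φ.symm hd
        rw [LinearEquiv.symm_apply_apply, Finsupp.sum, map_sum] at this
        simpa [Finsupp.sum] using this.symm
      have h4 : f a (cl ℓ (y - algebraMap k K a)) = 0 := by
        rw [hd', Finsupp.sum, map_sum]
        exact Finset.sum_eq_zero fun i _ => by rw [map_smul, smul_eq_mul, hconst a hgt, h3, mul_zero]
      rw [hf1] at h4
      exact one_ne_zero h4
  have hb : ∃ b, ∀ a ≠ a₀, f a (φ.symm (cl ℓ (U - algebraMap l L b))) = 0 := by
    by_contra! hcon
    have hc0 : ∀ b, c b = 0 := by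
      intro b
      obtain ⟨a, ha, hab⟩ := hcon b
      have hlt : (O a).valuation (U - algebraMap l L b) < 1 :=
        lt_of_le_of_ne ((Valuation.map_sub _ _ _).trans
          (max_le (hsees a ha) ((hO a).val_const_le b))) ((hO a).val_ne_one hab)
      have h1 : f a (cl ℓ (y - algebraMap k K a₀)) =
          c b * f a (φ.symm (cl ℓ (U - algebraMap l L b))) := by
        rw [hc', Finsupp.sum, map_sum, Finset.sum_eq_single b]
        · rw [map_smul, smul_eq_mul]
        · intro b' _ hb'
          have : f a (φ.symm (cl ℓ (U - algebraMap l L b'))) = 0 := (hO a).eq_zero_of_lt hb' hlt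
          rw [map_smul, this, smul_zero]
        · intro hb'
          rw [Finsupp.notMem_support_iff.1 hb', zero_smul, map_zero]
      rw [hf0 a a₀ ha.symm] at h1
      exact (mul_eq_zero.1 h1.symm).resolve_right hab
    have h2 := hf1 a₀
    rw [hc', Finsupp.sum, map_sum, Finset.sum_eq_zero fun i _ => by
      rw [hc0, zero_smul, map_zero]] at h2
    exact zero_ne_one h2
  obtain ⟨b, hb⟩ := hb
  obtain ⟨hY, hadj⟩ := Om_inv_sub hU.1 b
  have hQ := hU.of_adjoin_eq hY hadj
  obtain ⟨π, ε, h⟩ := exists_chart_of_finite (φ := φ) (y := y) hY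
    (hmap.trans (Om_eq_of_adjoin_eq hU.1 hY hadj).symm) (hQ.linearIndependent hp') f hf1 hf0
    fun a => by
      refine ⟨O a, hO a, ?_⟩
      rw [map_inv₀]
      have hne : U - algebraMap l L b ≠ 0 := sub_const_ne_zero hU.1 b
      rw [inv_le_one₀ (zero_lt_iff.2 ((Valuation.ne_zero_iff _).2 hne))]
      by_cases ha : a = a₀
      · subst ha
        rw [Valuation.map_sub_eq_of_lt_left _ (((hO a).val_const_le b).trans_lt ha₀)]
        exact ha₀.le
      · by_contra! hlt
        have h1 : Om ℓ l U ≤ LinearMap.ker (f a ∘ₗ φ.symm.toLinearMap) := by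
          refine Submodule.span_le.2 ?_
          rintro _ ⟨b', rfl⟩
          by_cases hbb : b' = b
          · rw [hbb]; exact hb a ha
          · exact (hO a).eq_zero_of_lt hbb hlt
        have h3 := h1 (hmemU a)
        simp [hf1] at h3
  exact ⟨_, π, ε, h⟩

/-- Charts of linearly independent elements of a good space are algebraically independent. -/
theorem algebraicIndependent_of_chart (hp' : (p' : ZMod ℓ) ≠ 0) (H : HalfTransport p k l p' φ)
    (hV : Good p ℓ k V) {r : ℕ} (hr : r ≤ 3) {y : Fin r → K} (hy : ∀ i, y i ∈ V)
    (hli : LinearIndependent k y) {Y : Fin r → L} {π : Fin r → k ≃ l} {ε : Fin r → k → ZMod ℓ}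
    (h : ∀ i, Chart φ (y i) (Y i) (π i) (ε i)) : AlgebraicIndependent l Y := by
  rcases Nat.eq_zero_or_pos r with rfl | hr0
  · exact algebraicIndependent_empty_type
  rw [algebraicIndependent_iff]
  intro P hP
  by_contra hP0
  obtain ⟨b, hb⟩ := exists_eval_ne_zero hP0
  obtain ⟨f, hf, hs⟩ := hV.exists_adm hr hy hli (fun i => (π i).symm (b i)) hr0
  obtain ⟨O, hO⟩ := (H.adm hf).exists_compat hp'
  have h1 : ∀ i, Res O (Y i) (b i) := fun i => by
    have h2 := hs (Pi.single i 1) (by simp)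
    rw [Finset.sum_eq_single i (by intro j _ hj; simp [hj]) (by simp),
      Finset.sum_eq_single i (by intro j _ hj; simp [hj]) (by simp)] at h2
    simp only [Pi.single_eq_same, map_one, one_mul] at h2
    have h3 := (h i).sees_iff.1 h2
    rw [Equiv.apply_symm_apply] at h3
    exact h3.res hO
  have h2 := Res.aeval hO h1 P
  rw [hP] at h2
  have h3 : Res O (0 : L) (0 : l) := by simpa using Res.const (O := O) (K := L) (0 : l)
  exact hb (Res.unique hO h2 h3)
end Exists
end MilnorRec

namespace MilnorRec

section Poly
variable {l : Type*} [Field l]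

lemma exists_eq_pow_of_injective_pow [IsAlgClosed l] (p : ℕ) [ExpChar l p] {N : ℕ} (hN : N ≠ 0)
    (h : Function.Injective fun x : l => x ^ N) : ∃ m, N = p ^ m := by
  obtain ⟨m, N', hN', hNm⟩ : ∃ m N' : ℕ, (N' : l) ≠ 0 ∧ N = p ^ m * N' := by
    rcases ‹ExpChar l p› with _ | hprime
    · exact ⟨0, N, by exact_mod_cast hN, by simp⟩
    · obtain ⟨m, N', h1, h2⟩ := Nat.exists_eq_pow_mul_and_not_dvd hN p hprime.ne_one
      exact ⟨m, N', fun h0 => h1 ((CharP.cast_eq_zero_iff l p N').1 h0), h2⟩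
  refine ⟨m, ?_⟩
  have : NeZero (N' : l) := ⟨hN'⟩
  obtain ⟨ζ, hζ⟩ := HasEnoughRootsOfUnity.exists_primitiveRoot l N'
  have h1 : ζ = 1 := h (by simp only [hNm, one_pow, mul_comm (p ^ m), pow_mul, hζ.pow_eq_one])
  rw [h1] at hζ
  have h2 : N' = 1 := by simpa using hζ.eq_orderOf
  rw [hNm, h2, mul_one]

open Polynomial in
/-- Injective polynomial functions over an algebraically closed field. -/
theorem exists_eq_of_injective_eval [IsAlgClosed l] (p : ℕ) [ExpChar l p] {P : l[X]} (h : Function.Injective fun x => P.eval x) :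
    ∃ m c e, c ≠ 0 ∧ P = C c * X ^ p ^ m + C e := by
  have hN : P.natDegree ≠ 0 := by
    intro h0
    rw [eq_C_of_natDegree_eq_zero h0] at h
    exact zero_ne_one (@h 0 1 (by simp))
  set Q := P - C (P.eval 0) with hQ
  have hQd : Q.natDegree = P.natDegree := natDegree_sub_C
  have hQ0 : Q ≠ 0 := by rintro h0; rw [h0] at hQd; exact hN (by simpa using hQd.symm)
  have hroots : Q.roots = Multiset.replicate P.natDegree 0 := by
    rw [Multiset.eq_replicate, ← hQd]
    refine ⟨((IsAlgClosed.splits Q).natDegree_eq_card_roots).symm, fun b hb => h ?_⟩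
    have := (mem_roots hQ0).1 hb
    simpa [hQ, IsRoot, sub_eq_zero] using this
  have hQe : Q = C Q.leadingCoeff * X ^ P.natDegree := by
    conv_lhs => rw [(IsAlgClosed.splits Q).eq_prod_roots, hroots]
    simp
  have hc : Q.leadingCoeff ≠ 0 := leadingCoeff_ne_zero.2 hQ0
  have hP : P = C Q.leadingCoeff * X ^ P.natDegree + C (P.eval 0) := by
    rw [← hQe, hQ, sub_add_cancel]
  obtain ⟨m, hm⟩ := exists_eq_pow_of_injective_pow (l := l) p hN fun x y hxy => h (by
    simp only at hxy ⊢
    rw [hP]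
    simp [hxy])
  exact ⟨m, _, _, hc, by rw [← hm]; exact hP⟩

open Polynomial in
/-- Polynomial group laws are additive up to Frobenius. -/
theorem eval_eq_add_of_injective [IsAlgClosed l] (p : ℕ) [ExpChar l p] {R : MvPolynomial (Fin 2) l} {Q : ℕ} (hQ : Q ≠ 0)
    (hinj : ∀ b, Function.Injective fun s => MvPolynomial.eval ![s, b] R)
    (h0 : ∀ b, MvPolynomial.eval ![0, b] R = b ^ Q)
    (h0' : ∀ s, MvPolynomial.eval ![s, 0] R = s ^ Q) (s b : l) :
    MvPolynomial.eval ![s, b] R = s ^ Q + b ^ Q := by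
  let G : l[X][X] := MvPolynomial.aeval ![X, C X] R
  have hG : ∀ b s, (G.map (evalRingHom b)).eval s = MvPolynomial.eval ![s, b] R := by
    intro b s
    have : (evalRingHom s).comp ((mapRingHom (evalRingHom b)).comp
        (MvPolynomial.aeval ![X, C X] : MvPolynomial (Fin 2) l →ₐ[l] l[X][X]).toRingHom) =
        MvPolynomial.eval ![s, b] := by
      refine MvPolynomial.ringHom_ext (fun r => ?_) fun i => ?_
      · simp [IsScalarTower.algebraMap_apply l l[X] l[X][X]]
      · fin_cases i <;> simp
    exact RingHom.congr_fun this R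
  have hex : ∀ b, ∃ m c e, c ≠ 0 ∧ G.map (evalRingHom b) = C c * X ^ p ^ m + C e := fun b =>
    exists_eq_of_injective_eval p (by simpa only [hG] using hinj b)
  choose m c e hc hGb using hex
  have hcb : ∀ b, c b = MvPolynomial.eval ![1, b] R - MvPolynomial.eval ![0, b] R := fun b => by
    rw [← hG, ← hG, hGb]
    simp [zero_pow (expChar_pow_pos l p _).ne']
  have hc1 : ∀ b, c b = 1 := by
    set D : l[X] := G.eval 1 - G.eval 0 with hD
    have hDb : ∀ b, D.eval b = c b := fun b => by
      rw [hcb, ← hG, ← hG, hD, eval_sub]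
      simp only [eval_map, eval₂_evalRingHom]
      simp [evalEval]
    have hdeg0 : D.degree = 0 := by
      by_contra hne
      obtain ⟨b, hb⟩ := IsAlgClosed.exists_root D hne
      exact hc b (by rw [← hDb]; exact hb)
    intro b
    rw [← hDb, eq_C_of_degree_eq_zero hdeg0, eval_C, ← eval_C (x := (0 : l)) (a := D.coeff 0),
      ← eq_C_of_degree_eq_zero hdeg0, hDb, hcb, h0', h0']
    simp [hQ]
  have hcoef : ∀ i ≠ 0, ∃ d : l, G.coeff i = C d := by
    intro i hi
    have h1 : G.coeff i * (G.coeff i - 1) = 0 := by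
      refine Polynomial.funext fun b => ?_
      have h2 : (G.coeff i).eval b = (G.map (evalRingHom b)).coeff i := by simp [coeff_map]
      rw [eval_mul, eval_sub, eval_one, eval_zero, h2, hGb, hc1]
      simp only [map_one, one_mul, coeff_add, coeff_X_pow, coeff_C, hi, if_false, add_zero]
      split_ifs <;> simp
    rcases mul_eq_zero.1 h1 with h | h
    · exact ⟨0, by simp [h]⟩
    · exact ⟨1, by simp [sub_eq_zero.1 h]⟩
  have hGe : G.map (evalRingHom b) = G.map (evalRingHom 0) +
      C ((G.map (evalRingHom b)).coeff 0 - (G.map (evalRingHom 0)).coeff 0) := by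
    ext i
    rcases eq_or_ne i 0 with rfl | hi
    · simp
    · obtain ⟨d, hd⟩ := hcoef i hi
      simp [coeff_map, hd, coeff_C, hi]
  rw [← hG, hGe, eval_add, hG, h0', eval_C, coeff_zero_eq_eval_zero, coeff_zero_eq_eval_zero, hG,
    hG, h0, h0, zero_pow hQ, sub_zero]

open Polynomial in
/-- If three Frobenius monomials satisfy a linear relation, their exponents agree. -/
lemma eq_of_forall_mul_pow_eq [Infinite l] {A B : l} (hB : B ≠ 0) {i j m : ℕ}
    (h : ∀ x : l, A * x ^ i = B * x ^ j + x ^ m) : j = m := by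
  by_contra hne
  have h1 : C A * X ^ i = C B * X ^ j + (X ^ m : l[X]) := Polynomial.funext fun x => by simp [h]
  have hj := congrArg (fun P => P.coeff j) h1
  have hm := congrArg (fun P => P.coeff m) h1
  simp only [coeff_C_mul, coeff_X_pow, coeff_add, if_true, hne, Ne.symm hne, if_false, mul_one,
    mul_zero, add_zero, zero_add] at hj hm
  split_ifs at hj hm with h2 h3 h3
  · exact hne (h2.trans h3.symm)
  · simp at hm
  · simp at hj; exact hB hj.symm
  · simp at hm

end Poly
end MilnorRec

namespace MilnorRec
open IntermediateField MvPolynomial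

section Recon
variable (p p' ℓ : ℕ) {k l K L : Type*} [Field k] [Field K] [Algebra k K]
  [Field l] [Field L] [Algebra l L] [Fact ℓ.Prime]

/-- An isomorphism between the groups `K^×/ℓ` and `L^×/ℓ` which transports rational lines and
Steinberg relations in both directions. -/
structure Recon (φ : KV ℓ K ≃ₗ[ZMod ℓ] KV ℓ L) : Prop where
  setK : Setup p ℓ k K 5
  setL : Setup p' ℓ l L 3
  half : HalfTransport p k l p' φ
  half' : HalfTransport p' l k p φ.symm

end Recon

section Relation
variable {p p' ℓ : ℕ} {k l K L : Type*} [Field k] [Field K] [Algebra k K]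
  [Field l] [Field L] [Algebra l L] [Fact ℓ.Prime] [IsAlgClosed k] [IsAlgClosed l]
  [ExpChar k p] [ExpChar l p'] {φ : KV ℓ K ≃ₗ[ZMod ℓ] KV ℓ L} {V : Submodule k K}

omit [IsAlgClosed k] [ExpChar k p] [Field l] [IsAlgClosed l] [Field L] in
lemma Res.sum {f : KV ℓ K →ₗ[ZMod ℓ] ZMod ℓ} {O : ValuationSubring K} (h : Compat k f O)
    {r : ℕ} {y : Fin r → K} {a : Fin r → k} (hy : ∀ i, Res O (y i) (a i)) (c : Fin r → k) :
    Res O (∑ i, algebraMap k K (c i) * y i) (∑ i, c i * a i) := by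
  have := Res.aeval h hy (∑ i, C (c i) * X i)
  simpa only [map_sum, map_mul, aeval_C, aeval_X, eval_C, eval_X] using this

omit [ExpChar k p] in
theorem relation_of_chart (R : Recon p p' ℓ (k := k) (l := l) φ) (hV : Good p ℓ k V)
    {r : ℕ} (hr : r ≤ 3) (hr0 : 0 < r) {y : Fin r → K} (hy : ∀ i, y i ∈ V)
    (hli : LinearIndependent k y) {Y : Fin r → L} {π : Fin r → k ≃ l} {ε : Fin r → k → ZMod ℓ}
    (h : ∀ i, Chart φ (y i) (Y i) (π i) (ε i)) {c : Fin r → k} (hc : c ≠ 0) {w : K}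
    (hwc : ∑ i, algebraMap k K (c i) * y i = w) {W : L} {πw : k ≃ l} {εw : k → ZMod ℓ}
    (hw : Chart φ w W πw εw) :
    ∃ (n : ℕ) (P : MvPolynomial (Fin r) l), W ^ p' ^ n = aeval Y P ∧
      ∀ b, πw (∑ i, c i * (π i).symm (b i)) ^ p' ^ n = eval b P := by
  refine R.setL.polynomial_of_determined
    (algebraicIndependent_of_chart R.setL.ne_zero R.half hV hr hy hli h) hw.trans
    (fun b => πw (∑ i, c i * (π i).symm (b i))) (fun f' hf' a b ha hb => ?_) fun b => ?_
  · have hf := R.half'.adm' hf'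
    obtain ⟨O, hO⟩ := hf.exists_compat R.setK.ne_zero
    have h1 := Res.sum hO (fun i => ((h i).sees_iff'.1 (ha i)).res hO) c
    rw [hwc] at h1
    have h2 := (hw.sees_iff'.1 hb).res hO
    rw [h1.unique hO h2, Equiv.apply_symm_apply]
  · obtain ⟨f, hf, hs⟩ := hV.exists_adm hr hy hli (fun i => (π i).symm (b i)) hr0
    refine ⟨f ∘ₗ φ.symm.toLinearMap, R.half.adm hf, fun i => ?_, ?_⟩
    · have h2 := hs (Pi.single i 1) (by simp)
      rw [Finset.sum_eq_single i (by intro j _ hj; simp [hj]) (by simp),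
        Finset.sum_eq_single i (by intro j _ hj; simp [hj]) (by simp)] at h2
      have h3 := ((h i).sees_iff (a := (π i).symm (b i))).1 (by simpa using h2)
      rwa [Equiv.apply_symm_apply] at h3
    · have h2 := hs c hc
      rw [hwc] at h2
      exact hw.sees_iff.1 h2

omit [IsAlgClosed k] [ExpChar k p] [Field K] [Field L] [ExpChar l p'] in
lemma exists_pow_of_relation [ExpChar l p'] {g : l → l} {Q : ℕ} (hQ : ∃ n, Q = p' ^ n) (hg : Function.Injective g)
    (h0 : g 0 = 0) {P : Polynomial l} (hP : ∀ b, g b ^ Q = P.eval b) :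
    ∃ m, ∀ b, g b ^ Q = g 1 ^ Q * b ^ p' ^ m := by
  obtain ⟨n, rfl⟩ := hQ
  obtain ⟨m, c, e, -, h⟩ := exists_eq_of_injective_eval p' (P := P) fun x y hxy => by
    simp only [← hP] at hxy
    exact hg (iterateFrobenius_inj l p' n (by simpa [iterateFrobenius_def] using hxy))
  have hpos := (expChar_pow_pos l p' m).ne'
  have hposn := (expChar_pow_pos l p' n).ne'
  have he : e = 0 := by
    have := hP 0
    rw [h, h0] at this
    simpa [zero_pow hpos, zero_pow hposn] using this.symm
  refine ⟨m, fun b => ?_⟩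
  rw [hP, hP, h, he]
  simp

omit [IsAlgClosed l] in
/-- The polynomial obtained by restricting to a coordinate line through the origin. -/
lemma exists_eval_single {r : ℕ} (P : MvPolynomial (Fin r) l) (i : Fin r) :
    ∃ P' : Polynomial l, ∀ b, P'.eval b = eval (Pi.single i b) P := by
  refine ⟨aeval (Pi.single i Polynomial.X) P, fun b => ?_⟩
  have : (Polynomial.evalRingHom b).comp (aeval (Pi.single i Polynomial.X) :
      MvPolynomial (Fin r) l →ₐ[l] Polynomial l).toRingHom = eval (Pi.single i b) := by
    refine ringHom_ext (fun r => by simp) fun j => ?_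
    rcases eq_or_ne j i with rfl | hj
    · simp
    · simp [hj]
  exact RingHom.congr_fun this P

/-- A linear combination of charts determines each coordinate bijection up to Frobenius. -/
theorem exists_pow_of_chart (R : Recon p p' ℓ (k := k) (l := l) φ) (hV : Good p ℓ k V)
    {r : ℕ} (hr : r ≤ 3) (hr0 : 0 < r) {y : Fin r → K} (hy : ∀ i, y i ∈ V)
    (hli : LinearIndependent k y) {Y : Fin r → L} {π : Fin r → k ≃ l} {ε : Fin r → k → ZMod ℓ}
    (h : ∀ i, Chart φ (y i) (Y i) (π i) (ε i)) {c : Fin r → k} (hc : ∀ i, c i ≠ 0) {w : K}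
    (hwc : ∑ i, algebraMap k K (c i) * y i = w) {W : L} {πw : k ≃ l} {εw : k → ZMod ℓ}
    (hw : Chart φ w W πw εw) (h0 : ∀ i, π i 0 = 0) (hw0 : πw 0 = 0) (h1 : ∀ i, π i 1 = 1) :
    ∃ n, ∀ i, ∃ m, ∀ a, πw (c i * a) ^ p' ^ n = πw (c i) ^ p' ^ n * π i a ^ p' ^ m := by
  obtain ⟨n, P, -, hP⟩ := relation_of_chart R hV hr hr0 hy hli h
    (fun h => hc ⟨0, hr0⟩ (congrFun h _)) hwc hw
  refine ⟨n, fun i => ?_⟩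
  obtain ⟨P', hP'⟩ := exists_eval_single P i
  have hs0 : ∀ j, (π j).symm 0 = 0 := fun j => by rw [Equiv.symm_apply_eq, h0]
  have hs1 : (π i).symm 1 = 1 := by rw [Equiv.symm_apply_eq, h1]
  obtain ⟨m, hm⟩ := exists_pow_of_relation (p' := p') (g := fun b => πw (c i * (π i).symm b))
    (P := P') ⟨n, rfl⟩ (fun x y hxy => by simpa [hc i] using hxy) (by simp [hs0, hw0]) fun b => by
      rw [hP', ← hP]
      rw [Finset.sum_eq_single i (by intro j _ hj; simp [hj, hs0]) (by simp)]
      simp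
  refine ⟨m, fun a => ?_⟩
  have := hm (π i a)
  simpa [hs1] using this

end Relation
end MilnorRec

namespace MilnorRec
open IntermediateField MvPolynomial

section Common
variable {p p' ℓ : ℕ} {k l K L : Type*} [Field k] [Field K] [Algebra k K]
  [Field l] [Field L] [Algebra l L] [Fact ℓ.Prime] [IsAlgClosed k] [IsAlgClosed l]
  [ExpChar k p] [ExpChar l p'] {φ : KV ℓ K ≃ₗ[ZMod ℓ] KV ℓ L} {V : Submodule k K}

omit [ExpChar k p] [ExpChar l p'] in
lemma exists_normalized_chart (R : Recon p p' ℓ (k := k) (l := l) φ) (hV : Good p ℓ k V) {y : K}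
    (hy : y ∈ V) (hy0 : y ≠ 0) :
    ∃ Y π ε, Chart φ y Y (π : k ≃ l) ε ∧ π 0 = 0 ∧ π 1 = 1 := by
  obtain ⟨Y, π, ε, h⟩ := exists_chart R.setL.ne_zero R.half hV hy hy0
  have h01 : π 1 - π 0 ≠ 0 := sub_ne_zero.2 (π.injective.ne one_ne_zero)
  obtain ⟨Y', π', h', hc⟩ := h.affine (β := -((π 1 - π 0)⁻¹ * π 0)) (inv_ne_zero h01)
  refine ⟨Y', π', ε, hc, ?_, ?_⟩
  · rw [h']; ring
  · rw [h', ← sub_eq_add_neg, ← mul_sub, inv_mul_cancel₀ h01]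

omit [IsAlgClosed k] [ExpChar k p] in
/-- Twisting a chart by a power of Frobenius. -/
lemma Chart.twist' (R : Recon p p' ℓ (k := k) (l := l) φ) {y : K} {Y : L} {π π₀ : k ≃ l}
    {ε : k → ZMod ℓ} (h : Chart φ y Y π ε) {n m : ℕ} (hπ : ∀ a, π₀ a ^ p' ^ n = π a ^ p' ^ m) :
    ∃ Y₀ c, Chart φ y Y₀ π₀ fun a => c * ε a := by
  have : PerfectRing l p' := inferInstance
  obtain ⟨Y₀, h0⟩ := h.twist R.setL.ne_zero R.setL.perf hπ
  refine ⟨Y₀, ((p' ^ m : ℕ) : ZMod ℓ)⁻¹ * ((p' ^ n : ℕ) : ZMod ℓ), ?_⟩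
  convert h0 using 2
  ring

lemma frobenius_related (R : Recon p p' ℓ (k := k) (l := l) φ) (hV : Good p ℓ k V)
    {y : Fin 2 → K} (hy : ∀ i, y i ∈ V) (hli : LinearIndependent k y) {Y : Fin 2 → L}
    {π : Fin 2 → k ≃ l} {ε : Fin 2 → k → ZMod ℓ} (h : ∀ i, Chart φ (y i) (Y i) (π i) (ε i))
    (h0 : ∀ i, π i 0 = 0) (h1 : ∀ i, π i 1 = 1) :
    ∃ n m, ∀ a, π 0 a ^ p' ^ n = π 1 a ^ p' ^ m := by
  have hwV : y 0 + y 1 ∈ V := V.add_mem (hy 0) (hy 1)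
  have hw0 : y 0 + y 1 ≠ 0 := fun hs => by
    have := Fintype.linearIndependent_iff.1 hli (fun _ => 1) (by simpa using hs) 0
    exact one_ne_zero this
  obtain ⟨W, πw, εw, hw, hw0, hw1⟩ := exists_normalized_chart R hV hwV hw0
  obtain ⟨n, hn⟩ := exists_pow_of_chart R hV (by norm_num) (by norm_num) hy hli h (c := fun _ => 1)
    (by simp) (by simp) hw h0 hw0 h1
  obtain ⟨m, hm⟩ := hn 0
  obtain ⟨m', hm'⟩ := hn 1
  refine ⟨m, m', fun a => ?_⟩
  simpa [hw1] using (hm a).symm.trans (hm' a)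

/-- All the elements of a good space have charts with the same bijection on constants. -/
lemma exists_common_bijection (R : Recon p p' ℓ (k := k) (l := l) φ) (hV : Good p ℓ k V)
    {y₀ z₀ : K} (hy₀ : y₀ ∈ V) (hz₀ : z₀ ∈ V) (hli : LinearIndependent k ![y₀, z₀]) :
    ∃ π : k ≃ l, π 0 = 0 ∧ π 1 = 1 ∧ ∀ y ∈ V, y ≠ 0 → ∃ Y ε, Chart φ y Y π ε := by
  have hy0 : y₀ ≠ 0 := hli.ne_zero 0
  have hz0 : z₀ ≠ 0 := hli.ne_zero 1
  obtain ⟨Y₀, π, ε₀, hc₀, h0, h1⟩ := exists_normalized_chart R hV hy₀ hy0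
  have key : ∀ y ∈ V, ∀ z ∈ V, LinearIndependent k ![y, z] →
      (∃ Y ε, Chart φ y Y π ε) → ∃ Y ε, Chart φ z Y π ε := by
    rintro y hy z hz hyz ⟨Y, ε, hY⟩
    obtain ⟨Z, πz, εz, hZ, hz0, hz1⟩ := exists_normalized_chart R hV hz (hyz.ne_zero 1)
    obtain ⟨n, m, hnm⟩ := frobenius_related R hV (y := ![y, z]) (by simp [Fin.forall_fin_two, hy, hz])
      hyz (Y := ![Y, Z]) (π := ![π, πz]) (ε := ![ε, εz]) (by simp [Fin.forall_fin_two, hY, hZ])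
      (by simp [Fin.forall_fin_two, h0, hz0]) (by simp [Fin.forall_fin_two, h1, hz1])
    obtain ⟨Z', c, hZ'⟩ := hZ.twist' R hnm
    exact ⟨_, _, hZ'⟩
  refine ⟨π, h0, h1, fun y hy hyne => ?_⟩
  have hz := key y₀ hy₀ z₀ hz₀ hli ⟨_, _, hc₀⟩
  by_cases hyli : LinearIndependent k ![y₀, y]
  · exact key y₀ hy₀ y hy hyli ⟨_, _, hc₀⟩
  · refine key z₀ hz₀ y hy ?_ hz
    rw [LinearIndependent.pair_iff' hy0] at hyli hli
    rw [LinearIndependent.pair_iff' hz0]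
    push Not at hyli
    obtain ⟨a, rfl⟩ := hyli
    intro b hb
    have ha : a ≠ 0 := by rintro rfl; simp at hyne
    have hb0 : b ≠ 0 := by rintro rfl; rw [zero_smul] at hb; exact hyne hb.symm
    exact hli (b⁻¹ * a) (by rw [mul_smul, ← hb, smul_smul, inv_mul_cancel₀ hb0, one_smul])

omit [IsAlgClosed l] in
lemma pow_frobenius_injective (n : ℕ) : Function.Injective fun x : l => x ^ p' ^ n := fun x y h =>
  iterateFrobenius_inj l p' n (by simpa [iterateFrobenius_def] using h)

theorem exists_ringEquiv (R : Recon p p' ℓ (k := k) (l := l) φ) (hV : Good p ℓ k V)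
    {y₀ z₀ : K} (hy₀ : y₀ ∈ V) (hz₀ : z₀ ∈ V) (hli : LinearIndependent k ![y₀, z₀]) :
    ∃ π : k ≃+* l, ∀ y ∈ V, y ≠ 0 → ∃ Y ε, Chart φ y Y π.toEquiv ε := by
  obtain ⟨π, h0, h1, hπ⟩ := exists_common_bijection R hV hy₀ hz₀ hli
  have hy0 : y₀ ≠ 0 := hli.ne_zero 0
  have hz0 : z₀ ≠ 0 := hli.ne_zero 1
  obtain ⟨Y, εy, hY⟩ := hπ y₀ hy₀ hy0
  obtain ⟨Z, εz, hZ⟩ := hπ z₀ hz₀ hz0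
  have hadd : ∀ a b, π (a + b) = π a + π b := by
    have hw0 : y₀ + z₀ ≠ 0 := fun hs => by
      have := Fintype.linearIndependent_iff.1 hli (fun _ => 1) (by simpa using hs) 0
      exact one_ne_zero this
    obtain ⟨W, εw, hW⟩ := hπ _ (V.add_mem hy₀ hz₀) hw0
    obtain ⟨n, P, -, hP⟩ := relation_of_chart R hV (by norm_num) (by norm_num) (y := ![y₀, z₀])
      (by simp [Fin.forall_fin_two, hy₀, hz₀]) hli (Y := ![Y, Z]) (π := ![π, π]) (ε := ![εy, εz])
      (by simp [Fin.forall_fin_two, hY, hZ]) (c := ![1, 1]) (by simp) (by simp) hW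
    have hP' : ∀ s b, π (π.symm s + π.symm b) ^ p' ^ n = eval ![s, b] P := fun s b => by
      rw [← hP]; simp
    have hs0 : π.symm 0 = 0 := by rw [Equiv.symm_apply_eq, h0]
    have key := eval_eq_add_of_injective p' (R := P) (expChar_pow_pos l p' n).ne'
      (fun b x y hxy => by
        simp only [← hP'] at hxy
        simpa using pow_frobenius_injective n hxy)
      (fun b => by rw [← hP', hs0, zero_add, Equiv.apply_symm_apply])
      (fun b => by rw [← hP', hs0, add_zero, Equiv.apply_symm_apply])
    intro a b
    have := key (π a) (π b)
    rw [← hP', ← add_pow_expChar_pow] at this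
    simpa using pow_frobenius_injective n this
  have hmul' : ∀ c ≠ 0, ∃ n m, ∀ a, π (c * a) ^ p' ^ n = π c ^ p' ^ n * π a ^ p' ^ m := by
    intro c hc
    have hcy : algebraMap k K c * y₀ ≠ 0 := mul_ne_zero (by simpa using hc) hy0
    obtain ⟨W, εw, hW⟩ := hπ (algebraMap k K c * y₀)
      (by rw [← Algebra.smul_def]; exact V.smul_mem _ hy₀) hcy
    obtain ⟨n, hn⟩ := exists_pow_of_chart R hV (r := 1) (by norm_num) (by norm_num) (y := fun _ => y₀)
      (fun _ => hy₀) (LinearIndependent.of_subsingleton 0 hy0) (Y := fun _ => Y) (π := fun _ => π)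
      (ε := fun _ => εy) (fun _ => hY) (c := fun _ => c) (fun _ => hc) (by simp) hW
      (fun _ => h0) h0 fun _ => h1
    exact ⟨n, hn 0⟩
  have hneg : ∀ a, π (-a) = -π a := fun a => by
    have := hadd (-a) a
    rw [neg_add_cancel, h0] at this
    exact eq_neg_of_add_eq_zero_left this.symm
  have hmul : ∀ c a, π (c * a) = π c * π a := by
    intro c a
    rcases eq_or_ne c 0 with rfl | hc
    · simp [h0]
    rcases eq_or_ne (c + 1) 0 with hc1 | hc1
    · rw [eq_neg_of_add_eq_zero_left hc1, hneg, h1, neg_one_mul, neg_one_mul, hneg]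
    obtain ⟨n, m, hnm⟩ := hmul' c hc
    obtain ⟨n₁, m₁, hnm₁⟩ := hmul' (c + 1) hc1
    have hπc : π c ≠ 0 := fun h => hc (π.injective (h.trans h0.symm))
    have key : p' ^ m * p' ^ n₁ = p' ^ n * p' ^ n₁ := by
      refine eq_of_forall_mul_pow_eq (A := (π (c + 1)) ^ (p' ^ n₁ * p' ^ n))
        (B := π c ^ (p' ^ n * p' ^ n₁)) (pow_ne_zero _ hπc) (i := p' ^ m₁ * p' ^ n) fun x => ?_
      obtain ⟨a, rfl⟩ := π.surjective x
      rw [pow_mul, pow_mul (π a) (p' ^ m₁), ← mul_pow, ← hnm₁, pow_mul (π c), pow_mul (π a) (p' ^ m),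
        ← mul_pow, ← hnm, add_mul, one_mul, hadd, ← pow_mul, ← pow_mul, ← pow_add, ← pow_add,
        add_comm n₁ n, add_pow_expChar_pow]
    have hQ : p' ^ m = p' ^ n := Nat.eq_of_mul_eq_mul_right (expChar_pow_pos l p' n₁) key
    have := hnm a
    rw [hQ, ← mul_pow] at this
    exact pow_frobenius_injective n this
  exact ⟨{ π with map_mul' := hmul, map_add' := hadd }, hπ⟩

end Common
end MilnorRec

namespace MilnorRec
open IntermediateField MvPolynomial

section Semilinear
variable {p p' ℓ : ℕ} {k l K L : Type*} [Field k] [Field K] [Algebra k K]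
  [Field l] [Field L] [Algebra l L] [Fact ℓ.Prime] [IsAlgClosed k] [IsAlgClosed l]
  [ExpChar k p] [ExpChar l p'] {φ : KV ℓ K ≃ₗ[ZMod ℓ] KV ℓ L} {V : Submodule k K}

/-- Charts are compatible with linear combinations. -/
theorem Chart.sum_eq (R : Recon p p' ℓ (k := k) (l := l) φ) (hV : Good p ℓ k V) {π : k ≃+* l}
    {r : ℕ} (hr : r ≤ 3) (hr0 : 0 < r) {y : Fin r → K} (hy : ∀ i, y i ∈ V)
    (hli : LinearIndependent k y) {Y : Fin r → L} {ε : Fin r → k → ZMod ℓ}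
    (h : ∀ i, Chart φ (y i) (Y i) π.toEquiv (ε i)) {c : Fin r → k} (hc : c ≠ 0) {w : K}
    (hwc : ∑ i, algebraMap k K (c i) * y i = w) {W : L} {εw : k → ZMod ℓ}
    (hw : Chart φ w W π.toEquiv εw) : W = ∑ i, algebraMap l L (π (c i)) * Y i := by
  obtain ⟨n, P, hW, hP⟩ := relation_of_chart R hV hr hr0 hy hli h hc hwc hw
  have h1 : P = (∑ i, C (π (c i)) * X i) ^ p' ^ n := MvPolynomial.funext fun b => by
    rw [← hP]; simp
  have hL : ExpChar L p' := expChar_of_injective_algebraMap (algebraMap l L).injective p'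
  refine iterateFrobenius_inj L p' n ?_
  rw [iterateFrobenius_def, iterateFrobenius_def, hW, h1]
  simp

omit [IsAlgClosed k] [ExpChar k p] in
/-- The coordinate of a chart is determined by the bijection on constants. -/
theorem Chart.unique (R : Recon p p' ℓ (k := k) (l := l) φ) (hV : Good p ℓ k V) {y : K}
    (hy : y ∈ V) (hy0 : y ≠ 0) {Y Y' : L} {π : k ≃ l} {ε ε' : k → ZMod ℓ}
    (h : Chart φ y Y π ε) (h' : Chart φ y Y' π ε') : Y = Y' ∧ ε = ε' := by
  have hYY : Y = Y' := by
    refine sub_eq_zero.1 (R.setL.eq_zero_of_res {Y} (by simpa using h.trans) fun f hf hs O hO => ?_)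
    obtain ⟨b, hb⟩ := hs Y (by simp)
    have hb' : Sees l f Y' b := h'.sees_iff'.2 (h.sees_iff'.1 hb)
    simpa using (hb.res hO).sub hO (hb'.res hO)
  refine ⟨hYY, funext fun a => ?_⟩
  subst hYY
  obtain ⟨f, -, hf, -⟩ := hV.exists_dual hy hy0 a
  have h1 := h.apply f a
  rw [h'.apply f a] at h1 hf
  exact (mul_right_cancel₀ (right_ne_zero_of_mul_eq_one hf) h1).symm

lemma ε_eq_of_linearIndependent (R : Recon p p' ℓ (k := k) (l := l) φ) (hV : Good p ℓ k V)
    {π : k ≃+* l} (hπ : ∀ y ∈ V, y ≠ 0 → ∃ Y ε, Chart φ y Y π.toEquiv ε) {y z : K}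
    (hy : y ∈ V) (hz : z ∈ V) (hli : LinearIndependent k ![y, z]) {Y Z : L} {ε ε' : k → ZMod ℓ}
    (hY : Chart φ y Y π.toEquiv ε) (hZ : Chart φ z Z π.toEquiv ε') (a b : k) : ε a = ε' b := by
  have hw0 : y + z ≠ 0 := fun hs => by
    have := Fintype.linearIndependent_iff.1 hli (fun _ => 1) (by simpa using hs) 0
    exact one_ne_zero this
  obtain ⟨W, δ, hW⟩ := hπ _ (V.add_mem hy hz) hw0
  have hWe : W = Y + Z := by
    have := Chart.sum_eq R hV (by norm_num) (by norm_num) (y := ![y, z])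
      (by simp [Fin.forall_fin_two, hy, hz]) hli (Y := ![Y, Z]) (ε := ![ε, ε'])
      (Fin.forall_fin_two.2 ⟨hY, hZ⟩) (c := ![1, 1]) (by simp) (by simp) hW
    simpa using this
  have key : ∀ {y z : K} {Y Z : L} {ε ε' : k → ZMod ℓ} {a b : k}, y ∈ V → z ∈ V →
      LinearIndependent k ![y, z] → Chart φ y Y π.toEquiv ε → Chart φ z Z π.toEquiv ε' →
      Chart φ (y + z) (Y + Z) π.toEquiv δ → ε a = δ (a + b) := by
    intro y z Y Z ε ε' a b hy hz hli hY hZ hW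
    obtain ⟨f, hf, hn⟩ := hV.arc 2 (by norm_num) ![y, z] (by simp [Fin.forall_fin_two, hy, hz]) hli
      ![1, ℓ] (by simp [Fin.forall_fin_two, (Fact.out : ℓ.Prime).pos]) ⟨0, by simp⟩ ![a, b]
    have h1 := (hn ![1, 0] 0 (by simp) (by simp [Fin.forall_fin_two])).1
    have h2 := (hn ![0, 1] 1 (by simp) (by simp [Fin.forall_fin_two])).1
    have h3 := (hn ![1, 1] 0 (by simp)
      (by simpa [Fin.forall_fin_two] using (Fact.out : ℓ.Prime).one_le)).1
    have e3 : y - algebraMap k K a + (z - algebraMap k K b) = y + z - algebraMap k K (a + b) := by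
      rw [map_add]; ring
    simp only [Fin.sum_univ_two, Matrix.cons_val_zero, Matrix.cons_val_one, map_one, map_zero,
      one_mul, zero_mul, add_zero, zero_add, Nat.cast_one, CharP.cast_eq_zero, e3] at h1 h2 h3
    rw [hY.apply] at h1
    rw [hZ.apply, mul_eq_zero, or_iff_right (hZ.ne_zero _)] at h2
    rw [hW.apply] at h3
    obtain ⟨O, hO⟩ := (R.half.adm hf).exists_compat R.setL.ne_zero
    have e4 : Y - algebraMap l L (π a) + algebraMap l L 1 * (Z - algebraMap l L (π b)) =
        Y + Z - algebraMap l L (π (a + b)) := by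
      rw [map_add, map_add, map_one]; ring
    have hne := right_ne_zero_of_mul_eq_one h1
    rcases hO.add_const (sub_const_ne_zero hY.trans (π a)) (sub_const_ne_zero hZ.trans (π b))
      (fun h => hne (h.trans h2)) with h | h
    · have := h 1 one_ne_zero
      rw [e4] at this
      exact absurd (this.trans h2) (right_ne_zero_of_mul_eq_one h3)
    · have := h 1 one_ne_zero
      rw [e4] at this
      rw [show π.toEquiv (a + b) = π (a + b) from rfl, this] at h3
      exact mul_right_cancel₀ hne (h1.trans h3.symm)
  rw [key (b := b) hy hz hli hY hZ (hWe ▸ hW), add_comm a b]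
  refine (key hz hy ?_ hZ hY (by rw [add_comm z, add_comm Z, ← hWe]; exact hW)).symm
  exact LinearIndependent.pair_symm_iff.1 hli

/-- The charts of a good space are given by a field isomorphism and a common factor. -/
theorem exists_uniform_chart (R : Recon p p' ℓ (k := k) (l := l) φ) (hV : Good p ℓ k V)
    {y₀ z₀ : K} (hy₀ : y₀ ∈ V) (hz₀ : z₀ ∈ V) (hli : LinearIndependent k ![y₀, z₀]) :
    ∃ (π : k ≃+* l) (e : ZMod ℓ), ∀ y ∈ V, y ≠ 0 → ∃ Y, Chart φ y Y π.toEquiv fun _ => e := by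
  obtain ⟨π, hπ⟩ := exists_ringEquiv R hV hy₀ hz₀ hli
  have hy0 : y₀ ≠ 0 := hli.ne_zero 0
  have hz0 : z₀ ≠ 0 := hli.ne_zero 1
  obtain ⟨Y₀, ε, hY₀⟩ := hπ y₀ hy₀ hy0
  obtain ⟨Z₀, δ, hZ₀⟩ := hπ z₀ hz₀ hz0
  have hε : ∀ a, ε a = δ 0 := fun a => ε_eq_of_linearIndependent R hV hπ hy₀ hz₀ hli hY₀ hZ₀ a 0
  have hδ : ∀ a, δ a = δ 0 := fun a =>
    (ε_eq_of_linearIndependent R hV hπ hy₀ hz₀ hli hY₀ hZ₀ 0 a).symm.trans (hε 0)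
  refine ⟨π, δ 0, fun y hy hyne => ?_⟩
  obtain ⟨Y, η, hY⟩ := hπ y hy hyne
  suffices h : η = fun _ => δ 0 from ⟨Y, h ▸ hY⟩
  funext a
  by_cases hyli : LinearIndependent k ![y₀, y]
  · rw [← hε 0]
    exact (ε_eq_of_linearIndependent R hV hπ hy₀ hy hyli hY₀ hY 0 a).symm
  · refine (ε_eq_of_linearIndependent R hV hπ hz₀ hy ?_ hZ₀ hY 0 a).symm
    rw [LinearIndependent.pair_iff' hy0] at hyli hli
    rw [LinearIndependent.pair_iff' hz0]
    push Not at hyli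
    obtain ⟨a, rfl⟩ := hyli
    intro b hb
    have ha : a ≠ 0 := by rintro rfl; simp at hyne
    have hb0 : b ≠ 0 := by rintro rfl; rw [zero_smul] at hb; exact hyne hb.symm
    exact hli (b⁻¹ * a) (by rw [mul_smul, ← hb, smul_smul, inv_mul_cancel₀ hb0, one_smul])

/-- Two good spaces with a common nonzero element have the same charts. -/
theorem uniform_chart_of_mem (R : Recon p p' ℓ (k := k) (l := l) φ) (hV : Good p ℓ k V)
    {y₀ z₀ : K} (hy₀ : y₀ ∈ V) (hz₀ : z₀ ∈ V) (hli : LinearIndependent k ![y₀, z₀])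
    {π : k ≃+* l} {e : ZMod ℓ} {x : K} (hx : x ∈ V) (hx0 : x ≠ 0) {X₁ : L}
    (hX : Chart φ x X₁ π.toEquiv fun _ => e) {y : K} (hy : y ∈ V) (hyne : y ≠ 0) :
    ∃ Y, Chart φ y Y π.toEquiv fun _ => e := by
  obtain ⟨π', e', h'⟩ := exists_uniform_chart R hV hy₀ hz₀ hli
  obtain ⟨X', hX'⟩ := h' x hx hx0
  obtain ⟨n, hn⟩ := exists_pow_of_chart R hV (r := 1) (by norm_num) (by norm_num) (y := fun _ => x)
    (fun _ => hx) (LinearIndependent.of_subsingleton 0 hx0) (fun _ => hX') (c := fun _ => 1)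
    (by simp) (by simp) hX (by simp) (by simp) (by simp)
  obtain ⟨m, hm⟩ := hn 0
  have hπ : ∀ a, π.toEquiv a ^ p' ^ n = π'.toEquiv a ^ p' ^ m := fun a => by simpa using hm a
  obtain ⟨Y', hY'⟩ := h' y hy hyne
  have : PerfectRing l p' := inferInstance
  obtain ⟨Y, hY⟩ := hY'.twist R.setL.ne_zero R.setL.perf hπ
  obtain ⟨X₃, hX₃⟩ := hX'.twist R.setL.ne_zero R.setL.perf hπ
  refine ⟨Y, ?_⟩
  rwa [(Chart.unique R hV hx hx0 hX hX₃).2]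

end Semilinear
end MilnorRec

namespace MilnorRec
open IntermediateField MvPolynomial

section Exchange
variable {k K ι : Type*} [Field k] [Field K] [Algebra k K] [Finite ι] [DecidableEq ι]

lemma exists_isTranscendenceBasis_update {x : ι → K} (hx : IsTranscendenceBasis k x) {w : K}
    (hw : Transcendental k w) : ∃ i₀, IsTranscendenceBasis k (Function.update x i₀ w) := by
  by_cases hwx : w ∈ Set.range x
  · obtain ⟨i, rfl⟩ := hwx
    exact ⟨i, by rwa [Function.update_eq_self]⟩
  have hind : AlgebraicIndepOn k id ({w} : Set K) := by
    have : AlgebraicIndependent k fun i : ({w} : Set K) => (i : K) :=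
      (algebraicIndependent_unique_type_iff (ι := ({w} : Set K))).2 hw
    exact this
  have hA := hx.isAlgebraic
  have halg : Algebra.IsAlgebraic (Algebra.adjoin k (insert w (Set.range x))) K :=
    ⟨fun a => (hA.isAlgebraic a).adjoin_of_forall_isAlgebraic (by
      rintro y ⟨h1, h2⟩; exact absurd (Set.mem_insert_of_mem _ h1) h2)⟩
  obtain ⟨u, hwu, hux, hu⟩ := exists_isTranscendenceBasis_between {w} (insert w (Set.range x))
    (by simp) hind
  obtain ⟨i₀, hi₀⟩ : ∃ i, x i ∉ u := by
    by_contra! h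
    have hueq : u = insert w (Set.range x) := hux.antisymm
      (Set.insert_subset (hwu rfl) (by rintro _ ⟨i, rfl⟩; exact h i))
    have h1 := hx.lift_cardinalMk_eq hu
    have h2 : Nat.card ι = u.ncard := by
      have := congrArg Cardinal.toNat h1
      rw [← Nat.card_coe_set_eq]
      simpa [Nat.card] using this
    rw [hueq, Set.ncard_insert_of_notMem hwx (Set.finite_range x), ← Nat.card_coe_set_eq,
      Nat.card_range_of_injective hx.1.injective] at h2
    omega
  refine ⟨i₀, hx.of_isAlgebraic fun i => ?_⟩
  have huA := hu.isAlgebraic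
  rw [Subtype.range_coe] at huA
  refine (huA.isAlgebraic (x i)).adjoin_of_forall_isAlgebraic ?_
  rintro y ⟨h1, h2⟩
  refine absurd ?_ h2
  rcases hux h1 with rfl | ⟨j, rfl⟩
  · exact ⟨i₀, by simp⟩
  · exact ⟨j, Function.update_of_ne (fun h : j = i₀ => hi₀ (by rwa [← h])) _ _⟩

lemma isTranscendenceBasis_scale {x : ι → K} (hx : IsTranscendenceBasis k x) (i₀ : ι)
    (s : Set ι) [DecidablePred (· ∈ s)] :
    IsTranscendenceBasis k fun i => if i = i₀ then x i₀ else if i ∈ s then x i₀ * x i else x i := by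
  set x' : ι → K := fun i => if i = i₀ then x i₀ else if i ∈ s then x i₀ * x i else x i with hx'
  have h0 : x i₀ ∈ adjoin k (Set.range x') := subset_adjoin _ _ ⟨i₀, by simp [hx']⟩
  have hne : x i₀ ≠ 0 := hx.1.ne_zero i₀
  refine hx.of_mem_adjoin fun i => ?_
  have hi : x' i ∈ adjoin k (Set.range x') := subset_adjoin _ _ ⟨i, rfl⟩
  by_cases h1 : i = i₀
  · rwa [h1]
  by_cases h2 : i ∈ s
  · have : x i = x' i / x i₀ := by simp [hx', h1, h2, mul_div_cancel_left₀ _ hne]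
    rw [this]
    exact div_mem hi h0
  · simpa [hx', h1, h2] using hi

end Exchange

section Ortho
variable {k K ι : Type*} [Field k] [Field K] [Algebra k K] [Fintype ι]

/-- Two linear conditions on three coordinates have a nonzero solution. -/
lemma exists_orthogonal_pair (v w : Fin 3 → k) :
    ∃ c : Fin 3 → k, c ≠ 0 ∧ ∑ i, c i * v i = 0 ∧ ∑ i, c i * w i = 0 := by
  let F : (Fin 3 → k) →ₗ[k] (Fin 2 → k) := LinearMap.pi ![Fintype.linearCombination k v,
    Fintype.linearCombination k w]
  have hF : ¬ Function.Injective F := fun h => by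
    have := LinearMap.finrank_le_finrank_of_injective h
    simp at this
  rw [← LinearMap.ker_eq_bot, Submodule.eq_bot_iff] at hF
  push Not at hF
  obtain ⟨c, hc, hc0⟩ := hF
  have hc' := LinearMap.mem_ker.1 hc
  refine ⟨c, hc0, ?_, ?_⟩
  · simpa [F, Fintype.linearCombination_apply] using congrFun hc' 0
  · simpa [F, Fintype.linearCombination_apply] using congrFun hc' 1

lemma lin_sum_eq (x : ι → K) {j : Fin 3 → ι} (hj : Function.Injective j) (c : Fin 3 → k) :
    ∃ c' : ι → k, lin x c' = ∑ i, algebraMap k K (c i) * x (j i) ∧ (∀ v : ι → k,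
      ∑ i, c' i * v i = ∑ i, c i * v (j i)) ∧ (c ≠ 0 → c' ≠ 0) := by
  classical
  refine ⟨Function.extend j c 0, ?_, fun v => ?_, fun hc h0 => hc ?_⟩
  · unfold lin
    symm
    rw [← Finset.sum_subset (Finset.subset_univ (Finset.univ.map ⟨j, hj⟩)), Finset.sum_map]
    · exact Finset.sum_congr rfl fun i _ => by simp [hj.extend_apply]
    · intro i _ hi
      rw [Function.extend_apply' _ _ _ (by simpa using hi)]; simp
  · symm
    rw [← Finset.sum_subset (Finset.subset_univ (Finset.univ.map ⟨j, hj⟩)), Finset.sum_map]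
    · exact Finset.sum_congr rfl fun i _ => by simp [hj.extend_apply]
    · intro i _ hi
      rw [Function.extend_apply' _ _ _ (by simpa using hi)]; simp
  · funext i
    rw [← hj.extend_apply c 0 i, h0]; simp

/-- Hyperplane sections of two coordinate systems with three common coordinates meet. -/
lemma exists_mem_hyp_inf {x x' : ι → K} (hx : IsTranscendenceBasis k x) {j : Fin 3 → ι}
    (hj : Function.Injective j) (h : ∀ i, x (j i) = x' (j i)) (v v' : ι → k) :
    ∃ y ∈ hyp x v, y ≠ 0 ∧ y ∈ hyp x' v' := by
  obtain ⟨c, hc, h1, h2⟩ := exists_orthogonal_pair (v ∘ j) (v' ∘ j)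
  obtain ⟨c₁, e1, f1, g1⟩ := lin_sum_eq x hj c
  obtain ⟨c₂, e2, f2, -⟩ := lin_sum_eq x' hj c
  refine ⟨_, mem_hyp.2 ⟨c₁, (f1 v).trans h1, rfl⟩,
    fun h0 => (transcendental_lin hx (g1 hc)) (h0 ▸ isAlgebraic_zero), ?_⟩
  rw [e1]
  simp only [h, ← e2]
  exact mem_hyp.2 ⟨c₂, (f2 v').trans h2, rfl⟩

lemma exists_linearIndependent_mem_hyp {x : ι → K} (hx : IsTranscendenceBasis k x) (v : ι → k)
    {r : ℕ} (hι : r + 1 ≤ Fintype.card ι) :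
    ∃ y : Fin r → K, (∀ i, y i ∈ hyp x v) ∧ LinearIndependent k y := by
  have hli : LinearIndependent k x := hx.1.linearIndependent
  have h1 : r ≤ Module.finrank k (hyp x v) := by
    have hinj : Function.Injective (Fintype.linearCombination k x) :=
      linearIndependent_iff_injective_fintypeLinearCombination.1 hli
    rw [hyp, ← (Submodule.equivMapOfInjective _ hinj _).finrank_eq]
    have := LinearMap.finrank_range_add_finrank_ker (Fintype.linearCombination k v)
    have h2 := Submodule.finrank_le (LinearMap.range (Fintype.linearCombination k v))
    rw [Module.finrank_self] at h2
    rw [Module.finrank_pi] at this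
    omega
  obtain ⟨b, hb⟩ : ∃ b : Fin r → hyp x v, LinearIndependent k b :=
    exists_linearIndependent_of_le_finrank h1
  exact ⟨_, fun i => (b i).2, hb.map' (hyp x v).subtype (Submodule.ker_subtype _)⟩

lemma exists_pair_mem_hyp {x : ι → K} (hx : IsTranscendenceBasis k x)
    (hι : 3 ≤ Fintype.card ι) (v : ι → k) :
    ∃ y ∈ hyp x v, ∃ z ∈ hyp x v, LinearIndependent k ![y, z] := by
  obtain ⟨b, hb, hli⟩ := exists_linearIndependent_mem_hyp hx v hι
  refine ⟨b 0, hb 0, b 1, hb 1, ?_⟩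
  have hbv : ![b 0, b 1] = b := by funext i; fin_cases i <;> rfl
  rwa [hbv]

end Ortho
end MilnorRec

namespace MilnorRec
open IntermediateField MvPolynomial

section Linked
variable {p p' ℓ : ℕ} {k l K L : Type*} [Field k] [Field K] [Algebra k K]
  [Field l] [Field L] [Algebra l L] [Fact ℓ.Prime]

/-- Every line of some hyperplane section of the coordinates `x` is charted by `π` with
factor `e`. -/
def Linked (φ : KV ℓ K ≃ₗ[ZMod ℓ] KV ℓ L) (π : k ≃+* l) (e : ZMod ℓ) {ι : Type*} [Fintype ι]
    (x : ι → K) : Prop :=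
  ∃ v : ι → k, ∀ y ∈ hyp x v, y ≠ 0 → ∃ Y, Chart φ y Y π.toEquiv fun _ => e

variable [IsAlgClosed k] [IsAlgClosed l] [ExpChar k p] [ExpChar l p']
  {φ : KV ℓ K ≃ₗ[ZMod ℓ] KV ℓ L} {ι : Type*} [Fintype ι]

theorem exists_linked (R : Recon p p' ℓ (k := k) (l := l) φ) {x : ι → K}
    (hx : IsTranscendenceBasis k x) (hι : 5 ≤ Fintype.card ι) :
    ∃ (π : k ≃+* l) (e : ZMod ℓ), Linked φ π e x := by
  obtain ⟨H, hH, hg⟩ := exists_good R.setK.pfg R.setK.ne_zero hx hι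
  obtain ⟨v, hv⟩ := exists_eval_ne_zero hH
  obtain ⟨y, hy, z, hz, hli⟩ := exists_pair_mem_hyp hx (by omega) v
  obtain ⟨π, e, h⟩ := exists_uniform_chart R (hg v hv) hy hz hli
  exact ⟨π, e, v, h⟩

theorem Linked.congr (R : Recon p p' ℓ (k := k) (l := l) φ) {π : k ≃+* l} {e : ZMod ℓ}
    {x x' : ι → K} (h : Linked φ π e x) (hx : IsTranscendenceBasis k x)
    (hx' : IsTranscendenceBasis k x') (hι : 5 ≤ Fintype.card ι) {j : Fin 3 → ι}
    (hj : Function.Injective j) (hxx' : ∀ i, x (j i) = x' (j i)) : Linked φ π e x' := by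
  obtain ⟨v, hv⟩ := h
  obtain ⟨H, hH, hg⟩ := exists_good R.setK.pfg R.setK.ne_zero hx' hι
  obtain ⟨v', hv'⟩ := exists_eval_ne_zero hH
  obtain ⟨y, hy, hy0, hy'⟩ := exists_mem_hyp_inf hx hj hxx' v v'
  obtain ⟨Y, hY⟩ := hv y hy hy0
  obtain ⟨y₀, hy₀, z₀, hz₀, hli⟩ := exists_pair_mem_hyp hx' (by omega) v'
  exact ⟨v', fun z hz hz0 => uniform_chart_of_mem R (hg v' hv') hy₀ hz₀ hli hy' hy0 hY hz hz0⟩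

/-- Every element transcendental over `k` is a quotient of two charted elements. -/
theorem Linked.exists_quotient (R : Recon p p' ℓ (k := k) (l := l) φ) {π : k ≃+* l} {e : ZMod ℓ}
    {x : ι → K} (h : Linked φ π e x) (hx : IsTranscendenceBasis k x)
    (hι : 5 ≤ Fintype.card ι) {w : K} (hw : Transcendental k w) :
    ∃ (m : K) (M N : L), m ≠ 0 ∧ Chart φ m M π.toEquiv (fun _ => e) ∧
      Chart φ (w * m) N π.toEquiv fun _ => e := by
  classical
  obtain ⟨i₀, hA⟩ := exists_isTranscendenceBasis_update hx hw
  obtain ⟨j, hj, rfl⟩ : ∃ j : Fin 5 → ι, Function.Injective j ∧ j 0 = i₀ := by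
    obtain ⟨g⟩ : Nonempty (Fin 5 ↪ ι) :=
      Function.Embedding.nonempty_of_card_le (by simpa using hι)
    exact ⟨Equiv.swap (g 0) i₀ ∘ g, (Equiv.injective _).comp g.injective, by simp⟩
  set A := Function.update x (j 0) w with hAdef
  have hjne : ∀ a b, a ≠ b → j a ≠ j b := fun a b hab h => hab (hj h)
  have hLA : Linked φ π e A := h.congr R hx hA hι (j := j ∘ ![1, 2, 3])
    (hj.comp (by decide)) fun i => by
      have : (![1, 2, 3] : Fin 3 → Fin 5) i ≠ 0 := by revert i; decide
      simp only [hAdef, Function.comp_apply]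
      rw [Function.update_of_ne (hjne _ _ this)]
  have hA0 : A (j 0) = w := by simp [hAdef]
  let B (s : Set ι) : ι → K := fun i =>
    if i = j 0 then A (j 0) else if i ∈ s then A (j 0) * A i else A i
  have hB : ∀ s, IsTranscendenceBasis k (B s) := fun s => isTranscendenceBasis_scale hA (j 0) s
  have h1 : Linked φ π e (B {j 1}) := hLA.congr R hA (hB _) hι (j := j ∘ ![2, 3, 4])
    (hj.comp (by decide)) fun i => by
      have h0 : (![2, 3, 4] : Fin 3 → Fin 5) i ≠ 0 := by revert i; decide
      have h1 : (![2, 3, 4] : Fin 3 → Fin 5) i ≠ 1 := by revert i; decide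
      simp [B, hj.eq_iff, h0, h1]
  have h2 : Linked φ π e (B {j 1, j 2, j 3}) := h1.congr R (hB _) (hB _) hι (j := j ∘ ![0, 1, 4])
    (hj.comp (by decide)) fun i => by
      fin_cases i <;> simp [B, hj.eq_iff]
  obtain ⟨v, hv⟩ := hLA
  obtain ⟨v', hv'⟩ := h2
  have hj' : Function.Injective (j ∘ ![1, 2, 3]) := hj.comp (by decide)
  obtain ⟨c, hc, o1, o2⟩ := exists_orthogonal_pair (v ∘ j ∘ ![1, 2, 3]) (v' ∘ j ∘ ![1, 2, 3])
  obtain ⟨c₁, e1, f1, g1⟩ := lin_sum_eq A hj' c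
  obtain ⟨c₂, e2, f2, g2⟩ := lin_sum_eq (B {j 1, j 2, j 3}) hj' c
  have hne₁ : lin A c₁ ≠ 0 := fun h0 => (transcendental_lin hA (g1 hc)) (h0 ▸ isAlgebraic_zero)
  have hne₂ : lin (B {j 1, j 2, j 3}) c₂ ≠ 0 :=
    fun h0 => (transcendental_lin (hB _) (g2 hc)) (h0 ▸ isAlgebraic_zero)
  have heq : lin (B {j 1, j 2, j 3}) c₂ = w * lin A c₁ := by
    rw [e1, e2, Finset.mul_sum]
    refine Finset.sum_congr rfl fun i _ => ?_
    have h0 : (![1, 2, 3] : Fin 3 → Fin 5) i ≠ 0 := by revert i; decide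
    have h1 : (![1, 2, 3] : Fin 3 → Fin 5) i = 1 ∨ (![1, 2, 3] : Fin 3 → Fin 5) i = 2 ∨
      (![1, 2, 3] : Fin 3 → Fin 5) i = 3 := by revert i; decide
    have h2 : B {j 1, j 2, j 3} ((j ∘ ![1, 2, 3]) i) = w * A ((j ∘ ![1, 2, 3]) i) := by
      simp [B, hj.eq_iff, h0, h1, hA0]
    rw [h2]; ring
  obtain ⟨M, hM⟩ := hv _ (mem_hyp.2 ⟨c₁, (f1 v).trans o1, rfl⟩) hne₁
  obtain ⟨N, hN⟩ := hv' _ (mem_hyp.2 ⟨c₂, (f2 v').trans o2, rfl⟩) hne₂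
  exact ⟨_, M, N, hne₁, hM, heq ▸ hN⟩

end Linked

section Graph
variable {p p' ℓ : ℕ} {k l K L : Type*} [Field k] [Field K] [Algebra k K]
  [Field l] [Field L] [Algebra l L] [Fact ℓ.Prime]

/-- At almost all corresponding places, `U` has the residue corresponding to that of `u`. -/
def Graph (p' : ℕ) (φ : KV ℓ K ≃ₗ[ZMod ℓ] KV ℓ L) (π : k ≃+* l) (u : K) (U : L) : Prop :=
  ∃ S : Finset L, (∀ s ∈ S, Transcendental l s) ∧ ∀ f : KV ℓ L →ₗ[ZMod ℓ] ZMod ℓ, Adm p' l f →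
    (∀ s ∈ S, ∃ b : l, Sees l f s b) → ∀ O, Compat k (f ∘ₗ φ.toLinearMap) O → ∀ O', Compat l f O' →
      ∃ a : k, Res O u a ∧ Res O' U (π a)

variable {φ : KV ℓ K ≃ₗ[ZMod ℓ] KV ℓ L} {π : k ≃+* l} {u v : K} {U V : L}

lemma Graph.const (a : k) : Graph p' φ π (algebraMap k K a) (algebraMap l L (π a)) :=
  ⟨∅, by simp, fun _ _ _ _ _ _ _ => ⟨a, Res.const a, Res.const _⟩⟩

lemma Graph.add (h : Graph p' φ π u U) (h' : Graph p' φ π v V) :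
    Graph p' φ π (u + v) (U + V) := by
  classical
  obtain ⟨S, hS, H⟩ := h
  obtain ⟨T, hT, H'⟩ := h'
  refine ⟨S ∪ T, fun s hs => (Finset.mem_union.1 hs).elim (hS s) (hT s),
    fun f hf hs O hO O' hO' => ?_⟩
  obtain ⟨a, h1, h2⟩ := H f hf (fun s h => hs s (Finset.mem_union_left _ h)) O hO O' hO'
  obtain ⟨b, h3, h4⟩ := H' f hf (fun s h => hs s (Finset.mem_union_right _ h)) O hO O' hO'
  exact ⟨a + b, h1.add h3, by rw [map_add]; exact h2.add h4⟩

lemma Graph.mul (h : Graph p' φ π u U) (h' : Graph p' φ π v V) :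
    Graph p' φ π (u * v) (U * V) := by
  classical
  obtain ⟨S, hS, H⟩ := h
  obtain ⟨T, hT, H'⟩ := h'
  refine ⟨S ∪ T, fun s hs => (Finset.mem_union.1 hs).elim (hS s) (hT s),
    fun f hf hs O hO O' hO' => ?_⟩
  obtain ⟨a, h1, h2⟩ := H f hf (fun s h => hs s (Finset.mem_union_left _ h)) O hO O' hO'
  obtain ⟨b, h3, h4⟩ := H' f hf (fun s h => hs s (Finset.mem_union_right _ h)) O hO O' hO'
  exact ⟨a * b, h1.mul hO h3, by rw [map_mul]; exact h2.mul hO' h4⟩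

lemma Graph.inv [IsAlgClosed l] (h : Graph p' φ π u U) (hU : U ≠ 0) :
    Graph p' φ π u⁻¹ U⁻¹ := by
  classical
  obtain ⟨S, hS, H⟩ := h
  by_cases hUt : Transcendental l U
  · have hUi : Transcendental l U⁻¹ := fun h => hUt (by simpa using h.inv)
    refine ⟨insert U⁻¹ S, by simpa [hUi] using hS, fun f hf hs O hO O' hO' => ?_⟩
    obtain ⟨a, h1, h2⟩ := H f hf (fun s h => hs s (Finset.mem_insert_of_mem h)) O hO O' hO'
    obtain ⟨b, hb⟩ := hs U⁻¹ (Finset.mem_insert_self _ _)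
    have h3 := h2.mul hO' (hb.res hO')
    rw [mul_inv_cancel₀ hU, ← map_one (algebraMap l L)] at h3
    have h4 := (Res.const (1 : l)).unique hO' h3
    have ha : π a ≠ 0 := left_ne_zero_of_mul (h4 ▸ one_ne_zero)
    exact ⟨a⁻¹, h1.inv hO ((map_ne_zero π).1 ha), by rw [map_inv₀]; exact h2.inv hO' ha⟩
  · obtain ⟨c, rfl⟩ := exists_const_of_isAlgebraic hUt
    refine ⟨S, hS, fun f hf hs O hO O' hO' => ?_⟩
    obtain ⟨a, h1, h2⟩ := H f hf hs O hO O' hO'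
    have ha : π a ≠ 0 := by
      rw [h2.unique hO' (Res.const c)]
      exact (map_ne_zero _).1 hU
    exact ⟨a⁻¹, h1.inv hO ((map_ne_zero π).1 ha), by rw [map_inv₀]; exact h2.inv hO' ha⟩

variable [IsAlgClosed k] [IsAlgClosed l] [ExpChar k p] [ExpChar l p']

omit [ExpChar k p] in
lemma Graph.unique (R : Recon p p' ℓ (k := k) (l := l) φ) (h : Graph p' φ π u U)
    (h' : Graph p' φ π u V) : U = V := by
  classical
  obtain ⟨S, hS, H⟩ := h
  obtain ⟨T, hT, H'⟩ := h'
  refine sub_eq_zero.1 (R.setL.eq_zero_of_res (S ∪ T)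
    (fun s hs => (Finset.mem_union.1 hs).elim (hS s) (hT s)) fun f hf hs O' hO' => ?_)
  obtain ⟨O, hO⟩ := (R.half'.adm' hf).exists_compat R.setK.ne_zero
  obtain ⟨a, h1, h2⟩ := H f hf (fun s h => hs s (Finset.mem_union_left _ h)) O hO O' hO'
  obtain ⟨b, h3, h4⟩ := H' f hf (fun s h => hs s (Finset.mem_union_right _ h)) O hO O' hO'
  simpa [h1.unique hO h3] using h2.sub hO' h4

omit [IsAlgClosed k] [IsAlgClosed l] [ExpChar l p'] in
lemma Chart.graph {ε : k → ZMod ℓ} (h : Chart φ u U π.toEquiv ε) : Graph p' φ π u U := by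
  refine ⟨{U}, by simpa using h.trans, fun f hf hs O hO O' hO' => ?_⟩
  obtain ⟨b, hb⟩ := hs U (by simp)
  refine ⟨π.symm b, (h.sees_iff'.1 hb).res hO, ?_⟩
  simpa using hb.res hO'

omit [IsAlgClosed k] [IsAlgClosed l] in
lemma Chart.cl_eq {e : ZMod ℓ} (h : Chart φ u U π.toEquiv fun _ => e) :
    φ (cl ℓ u) = e • cl ℓ U := by
  simpa using h.map 0

variable {ι : Type*} [Fintype ι]

theorem exists_graph (R : Recon p p' ℓ (k := k) (l := l) φ) {e : ZMod ℓ}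
    {x : ι → K} (h : Linked φ π e x) (hx : IsTranscendenceBasis k x)
    (hι : 5 ≤ Fintype.card ι) (w : K) :
    ∃ W : L, φ (cl ℓ w) = e • cl ℓ W ∧ Graph p' φ π w W := by
  by_cases hw : Transcendental k w
  · obtain ⟨m, M, N, hm, hM, hN⟩ := h.exists_quotient R hx hι hw
    have hM0 : M ≠ 0 := fun h => hM.trans (h ▸ isAlgebraic_zero)
    have hN0 : N ≠ 0 := fun h => hN.trans (h ▸ isAlgebraic_zero)
    have h1 : w * m * m⁻¹ = w := mul_inv_cancel_right₀ hm w
    refine ⟨N * M⁻¹, ?_, h1 ▸ hN.graph.mul (hM.graph.inv hM0)⟩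
    rw [← div_eq_mul_inv, cl_div hN0 hM0, smul_sub, ← hN.cl_eq, ← hM.cl_eq, ← map_sub,
      cl_mul (by rintro rfl; exact hw isAlgebraic_zero) hm, add_sub_cancel_right]
  · obtain ⟨c, rfl⟩ := exists_const_of_isAlgebraic hw
    exact ⟨_, by rw [cl_const, cl_const]; simp, Graph.const c⟩

/-- The reconstruction of a field embedding. -/
theorem Recon.exists_ringHom (R : Recon p p' ℓ (k := k) (l := l) φ) :
    ∃ (π : k ≃+* l) (e : ZMod ℓ) (σ : K →+* L), e ≠ 0 ∧
      (∀ a, σ (algebraMap k K a) = algebraMap l L (π a)) ∧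
      ∀ w, φ (cl ℓ w) = e • cl ℓ (σ w) := by
  obtain ⟨n, hn, x, hx⟩ := R.setK.basis
  have hι : 5 ≤ Fintype.card (Fin n) := by simpa using hn
  obtain ⟨π, e, h⟩ := exists_linked R hx hι
  choose σ hσ hg using exists_graph R h hx hι
  have hu : ∀ {w W}, Graph p' φ π w W → σ w = W := fun h => (hg _).unique R h
  have hc : ∀ a, σ (algebraMap k K a) = algebraMap l L (π a) := fun a => hu (Graph.const a)
  refine ⟨π, e, ⟨⟨⟨σ, ?_⟩, ?_⟩, ?_, ?_⟩, ?_, hc, hσ⟩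
  · simpa using hc 1
  · exact fun a b => hu ((hg a).mul (hg b))
  · simpa using hc 0
  · exact fun a b => hu ((hg a).add (hg b))
  · rintro rfl
    obtain ⟨v, hv⟩ := h
    obtain ⟨y, hy, z, hz, hli⟩ := exists_pair_mem_hyp hx (by omega) v
    obtain ⟨Y, hY⟩ := hv y hy (hli.ne_zero 0)
    exact hY.ne_zero 0 rfl

end Graph
end MilnorRec

namespace MilnorRec
open IntermediateField MvPolynomial

section Frobenius
variable {p ℓ : ℕ} {k K : Type*} [Field k] [Field K] [Algebra k K] [Fact ℓ.Prime]

omit [Fact (Nat.Prime ℓ)] in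
lemma Setup.of_algebraicIndependent {d e : ℕ} (H : Setup p ℓ k K d) {y : Fin e → K}
    (hy : AlgebraicIndependent k y) : Setup p ℓ k K e := by
  refine ⟨H.pfg, H.ne_zero, H.perf, ?_⟩
  obtain ⟨t, hyt, ht⟩ := exists_isTranscendenceBasis_superset hy.to_subtype_range
  obtain ⟨hfin, -⟩ := H.card_basis ht
  refine ⟨Nat.card t, ?_, _, (isTranscendenceBasis_equiv (Finite.equivFin t).symm).2 ht⟩
  have := Nat.card_le_card_of_injective (fun i : Fin e => (⟨y i, hyt ⟨i, rfl⟩⟩ : t))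
    fun i j hij => hy.injective (congrArg Subtype.val hij)
  simpa using this

variable [IsAlgClosed k] [ExpChar k p]

/-- A semilinear endomorphism which acts on `K^×/ℓ` as a homothety is, up to Frobenius, the
identity. -/
theorem Setup.pow_eq_pow (H : Setup p ℓ k K 5) {π : k ≃+* k} {ρ : K →+* K} {δ : ZMod ℓ}
    (hδ : δ ≠ 0) (hπ : ∀ a, ρ (algebraMap k K a) = algebraMap k K (π a))
    (hρ : ∀ w, cl ℓ (ρ w) = δ • cl ℓ w) :
    ∃ n m : ℕ, ∀ w, ρ w ^ p ^ n = w ^ p ^ m := by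
  have H3 : Setup p ℓ k K 3 := H.mono (by norm_num)
  have hsees : ∀ {f : KV ℓ K →ₗ[ZMod ℓ] ZMod ℓ} {w : K} {a : k}, Sees k f w a →
      Sees k f (ρ w) (π a) := by
    have key : ∀ (f : KV ℓ K →ₗ[ZMod ℓ] ZMod ℓ) (w : K) (a : k),
        f (cl ℓ (ρ w - algebraMap k K (π a))) = δ * f (cl ℓ (w - algebraMap k K a)) := by
      intro f w a
      rw [← hπ, ← map_sub, hρ, map_smul, smul_eq_mul]
    rintro f w a ⟨h1, b, h2⟩
    exact ⟨by rw [key]; exact mul_ne_zero hδ h1, π b, by rw [key, h2, mul_zero]⟩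
  have htr : ∀ {w}, Transcendental k w → Transcendental k (ρ w) := by
    intro w hw h
    obtain ⟨a, ha⟩ := exists_const_of_isAlgebraic (not_not.2 h)
    obtain ⟨b, rfl⟩ := π.surjective a
    rw [← hπ] at ha
    rw [ρ.injective ha] at hw
    exact hw (isAlgebraic_algebraMap b)
  obtain ⟨N, hN, x, hx⟩ := H.basis
  obtain ⟨h, hh, hg⟩ := exists_good H.pfg H.ne_zero hx (by simpa using hN)
  obtain ⟨v, hv⟩ := exists_eval_ne_zero hh
  obtain ⟨y, hy, hli⟩ := exists_linearIndependent_mem_hyp hx v (r := 1)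
    (by rw [Fintype.card_fin]; omega)
  have hy0 : y 0 ≠ 0 := hli.ne_zero 0
  have hyt : Transcendental k (y 0) := ((hg v hv).qgen _ (hy 0) hy0).1
  have hyi : AlgebraicIndependent k y := (algebraicIndependent_unique_type_iff).2 hyt
  obtain ⟨n, P, -, hP⟩ := H3.polynomial_of_determined hyi (htr hyt) (fun a => π (a 0))
    (fun f hf a b ha hb => by
      obtain ⟨O, hO⟩ := hf.exists_compat H.ne_zero
      exact (hb.res hO).unique hO ((hsees (ha 0)).res hO))
    (fun a => by
      obtain ⟨f, hf, h1, h0⟩ := (hg v hv).exists_dual (hy 0) hy0 (a 0)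
      have hs : Sees k f (y 0) (a 0) :=
        ⟨by rw [h1]; exact one_ne_zero, a 0 + 1, h0 _ (by simp)⟩
      exact ⟨f, hf, fun i => by rwa [Subsingleton.elim i 0], hsees hs⟩)
  obtain ⟨P', hP'⟩ := exists_eval_single P 0
  have hev : ∀ b, P'.eval b = π b ^ p ^ n := fun b => by
    rw [hP', ← hP]; simp
  obtain ⟨m, c, e, hc, rfl⟩ := exists_eq_of_injective_eval p (P := P') (fun a b hab => by
    simp only [hev] at hab
    exact π.injective (pow_frobenius_injective n hab))
  have hpm : p ^ m ≠ 0 := (expChar_pow_pos k p m).ne'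
  have hpn : p ^ n ≠ 0 := (expChar_pow_pos k p n).ne'
  have he : e = 0 := by simpa [zero_pow hpm, zero_pow hpn] using hev 0
  have hc1 : c = 1 := by simpa [he] using hev 1
  have hev' : ∀ b, π b ^ p ^ n = b ^ p ^ m := fun b => by rw [← hev]; simp [he, hc1]
  refine ⟨n, m, fun w => ?_⟩
  by_cases hw : Transcendental k w
  · refine sub_eq_zero.1 (H3.eq_zero_of_res {w} (by simpa using hw) fun f hf hs O hO => ?_)
    obtain ⟨a, ha⟩ := hs w (by simp)
    have := (((hsees ha).res hO).pow hO (p ^ n)).sub hO ((ha.res hO).pow hO (p ^ m))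
    rwa [hev', sub_self] at this
  · obtain ⟨a, rfl⟩ := exists_const_of_isAlgebraic hw
    rw [hπ, ← map_pow (algebraMap k K), ← map_pow (algebraMap k K), hev']

end Frobenius

section Main
variable {p p' ℓ : ℕ} {k l K L : Type*} [Field k] [Field K] [Algebra k K]
  [Field l] [Field L] [Algebra l L] [Fact ℓ.Prime] [IsAlgClosed k] [IsAlgClosed l]
  [ExpChar k p] [ExpChar l p'] {φ : KV ℓ K ≃ₗ[ZMod ℓ] KV ℓ L}

omit [ExpChar l p'] in
theorem Recon.of_setup (hK : Setup p ℓ k K 5) {d : ℕ} (hL : Setup p' ℓ l L d)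
    (h : HalfTransport p k l p' φ) (h' : HalfTransport p' l k p φ.symm) :
    Recon p p' ℓ (k := k) (l := l) φ := by
  refine ⟨hK, ?_, h, h'⟩
  obtain ⟨N, hN, x, hx⟩ := hK.basis
  obtain ⟨H, hH, hg⟩ := exists_good hK.pfg hK.ne_zero hx (by simpa using hN)
  obtain ⟨v, hv⟩ := exists_eval_ne_zero hH
  obtain ⟨y, hy, hli⟩ := exists_linearIndependent_mem_hyp hx v (r := 3)
    (by rw [Fintype.card_fin]; omega)
  choose Y π ε hY using fun i => exists_chart hL.ne_zero h (hg v hv) (hy i) (hli.ne_zero i)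
  exact hL.of_algebraicIndependent
    (algebraicIndependent_of_chart hL.ne_zero h (hg v hv) le_rfl hy hli hY)

/-- The reconstruction of a field isomorphism. -/
theorem exists_fieldEquiv (hK : Setup p ℓ k K 5) {d : ℕ} (hL : Setup p' ℓ l L d)
    (h : HalfTransport p k l p' φ) (h' : HalfTransport p' l k p φ.symm) :
    ∃ (e : ZMod ℓ) (σ : K ≃+* L), e ≠ 0 ∧ ∀ w, φ (cl ℓ w) = e • cl ℓ (σ w) := by
  obtain ⟨π, e, σ, he, hπ, hσ⟩ := (Recon.of_setup hK hL h h').exists_ringHom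
  have hL5 : Setup p' ℓ l L 5 := by
    obtain ⟨N, hN, x, hx⟩ := hK.basis
    exact (hL.of_algebraicIndependent (hx.1.ringHom_of_comp_eq π σ π.surjective σ.injective
      (by ext a; simp [hπ]))).mono hN
  obtain ⟨π', e', τ, he', hπ', hτ⟩ :=
    (Recon.of_setup (φ := φ.symm) hL5 hK h' h).exists_ringHom
  obtain ⟨n, m, hnm⟩ := hL5.pow_eq_pow (π := π'.trans π) (ρ := σ.comp τ) (δ := (e * e')⁻¹)
    (inv_ne_zero (mul_ne_zero he he')) (fun a => by simp [hπ', hπ]) (fun w => by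
      have h1 := congrArg φ (hτ w)
      rw [LinearEquiv.apply_symm_apply, map_smul, hσ, smul_smul, mul_comm] at h1
      rw [h1, inv_smul_smul₀ (mul_ne_zero he he')]
      rfl)
  have hsurj : Function.Surjective σ := fun w => by
    obtain ⟨z, hz⟩ : ∃ z, z ^ p' ^ m = w := by
      clear hnm
      induction m with
      | zero => exact ⟨w, by simp⟩
      | succ m ih =>
        obtain ⟨z, hz⟩ := ih
        obtain ⟨z', hz'⟩ := hL5.perf z
        exact ⟨z', by rw [pow_succ', pow_mul, hz', hz]⟩
    exact ⟨τ z ^ p' ^ n, by rw [map_pow, ← hz, ← hnm]; rfl⟩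
  exact ⟨e, RingEquiv.ofBijective σ ⟨σ.injective, hsurj⟩, he, hσ⟩

end Main
end MilnorRec

namespace MilnorRec
open IntermediateField

section PerfectClosure
variable {p ℓ : ℕ} {k K M : Type*} [Field k] [Field K] [Field M] [Algebra k K] [Algebra k M]
  [Algebra K M] [IsScalarTower k K M] [Fact ℓ.Prime]

lemma expChar_natCast_ne_zero (p : ℕ) [ExpChar k p] (h : ringChar k ≠ ℓ) : (p : ZMod ℓ) ≠ 0 := by
  rcases ‹ExpChar k p› with _ | hp
  · simp
  · rw [ringChar.eq k p] at h
    rw [Ne, ZMod.natCast_eq_zero_iff, Nat.prime_dvd_prime_iff_eq Fact.out hp]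
    exact h.symm

lemma exists_pow_expChar_eq (p : ℕ) [ExpChar M p] [PerfectField M] (y : M) : ∃ z, z ^ p = y := by
  have : PerfectRing M p := PerfectField.toPerfectRing p
  exact (bijective_frobenius M p).2 y

lemma PFG.exists_isTranscendenceBasis [ExpChar k p] (h : PFG p k K) :
    ∃ (n : ℕ) (x : Fin n → K), IsTranscendenceBasis k x := by
  obtain ⟨s, hs⟩ := h
  have : Algebra.IsAlgebraic (Algebra.adjoin k (s : Set K)) K := ⟨fun x => by
    obtain ⟨n, hn⟩ := hs x
    obtain ⟨a, ha, b, hb, hab⟩ := mem_adjoin_iff_div.1 hn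
    refine IsAlgebraic.of_pow (pow_pos (expChar_pos k p) n) ?_
    rw [hab, div_eq_mul_inv]
    exact (isAlgebraic_algebraMap (⟨a, ha⟩ : Algebra.adjoin k (s : Set K))).mul
      (isAlgebraic_algebraMap (⟨b, hb⟩ : Algebra.adjoin k (s : Set K))).inv⟩
  obtain ⟨t, hts, ht⟩ := exists_isTranscendenceBasis_subset (R := k) (s : Set K)
  have hfin : Finite t := s.finite_toSet.subset hts
  exact ⟨Nat.card t, _, (isTranscendenceBasis_equiv (Finite.equivFin t).symm).2 ht⟩

lemma _root_.IsFunctionField.pfg [ExpChar k p] [IsPurelyInseparable K M] (hK : IsFunctionField k K) :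
    PFG p k M := by
  classical
  obtain ⟨s, hs⟩ := hK
  have : ExpChar K p := expChar_of_injective_algebraMap (algebraMap k K).injective p
  refine ⟨s.image (algebraMap K M), fun x => ?_⟩
  obtain ⟨n, y, hy⟩ := IsPurelyInseparable.pow_mem K p x
  refine ⟨n, ?_⟩
  rw [← hy, Finset.coe_image]
  have := adjoin_map k (s : Set K) (IsScalarTower.toAlgHom k K M)
  rw [hs] at this
  have h2 : algebraMap K M y ∈ (⊤ : IntermediateField k K).map (IsScalarTower.toAlgHom k K M) :=
    ⟨y, trivial, rfl⟩
  rw [this] at h2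
  exact h2

lemma _root_.IsFunctionField.setup [ExpChar k p] [IsPurelyInseparable K M] [PerfectField M]
    (hK : IsFunctionField k K) (h : ringChar k ≠ ℓ) : Setup p ℓ k M 0 := by
  have : ExpChar M p := expChar_of_injective_algebraMap (algebraMap k M).injective p
  have hM : PFG p k M := hK.pfg
  obtain ⟨n, x, hx⟩ := hM.exists_isTranscendenceBasis
  exact ⟨hM, expChar_natCast_ne_zero p h, exists_pow_expChar_eq p, n, n.zero_le, x, hx⟩

end PerfectClosure
end MilnorRec

namespace MilnorRec
open IntermediateField

section General
variable {p ℓ : ℕ} {k K M : Type*} [Field k] [Field K] [Field M] [Algebra k K] [Algebra k M]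
  [Algebra K M] [IsScalarTower k K M]

lemma map_adjoin_simple_algebraMap (u : K) :
    k⟮u⟯.map (IsScalarTower.toAlgHom k K M) = k⟮algebraMap K M u⟯ := by
  rw [adjoin_map, Set.image_singleton]; rfl

lemma algebraMap_mem_adjoin_simple {u α : K} :
    algebraMap K M α ∈ k⟮algebraMap K M u⟯ ↔ α ∈ k⟮u⟯ := by
  rw [← map_adjoin_simple_algebraMap]
  constructor
  · rintro ⟨β, hβ, h⟩
    rwa [← (algebraMap K M).injective h]
  · exact fun h => ⟨α, h, rfl⟩

lemma isAlgebraic_adjoin_simple_algebraMap {u α : K} :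
    IsAlgebraic k⟮algebraMap K M u⟯ (algebraMap K M α) ↔ IsAlgebraic k⟮u⟯ α := by
  rw [← map_adjoin_simple_algebraMap]
  let e := k⟮u⟯.equivMap (IsScalarTower.toAlgHom k K M)
  have h : (algebraMap (k⟮u⟯.map (IsScalarTower.toAlgHom k K M)) M).comp (e : _ →+* _) =
    (algebraMap K M).comp (algebraMap k⟮u⟯ K) := rfl
  exact ⟨fun H => H.of_ringHom_of_comp_eq (e : _ →+* _) (algebraMap K M) e.surjective
    (algebraMap K M).injective h, fun H => H.ringHom_of_comp_eq (e : _ →+* _) (algebraMap K M)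
    e.injective h⟩

lemma _root_.IsGeneralElement.qgen [IsAlgClosed k] [ExpChar k p] [IsPurelyInseparable K M] {u : K}
    (hu : IsGeneralElement k u) : QGen p k (algebraMap K M u) := by
  have : ExpChar K p := expChar_of_injective_algebraMap (algebraMap k K).injective p
  constructor
  · rw [transcendental_algebraMap_iff (algebraMap K M).injective]
    intro h
    obtain ⟨a, rfl⟩ := exists_const_of_isAlgebraic (not_not.2 h)
    exact hu.1 ⟨a, rfl⟩
  · intro α hα
    obtain ⟨n, β, hβ⟩ := IsPurelyInseparable.pow_mem K p α
    refine ⟨n, ?_⟩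
    rw [← hβ, algebraMap_mem_adjoin_simple]
    refine hu.2 β ((isAlgebraic_adjoin_simple_algebraMap (M := M)).1 ?_)
    rw [hβ]
    exact hα.pow _

lemma isSeparable_of_derivative_ne_zero {s : M} {G : Polynomial K} (h : Polynomial.aeval s G = 0)
    (h' : Polynomial.aeval s G.derivative ≠ 0) : IsSeparable K s := by
  have hG : G ≠ 0 := by rintro rfl; simp at h'
  have hint : IsIntegral K s := isAlgebraic_iff_isIntegral.1 ⟨G, hG, h⟩
  rw [IsSeparable, Polynomial.separable_iff_derivative_ne_zero (minpoly.irreducible hint)]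
  intro h0
  obtain ⟨H, rfl⟩ := minpoly.dvd K s h
  apply h'
  rw [Polynomial.derivative_mul, h0]
  simp

/-- If `u` is not a `p`-th power then `k(u)` is closed under `p`-th roots. -/
lemma mem_adjoin_of_pow_mem [IsAlgClosed k] [CharP k p] (hp : p.Prime) [IsPurelyInseparable K M]
    [PerfectField M] {u : K} (hu : Transcendental k u) (hup : ∀ v : K, v ^ p ≠ u) {α : K}
    (hα : α ^ p ∈ k⟮u⟯) : α ∈ k⟮u⟯ := by
  have : Fact p.Prime := ⟨hp⟩
  have : ExpChar k p := .prime hp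
  have : CharP K p := charP_of_injective_algebraMap (algebraMap k K).injective p
  have : ExpChar M p := expChar_of_injective_algebraMap (algebraMap k M).injective p
  have : CharP M p := charP_of_injective_algebraMap (algebraMap k M).injective p
  obtain ⟨P, Q, hPQ⟩ := (mem_adjoin_simple_iff k _).1 hα
  by_cases hQ : Polynomial.aeval u Q = 0
  · rw [hQ, div_zero] at hPQ
    rw [eq_zero_of_pow_eq_zero hPQ]; exact zero_mem _
  have hQm : Polynomial.aeval u Q ∈ k⟮u⟯ :=
    (mem_adjoin_simple_iff k _).2 ⟨Q, 1, by simp⟩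
  suffices H : α * Polynomial.aeval u Q ∈ k⟮u⟯ by
    have := div_mem H hQm
    rwa [mul_div_cancel_right₀ _ hQ] at this
  have hβ : (α * Polynomial.aeval u Q) ^ p = Polynomial.aeval u (P * Q ^ (p - 1)) := by
    rw [mul_pow, hPQ, map_mul, map_pow, div_mul_eq_mul_div, div_eq_iff hQ, mul_assoc, ← pow_succ,
      Nat.sub_add_cancel hp.one_le]
  generalize α * Polynomial.aeval u Q = β at hβ ⊢
  obtain ⟨R, hR⟩ : ∃ R : Polynomial k, P * Q ^ (p - 1) = R.map (frobenius k p) := by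
    have : Function.Surjective (Polynomial.mapRingHom (frobenius k p)) :=
      Polynomial.map_surjective _ (bijective_frobenius k p).2
    obtain ⟨R, h⟩ := this (P * Q ^ (p - 1))
    exact ⟨R, h.symm⟩
  rw [hR] at hβ
  obtain ⟨s, hs⟩ := exists_pow_expChar_eq p (algebraMap K M u)
  have hβs : algebraMap K M β = Polynomial.aeval s R := by
    apply (frobenius M p).injective
    rw [frobenius_def, frobenius_def, ← map_pow, hβ, ← Polynomial.aeval_algebraMap_apply, ← hs,
      ← Polynomial.expand_aeval, ← Polynomial.map_expand, Polynomial.map_frobenius_expand, map_pow]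
  have hsK : ¬ IsSeparable K s := by
    intro h
    obtain ⟨v, rfl⟩ := IsPurelyInseparable.inseparable K s h
    exact hup v ((algebraMap K M).injective (by rw [map_pow, hs]))
  have hstr : Transcendental k s := by
    intro h
    have := h.pow p
    rw [hs] at this
    exact (transcendental_algebraMap_iff (algebraMap K M).injective).2 hu this
  have hder : R.derivative = 0 := by
    by_contra h0
    refine hsK (isSeparable_of_derivative_ne_zero
      (G := R.map (algebraMap k K) - Polynomial.C β) ?_ ?_)
    · rw [map_sub, Polynomial.aeval_C, hβs, Polynomial.aeval_map_algebraMap, sub_self]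
    · rw [Polynomial.derivative_sub, Polynomial.derivative_C, sub_zero, Polynomial.derivative_map,
        Polynomial.aeval_map_algebraMap]
      exact fun h => hstr ⟨_, h0, h⟩
  have hexp := Polynomial.expand_contract p hder hp.ne_zero
  rw [← hexp, Polynomial.expand_aeval, hs, Polynomial.aeval_algebraMap_apply] at hβs
  rw [(algebraMap K M).injective hβs]
  exact (mem_adjoin_simple_iff k _).2 ⟨R.contract p, 1, by simp⟩

lemma isGeneralElement_of_qgen [IsAlgClosed k] [ExpChar k p] [IsPurelyInseparable K M]
    [PerfectField M] {u : K} (hu : QGen p k (algebraMap K M u))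
    (hup : p ≠ 1 → ∀ v : K, v ^ p ≠ u) : IsGeneralElement k u := by
  have hut : Transcendental k u := (transcendental_algebraMap_iff (algebraMap K M).injective).1 hu.1
  refine ⟨?_, fun α hα => ?_⟩
  · rintro ⟨a, rfl⟩
    exact hut (isAlgebraic_algebraMap a)
  · obtain ⟨n, hn⟩ := hu.2 (algebraMap K M α) (isAlgebraic_adjoin_simple_algebraMap.2 hα)
    rw [← map_pow, algebraMap_mem_adjoin_simple] at hn
    cases ‹ExpChar k p› with
    | zero => simpa using hn
    | prime hp =>
      induction n with
      | zero => simpa using hn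
      | succ n ih =>
        refine ih (mem_adjoin_of_pow_mem (M := M) hp hut (hup hp.ne_one) ?_)
        rwa [← pow_mul, ← pow_succ]

lemma QGen.pow_expChar_pow [IsAlgClosed k] [ExpChar k p] {t : K} (ht : QGen p k t) (n : ℕ) :
    QGen p k (t ^ p ^ n) := by
  have : ExpChar K p := expChar_of_injective_algebraMap (algebraMap k K).injective p
  refine ⟨ht.1.pow (pow_pos (expChar_pos k p) n), fun α hα => ?_⟩
  have hα' : IsAlgebraic k⟮t⟯ α := by
    have hle : k⟮t ^ p ^ n⟯ ≤ k⟮t⟯ := adjoin_simple_le_iff.2 (pow_mem (mem_adjoin_simple_self k t) _)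
    exact hα.ringHom_of_comp_eq (inclusion hle : _ →+* _) (RingHom.id K) (inclusion hle).injective rfl
  obtain ⟨m, hm⟩ := ht.2 α hα'
  refine ⟨m + n, ?_⟩
  rw [pow_add, pow_mul]
  obtain ⟨P, Q, hPQ⟩ := (mem_adjoin_simple_iff k _).1 hm
  have key : ∀ P : Polynomial k, Polynomial.aeval t P ^ p ^ n =
      Polynomial.aeval (t ^ p ^ n) (P.map (iterateFrobenius k p n)) := fun P => by
    rw [← Polynomial.expand_aeval, ← Polynomial.map_expand, Polynomial.map_iterateFrobenius_expand,
      map_pow]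
  rw [hPQ, div_pow, key, key]
  exact (mem_adjoin_simple_iff k _).2 ⟨_, _, rfl⟩

lemma Om_pow_expChar_pow [Fact ℓ.Prime] [IsAlgClosed k] [ExpChar k p] (hp : (p : ZMod ℓ) ≠ 0) (t : K)
    (n : ℕ) : Om ℓ k (t ^ p ^ n) = Om ℓ k t := by
  have : ExpChar K p := expChar_of_injective_algebraMap (algebraMap k K).injective p
  have key : ∀ a : k, cl ℓ (t ^ p ^ n - algebraMap k K (a ^ p ^ n)) =
      ((p ^ n : ℕ) : ZMod ℓ) • cl ℓ (t - algebraMap k K a) := fun a => by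
    rw [map_pow, ← sub_pow_expChar_pow, cl_pow']
  apply le_antisymm <;> refine Submodule.span_le.2 ?_ <;> rintro _ ⟨a, rfl⟩
  · obtain ⟨b, rfl⟩ := IsAlgClosed.exists_pow_nat_eq a (pow_pos (expChar_pos k p) n)
    simp only [key]
    exact Submodule.smul_mem _ _ (Submodule.subset_span ⟨b, rfl⟩)
  · have := Submodule.smul_mem (Om ℓ k (t ^ p ^ n)) (((p ^ n : ℕ) : ZMod ℓ)⁻¹)
      (Submodule.subset_span ⟨a ^ p ^ n, rfl⟩)
    simpa only [SetLike.mem_coe, key, inv_smul_smul₀ (natCast_pow_ne_zero hp n)] using this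

end General
end MilnorRec

namespace MilnorRec
open IntermediateField

section MaxRoot
variable {p ℓ : ℕ} {k K M : Type*} [Field k] [Field K] [Field M] [Algebra k K] [Algebra k M]
  [Algebra K M] [IsScalarTower k K M]

lemma eq_one_of_pow_eq_mul_pow {ι : Type*} {x : ι → K} (hx : AlgebraicIndependent k x) {i : ι}
    {c : K} (hc : c ∈ adjoin k (Set.range x)) {m : ℕ} (h : c ^ m = x i) : m = 1 := by
  obtain ⟨a, ha, b, hb, rfl⟩ := mem_adjoin_iff_div.1 hc
  rw [Algebra.adjoin_range_eq_range_aeval] at ha hb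
  obtain ⟨A, rfl⟩ := ha
  obtain ⟨B, rfl⟩ := hb
  change (MvPolynomial.aeval x A / MvPolynomial.aeval x B) ^ m = x i at h
  rcases eq_or_ne m 0 with rfl | hm
  · rw [pow_zero] at h
    exact absurd (h ▸ isAlgebraic_one) (hx.transcendental i)
  have h0 : MvPolynomial.aeval x A / MvPolynomial.aeval x B ≠ 0 := by
    intro h0
    rw [h0, zero_pow hm] at h
    exact hx.ne_zero i h.symm
  have hA0 := (div_ne_zero_iff.1 h0).1
  have hB0 := (div_ne_zero_iff.1 h0).2
  have hA : A ≠ 0 := by rintro rfl; simp at hA0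
  have hB : B ≠ 0 := by rintro rfl; simp at hB0
  have key : A ^ m = MvPolynomial.X i * B ^ m := by
    apply hx
    rw [div_pow, div_eq_iff (pow_ne_zero _ hB0)] at h
    simpa using h
  have hpow : ∀ (P : MvPolynomial ι k), P ≠ 0 → ∀ n : ℕ,
      (P ^ n).degreeOf i = n * P.degreeOf i := fun P hP n => by
    induction n with
    | zero => simp
    | succ n ih =>
      rw [pow_succ, MvPolynomial.degreeOf_mul_eq (pow_ne_zero _ hP) hP, ih]; ring
  have hdeg := congrArg (MvPolynomial.degreeOf i) key
  rw [MvPolynomial.degreeOf_mul_eq (MvPolynomial.X_ne_zero i) (pow_ne_zero _ hB), hpow A hA,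
    hpow B hB, MvPolynomial.degreeOf_X_self] at hdeg
  exact Nat.dvd_one.1 ((Nat.dvd_add_left (dvd_mul_right m _)).1 (hdeg ▸ dvd_mul_right m _))

lemma exists_forall_pow_ne (hK : IsFunctionField k K) [CharP k p] (hp : p.Prime) {w : K}
    (hw : Transcendental k w) : ∃ N, ∀ v : K, v ^ p ^ N ≠ w := by
  obtain ⟨s, hs⟩ := hK
  obtain ⟨t, hwt, ht⟩ := exists_isTranscendenceBasis_superset
    (s := {w}) (R := k) (algebraicIndependent_unique_type_iff.2 hw)
  have := ht.isAlgebraic_field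
  rw [Subtype.range_coe] at this
  have hfin : FiniteDimensional (adjoin k t) (adjoin (adjoin k t) (s : Set K)) :=
    finiteDimensional_adjoin fun x _ => (Algebra.IsAlgebraic.isAlgebraic x).isIntegral
  have htop : adjoin (adjoin k t) (s : Set K) = ⊤ := by
    rw [eq_top_iff]
    intro x _
    have hle : adjoin k (s : Set K) ≤ (adjoin (adjoin k t) (s : Set K)).restrictScalars k :=
      adjoin_le_iff.2 (subset_adjoin _ _)
    exact hle (hs.symm ▸ mem_top)
  rw [htop] at hfin
  have : FiniteDimensional (adjoin k t) K := topEquiv.toLinearEquiv.finiteDimensional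
  have : ExpChar (adjoin k t) p :=
    have : ExpChar k p := .prime hp
    expChar_of_injective_algebraMap (algebraMap k _).injective p
  refine ⟨Module.finrank (adjoin k t) K, fun v hv => ?_⟩
  generalize hN : Module.finrank (adjoin k t) K = N at hv
  have hwF : w ∈ adjoin k t := subset_adjoin k t (hwt rfl)
  obtain ⟨n, c, hc⟩ := (minpoly.natSepDegree_eq_one_iff_eq_X_pow_sub_C p).1
    ((minpoly.natSepDegree_eq_one_iff_pow_mem p).2 ⟨N, (⟨w, hwF⟩ : adjoin k t), hv.symm⟩)
  have hvc : v ^ p ^ n = c := by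
    have := minpoly.aeval (adjoin k t) v
    rw [hc, map_sub, map_pow, Polynomial.aeval_X, Polynomial.aeval_C, sub_eq_zero] at this
    exact this
  rcases lt_or_ge n N with hn | hn
  · have h1 : (c : K) ^ p ^ (N - n) = w := by
      rw [← hvc, ← pow_mul, ← pow_add, Nat.add_sub_cancel' hn.le, hv]
    have := eq_one_of_pow_eq_mul_pow ht.1 (i := ⟨w, hwt rfl⟩) (c := c)
      (by rw [Subtype.range_coe]; exact c.2) h1
    exact absurd this (Nat.one_lt_pow (Nat.sub_pos_of_lt hn).ne' hp.one_lt).ne'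
  · have h1 := minpoly.natDegree_le (A := adjoin k t) v
    rw [hc, Polynomial.natDegree_X_pow_sub_C, hN] at h1
    exact absurd (h1.trans_lt (N.lt_pow_self hp.one_lt))
      (Nat.pow_le_pow_right hp.pos hn).not_gt

lemma QGen.of_pow_expChar_pow [ExpChar k p] {t : K} {n : ℕ} (ht : QGen p k (t ^ p ^ n)) :
    QGen p k t := by
  have hpos := pow_pos (expChar_pos k p) n
  refine ⟨fun h => ht.1 (h.pow _), fun α hα => ?_⟩
  obtain ⟨m, hm⟩ := ht.2 α (isAlgebraic_adjoin_iff.2 <|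
    IsAlgebraic.adjoin_of_forall_isAlgebraic (s := {t}) (by
      rintro _ ⟨rfl, -⟩
      exact IsAlgebraic.of_pow hpos (isAlgebraic_adjoin_iff.1 (isAlgebraic_algebraMap
        (⟨_, mem_adjoin_simple_self k _⟩ : k⟮_⟯)))) (isAlgebraic_adjoin_iff.1 hα))
  exact ⟨m, adjoin_simple_le_iff.2 (pow_mem (mem_adjoin_simple_self k t) _) hm⟩

lemma exists_isGeneralElement [Fact ℓ.Prime] [IsAlgClosed k] [ExpChar k p]
    (hp : (p : ZMod ℓ) ≠ 0) [IsPurelyInseparable K M] [PerfectField M] (hK : IsFunctionField k K)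
    {t : M} (ht : QGen p k t) :
    ∃ u : K, IsGeneralElement k u ∧ Om ℓ k t = Om ℓ k (algebraMap K M u) := by
  have : ExpChar K p := expChar_of_injective_algebraMap (algebraMap k K).injective p
  have : ExpChar M p := expChar_of_injective_algebraMap (algebraMap k M).injective p
  obtain ⟨n, w, hw⟩ := IsPurelyInseparable.pow_mem K p t
  have hwt : Transcendental k w := (transcendental_algebraMap_iff (algebraMap K M).injective).1
    (hw ▸ ht.1.pow (pow_pos (expChar_pos k p) n))
  obtain ⟨u, N, huN, hu⟩ : ∃ (u : K) (N : ℕ), u ^ p ^ N = w ∧ (p ≠ 1 → ∀ v : K, v ^ p ≠ u) := by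
    cases ‹ExpChar k p› with
    | zero => exact ⟨w, 0, by simp⟩
    | prime hp =>
      by_contra! H
      obtain ⟨N, hN⟩ := exists_forall_pow_ne hK hp hwt
      have : ∀ N, ∃ v : K, v ^ p ^ N = w := fun N => by
        induction N with
        | zero => exact ⟨w, by simp⟩
        | succ N ih =>
          obtain ⟨v, hv⟩ := ih
          obtain ⟨-, v', hv'⟩ := H v N hv
          exact ⟨v', by rw [pow_succ', pow_mul, hv', hv]⟩
      obtain ⟨v, hv⟩ := this N
      exact hN v hv
  have hOm : Om ℓ k t = Om ℓ k (algebraMap K M u) := by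
    rw [← Om_pow_expChar_pow hp t n, ← hw, ← huN, map_pow, Om_pow_expChar_pow hp]
  refine ⟨u, isGeneralElement_of_qgen (M := M) (QGen.of_pow_expChar_pow (n := N) ?_) hu, hOm⟩
  rw [← map_pow, huN, hw]
  exact ht.pow_expChar_pow n

end MaxRoot
end MilnorRec

namespace MilnorRec

section Milnor
variable {ℓ : ℕ} {K : Type*} [Field K] {N : Type*} [AddCommGroup N]

/-- The multilinear map attached to a biadditive function on units. -/
def unitsMultilinear (g : Kˣ → Kˣ → N)
    (hl : ∀ a a' b, g (a * a') b = g a b + g a' b) (hr : ∀ a b b', g a (b * b') = g a b + g a b') :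
    MultilinearMap ℤ (fun _ : Fin 2 => Additive Kˣ) N :=
  let B : Additive Kˣ →+ Additive Kˣ →+ N :=
    AddMonoidHom.mk' (fun a => AddMonoidHom.mk' (fun b => g a.toMul b.toMul)
      fun b b' => hr _ _ _) fun a a' => by ext b; exact hl _ _ _
  { toFun := fun m => B (m 0) (m 1)
    map_update_add' := @fun inst m i x y => by
      obtain rfl := Subsingleton.elim inst (instDecidableEqFin 2)
      fin_cases i <;> simp
    map_update_smul' := @fun inst m i c x => by
      obtain rfl := Subsingleton.elim inst (instDecidableEqFin 2)
      fin_cases i <;> simp }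

/-- The universal property of `k^M_2`. -/
theorem exists_milnorKMod_hom (hN : ∀ n : N, ℓ • n = 0) (g : Kˣ → Kˣ → N)
    (hl : ∀ a a' b, g (a * a') b = g a b + g a' b) (hr : ∀ a b b', g a (b * b') = g a b + g a b')
    (hs : ∀ a b : Kˣ, (a : K) + b = 1 → g a b = 0) :
    ∃ β : MilnorKMod ℓ 2 K →+ N, ∀ a b, β (milnorSymbol ℓ ![a, b]) = g a b := by
  let β₀ : MilnorPre 2 K →ₗ[ℤ] N := PiTensorProduct.lift (unitsMultilinear g hl hr)
  have hβ₀ : ∀ a : Fin 2 → Kˣ,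
      β₀ (PiTensorProduct.tprod ℤ fun i => Additive.ofMul (a i)) = g (a 0) (a 1) := fun a =>
    PiTensorProduct.lift.tprod _
  have h1 : SteinbergRel 2 K ≤ LinearMap.ker β₀ := by
    refine Submodule.span_le.2 ?_
    rintro _ ⟨a, ⟨i, j, hij, h⟩, rfl⟩
    obtain ⟨rfl, rfl⟩ : i = 0 ∧ j = 1 := by omega
    exact (hβ₀ a).trans (hs _ _ h)
  let β₁ : MilnorK 2 K →ₗ[ℤ] N := Submodule.liftQ _ β₀ h1
  have h2 : LinearMap.range ((ℓ : ℤ) • (LinearMap.id : MilnorK 2 K →ₗ[ℤ] MilnorK 2 K)) ≤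
      LinearMap.ker β₁ := by
    rintro _ ⟨x, rfl⟩
    rw [LinearMap.mem_ker, LinearMap.smul_apply, map_smul, LinearMap.id_apply,
      natCast_zsmul, hN]
  exact ⟨(Submodule.liftQ _ β₁ h2).toAddMonoidHom, fun a b => hβ₀ ![a, b]⟩

lemma milnorKMod_hom_ext {β β' : MilnorKMod ℓ 2 K →+ N}
    (h : ∀ a b : Kˣ, β (milnorSymbol ℓ ![a, b]) = β' (milnorSymbol ℓ ![a, b])) : β = β' := by
  have : β.toIntLinearMap = β'.toIntLinearMap := by
    refine Submodule.linearMap_qext _ (Submodule.linearMap_qext _ (PiTensorProduct.ext ?_))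
    ext m
    have := h (m 0).toMul (m 1).toMul
    have e : (fun i => Additive.ofMul ((![(m 0).toMul, (m 1).toMul] : Fin 2 → Kˣ) i)) = m := by
      ext i; fin_cases i <;> rfl
    simp only [milnorSymbol, e] at this
    exact this
  ext x
  exact LinearMap.congr_fun this x

lemma nsmul_milnorKMod (x : MilnorKMod ℓ 2 K) : ℓ • x = 0 := by
  obtain ⟨y, rfl⟩ := Submodule.Quotient.mk_surjective _ x
  rw [← Submodule.Quotient.mk_smul, Submodule.Quotient.mk_eq_zero]
  exact ⟨y, by simp⟩

lemma milnorSymbol_mul_left (a a' b : Kˣ) :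
    milnorSymbol ℓ ![a * a', b] = milnorSymbol ℓ ![a, b] + milnorSymbol ℓ ![a', b] := by
  have := (PiTensorProduct.tprod ℤ (s := fun _ : Fin 2 => Additive Kˣ)).map_update_add
    ![0, Additive.ofMul b] 0 (Additive.ofMul a) (Additive.ofMul a')
  have e : ∀ c : Kˣ, Function.update ![0, Additive.ofMul b] 0 (Additive.ofMul c) =
      fun i => Additive.ofMul ((![c, b] : Fin 2 → Kˣ) i) := fun c => by
    ext i; fin_cases i <;> rfl
  rw [e, e, ← ofMul_mul, e] at this
  simp only [milnorSymbol, this]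
  rfl

lemma milnorSymbol_mul_right (a b b' : Kˣ) :
    milnorSymbol ℓ ![a, b * b'] = milnorSymbol ℓ ![a, b] + milnorSymbol ℓ ![a, b'] := by
  have := (PiTensorProduct.tprod ℤ (s := fun _ : Fin 2 => Additive Kˣ)).map_update_add
    ![Additive.ofMul a, 0] 1 (Additive.ofMul b) (Additive.ofMul b')
  have e : ∀ c : Kˣ, Function.update ![Additive.ofMul a, 0] 1 (Additive.ofMul c) =
      fun i => Additive.ofMul ((![a, c] : Fin 2 → Kˣ) i) := fun c => by
    ext i; fin_cases i <;> rfl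
  rw [e, e, ← ofMul_mul, e] at this
  simp only [milnorSymbol, this]
  rfl

lemma milnorSymbol_eq_zero {a b : Kˣ} (h : (a : K) + b = 1) : milnorSymbol ℓ ![a, b] = 0 := by
  have h' : PiTensorProduct.tprod ℤ (fun i => Additive.ofMul ((![a, b] : Fin 2 → Kˣ) i)) ∈
      SteinbergRel 2 K := Submodule.subset_span ⟨![a, b], ⟨0, 1, by simp, h⟩, rfl⟩
  rw [milnorSymbol, (Submodule.Quotient.mk_eq_zero _).2 h']
  rfl

lemma milnorSymbol_pow_left (a b : Kˣ) (n : ℕ) :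
    milnorSymbol ℓ ![a ^ n, b] = n • milnorSymbol ℓ ![a, b] := by
  induction n with
  | zero => simpa using milnorSymbol_mul_left (ℓ := ℓ) 1 1 b
  | succ n ih => rw [pow_succ, milnorSymbol_mul_left, ih, succ_nsmul]

lemma milnorSymbol_pow_right (a b : Kˣ) (n : ℕ) :
    milnorSymbol ℓ ![a, b ^ n] = n • milnorSymbol ℓ ![a, b] := by
  induction n with
  | zero => simpa using milnorSymbol_mul_right (ℓ := ℓ) a 1 1
  | succ n ih => rw [pow_succ, milnorSymbol_mul_right, ih, succ_nsmul]

lemma K1proj_eq_iff {a a' : Kˣ} : K1proj ℓ K a = K1proj ℓ K a' ↔ ∃ c, a' = a * c ^ ℓ := by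
  rw [K1proj, QuotientGroup.mk'_eq_mk']
  constructor
  · rintro ⟨_, ⟨c, rfl⟩, h⟩; exact ⟨c, h.symm⟩
  · rintro ⟨c, h⟩; exact ⟨_, ⟨c, rfl⟩, h.symm⟩

lemma K1proj_surjective : Function.Surjective (K1proj ℓ K) := QuotientGroup.mk'_surjective _

lemma milnorSymbol_congr {a a' b b' : Kˣ} (ha : K1proj ℓ K a = K1proj ℓ K a')
    (hb : K1proj ℓ K b = K1proj ℓ K b') : milnorSymbol ℓ ![a, b] = milnorSymbol ℓ ![a', b'] := by
  obtain ⟨c, rfl⟩ := K1proj_eq_iff.1 ha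
  obtain ⟨d, rfl⟩ := K1proj_eq_iff.1 hb
  rw [milnorSymbol_mul_left, milnorSymbol_mul_right, milnorSymbol_pow_left,
    milnorSymbol_pow_right, nsmul_milnorKMod, nsmul_milnorKMod, add_zero, add_zero]

end Milnor
end MilnorRec

namespace MilnorRec
open IntermediateField

section MulEquiv
variable {ℓ : ℕ} [Fact ℓ.Prime] {K L : Type*} [Field K] [Field L] (φ : K1 ℓ K ≃* K1 ℓ L)

/-- An isomorphism `k^M_1(K) ≃ k^M_1(L)`, written additively. -/
def KV.ofMulEquiv : KV ℓ K ≃ₗ[ZMod ℓ] KV ℓ L :=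
  LinearEquiv.ofBijective (AddMonoidHom.toZModLinearMap ℓ (MulEquiv.toAdditive φ).toAddMonoidHom)
    (MulEquiv.toAdditive φ).bijective

lemma KV.ofMulEquiv_ofMul (w : K1 ℓ K) :
    KV.ofMulEquiv φ (Additive.ofMul w) = Additive.ofMul (φ w) := rfl

variable {φ}

lemma KV.ofMulEquiv_cl_eq_iff {a : Kˣ} {a' : Lˣ} :
    KV.ofMulEquiv φ (cl ℓ (a : K)) = cl ℓ (a' : L) ↔ φ (K1proj ℓ K a) = K1proj ℓ L a' := by
  rw [cl_units, cl_units, KV.ofMulEquiv_ofMul]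
  exact Additive.ofMul.injective.eq_iff

omit [Fact (Nat.Prime ℓ)] in
lemma _root_.CompatWithK2.symm (h : CompatWithK2 ℓ φ) : CompatWithK2 ℓ φ.symm := by
  obtain ⟨ψ, hψ⟩ := h
  refine ⟨ψ.symm, fun a b a' b' ha hb => ?_⟩
  rw [AddEquiv.symm_apply_eq, hψ a' b' a b ?_ ?_]
  · rw [← ha, MulEquiv.apply_symm_apply]
  · rw [← hb, MulEquiv.apply_symm_apply]

lemma _root_.CompatWithK2.stein (h : CompatWithK2 ℓ φ) {f : KV ℓ K →ₗ[ZMod ℓ] ZMod ℓ}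
    {T : Submodule (ZMod ℓ) (KV ℓ K)}
    (hf : ∀ x : K, x ≠ 0 → 1 - x ≠ 0 → f (cl ℓ x) • cl ℓ (1 - x) - f (cl ℓ (1 - x)) • cl ℓ x ∈ T)
    {y : L} (hy : y ≠ 0) (hy' : 1 - y ≠ 0) :
    f ((KV.ofMulEquiv φ).symm (cl ℓ y)) • (KV.ofMulEquiv φ).symm (cl ℓ (1 - y)) -
      f ((KV.ofMulEquiv φ).symm (cl ℓ (1 - y))) • (KV.ofMulEquiv φ).symm (cl ℓ y) ∈ T := by
  obtain ⟨ψ, hψ⟩ := h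
  obtain ⟨β, hβ⟩ := exists_milnorKMod_hom (ℓ := ℓ) (K := K) (N := KV ℓ K ⧸ T)
    (fun n => by
      rw [← Nat.cast_smul_eq_nsmul (ZMod ℓ), ZMod.natCast_self, zero_smul])
    (fun a b => T.mkQ (f (cl ℓ (a : K)) • cl ℓ (b : K) - f (cl ℓ (b : K)) • cl ℓ (a : K)))
    (fun a a' b => by
      rw [← map_add, Units.val_mul, cl_mul a.ne_zero a'.ne_zero, map_add, add_smul, smul_add]
      congr 1; abel)
    (fun a b b' => by
      rw [← map_add, Units.val_mul, cl_mul b.ne_zero b'.ne_zero, map_add, add_smul, smul_add]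
      congr 1; abel)
    (fun a b hab => by
      obtain hb : (b : K) = 1 - a := by rw [← hab]; ring
      rw [hb, Submodule.mkQ_apply, Submodule.Quotient.mk_eq_zero]
      exact hf a a.ne_zero (hb ▸ b.ne_zero))
  lift y to Lˣ using hy.isUnit
  obtain ⟨z, hz⟩ := hy'.isUnit
  obtain ⟨a, ha⟩ := K1proj_surjective (φ.symm (K1proj ℓ L y))
  obtain ⟨b, hb⟩ := K1proj_surjective (φ.symm (K1proj ℓ L z))
  have ha' : φ (K1proj ℓ K a) = K1proj ℓ L y := by rw [ha, MulEquiv.apply_symm_apply]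
  have hb' : φ (K1proj ℓ K b) = K1proj ℓ L z := by rw [hb, MulEquiv.apply_symm_apply]
  have h0 : milnorSymbol ℓ ![a, b] = 0 := ψ.injective <| by
    rw [hψ a b y z ha' hb', map_zero, milnorSymbol_eq_zero (by rw [hz]; ring)]
  rw [← hz, ← KV.ofMulEquiv_cl_eq_iff.2 ha', ← KV.ofMulEquiv_cl_eq_iff.2 hb',
    LinearEquiv.symm_apply_apply, LinearEquiv.symm_apply_apply, ← Submodule.Quotient.mk_eq_zero,
    ← Submodule.mkQ_apply, ← hβ, h0, map_zero]

end MulEquiv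

section Omega
variable {p ℓ : ℕ} [Fact ℓ.Prime] {k K M : Type*} [Field k] [Field K] [Field M] [Algebra k K]
  [Algebra k M] [Algebra K M] [IsScalarTower k K M] [IsAlgClosed k]

lemma ofMul_mem_Om_iff {u : K} (hu : Transcendental k u) {w : K1 ℓ K} :
    (Additive.ofMul w : KV ℓ K) ∈ Om ℓ k u ↔ w ∈ Omega ℓ k⟮u⟯ := by
  constructor
  · suffices H : ∀ v : KV ℓ K, v ∈ Om ℓ k u → ∃ x : Kˣ, (x : K) ∈ k⟮u⟯ ∧ cl ℓ (x : K) = v by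
      intro h
      obtain ⟨x, hx, hw⟩ := H _ h
      rw [cl_units] at hw
      exact ⟨x, hx, Additive.ofMul.injective hw⟩
    intro v hv
    induction hv using Submodule.span_induction with
    | mem v hv =>
      obtain ⟨a, rfl⟩ := hv
      exact ⟨Units.mk0 _ (sub_const_ne_zero hu a),
        sub_mem (mem_adjoin_simple_self k u) (k⟮u⟯.algebraMap_mem a), rfl⟩
    | zero => exact ⟨1, one_mem _, cl_one⟩
    | add v w _ _ hv hw =>
      obtain ⟨x, hx, rfl⟩ := hv
      obtain ⟨y, hy, rfl⟩ := hw
      exact ⟨x * y, mul_mem hx hy, cl_mul x.ne_zero y.ne_zero⟩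
    | smul c v _ hv =>
      obtain ⟨x, hx, rfl⟩ := hv
      refine ⟨x ^ c.val, pow_mem hx _, ?_⟩
      rw [Units.val_pow_eq_pow_val, cl_pow', ZMod.natCast_zmod_val]
  · rintro ⟨x, hx, rfl⟩
    exact (cl_units (ℓ := ℓ) x) ▸ cl_mem_Om hu hx

omit [IsAlgClosed k] in
lemma Om_map_piEquiv [ExpChar K p] (hp : (p : ZMod ℓ) ≠ 0) [IsPurelyInseparable K M] (u : K) :
    (Om ℓ k u).map (KV.piEquiv (K := M) hp).toLinearMap = Om ℓ k (algebraMap K M u) := by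
  rw [Om, Om, Submodule.map_span, ← Set.range_comp]
  congr 2
  ext a
  refine (KV.map_cl (algebraMap K M) _).trans ?_
  rw [map_sub, ← IsScalarTower.algebraMap_apply]

lemma _root_.IsGeneralElement.transcendental {u : K} (hu : IsGeneralElement k u) :
    Transcendental k u := fun h => hu.1 <| by
  obtain ⟨a, rfl⟩ := exists_const_of_isAlgebraic (not_not.2 h)
  exact IntermediateField.algebraMap_mem _ a

end Omega

section Transport
variable {p p' ℓ : ℕ} [Fact ℓ.Prime] {k K M l L N : Type*}
  [Field k] [Field K] [Field M] [Algebra k K] [Algebra k M] [Algebra K M] [IsScalarTower k K M]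
  [IsAlgClosed k] [ExpChar k p] [ExpChar K p] [IsPurelyInseparable K M] [PerfectField M]
  [Field l] [Field L] [Field N] [Algebra l L] [Algebra l N] [Algebra L N] [IsScalarTower l L N]
  [IsAlgClosed l] [ExpChar l p'] [ExpChar L p'] [IsPurelyInseparable L N] [PerfectField N]
  {φ : K1 ℓ K ≃* K1 ℓ L}

lemma Om_map_ofMulEquiv_iff {u : K} (hu : Transcendental k u) {w : L} (hw : Transcendental l w) :
    (Om ℓ k u).map (KV.ofMulEquiv φ).toLinearMap = Om ℓ l w ↔
      (Omega ℓ k⟮u⟯).map φ.toMonoidHom = Omega ℓ l⟮w⟯ := by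
  have key : ∀ x : K1 ℓ L, (Additive.ofMul x : KV ℓ L) ∈
      (Om ℓ k u).map (KV.ofMulEquiv φ).toLinearMap ↔ x ∈ (Omega ℓ k⟮u⟯).map φ.toMonoidHom := by
    intro x
    constructor
    · rintro ⟨v, hv, h⟩
      exact ⟨Additive.toMul (v : Additive (K1 ℓ K)), (ofMul_mem_Om_iff hu).1 hv, h⟩
    · rintro ⟨v, hv, rfl⟩
      exact ⟨_, (ofMul_mem_Om_iff hu).2 hv, rfl⟩
  constructor
  · intro h
    ext x
    rw [← key, h, ofMul_mem_Om_iff hw]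
  · intro h
    ext x
    exact ((key x).trans (by rw [h])).trans (ofMul_mem_Om_iff hw).symm

variable (M N φ) in
/-- The isomorphism of `KV` of purely inseparable extensions given by an isomorphism of the
mod-`ℓ` Milnor groups of the base fields. -/
def KV.hatEquiv (hp : (p : ZMod ℓ) ≠ 0) (hp' : (p' : ZMod ℓ) ≠ 0) : KV ℓ M ≃ₗ[ZMod ℓ] KV ℓ N :=
  (KV.piEquiv (K := M) hp).symm ≪≫ₗ KV.ofMulEquiv φ ≪≫ₗ KV.piEquiv (K := N) hp'

omit [PerfectField M] [PerfectField N] in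
lemma KV.hatEquiv_piEquiv (hp : (p : ZMod ℓ) ≠ 0) (hp' : (p' : ZMod ℓ) ≠ 0) (v : KV ℓ K) :
    KV.hatEquiv M N φ hp hp' (KV.piEquiv hp v) = KV.piEquiv hp' (KV.ofMulEquiv φ v) := by
  simp [KV.hatEquiv]

omit [IsAlgClosed k] [IsAlgClosed l] [PerfectField M] [PerfectField N] [ExpChar k p] in
lemma _root_.CompatWithK2.hatEquiv_stein (hp : (p : ZMod ℓ) ≠ 0) (hp' : (p' : ZMod ℓ) ≠ 0)
    (h2 : CompatWithK2 ℓ φ) (f : KV ℓ M →ₗ[ZMod ℓ] ZMod ℓ) (T : Submodule (ZMod ℓ) (KV ℓ M))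
    (_ : ∀ v ∈ T, f v = 0) (hf : ∀ x : M, x ≠ 0 → 1 - x ≠ 0 →
      f (cl ℓ x) • cl ℓ (1 - x) - f (cl ℓ (1 - x)) • cl ℓ x ∈ T)
    (y : N) (hy : y ≠ 0) (hy' : 1 - y ≠ 0) :
    f ((KV.hatEquiv M N φ hp hp').symm (cl ℓ y)) • cl ℓ (1 - y) -
      f ((KV.hatEquiv M N φ hp hp').symm (cl ℓ (1 - y))) • cl ℓ y ∈
        T.map (KV.hatEquiv M N φ hp hp').toLinearMap := by
  have hsymm : ∀ v, (KV.hatEquiv M N φ hp hp').symm (KV.piEquiv hp' v) =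
      KV.piEquiv hp ((KV.ofMulEquiv φ).symm v) := fun v => by
    rw [LinearEquiv.symm_apply_eq, KV.hatEquiv_piEquiv, LinearEquiv.apply_symm_apply]
  have : ExpChar N p' := expChar_of_injective_algebraMap (algebraMap L N).injective p'
  obtain ⟨n, y₀, hy₀⟩ := IsPurelyInseparable.pow_mem L p' y
  have hy₁ : algebraMap L N (1 - y₀) = (1 - y) ^ p' ^ n := by
    rw [sub_pow_expChar_pow, one_pow, ← hy₀, map_sub, map_one]
  have h0 : y₀ ≠ 0 := by
    rintro rfl; rw [map_zero] at hy₀; exact pow_ne_zero _ hy hy₀.symm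
  have h1 : 1 - y₀ ≠ 0 := by
    intro h; rw [h, map_zero] at hy₁; exact pow_ne_zero _ hy' hy₁.symm
  have hq := natCast_pow_ne_zero hp' n
  have e1 : ((p' ^ n : ℕ) : ZMod ℓ) • cl ℓ y = KV.piEquiv hp' (cl ℓ y₀) := by
    rw [← cl_pow', ← hy₀]; exact (KV.map_cl _ _).symm
  have e2 : ((p' ^ n : ℕ) : ZMod ℓ) • cl ℓ (1 - y) = KV.piEquiv hp' (cl ℓ (1 - y₀)) := by
    rw [← cl_pow', ← hy₁]; exact (KV.map_cl _ _).symm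
  have key := h2.stein (f := f ∘ₗ (KV.piEquiv (K := M) hp).toLinearMap)
    (T := T.comap (KV.piEquiv (K := M) hp).toLinearMap) (fun x hx hx' => by
      have := hf (algebraMap K M x) ((map_ne_zero _).2 hx)
        (by rw [← map_one (algebraMap K M), ← map_sub]; exact (map_ne_zero _).2 hx')
      rw [← map_one (algebraMap K M), ← map_sub, ← KV.map_cl, ← KV.map_cl] at this
      simpa [KV.piEquiv] using this) h0 h1
  rw [← Submodule.smul_mem_iff _ (mul_ne_zero hq hq)]
  refine ⟨_, key, ?_⟩
  simp only [map_sub, map_smul, LinearMap.comp_apply, LinearEquiv.coe_coe, ← hsymm,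
    LinearEquiv.apply_symm_apply]
  rw [← e1, ← e2]
  simp only [map_smul, smul_sub, smul_smul, smul_eq_mul]
  congr 2 <;> ring

omit [ExpChar k p] [PerfectField M] [ExpChar l p'] [PerfectField N] in
lemma Om_map_hatEquiv_iff (hp : (p : ZMod ℓ) ≠ 0) (hp' : (p' : ZMod ℓ) ≠ 0) {u : K}
    (hu : Transcendental k u) {w : L} (hw : Transcendental l w) :
    (Om ℓ k (algebraMap K M u)).map (KV.hatEquiv M N φ hp hp').toLinearMap =
      Om ℓ l (algebraMap L N w) ↔ (Omega ℓ k⟮u⟯).map φ.toMonoidHom = Omega ℓ l⟮w⟯ := by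
  have e : (KV.hatEquiv M N φ hp hp').toLinearMap ∘ₗ (KV.piEquiv (K := M) hp).toLinearMap =
      (KV.piEquiv (K := N) hp').toLinearMap ∘ₗ (KV.ofMulEquiv φ).toLinearMap :=
    LinearMap.ext fun v => by
      rw [LinearMap.comp_apply, LinearMap.comp_apply, LinearEquiv.coe_coe, LinearEquiv.coe_coe,
        LinearEquiv.coe_coe, LinearEquiv.coe_coe]
      exact KV.hatEquiv_piEquiv (φ := φ) hp hp' v
  have h2 := Om_map_piEquiv (M := M) (k := k) (ℓ := ℓ) hp u
  have h3 := Om_map_piEquiv (M := N) (k := l) (ℓ := ℓ) hp' w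
  have h4 := Submodule.map_comp (KV.piEquiv (ℓ := ℓ) (K := M) hp).toLinearMap
    (KV.hatEquiv M N φ hp hp').toLinearMap (Om ℓ k u)
  have h5 := Submodule.map_comp (KV.ofMulEquiv φ).toLinearMap
    (KV.piEquiv (K := N) hp').toLinearMap (Om ℓ k u)
  rw [e] at h4
  rw [← h2, ← h4, h5, ← h3, ← Om_map_ofMulEquiv_iff hu hw]
  exact (Submodule.map_injective_of_injective (KV.piEquiv (K := N) hp').injective).eq_iff

lemma halfTransport_hatEquiv (hp : (p : ZMod ℓ) ≠ 0) (hp' : (p' : ZMod ℓ) ≠ 0)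
    (hK : IsFunctionField k K) (h2 : CompatWithK2 ℓ φ)
    (hr : ∀ A, IsRationalSubgroup ℓ k A → IsRationalSubgroup ℓ l (A.map φ.toMonoidHom)) :
    HalfTransport p k l p' (KV.hatEquiv M N φ hp hp') := by
  refine ⟨fun f T h0 h1 y hy hy' => h2.hatEquiv_stein hp hp' f T h0 h1 y hy hy', fun t ht => ?_⟩
  obtain ⟨u, hu, ho⟩ := exists_isGeneralElement hp hK ht
  obtain ⟨w, hw, h⟩ := hr _ ⟨u, hu, rfl⟩
  refine ⟨algebraMap L N w, hw.qgen, ?_⟩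
  rw [ho]
  exact (Om_map_hatEquiv_iff hp hp' hu.transcendental hw.transcendental).2 h

omit [Fact (Nat.Prime ℓ)] [IsAlgClosed k] [IsAlgClosed l] in
lemma _root_.CompatWithRat.symm (h : CompatWithRat ℓ k l φ) : CompatWithRat ℓ l k φ.symm := by
  have e : ∀ A : Subgroup (K1 ℓ K), (A.map φ.toMonoidHom).map φ.symm.toMonoidHom = A := fun A => by
    rw [Subgroup.map_map]
    convert Subgroup.map_id A
    ext x; simp
  refine ⟨fun B hB => ?_, fun A hA => ⟨_, h.1 A hA, e A⟩⟩
  obtain ⟨A, hA, rfl⟩ := h.2 B hB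
  rwa [e]

end Transport
end MilnorRec

namespace MilnorRec
open IntermediateField

section Const
variable {p ℓ : ℕ} {k M l N : Type*} [Field k] [Field M] [Algebra k M] [Field l] [Field N]
  [Algebra l N]

lemma PFG.exists_const_of_forall_pow [ExpChar k p] [IsAlgClosed k] (h : PFG p k M) {u : M}
    (hu : ∀ n ≠ 0, ∃ v, v ^ n = u) : ∃ a, u = algebraMap k M a := by
  refine exists_const_of_isAlgebraic fun hut => ?_
  obtain ⟨t, hu_mem, ht⟩ := exists_isTranscendenceBasis_superset
    (s := {u}) (algebraicIndependent_unique_type_iff.2 hut)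
  have hA : Algebra.IsAlgebraic (adjoin k t) M := by
    have := ht.isAlgebraic_field
    rwa [Subtype.range_coe] at this
  have := h.finiteDimensional_separableClosure (adjoin k t)
  obtain ⟨q, hq, hqp⟩ := Nat.exists_infinite_primes
    (p + Module.finrank (adjoin k t) (separableClosure (adjoin k t) M) + 1)
  obtain ⟨v, hv⟩ := hu q hqp.ne_zero
  set w : adjoin k t := ⟨u, subset_adjoin k t (hu_mem rfl)⟩
  have hq0 : (q : adjoin k t) ≠ 0 := by
    have := expChar_of_injective_algebraMap (algebraMap k (adjoin k t)).injective p
    intro h0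
    cases this with
    | zero => exact hqp.ne_zero (by exact_mod_cast h0)
    | prime hp =>
      have := (Nat.prime_dvd_prime_iff_eq hp hqp).1 ((CharP.cast_eq_zero_iff _ p q).1 h0)
      omega
  have hw0 : w ≠ 0 := fun h0 =>
    hut ((show u = 0 from congrArg Subtype.val h0) ▸ isAlgebraic_zero)
  have hsep : (Polynomial.X ^ q - Polynomial.C w).Separable :=
    Polynomial.separable_X_pow_sub_C w hq0 hw0
  have hirr : Irreducible (Polynomial.X ^ q - Polynomial.C w) := by
    refine X_pow_sub_C_irreducible_of_prime hqp fun b hb => hqp.ne_one ?_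
    refine eq_one_of_pow_eq_mul_pow ht.1 (i := ⟨u, hu_mem rfl⟩) (c := b)
      (by rw [Subtype.range_coe]; exact b.2) (congrArg Subtype.val hb)
  have hm : Polynomial.aeval v (Polynomial.X ^ q - Polynomial.C w) = 0 := by
    simp [hv, w]
  have hvs : v ∈ separableClosure (adjoin k t) M := by
    rw [mem_separableClosure_iff]
    exact hsep.of_dvd (minpoly.dvd _ _ hm)
  have h1 := minpoly.eq_of_irreducible_of_monic hirr
    (x := (⟨v, hvs⟩ : separableClosure (adjoin k t) M))
    (Subtype.val_injective (by simpa using hm)) (Polynomial.monic_X_pow_sub_C _ hqp.ne_zero)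
  have h2 := minpoly.natDegree_le (A := adjoin k t)
    (⟨v, hvs⟩ : separableClosure (adjoin k t) M)
  rw [← h1, Polynomial.natDegree_X_pow_sub_C] at h2
  omega

lemma exists_ringHom_const [ExpChar k p] [IsAlgClosed k] [IsAlgClosed l] (h : PFG p k M)
    (σ : N →+* M) :
    ∃ π : l →+* k, ∀ a, σ (algebraMap l N a) = algebraMap k M (π a) := by
  have H : ∀ a : l, ∃ b : k, σ (algebraMap l N a) = algebraMap k M b := fun a =>
    h.exists_const_of_forall_pow fun n hn => by
      obtain ⟨b, hb⟩ := IsAlgClosed.exists_pow_nat_eq a (Nat.pos_of_ne_zero hn)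
      exact ⟨σ (algebraMap l N b), by rw [← map_pow, ← map_pow, hb]⟩
  choose π hπ using H
  have inj := (algebraMap k M).injective
  exact ⟨{ toFun := π
           map_one' := inj (by rw [← hπ]; simp)
           map_zero' := inj (by rw [← hπ]; simp)
           map_mul' := fun a b => inj (by rw [← hπ]; simp [hπ])
           map_add' := fun a b => inj (by rw [← hπ]; simp [hπ]) }, hπ⟩

lemma exists_ringEquiv_const {p' : ℕ} [ExpChar k p] [IsAlgClosed k] [ExpChar l p'] [IsAlgClosed l]
    (h : PFG p k M) (h' : PFG p' l N) (σ : M ≃+* N) :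
    ∃ π : k ≃+* l, ∀ a, σ (algebraMap k M a) = algebraMap l N (π a) := by
  obtain ⟨π, hπ⟩ := exists_ringHom_const (k := l) (l := k) h' (σ : M →+* N)
  obtain ⟨π', hπ'⟩ := exists_ringHom_const (k := k) (l := l) h (σ.symm : N →+* M)
  simp only [RingEquiv.coe_toRingHom] at hπ hπ'
  refine ⟨RingEquiv.ofRingHom π π' ?_ ?_, hπ⟩
  · ext a
    refine (algebraMap l N).injective ?_
    simp [← hπ, ← hπ']
  · ext a
    refine (algebraMap k M).injective ?_
    simp [← hπ, ← hπ']

end Const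

section Semilinear
variable {p ℓ : ℕ} {k M l N : Type*} [Field k] [Field M] [Algebra k M] [Field l] [Field N]
  [Algebra l N] {π : k ≃+* l} {σ : M ≃+* N} (h : ∀ a, σ (algebraMap k M a) = algebraMap l N (π a))
include h

lemma symm_algebraMap (a : l) : σ.symm (algebraMap l N a) = algebraMap k M (π.symm a) := by
  rw [RingEquiv.symm_apply_eq, h, RingEquiv.apply_symm_apply]

lemma map_mem_adjoin_simple {t α : M} (hα : α ∈ k⟮t⟯) : σ α ∈ l⟮σ t⟯ := by
  induction hα using adjoin_induction with
  | mem x hx =>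
    rw [Set.mem_singleton_iff.1 hx]; exact mem_adjoin_simple_self l _
  | algebraMap a => rw [h]; exact IntermediateField.algebraMap_mem _ _
  | add x y _ _ hx hy => rw [map_add]; exact add_mem hx hy
  | mul x y _ _ hx hy => rw [map_mul]; exact mul_mem hx hy
  | inv x _ hx => rw [map_inv₀]; exact inv_mem hx

lemma isAlgebraic_map_adjoin_simple {t α : M} (hα : IsAlgebraic k⟮t⟯ α) :
    IsAlgebraic l⟮σ t⟯ (σ α) := by
  let e : k⟮t⟯ →+* l⟮σ t⟯ :=
    ((σ : M →+* N).comp (algebraMap k⟮t⟯ M)).codRestrict l⟮σ t⟯ fun x => map_mem_adjoin_simple h x.2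
  exact hα.ringHom_of_comp_eq e (σ : M →+* N) e.injective rfl

lemma transcendental_map {t : M} (ht : Transcendental k t) : Transcendental l (σ t) := fun H => by
  have := H.ringHom_of_comp_eq (π.symm : l →+* k) (σ.symm : N →+* M) π.symm.injective
    (by ext a; exact (symm_algebraMap h a).symm)
  exact ht (by simpa using this)

lemma QGen.map {t : M} (ht : QGen p k t) : QGen p l (σ t) := by
  refine ⟨transcendental_map h ht.1, fun α hα => ?_⟩
  have := isAlgebraic_map_adjoin_simple (symm_algebraMap h) hα
  rw [RingEquiv.symm_apply_apply] at this
  obtain ⟨n, hn⟩ := ht.2 _ this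
  refine ⟨n, ?_⟩
  have := map_mem_adjoin_simple h hn
  rwa [map_pow, RingEquiv.apply_symm_apply] at this

lemma Om_map_ringHom [Fact ℓ.Prime] (t : M) :
    (Om ℓ k t).map (KV.map (σ : M →+* N)) = Om ℓ l (σ t) := by
  rw [Om, Om, Submodule.map_span, ← Set.range_comp]
  congr 1
  ext v
  constructor
  · rintro ⟨a, rfl⟩
    exact ⟨π a, by rw [Function.comp_apply, KV.map_cl]; simp [h]⟩
  · rintro ⟨a, rfl⟩
    exact ⟨π.symm a, by rw [Function.comp_apply, KV.map_cl]; simp [h]⟩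

end Semilinear
end MilnorRec

namespace MilnorRec
open IntermediateField

section Hat
variable {p p' ℓ : ℕ} [Fact ℓ.Prime] {K M L N : Type*} [Field K] [Field M] [Algebra K M]
  [ExpChar K p] [IsPurelyInseparable K M] [Field L] [Field N] [Algebra L N] [ExpChar L p']
  [IsPurelyInseparable L N]
  {φ φ' : K1 ℓ K ≃* K1 ℓ L} (hp : (p : ZMod ℓ) ≠ 0) (hp' : (p' : ZMod ℓ) ≠ 0)

lemma KV.hatEquiv_cl_eq_iff {x : Kˣ} {y : Lˣ} :
    KV.hatEquiv M N φ hp hp' (cl ℓ (algebraMap K M x)) = cl ℓ (algebraMap L N y) ↔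
      φ (K1proj ℓ K x) = K1proj ℓ L y := by
  have h1 : cl ℓ (algebraMap K M x) = KV.piEquiv hp (cl ℓ (x : K)) := (KV.map_cl _ _).symm
  have h2 : cl ℓ (algebraMap L N y) = KV.piEquiv hp' (cl ℓ (y : L)) := (KV.map_cl _ _).symm
  rw [h1, h2, KV.hatEquiv_piEquiv, (KV.piEquiv hp').injective.eq_iff, KV.ofMulEquiv_cl_eq_iff]

lemma KV.hatEquiv_symm (hp : (p : ZMod ℓ) ≠ 0) (hp' : (p' : ZMod ℓ) ≠ 0) :
      (KV.hatEquiv M N φ hp hp').symm = KV.hatEquiv N M φ.symm hp' hp := by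
  ext v
  rw [LinearEquiv.symm_apply_eq]
  obtain ⟨w, rfl⟩ := (KV.piEquiv (ℓ := ℓ) (M := L) (K := N) hp').surjective v
  rw [KV.hatEquiv_piEquiv (φ := φ.symm) hp' hp, KV.hatEquiv_piEquiv hp hp']
  congr 1
  exact (congrArg Additive.ofMul (φ.apply_symm_apply _)).symm

lemma KV.exists_hatEquiv_eq (Θ : KV ℓ M ≃ₗ[ZMod ℓ] KV ℓ N) :
    ∃ φ : K1 ℓ K ≃* K1 ℓ L, ∀ v, KV.hatEquiv M N φ hp hp' v = Θ v := by
  let Ξ : KV ℓ K ≃ₗ[ZMod ℓ] KV ℓ L := KV.piEquiv hp ≪≫ₗ Θ ≪≫ₗ (KV.piEquiv hp').symm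
  refine ⟨MulEquiv.toAdditive.symm (show Additive (K1 ℓ K) ≃+ Additive (K1 ℓ L) from
    Ξ.toAddEquiv), fun v => ?_⟩
  obtain ⟨w, rfl⟩ := (KV.piEquiv (ℓ := ℓ) (M := K) (K := M) hp).surjective v
  rw [KV.hatEquiv_piEquiv]
  refine (congrArg (KV.piEquiv hp') (?_ : _ = Ξ w)).trans ?_
  · rfl
  · simp [Ξ]

lemma KV.hatEquiv_eq_smul_iff {ε : ZMod ℓ} :
    (∀ v, KV.hatEquiv M N φ' hp hp' v = ε • KV.hatEquiv M N φ hp hp' v) ↔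
      ∀ x, φ' x = φ x ^ ε.val := by
  have hv : ∀ v : KV ℓ L, ε • v = ε.val • v := fun v => by
    rw [← Nat.cast_smul_eq_nsmul (ZMod ℓ), ZMod.natCast_zmod_val]
  have H : ∀ w : KV ℓ K, KV.ofMulEquiv φ' w = ε • KV.ofMulEquiv φ w ↔
      φ' (Additive.toMul (w : Additive (K1 ℓ K))) =
        φ (Additive.toMul (w : Additive (K1 ℓ K))) ^ ε.val := fun w => by
    rw [hv]
    exact Additive.ofMul.injective.eq_iff (b := φ (Additive.toMul (w : Additive (K1 ℓ K))) ^ ε.val)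
  constructor
  · intro h
    have h' : ∀ w : KV ℓ K, φ' (Additive.toMul (w : Additive (K1 ℓ K))) =
        φ (Additive.toMul (w : Additive (K1 ℓ K))) ^ ε.val := fun w => by
      have := h (KV.piEquiv hp w)
      rw [KV.hatEquiv_piEquiv hp hp', KV.hatEquiv_piEquiv hp hp', ← _root_.map_smul] at this
      exact (H w).1 ((KV.piEquiv hp').injective this)
    exact h'
  · intro h v
    obtain ⟨w, rfl⟩ := (KV.piEquiv (ℓ := ℓ) (M := K) (K := M) hp).surjective v
    rw [KV.hatEquiv_piEquiv hp hp', KV.hatEquiv_piEquiv hp hp', ← _root_.map_smul]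
    exact congrArg _ ((H w).2 (h _))

variable (ℓ) in
/-- The isomorphism of `KV` induced by a field isomorphism. -/
def KV.mapEquiv (σ : M ≃+* N) : KV ℓ M ≃ₗ[ZMod ℓ] KV ℓ N :=
  LinearEquiv.ofLinearMap (KV.map (σ : M →+* N)) (KV.map (σ.symm : N →+* M))
    (LinearMap.ext fun v => by
      obtain ⟨x, -, rfl⟩ := cl_surj v
      simp [KV.map_cl])
    (LinearMap.ext fun v => by
      obtain ⟨x, -, rfl⟩ := cl_surj v
      simp [KV.map_cl])

omit [Algebra K M] [Algebra L N] [IsPurelyInseparable K M] [IsPurelyInseparable L N]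
  [ExpChar K p] [ExpChar L p'] in
lemma KV.mapEquiv_cl (σ : M ≃+* N) (x : M) : KV.mapEquiv ℓ σ (cl ℓ x) = cl ℓ (σ x) :=
  KV.map_cl _ _

variable {hp hp'} {σ : M ≃+* N} (h : ∀ v, KV.hatEquiv M N φ hp hp' v = KV.mapEquiv ℓ σ v)
include h

lemma hatEquiv_symm_of_eq_mapEquiv (v : KV ℓ N) :
    KV.hatEquiv N M φ.symm hp' hp v = KV.mapEquiv ℓ σ.symm v := by
  rw [← KV.hatEquiv_symm hp hp', LinearEquiv.symm_apply_eq, h]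
  exact ((KV.mapEquiv ℓ σ).apply_symm_apply v).symm

lemma exists_milnorKMod_hom_of_eq_mapEquiv :
    ∃ ψ : MilnorKMod ℓ 2 K →+ MilnorKMod ℓ 2 L, ∀ (a b : Kˣ) (a' b' : Lˣ),
      φ (K1proj ℓ K a) = K1proj ℓ L a' → φ (K1proj ℓ K b) = K1proj ℓ L b' →
        ψ (milnorSymbol ℓ ![a, b]) = milnorSymbol ℓ ![a', b'] := by
  have H : ∀ a : Kˣ, ∃ a' : Lˣ, φ (K1proj ℓ K a) = K1proj ℓ L a' := fun a =>
    (K1proj_surjective (φ (K1proj ℓ K a))).imp fun _ => Eq.symm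
  choose r hr using H
  have hmul : ∀ a b, K1proj ℓ L (r (a * b)) = K1proj ℓ L (r a * r b) := fun a b => by
    rw [← hr, map_mul, map_mul, map_mul, hr, hr]
  obtain ⟨ψ, hψ⟩ := exists_milnorKMod_hom (ℓ := ℓ) nsmul_milnorKMod
    (fun a b => milnorSymbol ℓ ![r a, r b])
    (fun a a' b => by rw [milnorSymbol_congr (hmul a a') rfl, milnorSymbol_mul_left])
    (fun a b b' => by rw [milnorSymbol_congr rfl (hmul b b'), milnorSymbol_mul_right])
    (fun a b hab => by
      have : ExpChar N p' := expChar_of_injective_algebraMap (algebraMap L N).injective p'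
      obtain ⟨n, y, hy⟩ := IsPurelyInseparable.pow_mem L p' (σ (algebraMap K M a))
      have hz : algebraMap L N (1 - y) = σ (algebraMap K M b) ^ p' ^ n := by
        have hb : (b : K) = 1 - a := by rw [← hab]; ring
        rw [hb, map_sub, map_sub, map_sub, sub_pow_expChar_pow, hy]
        simp
      have key : ∀ (c : Kˣ) (z : L), algebraMap L N z = σ (algebraMap K M c) ^ p' ^ n →
          ∃ w : Lˣ, (w : L) = z ∧ K1proj ℓ L (r c ^ p' ^ n) = K1proj ℓ L w := by
        intro c z hz
        have hz0 : z ≠ 0 := by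
          rintro rfl
          rw [map_zero] at hz
          exact pow_ne_zero _ ((map_ne_zero σ).2 ((map_ne_zero _).2 c.ne_zero)) hz.symm
        refine ⟨Units.mk0 z hz0, rfl, ?_⟩
        rw [map_pow, ← hr, ← map_pow, ← map_pow, ← KV.hatEquiv_cl_eq_iff (M := M) (N := N) hp hp',
          h, KV.mapEquiv_cl, Units.val_mk0, hz]
        simp
      obtain ⟨w, rfl, h1⟩ := key a y hy
      obtain ⟨w', hw', h2⟩ := key b _ hz
      have h3 := milnorSymbol_congr h1 h2
      rw [milnorSymbol_eq_zero (a := w) (b := w') (by rw [hw']; ring), milnorSymbol_pow_left, milnorSymbol_pow_right,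
        ← mul_nsmul] at h3
      have hcop : Nat.Coprime (p' ^ n * p' ^ n) ℓ := by
        rw [Nat.coprime_comm, (Fact.out : ℓ.Prime).coprime_iff_not_dvd, ← ZMod.natCast_eq_zero_iff,
          Nat.cast_mul]
        exact mul_ne_zero (natCast_pow_ne_zero hp' n) (natCast_pow_ne_zero hp' n)
      exact AddMonoid.addOrderOf_eq_one_iff.1 (Nat.eq_one_of_dvd_coprimes hcop
        (addOrderOf_dvd_of_nsmul_eq_zero h3)
        (addOrderOf_dvd_of_nsmul_eq_zero (nsmul_milnorKMod _))))
  exact ⟨ψ, fun a b a' b' ha hb => (hψ a b).trans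
    (milnorSymbol_congr ((hr a).symm.trans ha) ((hr b).symm.trans hb))⟩

lemma compatWithK2_of_eq_mapEquiv : CompatWithK2 ℓ φ := by
  obtain ⟨ψ, hψ⟩ := exists_milnorKMod_hom_of_eq_mapEquiv h
  obtain ⟨ψ', hψ'⟩ := exists_milnorKMod_hom_of_eq_mapEquiv (hatEquiv_symm_of_eq_mapEquiv h)
  refine ⟨AddMonoidHom.toAddEquiv ψ ψ' (milnorKMod_hom_ext fun a b => ?_)
    (milnorKMod_hom_ext fun a b => ?_), hψ⟩
  · obtain ⟨a', ha⟩ := K1proj_surjective (φ (K1proj ℓ K a))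
    obtain ⟨b', hb⟩ := K1proj_surjective (φ (K1proj ℓ K b))
    rw [AddMonoidHom.comp_apply, hψ a b a' b' ha.symm hb.symm, hψ' a' b' a b]
    · rfl
    · rw [ha, MulEquiv.symm_apply_apply]
    · rw [hb, MulEquiv.symm_apply_apply]
  · obtain ⟨a', ha⟩ := K1proj_surjective (φ.symm (K1proj ℓ L a))
    obtain ⟨b', hb⟩ := K1proj_surjective (φ.symm (K1proj ℓ L b))
    rw [AddMonoidHom.comp_apply, hψ' a b a' b' ha.symm hb.symm, hψ a' b' a b]
    · rfl
    · rw [ha, MulEquiv.apply_symm_apply]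
    · rw [hb, MulEquiv.apply_symm_apply]

end Hat

section Rat
variable {p ℓ : ℕ} [Fact ℓ.Prime] {k K M l L N : Type*}
  [Field k] [Field K] [Field M] [Algebra k K] [Algebra k M] [Algebra K M] [IsScalarTower k K M]
  [IsAlgClosed k] [ExpChar k p] [ExpChar K p] [IsPurelyInseparable K M] [PerfectField M]
  [Field l] [Field L] [Field N] [Algebra l L] [Algebra l N] [Algebra L N] [IsScalarTower l L N]
  [IsAlgClosed l] [ExpChar l p] [ExpChar L p] [IsPurelyInseparable L N] [PerfectField N]
  {φ : K1 ℓ K ≃* K1 ℓ L} {hp : (p : ZMod ℓ) ≠ 0} {π : k ≃+* l} {σ : M ≃+* N}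

lemma isRationalSubgroup_map_of_eq_mapEquiv (hL : IsFunctionField l L)
    (h : ∀ v, KV.hatEquiv M N φ hp hp v = KV.mapEquiv ℓ σ v)
    (hπ : ∀ a, σ (algebraMap k M a) = algebraMap l N (π a)) {A : Subgroup (K1 ℓ K)}
    (hA : IsRationalSubgroup ℓ k A) : IsRationalSubgroup ℓ l (A.map φ.toMonoidHom) := by
  obtain ⟨u, hu, rfl⟩ := hA
  obtain ⟨w, hw, ho⟩ := exists_isGeneralElement hp hL (hu.qgen (M := M) (p := p) |>.map hπ)
  refine ⟨w, hw, (Om_map_hatEquiv_iff (M := M) (N := N) hp hp hu.transcendental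
    hw.transcendental).1 ?_⟩
  rw [← ho, ← Om_map_ringHom hπ]
  congr 1
  exact LinearMap.ext h

lemma compatWithRat_of_eq_mapEquiv (hK : IsFunctionField k K) (hL : IsFunctionField l L)
    (h : ∀ v, KV.hatEquiv M N φ hp hp v = KV.mapEquiv ℓ σ v)
    (hπ : ∀ a, σ (algebraMap k M a) = algebraMap l N (π a)) : CompatWithRat ℓ k l φ := by
  refine ⟨fun A hA => isRationalSubgroup_map_of_eq_mapEquiv hL h hπ hA, fun B hB =>
    ⟨_, isRationalSubgroup_map_of_eq_mapEquiv hK (hatEquiv_symm_of_eq_mapEquiv h)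
      (symm_algebraMap hπ) hB, ?_⟩⟩
  rw [Subgroup.map_map]
  convert Subgroup.map_id B
  ext x; simp

end Rat
end MilnorRec

namespace MilnorRec

instance {K : Type u} [Field K] (P : PerfectClosureOf K) : IsPurelyInseparable K P.carrier :=
  P.purelyInseparable

instance {K : Type u} [Field K] (P : PerfectClosureOf K) : PerfectField P.carrier := P.perfect

lemma inducesOnK1_iff {p p' ℓ : ℕ} [Fact ℓ.Prime] {K : Type u} {L : Type v} [Field K] [Field L]
    [ExpChar K p] [ExpChar L p'] {PK : PerfectClosureOf K} {PL : PerfectClosureOf L}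
    {σ : PK.carrier ≃+* PL.carrier} {φ : K1 ℓ K ≃* K1 ℓ L}
    (hp : (p : ZMod ℓ) ≠ 0) (hp' : (p' : ZMod ℓ) ≠ 0) :
    InducesOnK1 ℓ PK PL σ φ ↔
      ∀ v, KV.hatEquiv PK.carrier PL.carrier φ hp hp' v = KV.mapEquiv ℓ σ v := by
  have H : ∀ (x : Kˣ) (y : Lˣ), (∃ z : (PL.carrier)ˣ,
      Units.map σ.toRingHom.toMonoidHom (Units.map (algebraMap K PK.carrier).toMonoidHom x) =
        Units.map (algebraMap L PL.carrier).toMonoidHom y * z ^ ℓ) ↔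
      cl ℓ (algebraMap L PL.carrier y) = cl ℓ (σ (algebraMap K PK.carrier x)) := fun x y => by
    rw [← K1proj_eq_iff, ← Additive.ofMul.injective.eq_iff]
    erw [← cl_units, ← cl_units]
    rfl
  simp only [InducesOnK1, H]
  constructor
  · intro h v
    obtain ⟨w, rfl⟩ := (KV.piEquiv (ℓ := ℓ) (M := K) (K := PK.carrier) hp).surjective v
    obtain ⟨x, hx, rfl⟩ := cl_surj w
    obtain ⟨y, hy⟩ := K1proj_surjective (φ (K1proj ℓ K (Units.mk0 x hx)))
    have h1 : KV.piEquiv (ℓ := ℓ) (K := PK.carrier) hp (cl ℓ x) =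
      cl ℓ (algebraMap K PK.carrier (Units.mk0 x hx)) := KV.map_cl _ _
    rw [h1, KV.mapEquiv_cl, (KV.hatEquiv_cl_eq_iff hp hp').2 hy.symm]
    exact (h _ _).1 hy.symm
  · intro h x y
    rw [← KV.hatEquiv_cl_eq_iff (M := PK.carrier) (N := PL.carrier) hp hp', h, KV.mapEquiv_cl]
    exact eq_comm

lemma frobTwistEquiv_iff {p ℓ : ℕ} [Fact ℓ.Prime] {k M N : Type*} [Field k] [Field M] [Field N]
    [Algebra k M] [IsAlgClosed k] [ExpChar k p] (H : Setup p ℓ k M 5) {σ σ' : M ≃+* N} :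
    (∃ ε : (ZMod ℓ)ˣ, ∀ v, KV.mapEquiv ℓ σ' v = (ε : ZMod ℓ) • KV.mapEquiv ℓ σ v) ↔
      FrobTwistEquiv σ σ' := by
  have hM : ExpChar M p := expChar_of_injective_algebraMap (algebraMap k M).injective p
  constructor
  · rintro ⟨ε, h⟩
    obtain ⟨π, hπ⟩ := exists_ringEquiv_const H.pfg H.pfg (σ'.trans σ.symm)
    obtain ⟨n, m, hnm⟩ := H.pow_eq_pow (ρ := (σ'.trans σ.symm : M →+* M)) ε.ne_zero hπ
      (fun w => (KV.mapEquiv ℓ σ).injective (by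
        rw [_root_.map_smul, ← h, KV.mapEquiv_cl, KV.mapEquiv_cl]
        simp))
    have hσ : ∀ w, σ' w ^ p ^ n = σ w ^ p ^ m := fun w => by
      rw [← map_pow σ, ← hnm]; simp
    have hN : ExpChar N p := expChar_of_injective_ringHom (f := (σ : M →+* N)) σ.injective p
    obtain hp | hp := expChar_is_prime_or_one M p
    · have : CharP M p := by
        cases hM
        · exact absurd hp Nat.not_prime_one
        · assumption
      refine Or.inr ⟨p, hp, this, ?_⟩
      obtain hle | hle := le_total n m
      · refine Or.inl ⟨m - n, fun w => pow_frobenius_injective (p' := p) n ?_⟩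
        simp only [map_pow]
        rw [hσ, ← pow_mul, ← pow_add, Nat.sub_add_cancel hle]
      · refine Or.inr ⟨n - m, fun w => pow_frobenius_injective (p' := p) m ?_⟩
        simp only [map_pow]
        rw [← hσ, ← pow_mul, ← pow_add, Nat.sub_add_cancel hle]
    · refine Or.inl (RingEquiv.ext fun w => ?_)
      simpa [hp] using (hσ w).symm
  · have key : ∀ {q : ℕ}, q.Prime → CharP M q → ∀ n : ℕ, (((q ^ n : ℕ) : ZMod ℓ)) ≠ 0 := by
      intro q hq _ n
      have : ExpChar M q := .prime hq
      obtain rfl := ExpChar.eq hM this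
      exact natCast_pow_ne_zero H.ne_zero n
    rintro (rfl | ⟨q, hq, hc, ⟨n, h⟩ | ⟨n, h⟩⟩)
    · exact ⟨1, fun v => by simp⟩
    · refine ⟨Units.mk0 _ (key hq hc n), fun v => ?_⟩
      obtain ⟨x, -, rfl⟩ := cl_surj v
      rw [KV.mapEquiv_cl, KV.mapEquiv_cl, h, map_pow, cl_pow', Units.val_mk0]
    · refine ⟨(Units.mk0 _ (key hq hc n))⁻¹, fun v => ?_⟩
      obtain ⟨x, -, rfl⟩ := cl_surj v
      rw [KV.mapEquiv_cl, KV.mapEquiv_cl, h, map_pow, cl_pow', Units.val_inv_eq_inv_val,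
        Units.val_mk0, inv_smul_smul₀ (key hq hc n)]

end MilnorRec

open MilnorRec

theorem statement_19 (ℓ : ℕ) (hℓ : ℓ.Prime)
    (k : Type u) (K : Type u) (l : Type v) (L : Type v)
    [Field k] [Field K] [Algebra k K] [IsAlgClosed k]
    [Field l] [Field L] [Algebra l L] [IsAlgClosed l]
    (hchark : ringChar k ≠ ℓ) (hcharl : ringChar l ≠ ℓ)
    (hK : IsFunctionField k K) (hL : IsFunctionField l L)
    (htr : TrdegGe k K 5)
    (PK : PerfectClosureOf K) (PL : PerfectClosureOf L) :
    (∀ σ : PK.carrier ≃+* PL.carrier,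
      ((σ : PK.carrier → PL.carrier) ''
          (Set.range fun c : k => algebraMap K PK.carrier (algebraMap k K c)) =
        Set.range fun c : l => algebraMap L PL.carrier (algebraMap l L c)) ∧
      ∃ φ : K1 ℓ K ≃* K1 ℓ L,
        InducesOnK1 ℓ PK PL σ φ ∧ CompatWithK2 ℓ φ ∧ CompatWithRat ℓ k l φ) ∧
    (∀ (σ : PK.carrier ≃+* PL.carrier) (φ φ' : K1 ℓ K ≃* K1 ℓ L),
      InducesOnK1 ℓ PK PL σ φ → InducesOnK1 ℓ PK PL σ φ' → φ = φ') ∧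
    (∀ φ : K1 ℓ K ≃* K1 ℓ L, CompatWithK2 ℓ φ → CompatWithRat ℓ k l φ →
      ∃ (σ : PK.carrier ≃+* PL.carrier) (φ₀ : K1 ℓ K ≃* K1 ℓ L) (ε : (ZMod ℓ)ˣ),
        InducesOnK1 ℓ PK PL σ φ₀ ∧ ∀ x, φ x = φ₀ x ^ ((ε : ZMod ℓ)).val) ∧
    (∀ (σ σ' : PK.carrier ≃+* PL.carrier) (φ φ' : K1 ℓ K ≃* K1 ℓ L),
      InducesOnK1 ℓ PK PL σ φ → InducesOnK1 ℓ PK PL σ' φ' →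
      ((∃ ε : (ZMod ℓ)ˣ, ∀ x, φ' x = φ x ^ ((ε : ZMod ℓ)).val) ↔ FrobTwistEquiv σ σ')) := by
  have : Fact ℓ.Prime := ⟨hℓ⟩
  let : Algebra k PK.carrier := ((algebraMap K PK.carrier).comp (algebraMap k K)).toAlgebra
  let : Algebra l PL.carrier := ((algebraMap L PL.carrier).comp (algebraMap l L)).toAlgebra
  have : IsScalarTower k K PK.carrier := .of_algebraMap_eq' rfl
  have : IsScalarTower l L PL.carrier := .of_algebraMap_eq' rfl
  have : ExpChar K (ringExpChar k) :=
    expChar_of_injective_algebraMap (algebraMap k K).injective _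
  have : ExpChar L (ringExpChar l) :=
    expChar_of_injective_algebraMap (algebraMap l L).injective _
  have hp : (ringExpChar k : ZMod ℓ) ≠ 0 := expChar_natCast_ne_zero (k := k) _ hchark
  have hp' : (ringExpChar l : ZMod ℓ) ≠ 0 := expChar_natCast_ne_zero (k := l) _ hcharl
  have SL : Setup (ringExpChar l) ℓ l PL.carrier 0 := hL.setup hcharl
  have SK : Setup (ringExpChar k) ℓ k PK.carrier 5 := by
    obtain ⟨x, hx⟩ := htr
    exact (hK.setup hchark).of_algebraicIndependent
      (hx.map' (f := IsScalarTower.toAlgHom k K PK.carrier) (algebraMap K PK.carrier).injective)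
  refine ⟨fun σ => ?_, fun σ φ φ' h h' => ?_, fun φ h2 hr => ?_, fun σ σ' φ φ' h h' => ?_⟩
  · obtain ⟨π, hπ⟩ := exists_ringEquiv_const SK.pfg SL.pfg σ
    refine ⟨?_, ?_⟩
    · ext y
      simp only [← IsScalarTower.algebraMap_apply, Set.mem_image, Set.mem_range,
        exists_exists_eq_and, hπ]
      exact ⟨fun ⟨a, ha⟩ => ⟨π a, ha⟩, fun ⟨b, hb⟩ => ⟨π.symm b, by simpa using hb⟩⟩
    · have hexp : ringExpChar l = ringExpChar k := by
        have := expChar_of_injective_ringHom (f := (π : k →+* l)) π.injective (ringExpChar k)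
        exact ExpChar.eq inferInstance this
      have : ExpChar l (ringExpChar k) := hexp ▸ inferInstance
      have : ExpChar L (ringExpChar k) := hexp ▸ inferInstance
      obtain ⟨φ, hφ⟩ := KV.exists_hatEquiv_eq (K := K) (L := L) hp hp (KV.mapEquiv ℓ σ)
      exact ⟨φ, (inducesOnK1_iff hp hp).2 hφ, compatWithK2_of_eq_mapEquiv hφ,
        compatWithRat_of_eq_mapEquiv hK hL hφ hπ⟩
  · ext v
    obtain ⟨x, rfl⟩ := K1proj_surjective v
    obtain ⟨y, hy⟩ := K1proj_surjective (φ (K1proj ℓ K x))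
    rw [← hy]
    exact ((h' x y).2 ((h x y).1 hy.symm)).symm
  · obtain ⟨e, σ, he, h⟩ := exists_fieldEquiv SK SL
      (halfTransport_hatEquiv (M := PK.carrier) (N := PL.carrier) hp hp' hK h2 hr.1) (by
        rw [KV.hatEquiv_symm hp hp']
        exact halfTransport_hatEquiv hp' hp hL h2.symm hr.symm.1)
    obtain ⟨φ₀, hφ₀⟩ := KV.exists_hatEquiv_eq (K := K) (L := L) hp hp' (KV.mapEquiv ℓ σ)
    refine ⟨σ, φ₀, Units.mk0 e he, (inducesOnK1_iff hp hp').2 hφ₀,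
      (KV.hatEquiv_eq_smul_iff (M := PK.carrier) (N := PL.carrier) hp hp').1 fun v => ?_⟩
    obtain ⟨x, -, rfl⟩ := cl_surj v
    rw [hφ₀, KV.mapEquiv_cl, h, Units.val_mk0]
  · rw [← frobTwistEquiv_iff SK]
    simp only [← KV.hatEquiv_eq_smul_iff (M := PK.carrier) (N := PL.carrier) hp hp',
      (inducesOnK1_iff hp hp').1 h, (inducesOnK1_iff hp hp').1 h']

end
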